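/- Let K be a congruence function field over 𝔽₂ with genus g_K = 4 and class number h_K = 1, and let k = 𝔽₂(T) be its unique rational subfield with [K : k] = 5. Then every prime divisor of k of degree at most 3 (namely the infinite place 𝔭_∞ and the places of T, T+1, T²+T+1, T³+T+1, T³+T²+1) is inert in K/k, exactly one of the three prime divisors of k of degree 4 is (totally, tamely) ramified in K/k, and the other two primes of degree 4 are inert in K/k. -/

import Mathlib

set_option synthInstance.maxHeartbeats 1000000
set_option maxHeartbeats 1000000

open scoped Classical

noncomputable section

namespace CFF

variable (F : Type*) [Field F]

/-- `K` is a (congruence) function field in one variable over `F`: a finitely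
generated field extension of transcendence degree one. -/
def IsFunctionField (K : Type*) [Field K] [Algebra F K] : Prop :=
  ∃ x : K, Transcendental F x ∧
    FiniteDimensional (IntermediateField.adjoin F {x}) K

/-- The exact field of constants of `K` is `F`: every element of `K` algebraic
over `F` already lies in `F`. -/
def HasExactConstants (K : Type*) [Field K] [Algebra F K] : Prop :=
  ∀ a : K, IsAlgebraic F a → a ∈ (algebraMap F K).range

variable (K : Type*) [Field K] [Algebra F K]

/-- A place of the function field `K/F`: a proper valuation subring of `K`
containing the constants. -/
def IsPlace (O : ValuationSubring K) : Prop :=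
  O ≠ ⊤ ∧ ∀ c : F, algebraMap F K c ∈ O

/-- The type of places (prime divisors) of `K/F`. -/
def Place := {O : ValuationSubring K // IsPlace F K O}

variable {K}

/-- `𝔪`-adic order of an element of a valuation subring. -/
def ordAux (O : ValuationSubring K) (x : O) : ℕ :=
  sSup {n : ℕ | x ∈ IsLocalRing.maximalIdeal O ^ n}

/-- The order (normalized valuation) of `f ∈ K` at a valuation subring `O`. -/
def ordAt (O : ValuationSubring K) (f : K) : ℤ :=
  if h : f ∈ O then (ordAux O ⟨f, h⟩ : ℤ)
  else -(ordAux O ⟨f⁻¹, (O.mem_or_inv_mem f).resolve_left h⟩ : ℤ)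

/-- The constants embed into (the valuation ring of) any place. -/
def constHom (p : Place F K) : F →+* p.1 :=
  (algebraMap F K).codRestrict p.1.toSubring fun c => p.2.2 c

/-- The map from the constants to the residue field of a place. -/
def residueHom (p : Place F K) : F →+* IsLocalRing.ResidueField p.1 :=
  (IsLocalRing.residue (p.1 : ValuationSubring K)).comp (constHom F p)

/-- The degree of a place: the dimension of its residue field over the
constants. -/
def placeDegree (p : Place F K) : ℕ :=
  letI := (residueHom F p).toAlgebra
  Module.finrank F (IsLocalRing.ResidueField p.1)

variable (K)

/-- The group of divisors of `K/F`. -/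
abbrev Divisor := Place F K →₀ ℤ

/-- The degree homomorphism on divisors. -/
def degHom : Divisor F K →+ ℤ :=
  Finsupp.liftAddHom fun p => AddMonoidHom.mulRight (placeDegree F p : ℤ)

variable {K}

/-- The Riemann-Roch space `L(D)` of a divisor `D` (the span coincides with the
set of `f` with `div f ≥ -D`, which is an `F`-subspace). -/
def RRspace (D : Divisor F K) : Submodule F K :=
  Submodule.span F {f : K | ∀ p : Place F K, 0 ≤ D p + ordAt p.1 f}

/-- `ℓ(D)`, the dimension of the Riemann-Roch space of `D`. -/
def ell (D : Divisor F K) : ℕ := Module.finrank F (RRspace F D)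

variable (K)

/-- The genus of `K/F`, via Riemann's theorem: `g = max_D (deg D + 1 - ℓ(D))`. -/
def genus : ℕ :=
  sSup {g : ℕ | ∃ D : Divisor F K, (g : ℤ) = degHom F K D + 1 - ell F D}

/-- The subgroup of divisors of degree zero. -/
def zeroDivisors : AddSubgroup (Divisor F K) := (degHom F K).ker

/-- The subgroup of principal divisors. -/
def principalDivisors : AddSubgroup (Divisor F K) :=
  AddSubgroup.closure
    {D : Divisor F K | ∃ f : K, f ≠ 0 ∧ ∀ p : Place F K, D p = ordAt p.1 f}

/-- The group of divisor classes of degree zero of `K/F`. -/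
def ClassGroup0 :=
  zeroDivisors F K ⧸ (principalDivisors F K).addSubgroupOf (zeroDivisors F K)

instance : AddGroup (ClassGroup0 F K) := by
  unfold ClassGroup0; infer_instance

/-- The class number of `K/F`: the order of the group of divisor classes of
degree zero. -/
def classNumber : ℕ := Nat.card (ClassGroup0 F K)

section Extension

variable {k L : Type*} [Field k] [Field L] [Algebra F k] [Algebra F L] [Algebra k L]

/-- A place `P` of `L` lies over the place `p` of `k`. -/
def LiesOver (P : Place F L) (p : Place F k) : Prop :=
  P.1.comap (algebraMap k L) = p.1

variable (L)

/-- `p` is inert in `L/k`: there is a unique place of `L` above `p`, and its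
degree is `[L:k] · deg p` (i.e. the residue degree is `[L:k]`, so `e = 1`). -/
def IsInert (p : Place F k) : Prop :=
  ∃ P : Place F L, LiesOver F P p ∧
    placeDegree F P = Module.finrank k L * placeDegree F p ∧
    ∀ P' : Place F L, LiesOver F P' p → P' = P

/-- `p` splits completely in `L/k`: there are `[L:k]` places above `p`, each of
the same degree as `p`. -/
def SplitsCompletely (p : Place F k) : Prop :=
  Nat.card {P : Place F L // LiesOver F P p} = Module.finrank k L ∧
    ∀ P : Place F L, LiesOver F P p → placeDegree F P = placeDegree F p

/-- `p` is totally ramified in `L/k`: there is a unique place above `p`, of the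
same degree (so `f = 1` and `e = [L:k]`). -/
def IsTotallyRamified (p : Place F k) : Prop :=
  ∃ P : Place F L, LiesOver F P p ∧ placeDegree F P = placeDegree F p ∧
    ∀ P' : Place F L, LiesOver F P' p → P' = P

/-- `p` is unramified in `L/k`: at every place above `p` the orders of elements
of `k` are preserved (`e = 1`). -/
def IsUnramifiedAt (p : Place F k) : Prop :=
  ∀ P : Place F L, LiesOver F P p →
    ∀ x : k, ordAt P.1 (algebraMap k L x) = ordAt p.1 x

end Extension

section Rational

/-- The finite place of `𝔽₂(T)` corresponding to an irreducible polynomial `P`: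
the place contains all polynomials and `P` lies in its maximal ideal. -/
def IsFinitePlaceOf (p : Place (ZMod 2) (RatFunc (ZMod 2)))
    (P : Polynomial (ZMod 2)) : Prop :=
  (∀ g : Polynomial (ZMod 2), algebraMap (Polynomial (ZMod 2)) (RatFunc (ZMod 2)) g ∈ p.1) ∧
    (algebraMap (Polynomial (ZMod 2)) (RatFunc (ZMod 2)) P)⁻¹ ∉ p.1

/-- The infinite place `𝔭_∞` of `𝔽₂(T)`: the place where `T` has a pole. -/
def IsInfinitePlace (p : Place (ZMod 2) (RatFunc (ZMod 2))) : Prop :=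
  RatFunc.X ∉ p.1

end Rational

end CFF

namespace CFF

open Polynomial IntermediateField
open scoped IntermediateField.algebraAdjoinAdjoin

/-- Every non-constant element `x` of `K` is transcendental with `[K : F(x)]` finite. -/
class FnField (F K : Type*) [Field F] [Field K] [Algebra F K] : Prop where
  transcendental : ∀ x : K, x ∉ (algebraMap F K).range → Transcendental F x
  finite : ∀ x : K, x ∉ (algebraMap F K).range → FiniteDimensional F⟮x⟯ K

theorem algebraic_adjoin_simple_of_transcendental {F K : Type} [Field F] [Field K] [Algebra F K]
    {x y : K} (hx : Algebra.IsAlgebraic F⟮x⟯ K) (hy : Transcendental F y) :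
    Algebra.IsAlgebraic F⟮y⟯ K := by
  have h1 : Algebra.IsAlgebraic (Algebra.adjoin F {x}) K := by
    exact (IsFractionRing.comap_isAlgebraic_iff (A := Algebra.adjoin F {x}) (K := F⟮x⟯)).2 hx
  have h2 : Algebra.trdeg F K ≤ Cardinal.mk Unit := by
    simpa using Algebra.IsAlgebraic.trdeg_le_cardinalMk F ({x} : Set K)
  have h3 : AlgebraicIndependent F (fun _ : Unit => y) := by
    rw [algebraicIndependent_unique_type_iff]; exact hy
  have h4 := (h3.isTranscendenceBasis_of_trdeg_le_of_finite (by
    simpa using h2)).isAlgebraic_field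
  have h5 : Set.range (fun _ : Unit => y) = {y} := by simp
  rw [h5] at h4
  exact h4

theorem FnField.of_isFunctionField {F K : Type} [Field F] [Field K] [Algebra F K]
    (h : IsFunctionField F K) (hc : HasExactConstants F K) : FnField F K := by
  obtain ⟨x, hx, hfin⟩ := h
  have htr : ∀ y : K, y ∉ (algebraMap F K).range → Transcendental F y :=
    fun y hy h => hy (hc y h)
  refine ⟨htr, fun y hy => ?_⟩
  have halg := algebraic_adjoin_simple_of_transcendental (F := F) (x := x) inferInstance (htr y hy)
  have e1 : Algebra.EssFiniteType F F⟮x⟯ :=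
    (IntermediateField.essFiniteType_iff).2 (IntermediateField.fg_adjoin_of_finite (Set.finite_singleton x))
  have e2 : Algebra.EssFiniteType F K := Algebra.EssFiniteType.comp F F⟮x⟯ K
  have e3 : Algebra.EssFiniteType F⟮y⟯ K := Algebra.EssFiniteType.of_comp F F⟮y⟯ K
  have := IntermediateField.fg_top F⟮y⟯ K
  obtain ⟨s, hs⟩ := this
  have h6 : FiniteDimensional F⟮y⟯ (IntermediateField.adjoin F⟮y⟯ (s : Set K)) :=
    IntermediateField.finiteDimensional_adjoin fun z _ => (halg.1 z).isIntegral
  rw [hs] at h6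
  exact Module.Finite.equiv (IntermediateField.topEquiv (F := F⟮y⟯) (E := K)).toLinearEquiv

/-- A linear dependence over `F(x)` can be written with polynomial coefficients, not all of
which vanish at `0`. -/
theorem exists_polynomial_relation {F K : Type} [Field F] [Field K] [Algebra F K]
    {x : K} (hx : Transcendental F x) {ι : Type*} [Fintype ι] {u : ι → K}
    (h : ¬ LinearIndependent F⟮x⟯ u) :
    ∃ p : ι → F[X], (∃ i, (p i).coeff 0 ≠ 0) ∧ ∑ i, aeval x (p i) * u i = 0 := by
  have hx0 : x ≠ 0 := by
    rintro rfl; exact hx isAlgebraic_zero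
  have key : ∀ n : ℕ, ∀ p : ι → F[X], ∀ i0, p i0 ≠ 0 → (p i0).natDegree ≤ n →
      ∑ i, aeval x (p i) * u i = 0 →
      ∃ p : ι → F[X], (∃ i, (p i).coeff 0 ≠ 0) ∧ ∑ i, aeval x (p i) * u i = 0 := by
    intro n
    induction n with
    | zero =>
      intro p i0 h0 hd hs
      refine ⟨p, ⟨i0, ?_⟩, hs⟩
      rw [Polynomial.eq_C_of_natDegree_le_zero hd] at h0
      simpa using h0
    | succ n ih =>
      intro p i0 h0 hd hs
      by_cases hex : ∃ i, (p i).coeff 0 ≠ 0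
      · exact ⟨p, hex, hs⟩
      push Not at hex
      have hdiv : ∀ i, p i = X * (p i).divX := fun i => by
        conv_lhs => rw [← Polynomial.X_mul_divX_add (p i), hex i]
        simp
      refine ih (fun i => (p i).divX) i0 ?_ ?_ ?_
      · intro h; apply h0; rw [hdiv i0, h, mul_zero]
      · show (p i0).divX.natDegree ≤ n
        rw [Polynomial.natDegree_divX_eq_natDegree_tsub_one]; omega
      · have : x * ∑ i, aeval x (p i).divX * u i = 0 := by
          rw [← hs, Finset.mul_sum]
          refine Finset.sum_congr rfl fun i _ => ?_
          conv_rhs => rw [hdiv i]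
          simp [mul_assoc]
        exact (mul_eq_zero.1 this).resolve_left hx0
  rw [Fintype.linearIndependent_iff] at h
  push Not at h
  obtain ⟨g, hg, i0, hi0⟩ := h
  have hrep : ∀ i, ∃ r s : F[X], aeval x s ≠ 0 ∧ (g i : K) * aeval x s = aeval x r := by
    intro i
    obtain ⟨r, s, hrs⟩ := (IntermediateField.mem_adjoin_simple_iff (F := F) (α := x) (g i : K)).1 (g i).2
    by_cases hs : aeval x s = 0
    · refine ⟨0, 1, by simp, ?_⟩
      rw [hrs, hs]; simp
    · exact ⟨r, s, hs, by rw [hrs]; field_simp⟩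
  choose r s hs hrs using hrep
  refine key _ (fun i => r i * ∏ j ∈ Finset.univ.erase i, s j) i0 ?_ le_rfl ?_
  · intro h0
    have h1 := congrArg (aeval x) h0
    simp only [map_mul, map_prod, ← hrs, map_zero, mul_eq_zero, Finset.prod_eq_zero_iff] at h1
    rcases h1 with (h1 | h1) | ⟨j, _, h1⟩
    · exact hi0 (by exact_mod_cast h1)
    · exact hs _ h1
    · exact hs _ h1
  · have h2 : ∀ i, aeval x (r i * ∏ j ∈ Finset.univ.erase i, s j) * u i
        = (∏ j, aeval x (s j)) * (g i • u i) := by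
      intro i
      rw [map_mul, map_prod, ← hrs, ← Finset.mul_prod_erase Finset.univ _ (Finset.mem_univ i)]
      rw [Algebra.smul_def]
      simp only [IntermediateField.algebraMap_apply]
      ring
    rw [Finset.sum_congr rfl fun i _ => h2 i, ← Finset.mul_sum, hg, mul_zero]

theorem aeval_mul_mem {F K : Type} [Field F] [Field K] [Algebra F K] {x : K}
    (M : Submodule F K) (hM : ∀ m ∈ M, x * m ∈ M) (p : F[X]) {m : K} (hm : m ∈ M) :
    aeval x p * m ∈ M := by
  induction p using Polynomial.induction_on' with
  | add p q hp hq => rw [map_add, add_mul]; exact M.add_mem hp hq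
  | monomial n a =>
    rw [aeval_monomial, mul_assoc, ← Algebra.smul_def]
    refine M.smul_mem _ ?_
    induction n with
    | zero => simpa using hm
    | succ n ih => rw [pow_succ', mul_assoc]; exact hM _ ih

/-- Elements of an `F[x]`-submodule `M` that are independent modulo `x M` are at most
`[K : F(x)]` in number. -/
theorem card_le_finrank_of_indep_mod {F K : Type} [Field F] [Field K] [Algebra F K] {x : K}
    (hx : Transcendental F x) [FiniteDimensional F⟮x⟯ K]
    (M : Submodule F K) (hM : ∀ m ∈ M, x * m ∈ M) {ι : Type*} [Fintype ι] (u : ι → K)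
    (hu : ∀ i, u i ∈ M)
    (hind : ∀ c : ι → F, (∃ m ∈ M, ∑ i, c i • u i = x * m) → c = 0) :
    Fintype.card ι ≤ Module.finrank F⟮x⟯ K := by
  by_contra hlt
  have hnot : ¬ LinearIndependent F⟮x⟯ u := fun h => hlt h.fintype_card_le_finrank
  obtain ⟨p, ⟨i, hi⟩, hp⟩ := exists_polynomial_relation hx hnot
  have := hind (fun i => (p i).coeff 0) ⟨- ∑ i, aeval x (p i).divX * u i, ?_, ?_⟩
  · exact hi (congrFun this i)
  · exact M.neg_mem (M.sum_mem fun i _ => aeval_mul_mem M hM _ (hu i))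
  · have h3 : ∀ i, aeval x (p i) * u i = x * (aeval x (p i).divX * u i) + (p i).coeff 0 • u i := by
      intro i
      have h4 := congrArg (aeval x) (Polynomial.X_mul_divX_add (p i))
      rw [← h4, map_add, map_mul, aeval_X, aeval_C, Algebra.smul_def]; ring
    rw [Finset.sum_congr rfl fun i _ => h3 i, Finset.sum_add_distrib, ← Finset.mul_sum] at hp
    rw [mul_neg]; exact eq_neg_of_add_eq_zero_right hp

end CFF

namespace CFF

open Polynomial IntermediateField

section PlaceValuation

variable {F K : Type} [Field F] [Field K] [Algebra F K]

theorem Place.valuation_algebraMap (P : Place F K) {c : F} (hc : c ≠ 0) :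
    P.1.valuation (algebraMap F K c) = 1 := by
  apply le_antisymm
  · exact (P.1.valuation_le_one_iff _).2 (P.2.2 c)
  · have h := (P.1.valuation_le_one_iff _).2 (P.2.2 c⁻¹)
    rw [map_inv₀, map_inv₀] at h
    have h0 : P.1.valuation (algebraMap F K c) ≠ 0 := by
      simpa using hc
    exact (inv_le_one₀ (zero_lt_iff.2 h0)).1 h

theorem Place.notMem_range (P : Place F K) {x : K} (h0 : x ≠ 0)
    (h1 : P.1.valuation x ≠ 1) : x ∉ (algebraMap F K).range := by
  rintro ⟨c, rfl⟩
  refine h1 (P.valuation_algebraMap ?_)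
  rintro rfl; simp at h0

theorem Place.valuation_sum_smul (P : Place F K) {ι : Type} (s : Finset ι) (y : ι → K)
    (hy : Set.InjOn (fun i => P.1.valuation (y i)) s) (c : ι → F) {i0 : ι} (hi0 : i0 ∈ s)
    (hc : c i0 ≠ 0) :
    P.1.valuation (y i0) ≤ P.1.valuation (∑ i ∈ s, c i • y i) := by
  have hv : ∀ i, c i ≠ 0 → P.1.valuation (c i • y i) = P.1.valuation (y i) := fun i h => by
    rw [Algebra.smul_def, map_mul, P.valuation_algebraMap h, one_mul]
  obtain ⟨j, hj, hmax⟩ := Finset.exists_max_image (s.filter fun i => c i ≠ 0)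
    (fun i => P.1.valuation (y i)) ⟨i0, by simp [hi0, hc]⟩
  simp only [Finset.mem_filter] at hj hmax
  refine (hmax i0 ⟨hi0, hc⟩).trans ?_
  by_cases hj0 : P.1.valuation (y j) = 0
  · rw [hj0]; exact zero_le
  rw [← Finset.add_sum_erase s _ hj.1, Valuation.map_add_eq_of_lt_left]
  · rw [hv j hj.2]
  · rw [hv j hj.2]
    refine Valuation.map_sum_lt _ hj0 fun i hi => ?_
    rw [Finset.mem_erase] at hi
    by_cases hci : c i = 0
    · rw [hci, zero_smul, map_zero]; exact zero_lt_iff.2 hj0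
    · rw [hv i hci]
      refine lt_of_le_of_ne (hmax i ⟨hi.2, hci⟩) fun h => hi.1 (hy hi.2 hj.1 h)

/-- The valuation ring of a place as an `F`-submodule. -/
def Place.toSubmodule (P : Place F K) : Submodule F K where
  carrier := P.1
  add_mem' := fun ha hb => P.1.add_mem _ _ ha hb
  zero_mem' := P.1.zero_mem
  smul_mem' := fun c x hx => by
    rw [Algebra.smul_def]; exact P.1.mul_mem _ _ (P.2.2 c) hx

theorem Place.exists_ne_zero_lt_one (P : Place F K) : ∃ x : K, x ≠ 0 ∧ P.1.valuation x < 1 := by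
  have : ∃ y : K, y ∉ P.1 := by
    by_contra h
    push Not at h
    exact P.2.1 (by ext z; simp [h z])
  obtain ⟨y, hy⟩ := this
  have hy1 : 1 < P.1.valuation y := by
    rw [← not_le, P.1.valuation_le_one_iff]; exact hy
  have hy0 : y ≠ 0 := by rintro rfl; exact hy P.1.zero_mem
  exact ⟨y⁻¹, inv_ne_zero hy0, by rw [map_inv₀]; exact inv_lt_one_of_one_lt₀ hy1⟩

theorem valuationSubring_mem_maximalIdeal_pow {K : Type} [Field K] (O : ValuationSubring K) {t : K} (ht0 : t ≠ 0)
    (ht1 : O.valuation t < 1)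
    (ht : ∀ y, O.valuation y < 1 → O.valuation y ≤ O.valuation t) (n : ℕ) (z : O) :
    z ∈ IsLocalRing.maximalIdeal O ^ n ↔ O.valuation z.1 ≤ O.valuation t ^ n := by
  have hvt : O.valuation t ≠ 0 := by simpa using ht0
  let t' : O := ⟨t, (O.valuation_le_one_iff _).1 ht1.le⟩
  have hdvd : ∀ a b : O, O.valuation b.1 ≠ 0 → (b ∣ a ↔
      O.valuation a.1 ≤ O.valuation b.1) := by
    intro a b hb
    constructor
    · rintro ⟨c, rfl⟩
      rw [MulMemClass.coe_mul, map_mul]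
      exact mul_le_of_le_one_right' (O.valuation_le_one c)
    · intro h
      have hb0 : (b : K) ≠ 0 := by
        intro h0; exact hb (by rw [h0, map_zero])
      refine ⟨⟨a.1 / b.1, (O.valuation_le_one_iff _).1 ?_⟩, ?_⟩
      · rw [map_div₀]; exact div_le_one_of_le₀ h zero_le
      · apply Subtype.ext
        rw [MulMemClass.coe_mul]
        field_simp
  have hm : IsLocalRing.maximalIdeal O = Ideal.span {t'} := by
    ext a
    rw [Ideal.mem_span_singleton, hdvd a t' hvt, ValuationSubring.valuation_lt_one_iff]
    exact ⟨ht _, fun h => h.trans_lt ht1⟩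
  rw [hm, Ideal.span_singleton_pow, Ideal.mem_span_singleton, hdvd]
  · simp [t']
  · simpa [t'] using fun h => absurd h ht0

/-- The order of `f` at the place `P`. -/
abbrev ord (P : Place F K) (f : K) : ℤ := ordAt P.1 f

theorem ord_zero (P : Place F K) : ord P 0 = 0 := by
  have h : ({n : ℕ | (0 : P.1) ∈ IsLocalRing.maximalIdeal P.1 ^ n} : Set ℕ) = Set.univ := by
    ext n; simp
  unfold ord ordAt
  rw [dif_pos P.1.zero_mem]
  unfold ordAux
  have h2 : (⟨0, P.1.zero_mem⟩ : P.1) = 0 := rfl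
  rw [h2, h]
  simp

theorem ord_eq_of_valuation (P : Place F K) {t : K} (ht0 : t ≠ 0) (ht1 : P.1.valuation t < 1)
    (ht : ∀ f : K, f ≠ 0 → P.1.valuation f = P.1.valuation t ^ ordAt P.1 f) {f : K} (hf : f ≠ 0)
    {n : ℤ} (h : P.1.valuation f = P.1.valuation t ^ n) : ord P f = n := by
  have hvt : 0 < P.1.valuation t := zero_lt_iff.2 (by simpa using ht0)
  rw [ht f hf] at h
  exact zpow_right_injective₀ hvt ht1.ne h

variable [FnField F K]

theorem Place.chain_le (P : Place F K) {x : K} (hx0 : x ≠ 0) (hx : P.1.valuation x < 1)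
    (n : ℕ) (y : Fin n → K) (hy : ∀ i, P.1.valuation (y i) ≤ 1)
    (hxy : ∀ i, P.1.valuation x < P.1.valuation (y i))
    (hinj : Function.Injective fun i => P.1.valuation (y i)) :
    n ≤ Module.finrank F⟮x⟯ K := by
  have hr := P.notMem_range hx0 hx.ne
  have := FnField.finite x hr
  have h := card_le_finrank_of_indep_mod (FnField.transcendental x hr) P.toSubmodule
    (fun m hm => P.1.mul_mem _ _ ((P.1.valuation_le_one_iff _).1 hx.le) hm) y
    (fun i => (P.1.valuation_le_one_iff _).1 (hy i)) ?_
  · simpa using h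
  · rintro c ⟨m, hm, hs⟩
    by_contra hc
    obtain ⟨i, hi⟩ := Function.ne_iff.1 hc
    have h1 := P.valuation_sum_smul Finset.univ y hinj.injOn c (Finset.mem_univ i) hi
    rw [hs, map_mul] at h1
    have h2 : P.1.valuation m ≤ 1 := (P.1.valuation_le_one_iff _).2 hm
    exact absurd (h1.trans (mul_le_of_le_one_right' h2)) (not_le.2 (hxy i))

theorem Place.exists_max_lt_one (P : Place F K) :
    ∃ t : K, t ≠ 0 ∧ P.1.valuation t < 1 ∧
      ∀ y, P.1.valuation y < 1 → P.1.valuation y ≤ P.1.valuation t := by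
  obtain ⟨x, hx0, hx⟩ := P.exists_ne_zero_lt_one
  by_contra hcon
  push Not at hcon
  have step : ∀ t : {t : K // t ≠ 0 ∧ P.1.valuation t < 1},
      ∃ y : {t : K // t ≠ 0 ∧ P.1.valuation t < 1}, P.1.valuation t.1 < P.1.valuation y.1 := by
    rintro ⟨t, h0, h1⟩
    obtain ⟨y, hy1, hy2⟩ := hcon t h0 h1
    refine ⟨⟨y, ?_, hy1⟩, hy2⟩
    rintro rfl
    simp at hy2
  choose f hf using step
  let s : ℕ → {t : K // t ≠ 0 ∧ P.1.valuation t < 1} := fun n => f^[n] ⟨x, hx0, hx⟩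
  have hs : StrictMono fun n => P.1.valuation (s n).1 := by
    refine strictMono_nat_of_lt_succ fun n => ?_
    simp only [s, Function.iterate_succ_apply']
    exact hf _
  have h := P.chain_le hx0 hx (Module.finrank F⟮x⟯ K + 1) (fun i => (s (i + 1)).1)
    (fun i => (s (i+1)).2.2.le) (fun i => hs (Nat.succ_pos i.1))
    (fun i j hij => Fin.ext (by simpa using hs.injective hij))
  omega

theorem Place.exists_pow_eq (P : Place F K) {t : K} (ht0 : t ≠ 0) (ht1 : P.1.valuation t < 1)
    (ht : ∀ y, P.1.valuation y < 1 → P.1.valuation y ≤ P.1.valuation t) {y : K} (hy0 : y ≠ 0)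
    (hy : P.1.valuation y ≤ 1) : ∃ k : ℕ, P.1.valuation y = P.1.valuation t ^ k := by
  have hvt : 0 < P.1.valuation t := zero_lt_iff.2 (by simpa using ht0)
  rcases hy.lt_or_eq with hy1 | hy1
  swap
  · exact ⟨0, by simpa using hy1⟩
  have hex : ∃ j : ℕ, P.1.valuation t ^ j ≤ P.1.valuation y := by
    by_contra hcon
    push Not at hcon
    have h := P.chain_le hy0 hy1 (Module.finrank F⟮y⟯ K + 1) (fun i => t ^ (i : ℕ))
      (fun i => by rw [map_pow]; exact pow_le_one₀ hvt.le ht1.le)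
      (fun i => by rw [map_pow]; exact hcon _)
      (fun i j hij => by
        simp only [map_pow] at hij
        exact Fin.ext (pow_right_injective₀ hvt ht1.ne hij))
    omega
  refine ⟨Nat.find hex, le_antisymm ?_ (Nat.find_spec hex)⟩
  rcases Nat.eq_zero_or_pos (Nat.find hex) with h0 | h0
  · rw [h0]; simpa using hy
  · have h2 := not_le.1 (Nat.find_min hex (Nat.sub_lt h0 one_pos))
    have h3 : P.1.valuation (y / t ^ (Nat.find hex - 1)) < 1 := by
      rw [map_div₀, map_pow]; exact (div_lt_one₀ (pow_pos hvt _)).2 h2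
    have h4 := ht _ h3
    rw [map_div₀, map_pow, div_le_iff₀ (pow_pos hvt _), ← pow_succ', Nat.sub_add_cancel h0] at h4
    exact h4

theorem Place.ordAux_eq (P : Place F K) {t : K} (ht0 : t ≠ 0) (ht1 : P.1.valuation t < 1)
    (ht : ∀ y, P.1.valuation y < 1 → P.1.valuation y ≤ P.1.valuation t) (z : P.1) (k : ℕ)
    (hz : P.1.valuation z.1 = P.1.valuation t ^ k) : ordAux P.1 z = k := by
  have hvt : 0 < P.1.valuation t := zero_lt_iff.2 (by simpa using ht0)
  unfold ordAux
  have : {n : ℕ | z ∈ IsLocalRing.maximalIdeal P.1 ^ n} = Set.Iic k := by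
    ext n
    rw [Set.mem_ofPred_eq, valuationSubring_mem_maximalIdeal_pow P.1 ht0 ht1 ht, hz, Set.mem_Iic]
    exact pow_le_pow_iff_right_of_lt_one₀ hvt ht1
  rw [this]
  exact csSup_Iic

theorem Place.exists_uniformizer_valuation (P : Place F K) :
    ∃ t : K, t ≠ 0 ∧ P.1.valuation t < 1 ∧
      ∀ f : K, f ≠ 0 → P.1.valuation f = P.1.valuation t ^ ordAt P.1 f := by
  obtain ⟨t, ht0, ht1, ht⟩ := P.exists_max_lt_one
  refine ⟨t, ht0, ht1, fun f hf => ?_⟩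
  have hvt : 0 < P.1.valuation t := zero_lt_iff.2 (by simpa using ht0)
  unfold ordAt
  split_ifs with h
  · obtain ⟨k, hk⟩ := P.exists_pow_eq ht0 ht1 ht hf ((P.1.valuation_le_one_iff _).2 h)
    rw [P.ordAux_eq ht0 ht1 ht ⟨f, h⟩ k hk, hk, zpow_natCast]
  · have h' := (P.1.mem_or_inv_mem f).resolve_left h
    obtain ⟨k, hk⟩ := P.exists_pow_eq ht0 ht1 ht (inv_ne_zero hf)
      ((P.1.valuation_le_one_iff _).2 h')
    rw [P.ordAux_eq ht0 ht1 ht ⟨f⁻¹, h'⟩ k hk, zpow_neg, zpow_natCast, ← hk, map_inv₀, inv_inv]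

theorem ord_mul (P : Place F K) {f g : K} (hf : f ≠ 0) (hg : g ≠ 0) :
    ord P (f * g) = ord P f + ord P g := by
  obtain ⟨t, ht0, ht1, ht⟩ := P.exists_uniformizer_valuation
  refine ord_eq_of_valuation P ht0 ht1 ht (mul_ne_zero hf hg) ?_
  rw [map_mul, ht f hf, ht g hg, zpow_add₀ (by simpa using ht0)]

theorem ord_one (P : Place F K) : ord P 1 = 0 := by
  have := ord_mul P (one_ne_zero (α := K)) one_ne_zero
  rw [mul_one] at this; omega

theorem ord_inv (P : Place F K) (f : K) : ord P f⁻¹ = - ord P f := by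
  by_cases hf : f = 0
  · simp [hf, ord_zero]
  · have := ord_mul P hf (inv_ne_zero hf)
    rw [mul_inv_cancel₀ hf, ord_one] at this; omega

theorem ord_div (P : Place F K) {f g : K} (hf : f ≠ 0) (hg : g ≠ 0) :
    ord P (f / g) = ord P f - ord P g := by
  rw [div_eq_mul_inv, ord_mul P hf (inv_ne_zero hg), ord_inv]; ring

theorem ord_pow (P : Place F K) (f : K) (n : ℕ) : ord P (f ^ n) = n * ord P f := by
  by_cases hf : f = 0
  · subst hf
    rcases n with _ | n
    · simp [ord_one]
    · simp [ord_zero]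
  · induction n with
    | zero => simp [ord_one]
    | succ n ih => rw [pow_succ, ord_mul P (pow_ne_zero _ hf) hf, ih]; push_cast; ring

theorem ord_le_iff (P : Place F K) {f g : K} (hf : f ≠ 0) (hg : g ≠ 0) :
    ord P f ≤ ord P g ↔ P.1.valuation g ≤ P.1.valuation f := by
  obtain ⟨t, ht0, ht1, ht⟩ := P.exists_uniformizer_valuation
  have hvt : 0 < P.1.valuation t := zero_lt_iff.2 (by simpa using ht0)
  rw [ht f hf, ht g hg]
  exact (zpow_le_zpow_iff_right_of_lt_one₀ hvt ht1).symm

theorem mem_iff_ord (P : Place F K) {f : K} (hf : f ≠ 0) : f ∈ P.1 ↔ 0 ≤ ord P f := by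
  rw [← ord_one P, ord_le_iff P one_ne_zero hf, map_one, P.1.valuation_le_one_iff]

theorem ord_pos_iff (P : Place F K) {f : K} (hf : f ≠ 0) :
    0 < ord P f ↔ P.1.valuation f < 1 := by
  rw [← not_le, ← not_le, ← ord_one P, ord_le_iff P hf one_ne_zero, map_one]

theorem ord_add (P : Place F K) {f g : K} (hf : f ≠ 0) (hg : g ≠ 0) (h : f + g ≠ 0) :
    min (ord P f) (ord P g) ≤ ord P (f + g) := by
  have := P.1.valuation.map_add f g
  rw [min_le_iff, ord_le_iff P hf h, ord_le_iff P hg h]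
  exact le_max_iff.1 this

theorem ord_algebraMap (P : Place F K) (c : F) : ord P (algebraMap F K c) = 0 := by
  by_cases hc : c = 0
  · simp [hc, ord_zero]
  · have h1 := (mem_iff_ord P (f := algebraMap F K c) (by simpa using hc)).1 (P.2.2 c)
    have h2 := (mem_iff_ord P (f := algebraMap F K c⁻¹) (by simpa using hc)).1 (P.2.2 c⁻¹)
    rw [map_inv₀, ord_inv] at h2
    omega

theorem exists_ord_eq_one (P : Place F K) : ∃ t : K, t ≠ 0 ∧ ord P t = 1 := by
  obtain ⟨t, ht0, ht1, ht⟩ := P.exists_uniformizer_valuation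
  exact ⟨t, ht0, ord_eq_of_valuation P ht0 ht1 ht ht0 (by simp)⟩

theorem exists_ord_eq (P : Place F K) (n : ℤ) : ∃ t : K, t ≠ 0 ∧ ord P t = n := by
  obtain ⟨t, ht0, ht1, ht⟩ := P.exists_uniformizer_valuation
  exact ⟨t ^ n, zpow_ne_zero _ ht0,
    ord_eq_of_valuation P ht0 ht1 ht (zpow_ne_zero _ ht0) (by simp)⟩

end PlaceValuation

end CFF

namespace CFF

open Polynomial IntermediateField

section Filtration

variable {F K : Type} [Field F] [Field K] [Algebra F K] [FnField F K]

/-- The additive group of elements of order at least `n` at `P`. -/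
def fil (P : Place F K) (n : ℤ) : AddSubgroup K where
  carrier := {f | f = 0 ∨ n ≤ ord P f}
  zero_mem' := Or.inl rfl
  add_mem' := by
    rintro a b (rfl | ha) (rfl | hb)
    · left; simp
    · right; simpa using hb
    · right; simpa using ha
    · by_cases ha0 : a = 0
      · subst ha0; right; simpa using hb
      by_cases hb0 : b = 0
      · subst hb0; right; simpa using ha
      by_cases h : a + b = 0
      · left; exact h
      · right; exact (le_min ha hb).trans (ord_add P ha0 hb0 h)
  neg_mem' := by
    rintro a (rfl | ha)
    · left; simp
    · by_cases ha0 : a = 0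
      · left; simp [ha0]
      right
      have h : ord P (-a) = ord P a := by
        have := ord_algebraMap P (-1 : F)
        rw [← neg_one_mul, ord_mul P (by simp) ha0]
        simpa using this
      rw [h]; exact ha

theorem mem_fil {P : Place F K} {n : ℤ} {f : K} : f ∈ fil P n ↔ f = 0 ∨ n ≤ ord P f := Iff.rfl

theorem mem_fil_of_ne {P : Place F K} {n : ℤ} {f : K} (hf : f ≠ 0) : f ∈ fil P n ↔ n ≤ ord P f := by
  simp [mem_fil, hf]

theorem fil_anti (P : Place F K) {m n : ℤ} (h : m ≤ n) : fil P n ≤ fil P m := by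
  rintro f (rfl | hf)
  · exact AddSubgroup.zero_mem _
  · exact Or.inr (h.trans hf)

theorem mul_mem_fil {P : Place F K} {m n : ℤ} {f g : K} (hf : f ∈ fil P m) (hg : g ∈ fil P n) :
    f * g ∈ fil P (m + n) := by
  by_cases hf0 : f = 0
  · simp [hf0]
  by_cases hg0 : g = 0
  · simp [hg0]
  rw [mem_fil_of_ne hf0] at hf
  rw [mem_fil_of_ne hg0] at hg
  right
  rw [ord_mul P hf0 hg0]; omega

theorem mem_fil_ord (P : Place F K) (f : K) : f ∈ fil P (ord P f) := Or.inr le_rfl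

theorem mem_fil_zero {P : Place F K} {f : K} : f ∈ fil P 0 ↔ f ∈ P.1 := by
  by_cases hf : f = 0
  · simp [hf, AddSubgroup.zero_mem, P.1.zero_mem]
  · rw [mem_fil_of_ne hf, mem_iff_ord P hf]

theorem algebraMap_mem_fil (P : Place F K) (c : F) : algebraMap F K c ∈ fil P 0 :=
  mem_fil_zero.2 (P.2.2 c)

theorem one_mem_fil (P : Place F K) : (1 : K) ∈ fil P 0 := mem_fil_zero.2 P.1.one_mem

theorem mul_mem_fil_iff {P : Place F K} {n : ℤ} {a f : K} (ha : a ≠ 0) :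
    a * f ∈ fil P n ↔ f ∈ fil P (n - ord P a) := by
  by_cases hf : f = 0
  · simp [hf]
  · rw [mem_fil_of_ne hf, mem_fil_of_ne (mul_ne_zero ha hf), ord_mul P ha hf]; omega

theorem ord_add_eq_of_lt {P : Place F K} {f g : K} (hf : f ≠ 0) (hg : g ∈ fil P (ord P f + 1)) :
    f + g ≠ 0 ∧ ord P (f + g) = ord P f := by
  have h0 : f + g ≠ 0 := by
    intro h
    have : g = -f := by linear_combination h
    rw [this] at hg
    have := (fil P _).neg_mem hg
    rw [neg_neg, mem_fil_of_ne hf] at this; omega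
  refine ⟨h0, le_antisymm ?_ ?_⟩
  · by_contra hlt
    have h1 : f + g ∈ fil P (ord P f + 1) := by rw [mem_fil_of_ne h0]; omega
    have h2 := (fil P _).sub_mem h1 hg
    rw [add_sub_cancel_right, mem_fil_of_ne hf] at h2; omega
  · have := (fil P _).add_mem (mem_fil_ord P f) (fil_anti P (by omega) hg)
    rwa [mem_fil_of_ne h0] at this

theorem Place.le_imp_eq {P Q : Place F K} (h : P.1 ≤ Q.1) : P = Q := by
  by_contra hne
  have hex : ∃ f, f ∈ Q.1 ∧ f ∉ P.1 := by
    by_contra hcon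
    push Not at hcon
    exact hne (Subtype.ext (le_antisymm h hcon))
  obtain ⟨f, hfQ, hfP⟩ := hex
  have hf0 : f ≠ 0 := by rintro rfl; exact hfP P.1.zero_mem
  have h1 : ord P f < 0 := by
    by_contra h2; exact hfP ((mem_iff_ord P hf0).2 (not_lt.1 h2))
  refine Q.2.1 (eq_top_iff.2 fun y _ => ?_)
  by_cases hy : y = 0
  · rw [hy]; exact Q.1.zero_mem
  have h3 : y * (f⁻¹) ^ (ord P y).natAbs ∈ P.1 := by
    rw [mem_iff_ord P (mul_ne_zero hy (pow_ne_zero _ (inv_ne_zero hf0))),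
      ord_mul P hy (pow_ne_zero _ (inv_ne_zero hf0)), ord_pow, ord_inv]
    have : (ord P y).natAbs * 1 ≤ ((ord P y).natAbs : ℤ) * (- ord P f) :=
      mul_le_mul_of_nonneg_left (by omega) (by omega)
    omega
  have h4 := Q.1.mul_mem _ _ (h h3) (Q.1.toSubring.pow_mem hfQ (ord P y).natAbs)
  rwa [inv_pow, inv_mul_cancel_right₀ (pow_ne_zero _ hf0)] at h4

theorem exists_pos_neg {P Q : Place F K} (h : P ≠ Q) :
    ∃ f : K, f ≠ 0 ∧ 0 < ord P f ∧ ord Q f < 0 := by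
  have h1 : ∀ {P Q : Place F K}, P ≠ Q → ∃ f, f ≠ 0 ∧ 0 ≤ ord P f ∧ ord Q f < 0 := by
    intro P Q h
    have hn : ¬ P.1 ≤ Q.1 := fun hle => h (Place.le_imp_eq hle)
    obtain ⟨f, hfP, hfQ⟩ := SetLike.not_le_iff_exists.1 hn
    have hf0 : f ≠ 0 := by rintro rfl; exact hfQ Q.1.zero_mem
    refine ⟨f, hf0, (mem_iff_ord P hf0).1 hfP, ?_⟩
    by_contra h2; exact hfQ ((mem_iff_ord Q hf0).2 (not_lt.1 h2))
  obtain ⟨a, ha0, haP, haQ⟩ := h1 h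
  obtain ⟨b, hb0, hbQ, hbP⟩ := h1 h.symm
  refine ⟨a / b, div_ne_zero ha0 hb0, ?_, ?_⟩
  · rw [ord_div P ha0 hb0]; omega
  · rw [ord_div Q ha0 hb0]; omega

theorem exists_pos_forall_neg (P : Place F K) (S : Finset (Place F K)) (hP : P ∉ S) :
    ∃ f : K, f ≠ 0 ∧ 0 < ord P f ∧ ∀ Q ∈ S, ord Q f < 0 := by
  induction S using Finset.induction_on with
  | empty =>
    obtain ⟨t, ht0, ht⟩ := exists_ord_eq_one P
    exact ⟨t, ht0, by omega, by simp⟩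
  | insert R S hR ih =>
    rw [Finset.mem_insert, not_or] at hP
    obtain ⟨z, hz0, hzP, hzS⟩ := ih hP.2
    obtain ⟨y, hy0, hyP, hyR⟩ := exists_pos_neg hP.1
    set s : ℕ := 1 + (ord R z).natAbs + ∑ Q ∈ S, (ord Q z).natAbs with hs
    have hys : ∀ Q : Place F K, ord Q (y ^ s) = s * ord Q y := fun Q => ord_pow Q y s
    have hbound : ∀ Q ∈ insert R S, (ord Q z).natAbs < s := by
      intro Q hQ
      rcases Finset.mem_insert.1 hQ with rfl | hQ
      · omega
      · have := Finset.single_le_sum (f := fun Q => (ord Q z).natAbs) (fun _ _ => Nat.zero_le _) hQ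
        omega
    have key : ∀ Q ∈ insert R S, y ^ s + z ≠ 0 ∧ ord Q (y ^ s + z) < 0 := by
      intro Q hQ
      have hb := hbound Q hQ
      by_cases hneg : ord Q y < 0
      · have h1 : ord Q (y ^ s) ≤ - s := by rw [hys]; nlinarith
        have := ord_add_eq_of_lt (P := Q) (f := y ^ s) (g := z) (pow_ne_zero _ hy0) (by
          rw [mem_fil_of_ne hz0]; omega)
        exact ⟨this.1, by omega⟩
      · rcases Finset.mem_insert.1 hQ with rfl | hQ
        · exact absurd hyR hneg
        · have h1 : 0 ≤ ord Q (y ^ s) := by rw [hys]; push Not at hneg; positivity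
          have := ord_add_eq_of_lt (P := Q) (f := z) (g := y ^ s) hz0 (by
            rw [mem_fil_of_ne (pow_ne_zero _ hy0)]; have := hzS Q hQ; omega)
          rw [add_comm]
          exact ⟨this.1, by have := hzS Q hQ; omega⟩
    have hne := (key R (Finset.mem_insert_self _ _)).1
    refine ⟨y ^ s + z, hne, ?_, fun Q hQ => (key Q hQ).2⟩
    have := (fil P 1).add_mem (x := y ^ s) (y := z)
      (by rw [mem_fil_of_ne (pow_ne_zero _ hy0), hys]
          have : (1 : ℤ) ≤ s := by omega
          nlinarith)
      (by rw [mem_fil_of_ne hz0]; omega)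
    rw [mem_fil_of_ne hne] at this
    omega

/-- An element close to `1` at `P` and close to `0` at the places of `S`. -/
theorem exists_near_one (P : Place F K) (S : Finset (Place F K)) (hP : P ∉ S) (n : ℕ) :
    ∃ w : K, w - 1 ∈ fil P n ∧ ∀ Q ∈ S, w ∈ fil Q n := by
  rcases Nat.eq_zero_or_pos n with rfl | hn
  · exact ⟨0, by simpa using (fil P 0).neg_mem (one_mem_fil P), fun Q _ => AddSubgroup.zero_mem _⟩
  obtain ⟨z, hz0, hzP, hzS⟩ := exists_pos_forall_neg P S hP
  have h1 : 1 + z ^ n ≠ 0 ∧ ord P (1 + z ^ n) = ord P 1 :=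
    ord_add_eq_of_lt one_ne_zero (by
      rw [mem_fil_of_ne (pow_ne_zero _ hz0), ord_pow, ord_one]; nlinarith)
  rw [ord_one] at h1
  refine ⟨(1 + z ^ n)⁻¹, ?_, fun Q hQ => ?_⟩
  · have : (1 + z ^ n)⁻¹ - 1 = - (z ^ n / (1 + z ^ n)) := by field_simp [h1.1]; ring
    rw [this]
    refine (fil P n).neg_mem ?_
    rw [mem_fil_of_ne (div_ne_zero (pow_ne_zero _ hz0) h1.1), ord_div P (pow_ne_zero _ hz0) h1.1,
      ord_pow, h1.2]
    nlinarith
  · have h2 := ord_add_eq_of_lt (P := Q) (f := z ^ n) (g := 1) (pow_ne_zero _ hz0) (by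
      rw [mem_fil_of_ne one_ne_zero, ord_one, ord_pow]; have := hzS Q hQ; nlinarith)
    rw [add_comm] at h2
    rw [mem_fil_of_ne (inv_ne_zero h1.1), ord_inv, h2.2, ord_pow]
    have := hzS Q hQ
    nlinarith

/-- Weak approximation. -/
theorem weak_approx (S : Finset (Place F K)) (x : Place F K → K) (n : Place F K → ℤ) :
    ∃ y : K, ∀ P ∈ S, y - x P ∈ fil P (n P) := by
  set N : ℕ := ∑ P ∈ S, (n P).natAbs + ∑ P ∈ S, ∑ Q ∈ S, (ord Q (x P)).natAbs with hN
  have hw : ∀ P, ∃ w : K, P ∈ S → w - 1 ∈ fil P N ∧ ∀ Q ∈ S.erase P, w ∈ fil Q N := fun P => by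
    obtain ⟨w, hw⟩ := exists_near_one P (S.erase P) (by simp) N
    exact ⟨w, fun _ => hw⟩
  choose w hw using hw
  have hb : ∀ P ∈ S, ∀ Q ∈ S, n Q ≤ N + ord Q (x P) := by
    intro P hP Q hQ
    have h1 := Finset.single_le_sum (f := fun Q => (n Q).natAbs) (fun _ _ => Nat.zero_le _) hQ
    have h2 := Finset.single_le_sum (f := fun P => ∑ Q ∈ S, (ord Q (x P)).natAbs)
      (fun _ _ => Nat.zero_le _) hP
    have h3 := Finset.single_le_sum (f := fun Q => (ord Q (x P)).natAbs)
      (fun _ _ => Nat.zero_le _) hQ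
    omega
  refine ⟨∑ P ∈ S, w P * x P, fun Q hQ => ?_⟩
  rw [← Finset.add_sum_erase S _ hQ]
  have : w Q * x Q + ∑ P ∈ S.erase Q, w P * x P - x Q
      = (w Q - 1) * x Q + ∑ P ∈ S.erase Q, w P * x P := by ring
  rw [this]
  refine (fil Q _).add_mem ?_ ((fil Q _).sum_mem fun P hP => ?_)
  · exact fil_anti Q (hb Q hQ Q hQ) (mul_mem_fil (hw Q hQ).1 (mem_fil_ord Q _))
  · rw [Finset.mem_erase] at hP
    exact fil_anti Q (hb P hP.2 Q hQ) (mul_mem_fil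
      ((hw P hP.2).2 Q (Finset.mem_erase.2 ⟨hP.1.symm, hQ⟩)) (mem_fil_ord Q _))

end Filtration

section Degree

variable {F K : Type} [Field F] [Field K] [Algebra F K] [FnField F K]

theorem residueField_finite (P : Place F K) :
    @Module.Finite F (IsLocalRing.ResidueField P.1) _ _ (residueHom F P).toAlgebra.toModule := by
  let _ := (residueHom F P).toAlgebra
  obtain ⟨x, hx0, hx⟩ := P.exists_ne_zero_lt_one
  have hr := P.notMem_range hx0 hx.ne
  have := FnField.finite x hr
  have hxm : x ∈ P.1 := (P.1.valuation_le_one_iff _).1 hx.le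
  rw [← Module.rank_lt_aleph0_iff]
  refine lt_of_le_of_lt (rank_le (n := Module.finrank F⟮x⟯ K) fun s hs => ?_) (Cardinal.natCast_lt_aleph0)
  choose u hu using fun i : s => IsLocalRing.residue_surjective (R := P.1) i.1
  have h := card_le_finrank_of_indep_mod (FnField.transcendental x hr) P.toSubmodule
    (fun m hm => P.1.mul_mem _ _ hxm hm) (fun i => (u i : K)) (fun i => (u i).2) ?_
  · simpa using h
  · rintro c ⟨m, hm, hcm⟩
    have h1 : ∑ i, constHom F P (c i) * u i = (⟨x, hxm⟩ : P.1) * ⟨m, hm⟩ := by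
      apply Subtype.ext
      rw [MulMemClass.coe_mul]
      simp only [AddSubmonoidClass.coe_finsetSum, MulMemClass.coe_mul]
      rw [← hcm]
      exact Finset.sum_congr rfl fun i _ => (Algebra.smul_def _ _).symm
    have h2 := congrArg (IsLocalRing.residue P.1) h1
    rw [map_sum, map_mul] at h2
    have h3 : IsLocalRing.residue P.1 ⟨x, hxm⟩ = 0 := by
      rw [IsLocalRing.residue_eq_zero_iff, ValuationSubring.valuation_lt_one_iff]
      exact hx
    rw [h3, zero_mul] at h2
    rw [Fintype.linearIndependent_iff] at hs
    ext i
    refine hs c ?_ i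
    rw [← h2]
    refine Finset.sum_congr rfl fun i _ => ?_
    rw [map_mul, hu]; rfl

theorem placeDegree_pos (P : Place F K) : 0 < placeDegree F P := by
  let _ := (residueHom F P).toAlgebra
  have := residueField_finite P
  exact Module.finrank_pos (R := F) (M := IsLocalRing.ResidueField P.1)

theorem card_residueField [Fintype F] (P : Place F K) :
    Nat.card (IsLocalRing.ResidueField P.1) = Fintype.card F ^ placeDegree F P := by
  let _ := (residueHom F P).toAlgebra
  have := residueField_finite P
  have := Module.natCard_eq_pow_finrank (K := F) (V := IsLocalRing.ResidueField P.1)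
  rw [Nat.card_eq_fintype_card (α := F)] at this
  exact this

theorem relIndex_fil_one_zero (P : Place F K) :
    (fil P 1).relIndex (fil P 0) = Nat.card (IsLocalRing.ResidueField P.1) := by
  let i : P.1 →+ K := P.1.subtype.toAddMonoidHom
  let r : P.1 →+ IsLocalRing.ResidueField P.1 := (IsLocalRing.residue P.1).toAddMonoidHom
  have h1 : (⊤ : AddSubgroup P.1).map i = fil P 0 := by
    ext x
    rw [mem_fil_zero]
    constructor
    · rintro ⟨y, _, rfl⟩; exact y.2
    · intro hx; exact ⟨⟨x, hx⟩, trivial, rfl⟩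
  have h2 : (fil P 1).comap i = r.ker := by
    ext x
    rw [AddSubgroup.mem_comap, AddMonoidHom.mem_ker]
    show (x : K) ∈ fil P 1 ↔ IsLocalRing.residue P.1 x = 0
    rw [IsLocalRing.residue_eq_zero_iff, ValuationSubring.valuation_lt_one_iff]
    by_cases hx : (x : K) = 0
    · rw [hx]; simp [AddSubgroup.zero_mem]
    · rw [mem_fil_of_ne hx]
      exact (ord_pos_iff P hx)
  rw [← h1, ← AddSubgroup.relIndex_comap, h2, AddSubgroup.relIndex_top_right,
    AddSubgroup.index_ker]
  have h3 : r.range = ⊤ := AddMonoidHom.range_eq_top.2 IsLocalRing.residue_surjective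
  rw [h3]
  exact Nat.card_congr AddSubgroup.topEquiv.toEquiv

theorem fil_map_mul (P : Place F K) {a : K} (ha : a ≠ 0) (n : ℤ) :
    (fil P n).map (AddMonoidHom.mulLeft a) = fil P (n + ord P a) := by
  ext x
  constructor
  · rintro ⟨y, hy, rfl⟩
    exact (mul_mem_fil_iff ha).2 (by simpa using hy)
  · intro hx
    refine ⟨a⁻¹ * x, ?_, by simp [ha]⟩
    rw [SetLike.mem_coe, mul_mem_fil_iff (inv_ne_zero ha), ord_inv]
    simpa using hx

theorem mulLeft_injective' {a : K} (ha : a ≠ 0) :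
    Function.Injective (AddMonoidHom.mulLeft a) := fun _ _ h => mul_left_cancel₀ ha h

theorem relIndex_fil_succ (P : Place F K) (n : ℤ) :
    (fil P (n + 1)).relIndex (fil P n) = Nat.card (IsLocalRing.ResidueField P.1) := by
  obtain ⟨t, ht0, ht⟩ := exists_ord_eq P n
  have h1 := fil_map_mul P ht0 0
  have h2 := fil_map_mul P ht0 1
  rw [ht] at h1 h2
  rw [zero_add] at h1
  rw [add_comm n 1, ← h2, ← h1, ← relIndex_fil_one_zero P]
  exact AddSubgroup.relIndex_map_map_of_injective _ _ (mulLeft_injective' ht0)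

end Degree

end CFF

namespace CFF

open Polynomial IntermediateField

/-- Places of a function field over `𝔽₂`. -/
abbrev Pl (K : Type) [Field K] [Algebra (ZMod 2) K] := Place (ZMod 2) K

section Index

variable {K : Type} [Field K] [Algebra (ZMod 2) K]

/-- The degree of a place over `𝔽₂`. -/
abbrev pdeg (P : Pl K) : ℕ := placeDegree (ZMod 2) P

/-- The degree of a divisor. -/
abbrev deg (D : Divisor (ZMod 2) K) : ℤ := degHom (ZMod 2) K D

theorem deg_eq_sum (D : Divisor (ZMod 2) K) : deg D = D.sum fun P n => n * (pdeg P : ℤ) := by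
  simp only [deg, degHom, Finsupp.liftAddHom_apply]
  rfl

@[simp] theorem deg_single (P : Pl K) (n : ℤ) : deg (Finsupp.single P n) = n * pdeg P := by
  rw [deg_eq_sum, Finsupp.sum_single_index]; simp

theorem deg_eq_sum_of_subset (D : Divisor (ZMod 2) K) {S : Finset (Pl K)} (h : D.support ⊆ S) :
    deg D = ∑ P ∈ S, D P * pdeg P := by
  rw [deg_eq_sum]
  exact Finsupp.sum_of_support_subset _ h _ fun _ _ => by simp

theorem deg_nonneg {D : Divisor (ZMod 2) K} (h : 0 ≤ D) : 0 ≤ deg D := by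
  rw [deg_eq_sum]
  exact Finset.sum_nonneg fun P _ => mul_nonneg (h P) (by positivity)

theorem deg_mono {D E : Divisor (ZMod 2) K} (h : D ≤ E) : deg D ≤ deg E := by
  have := deg_nonneg (sub_nonneg.2 h)
  change 0 ≤ degHom _ _ (E - D) at this
  rw [map_sub] at this
  linarith

theorem deg_add (D E : Divisor (ZMod 2) K) : deg (D + E) = deg D + deg E :=
  map_add (degHom (ZMod 2) K) D E

theorem deg_neg (D : Divisor (ZMod 2) K) : deg (-D) = -deg D := map_neg (degHom (ZMod 2) K) D

theorem deg_sub (D E : Divisor (ZMod 2) K) : deg (D - E) = deg D - deg E :=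
  map_sub (degHom (ZMod 2) K) D E

theorem deg_nsmul (n : ℕ) (D : Divisor (ZMod 2) K) : deg (n • D) = n * deg D := by
  have := map_nsmul (degHom (ZMod 2) K) n D
  simpa using this

variable [FnField (ZMod 2) K]

theorem relIndex_fil_add (P : Pl K) (n : ℤ) (k : ℕ) :
    (fil P (n + k)).relIndex (fil P n) = 2 ^ (k * pdeg P) := by
  induction k with
  | zero => simp
  | succ k ih =>
    have h1 := AddSubgroup.relIndex_mul_relIndex (fil P (n + (k + 1 : ℕ))) (fil P (n + k))
      (fil P n) (fil_anti P (by push_cast; omega)) (fil_anti P (by omega))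
    rw [← h1, ih]
    have h2 := relIndex_fil_succ P (n + k)
    rw [card_residueField, ZMod.card] at h2
    push_cast
    rw [← add_assoc, h2, ← pow_add]
    congr 1; ring

/-- Elements with prescribed order bounds at the places of `S`. -/
def filS (S : Finset (Pl K)) (n : Pl K → ℤ) : AddSubgroup K := ⨅ P ∈ S, fil P (n P)

theorem mem_filS {S : Finset (Pl K)} {n : Pl K → ℤ} {f : K} :
    f ∈ filS S n ↔ ∀ P ∈ S, f ∈ fil P (n P) := by
  simp [filS, AddSubgroup.mem_iInf]

theorem relIndex_filS_step (S : Finset (Pl K)) (n m : Pl K → ℤ) (P : Pl K) (hP : P ∈ S) (k : ℕ)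
    (hm : m P = n P + k) (hne : ∀ Q, Q ≠ P → m Q = n Q) :
    (filS S m).relIndex (filS S n) = 2 ^ (k * pdeg P) := by
  have h1 : filS S m = fil P (m P) ⊓ filS S n := by
    ext f
    rw [AddSubgroup.mem_inf, mem_filS, mem_filS]
    constructor
    · intro h
      refine ⟨h P hP, fun Q hQ => ?_⟩
      by_cases hQP : Q = P
      · subst hQP; exact fil_anti Q (by omega) (h Q hQ)
      · rw [← hne Q hQP]; exact h Q hQ
    · rintro ⟨h1, h2⟩ Q hQ
      by_cases hQP : Q = P
      · subst hQP; exact h1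
      · rw [hne Q hQP]; exact h2 Q hQ
  have h2 : filS S n ⊔ fil P (m P) = fil P (n P) := by
    apply le_antisymm
    · refine sup_le (fun f hf => mem_filS.1 hf P hP) (fil_anti P (by omega))
    · intro f hf
      obtain ⟨y, hy⟩ := weak_approx S (fun Q => if Q = P then f else 0) m
      have hyP := hy P hP
      rw [if_pos rfl] at hyP
      have hyn : y ∈ filS S n := by
        rw [mem_filS]
        intro Q hQ
        by_cases hQP : Q = P
        · subst hQP
          have := (fil Q (n Q)).add_mem (fil_anti Q (by omega) hyP) hf
          simpa using this
        · have := hy Q hQ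
          rw [if_neg hQP, sub_zero, hne Q hQP] at this
          exact this
      have : f = y + -(y - f) := by ring
      rw [this]
      exact AddSubgroup.add_mem_sup hyn ((fil P _).neg_mem hyP)
  rw [h1, AddSubgroup.inf_relIndex_right, ← AddSubgroup.relIndex_sup_right, h2, hm,
    relIndex_fil_add]

theorem relIndex_filS (S : Finset (Pl K)) (n : Pl K → ℤ) (k : Pl K → ℕ) :
    (filS S fun P => n P + k P).relIndex (filS S n) = 2 ^ (∑ P ∈ S, k P * pdeg P) := by
  have key : ∀ U : Finset (Pl K), U ⊆ S →
      (filS S fun P => if P ∈ U then n P + k P else n P).relIndex (filS S n)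
        = 2 ^ (∑ P ∈ U, k P * pdeg P) := by
    intro U
    induction U using Finset.induction_on with
    | empty => intro _; simp
    | insert P U hP ih =>
      intro hU
      rw [Finset.insert_subset_iff] at hU
      rw [Finset.sum_insert hP, pow_add, ← ih hU.2]
      rw [← relIndex_filS_step S (fun Q => if Q ∈ U then n Q + k Q else n Q)
        (fun Q => if Q ∈ insert P U then n Q + k Q else n Q) P hU.1 (k P) (by simp [hP])
        (fun Q hQ => by simp [hQ])]
      refine (AddSubgroup.relIndex_mul_relIndex _ _ _ (fun f hf => ?_) (fun f hf => ?_)).symm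
      · rw [mem_filS] at hf ⊢
        intro Q hQ
        refine fil_anti Q ?_ (hf Q hQ)
        by_cases h1 : Q ∈ U
        · simp [h1]
        · by_cases h2 : Q = P <;> simp [h1, h2, hP]
      · rw [mem_filS] at hf ⊢
        intro Q hQ
        refine fil_anti Q ?_ (hf Q hQ)
        by_cases h1 : Q ∈ U <;> simp [h1]
  rw [← key S subset_rfl]
  congr 1
  ext f
  rw [mem_filS, mem_filS]
  exact forall₂_congr fun P hP => by simp [hP]

theorem relIndex_mul_le {x : K} (hx : x ∉ (algebraMap (ZMod 2) K).range) (M : AddSubgroup K)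
    (hM : ∀ m ∈ M, x * m ∈ M) :
    (M.map (AddMonoidHom.mulLeft x)).relIndex M ≤ 2 ^ Module.finrank (ZMod 2)⟮x⟯ K := by
  have := FnField.finite x hx
  let M' : Submodule (ZMod 2) K := AddSubgroup.toZModSubmodule 2 M
  let N : Submodule (ZMod 2) M' :=
    (AddSubgroup.toZModSubmodule 2 (M.map (AddMonoidHom.mulLeft x))).comap M'.subtype
  have h1 : (M.map (AddMonoidHom.mulLeft x)).relIndex M = Nat.card (M' ⧸ N) := rfl
  have hr : Module.rank (ZMod 2) (M' ⧸ N) ≤ Module.finrank (ZMod 2)⟮x⟯ K := by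
    refine rank_le fun s hs => ?_
    choose u hu using fun i : s => N.mkQ_surjective i.1
    have h := card_le_finrank_of_indep_mod (FnField.transcendental x hx) M' hM
      (fun i => (u i : K)) (fun i => (u i).2) ?_
    · simpa using h
    · rintro c ⟨m, hm, hcm⟩
      rw [Fintype.linearIndependent_iff] at hs
      ext i
      refine hs c ?_ i
      have h2 : ∑ i, c i • (i : M' ⧸ N) = N.mkQ (∑ i, c i • u i) := by
        rw [map_sum]
        exact Finset.sum_congr rfl fun i _ => by rw [map_smul, hu]
      rw [h2, Submodule.mkQ_apply, Submodule.Quotient.mk_eq_zero]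
      refine ⟨m, hm, ?_⟩
      simp only [Submodule.coe_subtype, AddSubmonoidClass.coe_finsetSum, Submodule.coe_smul]
      exact hcm.symm
  have hfin : Module.Finite (ZMod 2) (M' ⧸ N) := by
    rw [← Module.rank_lt_aleph0_iff]; exact hr.trans_lt Cardinal.natCast_lt_aleph0
  rw [h1, Module.natCard_eq_pow_finrank (K := ZMod 2), Nat.card_eq_fintype_card (α := ZMod 2),
    ZMod.card]
  exact Nat.pow_le_pow_right two_pos (Module.finrank_le_of_rank_le hr)

/-- The zeros of `x`, counted with multiplicity and degree, are at most `[K : 𝔽₂(x)]`. -/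
theorem sum_zeros_le {x : K} (hx : x ∉ (algebraMap (ZMod 2) K).range) (S : Finset (Pl K))
    (hS : ∀ P ∈ S, 0 ≤ ord P x) :
    ∑ P ∈ S, ord P x * pdeg P ≤ Module.finrank (ZMod 2)⟮x⟯ K := by
  have hx0 : x ≠ 0 := by rintro rfl; exact hx ⟨0, by simp⟩
  have h1 := relIndex_filS S (fun _ => 0) fun P => (ord P x).toNat
  have h2 : (filS S fun P => 0 + ((ord P x).toNat : ℤ))
      = (filS S fun _ => 0).map (AddMonoidHom.mulLeft x) := by
    ext f
    constructor
    · intro hf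
      refine ⟨x⁻¹ * f, ?_, by simp [hx0]⟩
      rw [SetLike.mem_coe, mem_filS]
      intro P hP
      rw [mul_mem_fil_iff (inv_ne_zero hx0), ord_inv]
      have := mem_filS.1 hf P hP
      rw [Int.toNat_of_nonneg (hS P hP)] at this
      rwa [sub_neg_eq_add]
    · rintro ⟨y, hy, rfl⟩
      rw [mem_filS]
      intro P hP
      rw [Int.toNat_of_nonneg (hS P hP)]
      refine (mul_mem_fil_iff hx0).2 ?_
      simpa using mem_filS.1 hy P hP
  rw [h2] at h1
  have h3 := relIndex_mul_le hx (filS S fun _ => 0) fun m hm => mem_filS.2 fun P hP => by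
    have := mul_mem_fil (mem_fil_ord P x) (mem_filS.1 hm P hP)
    exact fil_anti P (by have := hS P hP; omega) this
  rw [h1] at h3
  have h4 := (Nat.pow_le_pow_iff_right (by norm_num)).1 h3
  calc ∑ P ∈ S, ord P x * pdeg P = ((∑ P ∈ S, (ord P x).toNat * pdeg P : ℕ) : ℤ) := by
        push_cast
        exact Finset.sum_congr rfl fun P hP => by rw [Int.toNat_of_nonneg (hS P hP)]
    _ ≤ _ := by exact_mod_cast h4

theorem finite_zeros {x : K} (hx : x ≠ 0) : {P : Pl K | 0 < ord P x}.Finite := by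
  by_cases hr : x ∈ (algebraMap (ZMod 2) K).range
  · obtain ⟨c, rfl⟩ := hr
    simp [ord_algebraMap]
  by_contra hinf
  obtain ⟨S, hS, hcard⟩ := Set.Infinite.exists_subset_card_eq hinf
    (Module.finrank (ZMod 2)⟮x⟯ K + 1)
  have h := sum_zeros_le hr S fun P hP => (hS hP).le
  have h2 : ∑ P ∈ S, (1 : ℤ) ≤ ∑ P ∈ S, ord P x * pdeg P := by
    refine Finset.sum_le_sum fun P hP => ?_
    have h3 : 0 < ord P x := hS hP
    have h4 : 0 < pdeg P := placeDegree_pos P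
    nlinarith
  simp at h2
  rw [hcard] at h2
  push_cast at h2
  omega

theorem finite_ord_ne_zero (x : K) : (Function.support fun P : Pl K => ord P x).Finite := by
  by_cases hx : x = 0
  · subst hx; simp [ord_zero]
  refine ((finite_zeros hx).union (finite_zeros (inv_ne_zero hx))).subset fun P hP => ?_
  have hP : ord P x ≠ 0 := hP
  rcases lt_or_gt_of_ne hP with h | h
  · right; show 0 < ord P x⁻¹; rw [ord_inv]; omega
  · left; exact h

/-- The divisor of a function (zero for the zero function). -/
def pdiv (x : K) : Divisor (ZMod 2) K := Finsupp.ofSupportFinite _ (finite_ord_ne_zero x)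

@[simp] theorem pdiv_apply (x : K) (P : Pl K) : pdiv x P = ord P x := rfl

theorem pdiv_mul {x y : K} (hx : x ≠ 0) (hy : y ≠ 0) : pdiv (x * y) = pdiv x + pdiv y := by
  ext P; simp only [pdiv_apply, Finsupp.add_apply]; exact ord_mul P hx hy

theorem pdiv_inv (x : K) : pdiv x⁻¹ = - pdiv x := by
  ext P; simp only [pdiv_apply, Finsupp.neg_apply]; exact ord_inv P x

/-- The Riemann-Roch space as an additive group. -/
def L (D : Divisor (ZMod 2) K) : AddSubgroup K := ⨅ P, fil P (- D P)

theorem mem_L {D : Divisor (ZMod 2) K} {f : K} : f ∈ L D ↔ ∀ P, f ∈ fil P (- D P) := by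
  simp [L, AddSubgroup.mem_iInf]

theorem mem_L_of_ne {D : Divisor (ZMod 2) K} {f : K} (hf : f ≠ 0) : f ∈ L D ↔ 0 ≤ pdiv f + D := by
  rw [mem_L]
  refine forall_congr' fun P => ?_
  rw [mem_fil_of_ne hf]
  simp only [Finsupp.coe_zero, Pi.zero_apply, Finsupp.add_apply, pdiv_apply]
  omega

theorem L_mono {D E : Divisor (ZMod 2) K} (h : D ≤ E) : L D ≤ L E := fun f hf =>
  mem_L.2 fun P => fil_anti P (neg_le_neg (h P)) (mem_L.1 hf P)

theorem mul_mem_L {D E : Divisor (ZMod 2) K} {f g : K} (hf : f ∈ L D) (hg : g ∈ L E) :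
    f * g ∈ L (D + E) := mem_L.2 fun P => by
  have := mul_mem_fil (mem_L.1 hf P) (mem_L.1 hg P)
  rwa [← neg_add] at this

theorem RRspace_eq (D : Divisor (ZMod 2) K) :
    RRspace (ZMod 2) D = AddSubgroup.toZModSubmodule 2 (L D) := by
  apply le_antisymm
  · refine Submodule.span_le.2 fun f hf => ?_
    show f ∈ L D
    exact mem_L.2 fun P => Or.inr (by have := hf P; show - D P ≤ ordAt P.1 f; omega)
  · intro f hf
    have hf : f ∈ L D := hf
    by_cases h0 : f = 0
    · rw [h0]; exact Submodule.zero_mem _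
    · refine Submodule.subset_span fun P => ?_
      have := (mem_fil_of_ne h0).1 (mem_L.1 hf P)
      show 0 ≤ D P + ordAt P.1 f
      have h2 : ord P f = ordAt P.1 f := rfl
      omega

theorem card_L (D : Divisor (ZMod 2) K) (h : Finite (L D)) :
    Nat.card (L D) = 2 ^ ell (ZMod 2) D := by
  have h1 : ell (ZMod 2) D = Module.finrank (ZMod 2) (AddSubgroup.toZModSubmodule 2 (L D)) := by
    unfold ell; rw [RRspace_eq]
  rw [h1]
  have h2 : Finite (AddSubgroup.toZModSubmodule 2 (L D)) := h
  have := Module.natCard_eq_pow_finrank (K := ZMod 2) (V := AddSubgroup.toZModSubmodule 2 (L D))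
  rw [Nat.card_eq_fintype_card (α := ZMod 2), ZMod.card] at this
  exact this

end Index

end CFF

namespace CFF

open Polynomial IntermediateField

section Poles

variable {K : Type} [Field K] [Algebra (ZMod 2) K] [FnField (ZMod 2) K]

theorem zmod_two_cases (c : ZMod 2) : c = 0 ∨ c = 1 := by revert c; decide

theorem inv_notMem_range {x : K} (hx : x ∉ (algebraMap (ZMod 2) K).range) :
    x⁻¹ ∉ (algebraMap (ZMod 2) K).range := by
  rintro ⟨c, hc⟩
  exact hx ⟨c⁻¹, by rw [map_inv₀, hc, inv_inv]⟩

theorem ne_zero_of_notMem_range {x : K} (hx : x ∉ (algebraMap (ZMod 2) K).range) : x ≠ 0 := by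
  rintro rfl; exact hx ⟨0, by simp⟩

theorem exists_zero {x : K} (hx : x ∉ (algebraMap (ZMod 2) K).range) :
    ∃ P : Pl K, 0 < ord P x := by
  have hx0 := ne_zero_of_notMem_range hx
  have htr := FnField.transcendental x hx
  let A := Algebra.adjoin (ZMod 2) {x}
  have hxA : x ∈ A := Algebra.subset_adjoin rfl
  let I : Ideal A.toSubring := Ideal.span {⟨x, hxA⟩}
  have hI : I ≠ ⊤ := by
    rw [Ne, Ideal.span_singleton_eq_top]
    intro hu
    obtain ⟨y, hy⟩ := hu.exists_right_inv
    have hy1 : (y : K) ∈ A := y.2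
    obtain ⟨p, hp⟩ : (y : K) ∈ (aeval (R := ZMod 2) x).range := by
      rw [← Algebra.adjoin_singleton_eq_range_aeval]; exact hy1
    have h1 : x * aeval x p = 1 := by
      have := congrArg (Subtype.val) hy
      have h2 : x * (y : K) = 1 := this
      rwa [← hp] at h2
    have h2 : aeval x (X * p - 1) = 0 := by simp [h1]
    have h3 := (transcendental_iff.1 htr) _ h2
    have := congrArg (fun q => eval 0 q) h3
    simp at this
  obtain ⟨B, hAB, hIB⟩ := Ideal.image_subset_nonunits_valuationSubring I hI
  have hxB : x ∈ B.nonunits := hIB ⟨⟨x, hxA⟩, Ideal.subset_span rfl, rfl⟩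
  rw [ValuationSubring.mem_nonunits_iff] at hxB
  refine ⟨⟨B, ?_, fun c => hAB (A.algebraMap_mem c)⟩, ?_⟩
  · rintro rfl
    have : x⁻¹ ∈ (⊤ : ValuationSubring K) := ValuationSubring.mem_top _
    rw [← ValuationSubring.valuation_le_one_iff, map_inv₀] at this
    have h0 : (⊤ : ValuationSubring K).valuation x ≠ 0 := by simpa using hx0
    exact absurd (inv_le_one₀ (zero_lt_iff.2 h0) |>.1 this) (not_le.2 hxB)
  · exact (ord_pos_iff _ hx0).2 hxB

theorem exists_pole {x : K} (hx : x ∉ (algebraMap (ZMod 2) K).range) :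
    ∃ P : Pl K, ord P x < 0 := by
  obtain ⟨P, hP⟩ := exists_zero (inv_notMem_range hx)
  rw [ord_inv] at hP
  exact ⟨P, by omega⟩

theorem mem_L_zero {f : K} : f ∈ L (0 : Divisor (ZMod 2) K) ↔ f = 0 ∨ f = 1 := by
  constructor
  · intro hf
    by_contra hcon
    push Not at hcon
    have hr : f ∉ (algebraMap (ZMod 2) K).range := by
      rintro ⟨c, rfl⟩
      rcases zmod_two_cases c with rfl | rfl <;> simp at hcon
    obtain ⟨P, hP⟩ := exists_pole hr
    have := (mem_fil_of_ne hcon.1).1 (mem_L.1 hf P)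
    simp at this
    omega
  · rintro (rfl | rfl)
    · exact zero_mem _
    · exact mem_L.2 fun P => by simpa using one_mem_fil P

theorem card_L_zero : Nat.card (L (0 : Divisor (ZMod 2) K)) = 2 := by
  have : (L (0 : Divisor (ZMod 2) K) : Set K) = {0, 1} := by
    ext f; simp only [SetLike.mem_coe, mem_L_zero, Set.mem_insert_iff, Set.mem_singleton_iff]
  show Nat.card (L (0 : Divisor (ZMod 2) K) : Set K) = 2
  rw [this, Nat.card_coe_set_eq, Set.ncard_pair zero_ne_one]

theorem relIndex_L {D E : Divisor (ZMod 2) K} (h : D ≤ E) :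
    (L D).relIndex (L E) ≠ 0 ∧ ((L D).relIndex (L E) : ℤ) ≤ 2 ^ (deg E - deg D).toNat := by
  set S := (E - D).support
  have hk : ∀ P, ((((E - D) P).toNat : ℕ) : ℤ) = E P - D P := fun P => by
    have := h P
    rw [Finsupp.sub_apply]; omega
  have h1 := relIndex_filS S (fun P => - E P) fun P => ((E - D) P).toNat
  have h2 : (fun P => - E P + (((E - D) P).toNat : ℤ)) = fun P => - D P := by
    ext P; rw [hk]; ring
  rw [h2] at h1
  have h3 : L D = filS S (fun P => - D P) ⊓ L E := by
    ext f
    rw [AddSubgroup.mem_inf, mem_filS]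
    constructor
    · exact fun hf => ⟨fun P _ => mem_L.1 hf P, L_mono h hf⟩
    · rintro ⟨h1, h2⟩
      refine mem_L.2 fun P => ?_
      by_cases hP : P ∈ S
      · exact h1 P hP
      · have : D P = E P := by
          have := Finsupp.notMem_support_iff.1 hP
          rw [Finsupp.sub_apply] at this; omega
        rw [this]; exact mem_L.1 h2 P
  have h4 : L E ≤ filS S (fun P => - E P) := fun f hf => mem_filS.2 fun P _ => mem_L.1 hf P
  have h5 : (filS S (fun P => - D P)).relIndex (filS S (fun P => - E P)) ≠ 0 := by
    rw [h1]; positivity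
  have h6 := AddSubgroup.relIndex_le_of_le_right h4 h5
  rw [h3, AddSubgroup.inf_relIndex_right]
  refine ⟨fun h0 => h5 ?_, ?_⟩
  · have := AddSubgroup.relIndex_dvd_of_le_left (L E) (le_refl (filS S (fun P => - D P)))
    exact absurd h0 (AddSubgroup.relIndex_ne_zero_trans (K := filS S (fun P => - E P)) h5 (by
      rw [AddSubgroup.relIndex_eq_one.2 h4]; exact one_ne_zero))
  · rw [h1] at h6
    have h7 : (deg E - deg D).toNat = ∑ P ∈ S, ((E - D) P).toNat * pdeg P := by
      have : deg E - deg D = ((∑ P ∈ S, ((E - D) P).toNat * pdeg P : ℕ) : ℤ) := by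
        rw [← deg_sub, deg_eq_sum_of_subset (E - D) subset_rfl]
        push_cast
        refine Finset.sum_congr rfl fun P _ => ?_
        have := hk P
        change (E P - D P) * (pdeg P : ℤ) = ((E P - D P).toNat : ℤ) * pdeg P
        change ((E P - D P).toNat : ℤ) = _ at this
        rw [this]
      rw [this, Int.toNat_natCast]
    rw [h7]
    exact_mod_cast h6

theorem card_L_mul_relIndex {D E : Divisor (ZMod 2) K} (h : D ≤ E) :
    Nat.card (L D) * (L D).relIndex (L E) = Nat.card (L E) := by
  rw [← AddSubgroup.relIndex_bot_left, ← AddSubgroup.relIndex_bot_left,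
    AddSubgroup.relIndex_mul_relIndex _ _ _ bot_le (L_mono h)]

instance finite_L (D : Divisor (ZMod 2) K) : Finite (L D) := by
  have h0 : ∀ E : Divisor (ZMod 2) K, 0 ≤ E → Finite (L E) := fun E hE => by
    apply Nat.finite_of_card_ne_zero
    rw [← card_L_mul_relIndex hE, card_L_zero]
    exact mul_ne_zero two_ne_zero (relIndex_L hE).1
  have h1 := h0 (D ⊔ 0) le_sup_right
  exact Finite.of_injective _ (AddSubgroup.inclusion_injective (L_mono (le_sup_left : D ≤ D ⊔ 0)))

/-- The dimension of the Riemann-Roch space. -/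
abbrev rr (D : Divisor (ZMod 2) K) : ℕ := ell (ZMod 2) D

theorem card_L_eq (D : Divisor (ZMod 2) K) : Nat.card (L D) = 2 ^ rr D := card_L D inferInstance

theorem rr_zero : rr (0 : Divisor (ZMod 2) K) = 1 := by
  have := card_L_eq (0 : Divisor (ZMod 2) K)
  rw [card_L_zero] at this
  exact (Nat.pow_right_injective le_rfl (by simpa using this)).symm

theorem rr_mono {D E : Divisor (ZMod 2) K} (h : D ≤ E) : rr D ≤ rr E := by
  rw [← Nat.pow_le_pow_iff_right one_lt_two, ← card_L_eq, ← card_L_eq]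
  exact Nat.card_le_card_of_injective _ (AddSubgroup.inclusion_injective (L_mono h))

theorem relIndex_L_eq {D E : Divisor (ZMod 2) K} (h : D ≤ E) :
    (L D).relIndex (L E) = 2 ^ (rr E - rr D) := by
  have h1 := card_L_mul_relIndex h
  rw [card_L_eq, card_L_eq] at h1
  have h2 : (2 : ℕ) ^ rr E = 2 ^ rr D * 2 ^ (rr E - rr D) := by
    rw [← pow_add, Nat.add_sub_cancel' (rr_mono h)]
  rw [h2] at h1
  exact Nat.eq_of_mul_eq_mul_left (by positivity) h1

theorem rr_le_add {D E : Divisor (ZMod 2) K} (h : D ≤ E) : (rr E : ℤ) - rr D ≤ deg E - deg D := by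
  have h1 := (relIndex_L h).2
  rw [relIndex_L_eq h] at h1
  have h2 : rr E - rr D ≤ (deg E - deg D).toNat := by
    rw [← Nat.pow_le_pow_iff_right one_lt_two]; exact_mod_cast h1
  have := deg_mono h
  have := rr_mono h
  omega

end Poles

section DegreeFormula

variable {K : Type} [Field K] [Algebra (ZMod 2) K] [FnField (ZMod 2) K]

/-- The divisor of zeros. -/
def zdiv (x : K) : Divisor (ZMod 2) K := pdiv x ⊔ 0

theorem zdiv_apply (x : K) (P : Pl K) : zdiv x P = max (ord P x) 0 := rfl

theorem zdiv_nonneg (x : K) : 0 ≤ zdiv x := le_sup_right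

theorem zdiv_sub (x : K) : zdiv x - zdiv x⁻¹ = pdiv x := by
  ext P
  rw [Finsupp.sub_apply, zdiv_apply, zdiv_apply, ord_inv, pdiv_apply]
  omega

theorem deg_zdiv_le {x : K} (hx : x ∉ (algebraMap (ZMod 2) K).range) :
    deg (zdiv x) ≤ Module.finrank (ZMod 2)⟮x⟯ K := by
  refine le_trans (le_of_eq ?_) (sum_zeros_le hx (zdiv x).support fun P hP => ?_)
  · rw [deg_eq_sum_of_subset _ subset_rfl]
    refine Finset.sum_congr rfl fun P hP => ?_
    have h := Finsupp.mem_support_iff.1 hP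
    rw [zdiv_apply] at h ⊢
    rw [max_eq_left (by omega)]
  · have h := Finsupp.mem_support_iff.1 hP
    rw [zdiv_apply] at h
    omega

theorem mem_L_zdiv_inv (x : K) : x ∈ L (zdiv x⁻¹) := mem_L.2 fun P =>
  Or.inr (by rw [zdiv_apply, ord_inv]; omega)

theorem pow_mem_L {D : Divisor (ZMod 2) K} {f : K} (hf : f ∈ L D) (n : ℕ) : f ^ n ∈ L (n • D) := by
  induction n with
  | zero => simpa using mem_L_zero.2 (Or.inr rfl)
  | succ n ih => rw [pow_succ, succ_nsmul]; exact mul_mem_L ih hf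

theorem exists_mem_L_finset (s : Finset K) : ∃ C : Divisor (ZMod 2) K, 0 ≤ C ∧ ∀ x ∈ s, x ∈ L C := by
  refine ⟨∑ y ∈ s, zdiv y⁻¹, Finset.sum_nonneg fun y _ => zdiv_nonneg _, fun x hx => ?_⟩
  refine L_mono ?_ (mem_L_zdiv_inv x)
  exact Finset.single_le_sum (f := fun y : K => zdiv y⁻¹) (fun y _ => zdiv_nonneg _) hx

theorem smul_mem_L {D : Divisor (ZMod 2) K} {f : K} (c : ZMod 2) (hf : f ∈ L D) : c • f ∈ L D := by
  rcases zmod_two_cases c with rfl | rfl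
  · rw [zero_smul]; exact zero_mem _
  · rwa [one_smul]

theorem rr_le_deg {D : Divisor (ZMod 2) K} (h : 0 ≤ D) : (rr D : ℤ) ≤ deg D + 1 := by
  have := rr_le_add h
  rw [rr_zero] at this
  have h0 : deg (0 : Divisor (ZMod 2) K) = 0 := map_zero (degHom (ZMod 2) K)
  omega

theorem le_deg_zdiv_inv {x : K} (hx : x ∉ (algebraMap (ZMod 2) K).range) :
    (Module.finrank (ZMod 2)⟮x⟯ K : ℤ) ≤ deg (zdiv x⁻¹) := by
  have := FnField.finite x hx
  have htr := FnField.transcendental x hx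
  set n := Module.finrank (ZMod 2)⟮x⟯ K with hn
  let u := Module.finBasis (ZMod 2)⟮x⟯ K
  obtain ⟨C, hC0, hC⟩ := exists_mem_L_finset (Finset.univ.image u)
  set B := zdiv x⁻¹
  have key : ∀ l : ℕ, (n : ℤ) * l ≤ 1 + (l * deg B + deg C) := by
    intro l
    have hmem : ∀ c : Fin n → Fin l → ZMod 2,
        ∑ j, (∑ i, c j i • x ^ (i : ℕ)) * u j ∈ L (l • B + C) := fun c => by
      refine sum_mem fun j _ => mul_mem_L (sum_mem fun i _ => smul_mem_L _ ?_)
        (hC _ (Finset.mem_image_of_mem _ (Finset.mem_univ j)))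
      refine L_mono ?_ (pow_mem_L (mem_L_zdiv_inv x) i)
      exact nsmul_le_nsmul_left (zdiv_nonneg _) i.2.le
    let φ : (Fin n → Fin l → ZMod 2) → L (l • B + C) := fun c => ⟨_, hmem c⟩
    have hinj : Function.Injective φ := by
      intro c d hcd
      have h1 : ∑ j, (∑ i, c j i • x ^ (i : ℕ)) * u j = ∑ j, (∑ i, d j i • x ^ (i : ℕ)) * u j :=
        congrArg Subtype.val hcd
      let r : (Fin l → ZMod 2) → (ZMod 2)⟮x⟯ := fun c => ∑ i, c i • AdjoinSimple.gen (ZMod 2) x ^ (i : ℕ)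
      have hr : ∀ c, (r c : K) = ∑ i, c i • x ^ (i : ℕ) := fun c => by
        simp [r]
      have h2 : ∑ j, r (c j) • u j = ∑ j, r (d j) • u j := by
        simp only [IntermediateField.smul_def, hr]
        exact h1
      have h3 := fun j => congrFun (u.equivFun.symm.injective
        (by simpa only [Module.Basis.equivFun_symm_apply] using h2 :
          u.equivFun.symm (fun j => r (c j)) = u.equivFun.symm (fun j => r (d j)))) j
      funext j i
      have h4 : (∑ i, c j i • x ^ (i : ℕ)) = ∑ i, d j i • x ^ (i : ℕ) := by
        rw [← hr, ← hr]; exact congrArg _ (h3 j)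
      have h5 : aeval x (∑ i, Polynomial.C (c j i - d j i) * X ^ (i : ℕ)) = 0 := by
        simp only [map_sum, map_mul, map_pow, aeval_X, aeval_C, map_sub, sub_mul]
        simp only [← Algebra.smul_def]
        rw [Finset.sum_sub_distrib, h4, sub_self]
      have h6 := transcendental_iff.1 htr _ h5
      have h7 := congrArg (fun p => coeff p i) h6
      simp only [finset_sum_coeff, coeff_C_mul, coeff_X_pow, coeff_zero] at h7
      rw [Finset.sum_eq_single i] at h7
      · simpa [sub_eq_zero] using h7
      · intro b _ hb
        have : (i : ℕ) ≠ b := fun h => hb (Fin.ext h.symm)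
        simp [this]
      · simp
    have h8 := Nat.card_le_card_of_injective φ hinj
    rw [card_L_eq, Nat.card_fun, Nat.card_fun] at h8
    simp only [Nat.card_eq_fintype_card, Fintype.card_fin, ZMod.card] at h8
    rw [← pow_mul, Nat.pow_le_pow_iff_right one_lt_two] at h8
    have h9 := rr_le_deg (D := l • B + C) (add_nonneg (nsmul_nonneg (zdiv_nonneg _) l) hC0)
    rw [deg_add, deg_nsmul] at h9
    have h10 : ((l * n : ℕ) : ℤ) ≤ rr (l • B + C) := by exact_mod_cast h8
    push_cast at h10
    nlinarith
  by_contra hlt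
  push Not at hlt
  have h1 := key (1 + (deg C).toNat + 1)
  have h2 := deg_nonneg hC0
  push_cast at h1
  rw [Int.toNat_of_nonneg h2] at h1
  nlinarith

theorem adjoin_inv (x : K) : (ZMod 2)⟮x⁻¹⟯ = (ZMod 2)⟮x⟯ := by
  apply le_antisymm
  · rw [adjoin_simple_le_iff]; exact inv_mem (mem_adjoin_simple_self _ x)
  · rw [adjoin_simple_le_iff]
    simpa using inv_mem (mem_adjoin_simple_self (ZMod 2) x⁻¹)

theorem finrank_adjoin_inv (x : K) :
    Module.finrank (ZMod 2)⟮x⁻¹⟯ K = Module.finrank (ZMod 2)⟮x⟯ K := by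
  rw [adjoin_inv]

theorem deg_zdiv {x : K} (hx : x ∉ (algebraMap (ZMod 2) K).range) :
    deg (zdiv x) = Module.finrank (ZMod 2)⟮x⟯ K := by
  have h1 := deg_zdiv_le hx
  have h2 := le_deg_zdiv_inv (inv_notMem_range hx)
  rw [inv_inv, finrank_adjoin_inv] at h2
  omega

theorem deg_pdiv (x : K) : deg (pdiv x) = 0 := by
  by_cases hx : x ∈ (algebraMap (ZMod 2) K).range
  · obtain ⟨c, rfl⟩ := hx
    have : pdiv (algebraMap (ZMod 2) K c) = 0 := by ext P; simp [ord_algebraMap]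
    rw [this]; exact map_zero (degHom (ZMod 2) K)
  · rw [← zdiv_sub, deg_sub, deg_zdiv hx, deg_zdiv (inv_notMem_range hx), finrank_adjoin_inv, sub_self]

theorem rr_of_deg_neg {D : Divisor (ZMod 2) K} (h : deg D < 0) : rr D = 0 := by
  have h1 : L D = ⊥ := by
    rw [eq_bot_iff]
    intro f hf
    by_contra h0
    have h2 := deg_nonneg ((mem_L_of_ne h0).1 hf)
    rw [deg_add, deg_pdiv] at h2
    omega
  have h2 := card_L_eq D
  rw [h1, Nat.card_unique] at h2
  exact (Nat.pow_right_injective le_rfl (by simpa using h2)).symm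

theorem rr_add_pdiv (D : Divisor (ZMod 2) K) {x : K} (hx : x ≠ 0) : rr (D + pdiv x) = rr D := by
  have key : ∀ (D : Divisor (ZMod 2) K) {x : K}, x ≠ 0 → rr (D + pdiv x) ≤ rr D := fun D x hx => by
    rw [← Nat.pow_le_pow_iff_right one_lt_two, ← card_L_eq, ← card_L_eq]
    refine Nat.card_le_card_of_injective
      (fun f : L (D + pdiv x) => (⟨x * f, ?_⟩ : L D)) fun f g h => ?_
    · by_cases hf : (f : K) = 0
      · rw [hf, mul_zero]; exact zero_mem _
      · have := (mem_L_of_ne hf).1 f.2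
        rw [mem_L_of_ne (mul_ne_zero hx hf), pdiv_mul hx hf]
        refine this.trans (le_of_eq (by abel))
    · exact Subtype.ext (mul_left_cancel₀ hx (congrArg Subtype.val h))
  refine le_antisymm (key D hx) ?_
  have := key (D + pdiv x) (inv_ne_zero hx)
  rwa [pdiv_inv, add_neg_cancel_right] at this

end DegreeFormula

section FiniteDegree

variable {K : Type} [Field K] [Algebra (ZMod 2) K] [FnField (ZMod 2) K]

theorem pow_card_residue_sub_mem (P : Pl K) {x : K} (hx : x ∈ P.1) :
    x ^ (2 ^ pdeg P) - x ∈ fil P 1 := by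
  have hfin : Finite (IsLocalRing.ResidueField P.1) := by
    apply Nat.finite_of_card_ne_zero
    rw [card_residueField P, ZMod.card]; positivity
  have := Fintype.ofFinite (IsLocalRing.ResidueField P.1)
  have hc : Fintype.card (IsLocalRing.ResidueField P.1) = 2 ^ pdeg P := by
    rw [← Nat.card_eq_fintype_card, card_residueField P, ZMod.card]
  have h1 := FiniteField.pow_card (IsLocalRing.residue P.1 ⟨x, hx⟩)
  rw [hc, ← map_pow, ← sub_eq_zero, ← map_sub, IsLocalRing.residue_eq_zero_iff,
    ValuationSubring.valuation_lt_one_iff] at h1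
  by_cases h0 : x ^ (2 ^ pdeg P) - x = 0
  · rw [h0]; exact zero_mem _
  · rw [mem_fil_of_ne h0]
    exact (ord_pos_iff P h0).2 h1

end FiniteDegree

section Rational

instance : FnField (ZMod 2) (RatFunc (ZMod 2)) := by
  have h : ∀ x : RatFunc (ZMod 2), x ∉ (algebraMap (ZMod 2) (RatFunc (ZMod 2))).range →
      Transcendental (ZMod 2) x := fun x hx => by
    refine RatFunc.transcendental_of_ne_C x fun ⟨c, hc⟩ => hx ⟨c, ?_⟩
    rw [hc]; rfl
  refine FnField.of_isFunctionField ⟨RatFunc.X, RatFunc.transcendental_X, ?_⟩ fun a ha => ?_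
  · have h1 : (ZMod 2)⟮(RatFunc.X : RatFunc (ZMod 2))⟯ = ⊤ := RatFunc.adjoin_X
    rw [h1]
    exact Module.Finite.of_surjective (Algebra.linearMap
      (⊤ : IntermediateField (ZMod 2) (RatFunc (ZMod 2))) (RatFunc (ZMod 2)))
      fun y => ⟨⟨y, trivial⟩, rfl⟩
  · by_contra hc
    exact h a hc ha

end Rational

end CFF

namespace CFF

open Polynomial IntermediateField

section Dual

theorem card_dual_zmod_two {G : Type} [AddCommGroup G] (h2 : ∀ g : G, (2 : ℕ) • g = 0)
    [Finite G] : Nat.card (G →+ ZMod 2) = Nat.card G := by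
  letI : Module (ZMod 2) G := AddCommGroup.zmodModule h2
  have h1 : Nat.card (G →+ ZMod 2) = Nat.card (Module.Dual (ZMod 2) G) :=
    Nat.card_congr
      { toFun := fun f => f.toZModLinearMap 2
        invFun := fun f => f.toAddMonoidHom
        left_inv := fun f => by ext; rfl
        right_inv := fun f => by ext; rfl }
  rw [h1, Module.natCard_eq_pow_finrank (K := ZMod 2), Module.natCard_eq_pow_finrank (K := ZMod 2)
    (V := G), Subspace.dual_finrank_eq]

/-- Functionals with values in `𝔽₂` that vanish on a subgroup. -/
def annih {G : Type} [AddCommGroup G] (H : AddSubgroup G) : AddSubgroup (G →+ ZMod 2) where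
  carrier := {φ | ∀ g ∈ H, φ g = 0}
  add_mem' := fun {a b} ha hb g hg => by
    rw [AddMonoidHom.add_apply, ha g hg, hb g hg, add_zero]
  zero_mem' := fun _ _ => rfl
  neg_mem' := fun {a} ha g hg => by rw [AddMonoidHom.neg_apply, ha g hg, neg_zero]

theorem card_annih {G : Type} [AddCommGroup G] (h2 : ∀ g : G, (2 : ℕ) • g = 0)
    (H : AddSubgroup G) (hH : H.index ≠ 0) : Nat.card (annih H) = H.index := by
  haveI : Finite (G ⧸ H) := Nat.finite_of_card_ne_zero hH
  have h3 : ∀ g : G ⧸ H, (2 : ℕ) • g = 0 := by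
    intro g
    induction g using QuotientAddGroup.induction_on with
    | H z => rw [← QuotientAddGroup.mk_nsmul, h2]; rfl
  rw [AddSubgroup.index, ← card_dual_zmod_two h3]
  exact Nat.card_congr
    { toFun := fun φ => QuotientAddGroup.lift H φ.1 fun g hg => φ.2 g hg
      invFun := fun ψ => ⟨ψ.comp (QuotientAddGroup.mk' H), fun g hg => by
        rw [AddMonoidHom.comp_apply, (QuotientAddGroup.eq_zero_iff g).2 hg |> fun h => (h :
          QuotientAddGroup.mk' H g = 0), map_zero]⟩
      left_inv := fun φ => by ext; rfl
      right_inv := fun ψ => by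
        ext g; rfl }

end Dual

section Adeles

variable {K : Type} [Field K] [Algebra (ZMod 2) K] [FnField (ZMod 2) K]

/-- Families of elements bounded by a divisor. -/
def adel (D : Divisor (ZMod 2) K) : AddSubgroup (Pl K → K) where
  carrier := {α | ∀ P, α P ∈ fil P (- D P)}
  add_mem' := fun ha hb P => add_mem (ha P) (hb P)
  zero_mem' := fun P => zero_mem (fil P (- D P))
  neg_mem' := fun ha P => neg_mem (ha P)

theorem adel_mono {D E : Divisor (ZMod 2) K} (h : D ≤ E) : adel D ≤ adel E :=
  fun _ hα P => fil_anti P (neg_le_neg (h P)) (hα P)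

theorem relIndex_adel_single (D : Divisor (ZMod 2) K) (P : Pl K) :
    (adel D).relIndex (adel (D + Finsupp.single P 1)) = 2 ^ pdeg P := by
  set E := D + Finsupp.single P 1 with hE
  have hEP : E P = D P + 1 := by rw [hE]; simp
  have hEQ : ∀ Q, Q ≠ P → E Q = D Q := fun Q hQ => by
    rw [hE, Finsupp.add_apply, Finsupp.single_eq_of_ne hQ, add_zero]
  have h1 : adel D = (fil P (- D P)).comap (Pi.evalAddMonoidHom (fun _ => K) P) ⊓ adel E := by
    ext α
    rw [AddSubgroup.mem_inf, AddSubgroup.mem_comap]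
    constructor
    · refine fun h => ⟨h P, fun Q => ?_⟩
      by_cases hQ : Q = P
      · subst hQ; rw [hEP]; exact fil_anti Q (by omega) (h Q)
      · rw [hEQ Q hQ]; exact h Q
    · rintro ⟨h1, h2⟩ Q
      by_cases hQ : Q = P
      · subst hQ; exact h1
      · rw [← hEQ Q hQ]; exact h2 Q
  have h2 : (adel E).map (Pi.evalAddMonoidHom (fun _ => K) P) = fil P (- E P) := by
    ext f
    constructor
    · rintro ⟨α, hα, rfl⟩
      exact hα P
    · intro hf
      refine ⟨Function.update 0 P f, fun Q => ?_, by simp⟩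
      by_cases hQ : Q = P
      · subst hQ; simpa using hf
      · rw [Function.update_of_ne hQ]; exact zero_mem _
  rw [h1, AddSubgroup.inf_relIndex_right, AddSubgroup.relIndex_comap, h2, hEP]
  have := relIndex_fil_add P (-(D P + 1)) 1
  rw [one_mul] at this
  rw [← this]
  congr 2
  push_cast; ring

theorem eq_of_le_of_deg_le {D E : Divisor (ZMod 2) K} (h : D ≤ E) (hd : deg E ≤ deg D) :
    D = E := by
  by_contra hne
  obtain ⟨P, hP⟩ : ∃ P, D P < E P := by
    by_contra hcon
    push Not at hcon
    exact hne (le_antisymm h hcon)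
  have h1 : D + Finsupp.single P 1 ≤ E := by
    intro Q
    by_cases hQ : Q = P
    · subst hQ; simp; omega
    · rw [Finsupp.add_apply, Finsupp.single_eq_of_ne hQ, add_zero]; exact h Q
  have h2 := deg_mono h1
  rw [deg_add, deg_single] at h2
  have := placeDegree_pos (F := ZMod 2) P
  have h3 : (0 : ℤ) < pdeg P := by exact_mod_cast this
  omega

theorem relIndex_adel {D E : Divisor (ZMod 2) K} (h : D ≤ E) :
    (adel D).relIndex (adel E) = 2 ^ (deg E - deg D).toNat := by
  induction hn : (deg E - deg D).toNat using Nat.strong_induction_on generalizing D with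
  | _ n ih =>
  by_cases hDE : D = E
  · subst hDE; simp at hn; subst hn; simp
  obtain ⟨P, hP⟩ : ∃ P, D P < E P := by
    by_contra hcon
    push Not at hcon
    exact hDE (le_antisymm h hcon)
  have h1 : D + Finsupp.single P 1 ≤ E := by
    intro Q
    by_cases hQ : Q = P
    · subst hQ; simp; omega
    · rw [Finsupp.add_apply, Finsupp.single_eq_of_ne hQ, add_zero]; exact h Q
  have h2 := deg_mono h1
  have h3 := placeDegree_pos (F := ZMod 2) P
  have h4 : deg (D + Finsupp.single P 1) = deg D + pdeg P := by
    rw [deg_add, deg_single, one_mul]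
  have h5 : D ≤ D + Finsupp.single P 1 := le_add_of_nonneg_right (by simp)
  have h6 : 0 < pdeg P := h3
  rw [← AddSubgroup.relIndex_mul_relIndex _ _ _ (adel_mono h5) (adel_mono h1),
    relIndex_adel_single, ih ((deg E - deg (D + Finsupp.single P 1)).toNat) (by omega) h1 rfl,
    ← pow_add]
  congr 1
  omega

/-- The diagonal embedding of the function field in the families. -/
def diagHom (K : Type) [Field K] [Algebra (ZMod 2) K] : K →+ (Pl K → K) where
  toFun := fun f _ => f
  map_zero' := rfl
  map_add' := fun _ _ => rfl

/-- Families bounded by a divisor, up to constant families. -/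
def adelK (D : Divisor (ZMod 2) K) : AddSubgroup (Pl K → K) := adel D ⊔ (diagHom K).range

theorem comap_diag_adel (D : Divisor (ZMod 2) K) : (adel D).comap (diagHom K) = L D := by
  ext f
  rw [mem_L]; rfl

theorem relIndex_adelK {D E : Divisor (ZMod 2) K} (h : D ≤ E) :
    (adelK D).relIndex (adelK E) * 2 ^ (rr E - rr D) = 2 ^ (deg E - deg D).toNat := by
  have h1 : adelK E = adel E ⊔ adelK D := by
    rw [adelK, adelK, ← sup_assoc, sup_eq_left.2 (adel_mono h)]
  have h2 : adelK D ⊓ adel E = adel D ⊔ ((diagHom K).range ⊓ adel E) := by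
    rw [adelK, sup_inf_assoc_of_le _ (adel_mono h)]
  have h3 : (diagHom K).range ⊓ adel E = (L E).map (diagHom K) := by
    rw [← comap_diag_adel, AddSubgroup.map_comap_eq]
  rw [h1, AddSubgroup.relIndex_sup_right, ← AddSubgroup.inf_relIndex_right, h2, h3]
  have h4 := AddSubgroup.relIndex_mul_relIndex (adel D) (adel D ⊔ (L E).map (diagHom K)) (adel E)
    le_sup_left (sup_le (adel_mono h) (by rw [← h3]; exact inf_le_right))
  rw [relIndex_adel h, sup_comm, AddSubgroup.relIndex_sup_right, ← AddSubgroup.relIndex_comap,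
    comap_diag_adel, relIndex_L_eq h] at h4
  rw [← h4, mul_comm, sup_comm]

end Adeles

end CFF

namespace CFF

/-- A function field over `𝔽₂` of genus `4` and class number `1`. -/
class GenusFour (K : Type) [Field K] [Algebra (ZMod 2) K] [FnField (ZMod 2) K] : Prop where
  riemann : ∀ D : Divisor (ZMod 2) K, deg D ≤ rr D + 3
  attained : ∃ D : Divisor (ZMod 2) K, deg D = rr D + 3
  principal : ∀ D : Divisor (ZMod 2) K, deg D = 0 → ∃ f : K, f ≠ 0 ∧ pdiv f = D

section FromInvariants

variable {K : Type} [Field K] [Algebra (ZMod 2) K] [FnField (ZMod 2) K]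

theorem exists_pdiv_of_mem_principalDivisors {D : Divisor (ZMod 2) K}
    (hD : D ∈ principalDivisors (ZMod 2) K) : ∃ f : K, f ≠ 0 ∧ pdiv f = D := by
  induction hD using AddSubgroup.closure_induction with
  | mem D h =>
    obtain ⟨f, hf, h⟩ := h
    exact ⟨f, hf, by ext P; exact (h P).symm⟩
  | zero => exact ⟨1, one_ne_zero, by ext P; exact ord_one P⟩
  | add D E _ _ hD hE =>
    obtain ⟨f, hf, rfl⟩ := hD
    obtain ⟨g, hg, rfl⟩ := hE
    exact ⟨f * g, mul_ne_zero hf hg, pdiv_mul hf hg⟩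
  | neg D _ hD =>
    obtain ⟨f, hf, rfl⟩ := hD
    exact ⟨f⁻¹, inv_ne_zero hf, pdiv_inv f⟩

theorem GenusFour.of_invariants (hg : genus (ZMod 2) K = 4) (hh : classNumber (ZMod 2) K = 1) :
    GenusFour K := by
  set S := {g : ℕ | ∃ D : Divisor (ZMod 2) K, (g : ℤ) = degHom (ZMod 2) K D + 1 - ell (ZMod 2) D}
    with hS
  have hS4 : sSup S = 4 := hg
  have hbdd : BddAbove S := by
    by_contra hcon
    rw [Nat.sSup_of_not_bddAbove hcon] at hS4
    omega
  have hne : S.Nonempty := by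
    by_contra hcon
    rw [Set.not_nonempty_iff_eq_empty] at hcon
    rw [hcon] at hS4
    simp at hS4
  constructor
  · intro D
    by_cases h0 : deg D + 1 - rr D < 0
    · omega
    · have h1 : (deg D + 1 - rr D).toNat ∈ S := ⟨D, by
        change ((deg D + 1 - rr D).toNat : ℤ) = deg D + 1 - rr D
        omega⟩
      have := le_csSup hbdd h1
      omega
  · have h1 := Nat.sSup_mem hne hbdd
    rw [hS4] at h1
    obtain ⟨D, hD⟩ := h1
    refine ⟨D, ?_⟩
    change ((4 : ℕ) : ℤ) = deg D + 1 - rr D at hD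
    omega
  · intro D hD
    have h1 := (Nat.card_eq_one_iff_unique.1 hh).1
    have hD' : D ∈ zeroDivisors (ZMod 2) K := hD
    have h2 : ((⟨D, hD'⟩ : zeroDivisors (ZMod 2) K) : zeroDivisors (ZMod 2) K ⧸
      (principalDivisors (ZMod 2) K).addSubgroupOf (zeroDivisors (ZMod 2) K)) = (0 : _) :=
      h1.elim (α := ClassGroup0 (ZMod 2) K) _ _
    rw [QuotientAddGroup.eq_zero_iff] at h2
    exact exists_pdiv_of_mem_principalDivisors h2

end FromInvariants

section RiemannRoch

variable {K : Type} [Field K] [Algebra (ZMod 2) K] [FnField (ZMod 2) K]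

variable (K) in
/-- The repartitions: families bounded by some divisor. -/
def Adele : Submodule K (Pl K → K) where
  carrier := {α | ∃ D, α ∈ adel D}
  zero_mem' := ⟨0, zero_mem _⟩
  add_mem' := by
    rintro a b ⟨D, hD⟩ ⟨E, hE⟩
    exact ⟨D ⊔ E, add_mem (adel_mono le_sup_left hD) (adel_mono le_sup_right hE)⟩
  smul_mem' := by
    rintro x a ⟨D, hD⟩
    refine ⟨D - pdiv x, fun P => ?_⟩
    by_cases hx : x = 0
    · subst hx; simp
    · have := mul_mem_fil (mem_fil_ord P x) (hD P)
      change x * a P ∈ fil P (-((D - pdiv x) P))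
      have h1 : -((D - pdiv x) P) = ord P x + - D P := by
        change -(D P - ord P x) = ord P x + - D P
        ring
      rwa [h1]

theorem adel_le_Adele (D : Divisor (ZMod 2) K) : adel D ≤ (Adele K).toAddSubgroup :=
  fun _ h => ⟨D, h⟩

theorem diag_mem_adel (x : K) : diagHom K x ∈ adel (zdiv x⁻¹) :=
  fun P => mem_L.1 (mem_L_zdiv_inv x) P

theorem adelK_le_Adele (D : Divisor (ZMod 2) K) : adelK D ≤ (Adele K).toAddSubgroup :=
  sup_le (adel_le_Adele D) (by rintro _ ⟨x, rfl⟩; exact ⟨_, diag_mem_adel x⟩)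

theorem Adele_eq_adelK [GenusFour K] {D : Divisor (ZMod 2) K} (hD : deg D = rr D + 3) :
    (Adele K).toAddSubgroup = adelK D := by
  refine le_antisymm ?_ (adelK_le_Adele D)
  rintro α ⟨E, hE⟩
  have h1 : D ≤ D ⊔ E := le_sup_left
  have h2 := relIndex_adelK h1
  have h3 := rr_le_add h1
  have h4 := GenusFour.riemann (D ⊔ E)
  have h5 := rr_mono h1
  have h6 : (deg (D ⊔ E) - deg D).toNat = rr (D ⊔ E) - rr D := by omega
  rw [h6] at h2
  have h7 := Nat.eq_of_mul_eq_mul_right (by positivity) (h2.trans (one_mul _).symm)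
  exact AddSubgroup.relIndex_eq_one.1 h7 ((le_sup_left : adel (D ⊔ E) ≤ _)
    (adel_mono le_sup_right hE))

theorem relIndex_adelK_Adele [GenusFour K] (D : Divisor (ZMod 2) K) :
    (adelK D).relIndex (Adele K).toAddSubgroup = 2 ^ ((rr D : ℤ) - deg D + 3).toNat := by
  obtain ⟨D₀, h0⟩ := GenusFour.attained (K := K)
  have h1 : D ≤ D ⊔ D₀ := le_sup_left
  have h2 : D₀ ≤ D ⊔ D₀ := le_sup_right
  have h3 := rr_le_add h2
  have h4 := GenusFour.riemann (D ⊔ D₀)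
  rw [Adele_eq_adelK (D := D ⊔ D₀) (by omega)]
  have h5 := relIndex_adelK h1
  have h6 := rr_mono h1
  have h7 := rr_le_add h1
  refine Nat.eq_of_mul_eq_mul_right (m := 2 ^ (rr (D ⊔ D₀) - rr D)) (by positivity) ?_
  rw [h5, ← pow_add]
  congr 1
  omega


/-- The functionals on repartitions (Weil differentials) that vanish on constants and on
the families bounded by `D`. -/
def Om (D : Divisor (ZMod 2) K) : AddSubgroup (Adele K →+ ZMod 2) :=
  annih ((adelK D).addSubgroupOf (Adele K).toAddSubgroup)

theorem two_nsmul_eq_zero (x : K) : (2 : ℕ) • x = 0 := by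
  have : ((2 : ℕ) : ZMod 2) = 0 := rfl
  rw [← Nat.cast_smul_eq_nsmul (ZMod 2), this, zero_smul]

theorem mem_Om {D : Divisor (ZMod 2) K} {φ : Adele K →+ ZMod 2} :
    φ ∈ Om D ↔ (∀ α : Adele K, α.1 ∈ adel D → φ α = 0) ∧
      ∀ α : Adele K, α.1 ∈ (diagHom K).range → φ α = 0 := by
  constructor
  · intro h
    exact ⟨fun α hα => h α ((le_sup_left : adel D ≤ adelK D) hα),
      fun α hα => h α ((le_sup_right : _ ≤ adelK D) hα)⟩
  · rintro ⟨h1, h2⟩ ⟨α, hα⟩ h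
    obtain ⟨β, hβ, γ, hγ, hβγ⟩ := AddSubgroup.mem_sup.1
      (show α ∈ adel D ⊔ (diagHom K).range from h)
    have hβ' : β ∈ Adele K := ⟨D, hβ⟩
    have hγ' : γ ∈ Adele K := by
      obtain ⟨x, rfl⟩ := hγ
      exact ⟨_, diag_mem_adel x⟩
    have h3 : (⟨α, hα⟩ : Adele K) = ⟨β, hβ'⟩ + ⟨γ, hγ'⟩ := Subtype.ext hβγ.symm
    rw [h3, map_add, h1 _ hβ, h2 _ hγ, add_zero]

theorem card_Om [GenusFour K] (D : Divisor (ZMod 2) K) :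
    Nat.card (Om D) = 2 ^ ((rr D : ℤ) - deg D + 3).toNat := by
  rw [← relIndex_adelK_Adele]
  refine card_annih (fun g => Subtype.ext (funext fun P => ?_)) _ ?_
  · exact two_nsmul_eq_zero (g.1 P)
  · change (adelK D).relIndex (Adele K).toAddSubgroup ≠ 0
    rw [relIndex_adelK_Adele]; positivity

theorem mem_Om_sup {D E : Divisor (ZMod 2) K} {φ : Adele K →+ ZMod 2} (hD : φ ∈ Om D)
    (hE : φ ∈ Om E) : φ ∈ Om (D ⊔ E) := by
  refine mem_Om.2 ⟨fun α hα => ?_, (mem_Om.1 hD).2⟩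
  let β : Pl K → K := fun P => if E P ≤ D P then α.1 P else 0
  let γ : Pl K → K := fun P => if E P ≤ D P then 0 else α.1 P
  have hsup : ∀ P, (D ⊔ E) P = max (D P) (E P) := fun P => rfl
  have hβ : β ∈ adel D := fun P => by
    by_cases h : E P ≤ D P
    · have := hα P
      rw [hsup, max_eq_left h] at this
      simpa [β, h] using this
    · simp only [β, h, if_false]; exact zero_mem _
  have hγ : γ ∈ adel E := fun P => by
    by_cases h : E P ≤ D P
    · simp only [γ, h, if_true]; exact zero_mem _
    · have := hα P
      rw [hsup, max_eq_right (le_of_not_ge h)] at this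
      simpa [γ, h] using this
  have h3 : α = (⟨β, D, hβ⟩ : Adele K) + ⟨γ, E, hγ⟩ := by
    refine Subtype.ext (funext fun P => ?_)
    change α.1 P = β P + γ P
    by_cases h : E P ≤ D P <;> simp [β, γ, h]
  rw [h3, map_add, (mem_Om.1 hD).1 _ hβ, (mem_Om.1 hE).1 _ hγ, add_zero]

/-- The action of the function field on functionals. -/
def sm (x : K) (φ : Adele K →+ ZMod 2) : Adele K →+ ZMod 2 :=
  φ.comp (DistribSMul.toAddMonoidHom (Adele K) x)

theorem sm_apply (x : K) (φ : Adele K →+ ZMod 2) (α : Adele K) : sm x φ α = φ (x • α) := rfl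

theorem sm_sub (x y : K) (φ : Adele K →+ ZMod 2) : sm (x - y) φ = sm x φ - sm y φ := by
  ext α; rw [AddMonoidHom.sub_apply, sm_apply, sm_apply, sm_apply, ← map_sub]; congr 1; exact sub_smul x y α

theorem sm_sm (x y : K) (φ : Adele K →+ ZMod 2) : sm x (sm y φ) = sm (x * y) φ := by
  ext α; rw [sm_apply, sm_apply, sm_apply, mul_comm, mul_smul]

theorem sm_one (φ : Adele K →+ ZMod 2) : sm 1 φ = φ := by
  ext α; rw [sm_apply, one_smul]

theorem sm_zero_right (x : K) : sm x (0 : Adele K →+ ZMod 2) = 0 := rfl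

theorem eq_zero_of_sm {x : K} {φ : Adele K →+ ZMod 2} (hφ : φ ≠ 0) (h : sm x φ = 0) : x = 0 := by
  by_contra hx
  apply hφ
  rw [← sm_one φ, ← inv_mul_cancel₀ hx, ← sm_sm, h, sm_zero_right]

theorem sm_mem_Om {D E : Divisor (ZMod 2) K} {x : K} {φ : Adele K →+ ZMod 2}
    (hφ : φ ∈ Om (D + E)) (hx : x ∈ L E) : sm x φ ∈ Om D := by
  refine mem_Om.2 ⟨fun α hα => ?_, fun α hα => ?_⟩
  · refine (mem_Om.1 hφ).1 _ fun P => ?_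
    have := mul_mem_fil (mem_L.1 hx P) (hα P)
    have h1 : -((D + E) P) = - E P + - D P := by
      change -(D P + E P) = - E P + - D P
      ring
    rw [h1]; exact this
  · refine (mem_Om.1 hφ).2 _ ?_
    obtain ⟨f, hf⟩ := hα
    exact ⟨x * f, by
      funext P
      have := congrFun hf P
      change x * f = x * α.1 P
      rw [← this]; rfl⟩

theorem exists_mem_L_of_three_lt [GenusFour K] {D : Divisor (ZMod 2) K} (h : 3 < deg D) :
    ∃ f ∈ L D, f ≠ 0 := by
  have h1 := GenusFour.riemann D
  have h2 : 1 < Nat.card (L D) := by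
    rw [card_L_eq]; exact Nat.one_lt_two_pow (by omega)
  haveI := Finite.one_lt_card_iff_nontrivial.1 h2
  obtain ⟨f, hf⟩ := exists_ne (0 : L D)
  exact ⟨f.1, f.2, fun h => hf (Subtype.ext h)⟩

theorem exists_bound_Om [GenusFour K] : ∃ N : ℤ, ∀ (D : Divisor (ZMod 2) K) (φ : Adele K →+ ZMod 2),
    φ ∈ Om D → φ ≠ 0 → deg D ≤ N := by
  obtain ⟨D₀, h0⟩ := GenusFour.attained (K := K)
  refine ⟨deg D₀ + 3, fun D φ hφ hne => ?_⟩
  by_contra hcon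
  push Not at hcon
  obtain ⟨f, hf, hf0⟩ := exists_mem_L_of_three_lt (D := D - D₀) (by rw [deg_sub]; omega)
  have h1 := (mem_L_of_ne hf0).1 hf
  have h2 : D₀ ≤ D + pdiv f := by
    rw [← sub_nonneg]; convert h1 using 1; abel
  have h3 := rr_le_add h2
  have h4 := GenusFour.riemann (D + pdiv f)
  rw [rr_add_pdiv D hf0, deg_add, deg_pdiv] at *
  have h5 := card_Om D
  have h6 : ((rr D : ℤ) - deg D + 3).toNat = 0 := by omega
  rw [h6, pow_zero] at h5
  have h7 := (Nat.card_eq_one_iff_unique.1 h5).1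
  exact hne (congrArg Subtype.val (h7.elim (⟨φ, hφ⟩ : Om D) 0))

theorem exists_canonical_functional [GenusFour K] : ∃ (W : Divisor (ZMod 2) K) (φ : Adele K →+ ZMod 2),
    φ ≠ 0 ∧ φ ∈ Om W ∧ ∀ D, φ ∈ Om D → D ≤ W := by
  have h1 := card_Om (0 : Divisor (ZMod 2) K)
  have h0 : deg (0 : Divisor (ZMod 2) K) = 0 := map_zero (degHom (ZMod 2) K)
  rw [rr_zero, h0] at h1
  have h2 : 1 < Nat.card (Om (0 : Divisor (ZMod 2) K)) := by rw [h1]; norm_num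
  haveI : Finite (Om (0 : Divisor (ZMod 2) K)) := Nat.finite_of_card_ne_zero (by omega)
  haveI := Finite.one_lt_card_iff_nontrivial.1 h2
  obtain ⟨⟨φ, hφ⟩, hne⟩ := exists_ne (0 : Om (0 : Divisor (ZMod 2) K))
  have hne' : φ ≠ 0 := fun h => hne (Subtype.ext h)
  obtain ⟨N, hN⟩ := exists_bound_Om (K := K)
  obtain ⟨m, ⟨W, hW, hWm⟩, hmax⟩ := Int.exists_greatest_of_bdd
    (P := fun m => ∃ W : Divisor (ZMod 2) K, φ ∈ Om W ∧ deg W = m)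
    ⟨N, fun m ⟨W, hW, hm⟩ => hm ▸ hN W φ hW hne'⟩ ⟨0, 0, hφ, h0⟩
  refine ⟨W, φ, hne', hW, fun D hD => ?_⟩
  have h3 := hmax _ ⟨D ⊔ W, mem_Om_sup hD hW, rfl⟩
  rw [eq_of_le_of_deg_le (le_sup_right : W ≤ D ⊔ W) (by omega)]
  exact le_sup_left

theorem exists_eq_sm [GenusFour K] {W D : Divisor (ZMod 2) K} {φ ψ : Adele K →+ ZMod 2} (hφ0 : φ ≠ 0)
    (hφ : φ ∈ Om W) (hψ : ψ ∈ Om D) : ∃ x, ψ = sm x φ := by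
  by_contra hcon
  push Not at hcon
  obtain ⟨D₀, -⟩ := GenusFour.attained (K := K)
  obtain ⟨t, ht⟩ : ∃ t : K, t ∉ (algebraMap (ZMod 2) K).range := by
    by_contra hall
    push Not at hall
    have : (Set.univ : Set K) ⊆ Set.range (algebraMap (ZMod 2) K) := fun x _ => hall x
    have hfin : Finite K := Set.finite_univ_iff.1 ((Set.finite_range _).subset this)
    have h16 := card_Om (0 : Divisor (ZMod 2) K)
    have h0 : deg (0 : Divisor (ZMod 2) K) = 0 := map_zero (degHom (ZMod 2) K)
    rw [rr_zero, h0] at h16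
    haveI hP : IsEmpty (Pl K) := ⟨fun P => P.2.1 (by
      rw [eq_top_iff]
      intro x _
      obtain ⟨c, rfl⟩ := hall x
      exact P.2.2 c)⟩
    haveI : Subsingleton (Adele K) := ⟨fun a b => Subtype.ext (funext fun P => hP.elim P)⟩
    haveI : Subsingleton (Adele K →+ ZMod 2) := ⟨fun a b => by
      ext x; rw [Subsingleton.elim x 0, map_zero, map_zero]⟩
    exact hφ0 (Subsingleton.elim _ _)
  obtain ⟨P, -⟩ := exists_zero ht
  have hP := placeDegree_pos (F := ZMod 2) P
  have hP' : 0 < pdeg P := hP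
  set n : ℤ := 10 + |deg W| + |deg D|
  set B : Divisor (ZMod 2) K := Finsupp.single P n
  have hB : deg B = n * pdeg P := deg_single P n
  have hnB : n ≤ deg B := by
    rw [hB]
    have : (1 : ℤ) ≤ pdeg P := by exact_mod_cast hP'
    nlinarith [abs_nonneg (deg W), abs_nonneg (deg D)]
  have h1 := card_Om (-B)
  rw [rr_of_deg_neg (D := -B) (by
    rw [deg_neg]; have := abs_nonneg (deg W); have := abs_nonneg (deg D); omega), deg_neg] at h1
  haveI : Finite (Om (-B)) := Nat.finite_of_card_ne_zero (by rw [h1]; positivity)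
  let F : L (W + B) × L (D + B) → Om (-B) := fun z =>
    ⟨sm z.1.1 φ - sm z.2.1 ψ, sub_mem
      (sm_mem_Om (D := -B) (E := W + B) (by convert hφ using 2; abel) z.1.2)
      (sm_mem_Om (D := -B) (E := D + B) (by convert hψ using 2; abel) z.2.2)⟩
  have hF : Function.Injective F := by
    rintro ⟨⟨x, hx⟩, ⟨y, hy⟩⟩ ⟨⟨x', hx'⟩, ⟨y', hy'⟩⟩ h
    have h2 : sm x φ - sm y ψ = sm x' φ - sm y' ψ := congrArg Subtype.val h
    have h3 : sm (x - x') φ = sm (y - y') ψ := by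
      rw [sm_sub, sm_sub, sub_eq_sub_iff_add_eq_add, ← sub_eq_zero]
      rw [← sub_eq_zero] at h2
      rw [← h2]; abel
    have h4 : y - y' = 0 := by
      by_contra hne
      refine hcon ((y - y')⁻¹ * (x - x')) ?_
      rw [← sm_sm, h3, sm_sm, inv_mul_cancel₀ hne, sm_one]
    rw [h4] at h3
    have h5 : sm (x - x') φ = 0 := by
      rw [h3]; ext α; rw [sm_apply, zero_smul, map_zero]; rfl
    have h6 := eq_zero_of_sm hφ0 h5
    rw [sub_eq_zero] at h4 h6
    subst h4 h6; rfl
  have h2 := Nat.card_le_card_of_injective F hF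
  rw [Nat.card_prod, card_L_eq, card_L_eq, h1, ← pow_add,
    Nat.pow_le_pow_iff_right one_lt_two] at h2
  have h3 := GenusFour.riemann (W + B)
  have h4 := GenusFour.riemann (D + B)
  rw [deg_add] at h3 h4
  have := neg_abs_le (deg W)
  have := neg_abs_le (deg D)
  have := abs_nonneg (deg W)
  have := abs_nonneg (deg D)
  omega

/-- The Riemann-Roch theorem. -/
theorem riemann_roch [GenusFour K] : ∃ W : Divisor (ZMod 2) K,
    ∀ D, (rr D : ℤ) = deg D - 3 + rr (W - D) := by
  obtain ⟨W, φ, hφ0, hφ, hW⟩ := exists_canonical_functional (K := K)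
  refine ⟨W, fun D => ?_⟩
  have h1 := card_Om D
  haveI : Finite (Om D) := Nat.finite_of_card_ne_zero (by rw [h1]; positivity)
  let F : L (W - D) → Om D := fun x => ⟨sm x.1 φ,
    sm_mem_Om (by convert hφ using 2; abel) x.2⟩
  have hF : Function.Bijective F := by
    constructor
    · rintro ⟨x, hx⟩ ⟨y, hy⟩ h
      have h2 : sm x φ = sm y φ := congrArg Subtype.val h
      have h3 : sm (x - y) φ = 0 := by rw [sm_sub, h2, sub_self]
      exact Subtype.ext (sub_eq_zero.1 (eq_zero_of_sm hφ0 h3))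
    · rintro ⟨ψ, hψ⟩
      obtain ⟨x, rfl⟩ := exists_eq_sm hφ0 hφ hψ
      by_cases hx : x = 0
      · exact ⟨0, Subtype.ext (by subst hx; rfl)⟩
      refine ⟨⟨x, (mem_L_of_ne hx).2 ?_⟩, rfl⟩
      have h2 : sm x⁻¹ (sm x φ) ∈ Om (D - pdiv x) := by
        refine sm_mem_Om (E := pdiv x) (by convert hψ using 2; abel) ?_
        rw [mem_L_of_ne (inv_ne_zero hx), pdiv_inv]
        simp
      rw [sm_sm, inv_mul_cancel₀ hx, sm_one] at h2
      have h3 := hW _ h2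
      rw [← sub_nonneg] at h3
      convert h3 using 1; abel
  have h2 := Nat.card_congr (Equiv.ofBijective F hF)
  rw [card_L_eq, h1] at h2
  have h3 := Nat.pow_right_injective le_rfl h2
  have h4 := GenusFour.riemann D
  omega

end RiemannRoch

end CFF

namespace CFF

/-- A function field over `𝔽₂` of genus `4` and class number `1` with a divisor of degree `5`. -/
class Curve (K : Type) [Field K] [Algebra (ZMod 2) K] [FnField (ZMod 2) K] : Prop
    extends GenusFour K where
  five : ∃ D : Divisor (ZMod 2) K, deg D = 5

section DegreeOne

variable {K : Type} [Field K] [Algebra (ZMod 2) K] [FnField (ZMod 2) K]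

theorem deg_zero : deg (0 : Divisor (ZMod 2) K) = 0 := map_zero (degHom (ZMod 2) K)

theorem rr_eq_of_deg_eq [GenusFour K] {D E : Divisor (ZMod 2) K} (h : deg D = deg E) :
    rr D = rr E := by
  obtain ⟨f, hf, hfD⟩ := GenusFour.principal (D - E) (by rw [deg_sub]; omega)
  rw [← rr_add_pdiv E hf, hfD]
  congr 1; abel

theorem exists_canonical [GenusFour K] : ∃ W : Divisor (ZMod 2) K, deg W = 6 ∧
    ∀ D, (rr D : ℤ) = deg D - 3 + rr (W - D) := by
  obtain ⟨W, hW⟩ := riemann_roch (K := K)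
  refine ⟨W, ?_, hW⟩
  have h0 := hW 0
  have h1 := hW W
  rw [sub_self, rr_zero] at h1
  rw [sub_zero, rr_zero, deg_zero] at h0
  omega

theorem exists_deg_one [Curve K] : ∃ D : Divisor (ZMod 2) K, deg D = 1 := by
  obtain ⟨W, hW, -⟩ := exists_canonical (K := K)
  obtain ⟨D, hD⟩ := Curve.five (K := K)
  exact ⟨W - D, by rw [deg_sub]; omega⟩

variable (K) in
/-- A divisor of degree one. -/
def dd [Curve K] : Divisor (ZMod 2) K := (exists_deg_one (K := K)).choose

theorem deg_dd [Curve K] : deg (dd K) = 1 := (exists_deg_one (K := K)).choose_spec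

theorem deg_zsmul (n : ℤ) (D : Divisor (ZMod 2) K) : deg (n • D) = n * deg D := by
  rw [← smul_eq_mul]; exact map_zsmul (degHom (ZMod 2) K) n D

theorem deg_zsmul_dd [Curve K] (n : ℤ) : deg (n • dd K) = n := by
  rw [deg_zsmul, deg_dd, mul_one]

variable (K) in
/-- The dimension of the Riemann-Roch spaces of the divisors of degree `n`. -/
def el [Curve K] (n : ℤ) : ℕ := rr (n • dd K)

theorem rr_eq_el [Curve K] (D : Divisor (ZMod 2) K) : rr D = el K (deg D) :=
  rr_eq_of_deg_eq (deg_zsmul_dd _).symm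

theorem el_riemann_roch [Curve K] (n : ℤ) : (el K n : ℤ) = n - 3 + el K (6 - n) := by
  obtain ⟨W, hW, h⟩ := exists_canonical (K := K)
  have h1 := h (n • dd K)
  rwa [rr_eq_el (W - _), deg_sub, hW, deg_zsmul_dd] at h1

theorem el_of_neg [Curve K] {n : ℤ} (hn : n < 0) : el K n = 0 :=
  rr_of_deg_neg (by rwa [deg_zsmul_dd])

theorem el_zero [Curve K] : el K 0 = 1 := by
  rw [el, zero_smul, rr_zero]

/-- The effective divisors of degree `n`. -/
def Eff (K : Type) [Field K] [Algebra (ZMod 2) K] [FnField (ZMod 2) K] (n : ℤ) :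
    Set (Divisor (ZMod 2) K) := {D | 0 ≤ D ∧ deg D = n}

theorem eq_of_pdiv_eq {f g : K} (hf : f ≠ 0) (hg : g ≠ 0) (h : pdiv f = pdiv g) : f = g := by
  have h1 : f * g⁻¹ ∈ L (0 : Divisor (ZMod 2) K) := by
    rw [mem_L_of_ne (mul_ne_zero hf (inv_ne_zero hg)), pdiv_mul hf (inv_ne_zero hg), pdiv_inv, h]
    simp
  rcases mem_L_zero.1 h1 with h2 | h2
  · exact absurd h2 (mul_ne_zero hf (inv_ne_zero hg))
  · rwa [mul_inv_eq_one₀ hg] at h2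

/-- Effective divisors correspond to nonzero elements of a Riemann-Roch space. -/
def effEquiv [GenusFour K] (D : Divisor (ZMod 2) K) :
    {f : L D // f ≠ 0} ≃ Eff K (deg D) :=
  Equiv.ofBijective (fun f => ⟨pdiv f.1.1 + D,
      (mem_L_of_ne fun h => f.2 (Subtype.ext h)).1 f.1.2, by rw [deg_add, deg_pdiv, zero_add]⟩) <| by
    constructor
    · rintro ⟨⟨f, hf⟩, hf0⟩ ⟨⟨g, hg⟩, hg0⟩ h
      have h1 := add_right_cancel (congrArg Subtype.val h)
      refine Subtype.ext (Subtype.ext ?_)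
      exact eq_of_pdiv_eq (fun h => hf0 (Subtype.ext h)) (fun h => hg0 (Subtype.ext h)) h1
    · rintro ⟨E, hE0, hE⟩
      obtain ⟨f, hf, hfD⟩ := GenusFour.principal (E - D) (by rw [deg_sub]; omega)
      have h1 : pdiv f + D = E := by rw [hfD]; abel
      exact ⟨⟨⟨f, (mem_L_of_ne hf).2 (by rw [h1]; exact hE0)⟩,
        fun h => hf (congrArg Subtype.val h)⟩, Subtype.ext h1⟩

instance finite_Eff [Curve K] (n : ℤ) : Finite (Eff K n) := by
  rw [← deg_zsmul_dd (K := K) n]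
  exact Finite.of_equiv _ (effEquiv (n • dd K))

variable (K) in
/-- The number of effective divisors of degree `n`. -/
def An (n : ℤ) : ℕ := Nat.card (Eff K n)

theorem An_eq [Curve K] (n : ℤ) : An K n = 2 ^ el K n - 1 := by
  have h1 : An K (deg (n • dd K)) = Nat.card {f : L (n • dd K) // f ≠ 0} :=
    (Nat.card_congr (effEquiv (n • dd K))).symm
  rw [deg_zsmul_dd] at h1
  rw [h1, el, ← card_L_eq]
  haveI := Fintype.ofFinite (L (n • dd K))
  rw [Nat.card_eq_fintype_card, Nat.card_eq_fintype_card, Fintype.card_subtype_compl]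
  simp

theorem An_of_neg {n : ℤ} (hn : n < 0) : An K n = 0 := by
  haveI : IsEmpty (Eff K n) := ⟨fun D => by
    have := deg_nonneg D.2.1
    have := D.2.2
    omega⟩
  exact Nat.card_of_isEmpty

theorem finite_places_le [Curve K] (n : ℕ) : {P : Pl K | pdeg P ≤ n}.Finite := by
  have h1 : {P : Pl K | pdeg P ≤ n} = ⋃ d ∈ Finset.range (n + 1), {P : Pl K | pdeg P = d} := by
    ext P; simp [Nat.lt_succ_iff]
  rw [h1]
  refine Set.Finite.biUnion (Finset.finite_toSet _) fun d _ => ?_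
  have h2 : Set.InjOn (fun P : Pl K => (Finsupp.single P 1 : Divisor (ZMod 2) K))
      {P : Pl K | pdeg P = d} := fun P _ Q _ h => Finsupp.single_left_injective one_ne_zero h
  refine Set.Finite.of_finite_image (Set.Finite.subset (Set.toFinite (Eff K d)) ?_) h2
  rintro _ ⟨P, hP, rfl⟩
  refine ⟨by simp, ?_⟩
  rw [deg_single, one_mul]
  exact_mod_cast hP

variable (K) in
/-- The places of degree at most `n`. -/
def plc [Curve K] (n : ℕ) : Finset (Pl K) := (finite_places_le (K := K) n).toFinset

theorem mem_plc [Curve K] {n : ℕ} {P : Pl K} : P ∈ plc K n ↔ pdeg P ≤ n := by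
  simp [plc]

variable (K) in
/-- The number of points over the extension of degree `n` of the constant field. -/
def Sn [Curve K] (n : ℕ) : ℕ := ∑ P ∈ plc K n with pdeg P ∣ n, pdeg P

theorem card_Eff_ge [Curve K] (n : ℤ) (P : Pl K) (i : ℕ) :
    Nat.card {D : Eff K n // (i : ℤ) ≤ D.1 P} = An K (n - i * pdeg P) := by
  refine Nat.card_congr
    { toFun := fun D => ⟨D.1.1 - Finsupp.single P (i : ℤ), ?_, ?_⟩
      invFun := fun E => ⟨⟨E.1 + Finsupp.single P (i : ℤ), ?_, ?_⟩, ?_⟩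
      left_inv := fun D => ?_
      right_inv := fun E => ?_ }
  · intro Q
    change (0 : ℤ) ≤ D.1.1 Q - Finsupp.single P (i : ℤ) Q
    by_cases hQ : Q = P
    · subst hQ; have := D.2; simp only [Finsupp.single_eq_same]; omega
    · have := D.1.2.1 Q
      rw [Finsupp.single_eq_of_ne hQ, sub_zero]; exact this
  · have := D.1.2.2
    rw [deg_sub, deg_single, this]
  · exact add_nonneg E.2.1 (Finsupp.single_nonneg.2 (by omega))
  · have := E.2.2
    rw [deg_add, deg_single, this]; ring
  · have := E.2.1 P
    change (i : ℤ) ≤ E.1 P + Finsupp.single P (i : ℤ) P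
    rw [Finsupp.single_eq_same]
    change (0 : ℤ) ≤ E.1 P at this
    omega
  · exact Subtype.ext (Subtype.ext (sub_add_cancel _ _))
  · exact Subtype.ext (add_sub_cancel_right _ _)

theorem mul_An_eq [Curve K] (n : ℕ) :
    (n : ℤ) * An K n = ∑ j ∈ Finset.Icc 1 n, (Sn K j : ℤ) * An K (n - j) := by
  haveI := Fintype.ofFinite (Eff K n)
  have hsupp : ∀ D : Eff K n, ∀ P, 0 < D.1 P → D.1 P * pdeg P ≤ n := by
    intro D P hP
    have h1 : Finsupp.single P (D.1 P) ≤ D.1 := by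
      intro Q
      by_cases hQ : Q = P
      · subst hQ; simp
      · rw [Finsupp.single_eq_of_ne hQ]; exact D.2.1 Q
    have h2 := deg_mono h1
    rwa [deg_single, D.2.2] at h2
  have hpos : ∀ P : Pl K, 0 < pdeg P := fun P => placeDegree_pos (F := ZMod 2) P
  have hD : ∀ D : Eff K n, (n : ℤ) = ∑ P ∈ plc K n, ∑ i ∈ Finset.Icc 1 n,
      if (i : ℤ) ≤ D.1 P then (pdeg P : ℤ) else 0 := by
    intro D
    have h1 : D.1.support ⊆ plc K n := by
      intro P hP
      have h0 := D.2.1 P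
      change (0 : ℤ) ≤ D.1 P at h0
      have h2 : 0 < D.1 P := lt_of_le_of_ne h0 (Ne.symm (Finsupp.mem_support_iff.1 hP))
      have h3 := hsupp D P h2
      rw [mem_plc]
      have : (pdeg P : ℤ) ≤ D.1 P * pdeg P := by
        have := hpos P
        nlinarith
      exact_mod_cast this.trans h3
    have h2 := deg_eq_sum_of_subset D.1 h1
    rw [D.2.2] at h2
    refine h2.trans (Finset.sum_congr rfl fun P _ => ?_)
    rw [← Finset.sum_filter, Finset.sum_const, nsmul_eq_mul]
    congr 1
    have h0 := D.2.1 P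
    change (0 : ℤ) ≤ D.1 P at h0
    have hle : D.1 P ≤ n := by
      by_cases h : 0 < D.1 P
      · have := hsupp D P h
        have h4 : (1 : ℤ) ≤ pdeg P := by exact_mod_cast hpos P
        nlinarith
      · omega
    have h3 : (Finset.Icc 1 n).filter (fun i : ℕ => (i : ℤ) ≤ D.1 P) =
        Finset.Icc 1 (D.1 P).toNat := by
      ext i; simp only [Finset.mem_filter, Finset.mem_Icc]; omega
    rw [h3, Nat.card_Icc]
    omega
  have h1 : (n : ℤ) * An K n = ∑ D : Eff K n, (n : ℤ) := by
    rw [Finset.sum_const, An, Nat.card_eq_fintype_card, nsmul_eq_mul, mul_comm]; rfl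
  rw [h1, Finset.sum_congr rfl fun D _ => hD D, Finset.sum_comm]
  have h2 : ∀ P ∈ plc K n, ∑ D : Eff K n, ∑ i ∈ Finset.Icc 1 n,
      (if (i : ℤ) ≤ D.1 P then (pdeg P : ℤ) else 0) =
      ∑ j ∈ Finset.Icc 1 n, if pdeg P ∣ j then (pdeg P : ℤ) * An K (n - j) else 0 := by
    intro P _
    rw [Finset.sum_comm]
    have h3 : ∀ i : ℕ, ∑ D : Eff K n, (if (i : ℤ) ≤ D.1 P then (pdeg P : ℤ) else 0) =
        (pdeg P : ℤ) * An K (n - i * pdeg P) := by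
      intro i
      rw [← card_Eff_ge, ← Finset.sum_filter, Finset.sum_const, nsmul_eq_mul, mul_comm,
        Nat.card_eq_fintype_card, Fintype.card_subtype]
    rw [Finset.sum_congr rfl fun i _ => h3 i, ← Finset.sum_filter]
    have hp := hpos P
    have h4 : (Finset.Icc 1 n).filter (fun j => pdeg P ∣ j) =
        ((Finset.Icc 1 n).filter fun i => i * pdeg P ≤ n).image fun i => i * pdeg P := by
      ext j
      simp only [Finset.mem_filter, Finset.mem_Icc, Finset.mem_image]
      constructor
      · rintro ⟨⟨h1, h2⟩, c, rfl⟩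
        refine ⟨c, ⟨⟨Nat.pos_of_ne_zero (by rintro rfl; simp at h1), ?_⟩, ?_⟩, mul_comm _ _⟩
        · nlinarith
        · rwa [mul_comm]
      · rintro ⟨i, ⟨⟨h1, h2⟩, h3⟩, rfl⟩
        exact ⟨⟨Nat.mul_pos h1 hp, h3⟩, dvd_mul_left _ _⟩
    rw [h4, Finset.sum_image (fun a _ b _ h => Nat.eq_of_mul_eq_mul_right hp h),
      Finset.sum_filter]
    refine Finset.sum_congr rfl fun i _ => ?_
    split_ifs with h
    · push_cast; rfl
    · rw [An_of_neg (by have : (n : ℤ) < i * pdeg P := by exact_mod_cast (not_le.1 h)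
                        omega)]
      simp
  rw [Finset.sum_congr rfl h2, Finset.sum_comm]
  refine Finset.sum_congr rfl fun j hj => ?_
  rw [Finset.mem_Icc] at hj
  rw [← Finset.sum_filter, ← Finset.sum_mul, Sn]
  push_cast
  congr 1
  refine Finset.sum_congr ?_ fun _ _ => rfl
  ext P
  simp only [Finset.mem_filter, mem_plc]
  constructor
  · rintro ⟨-, h⟩
    exact ⟨Nat.le_of_dvd (by omega) h, h⟩
  · rintro ⟨h1, h⟩
    exact ⟨h1.trans hj.2, h⟩

end DegreeOne

end CFF

namespace CFF

section PowerSums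

/-- The power series `∑_{n ≥ 1} cⁿ Xⁿ`. -/
def geomTail (c : ℂ) : PowerSeries ℂ := PowerSeries.mk fun n => if n = 0 then 0 else c ^ n

/-- The Euler operator `X d/dX`. -/
def eulerOp (f : PowerSeries ℂ) : PowerSeries ℂ := PowerSeries.X * PowerSeries.derivative ℂ f

theorem eulerOp_mul (f g : PowerSeries ℂ) : eulerOp (f * g) = f * eulerOp g + g * eulerOp f := by
  rw [eulerOp, Derivation.leibniz, smul_eq_mul, smul_eq_mul, eulerOp, eulerOp]; ring

theorem coeff_eulerOp (f : PowerSeries ℂ) (n : ℕ) :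
    PowerSeries.coeff n (eulerOp f) = n * PowerSeries.coeff n f := by
  cases n with
  | zero => simp [eulerOp]
  | succ n =>
    rw [eulerOp, PowerSeries.coeff_succ_X_mul, PowerSeries.coeff_derivative]
    push_cast; ring

theorem eulerOp_linear (c : ℂ) : eulerOp (1 - PowerSeries.C c * PowerSeries.X) =
    - ((1 - PowerSeries.C c * PowerSeries.X) * geomTail c) := by
  ext n
  rw [coeff_eulerOp, sub_mul, one_mul, mul_assoc, map_neg, map_sub, map_sub,
    PowerSeries.coeff_C_mul, PowerSeries.coeff_C_mul, PowerSeries.coeff_X, PowerSeries.coeff_one]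
  rcases n with _ | n
  · simp [geomTail]
  · rw [PowerSeries.coeff_succ_X_mul, geomTail, PowerSeries.coeff_mk, PowerSeries.coeff_mk]
    rcases n with _ | n
    · simp
    · simp [pow_succ]; ring

theorem eulerOp_prod (s : Multiset ℂ) :
    eulerOp (s.map fun c => 1 - PowerSeries.C c * PowerSeries.X).prod =
      - ((s.map fun c => 1 - PowerSeries.C c * PowerSeries.X).prod * (s.map geomTail).sum) := by
  induction s using Multiset.induction_on with
  | empty => simp [eulerOp]
  | cons c s ih =>
    rw [Multiset.map_cons, Multiset.prod_cons, eulerOp_mul, ih, eulerOp_linear, Multiset.map_cons,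
      Multiset.sum_cons]
    ring

theorem exists_prod_one_sub (p : Polynomial ℂ) (h0 : p.coeff 0 = 1) :
    ∃ s : Multiset ℂ, p = (s.map fun c => 1 - Polynomial.C c * Polynomial.X).prod := by
  have hr : ∀ r ∈ p.roots, r ≠ 0 := by
    rintro r hr rfl
    have := Polynomial.isRoot_of_mem_roots hr
    rw [Polynomial.IsRoot, ← Polynomial.coeff_zero_eq_eval_zero, h0] at this
    exact one_ne_zero this
  refine ⟨p.roots.map fun r => r⁻¹, ?_⟩
  have h1 := (IsAlgClosed.splits p).eq_prod_roots
  set q := ((p.roots.map fun r => r⁻¹).map fun c => 1 - Polynomial.C c * Polynomial.X).prod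
    with hq
  have h2 : (p.roots.map fun r => (Polynomial.X - Polynomial.C r : Polynomial ℂ)) =
      p.roots.map fun r => Polynomial.C (-r) * (1 - Polynomial.C r⁻¹ * Polynomial.X) := by
    refine Multiset.map_congr rfl fun r h => ?_
    have : (Polynomial.C r : Polynomial ℂ) * Polynomial.C r⁻¹ = 1 := by
      rw [← Polynomial.C_mul, mul_inv_cancel₀ (hr r h), Polynomial.C_1]
    rw [Polynomial.C_neg]
    linear_combination (- Polynomial.X : Polynomial ℂ) * this
  have h3 : (p.roots.map fun r => Polynomial.C (-r)).prod =
      Polynomial.C (p.roots.map fun r => -r).prod := by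
    rw [map_multiset_prod Polynomial.C, Multiset.map_map]; rfl
  rw [h2, Multiset.prod_map_mul, h3, ← mul_assoc, ← Polynomial.C_mul] at h1
  set d := p.leadingCoeff * (p.roots.map fun r => -r).prod
  have h4 : p = Polynomial.C d * q := by
    rw [hq, Multiset.map_map]; exact h1
  have h5 : q.coeff 0 = 1 := by
    rw [hq, Polynomial.coeff_zero_multiset_prod, Multiset.map_map]
    apply Multiset.prod_eq_one
    intro x hx
    obtain ⟨c, -, rfl⟩ := Multiset.mem_map.1 hx
    simp
  have h6 : d = 1 := by
    have := congrArg (fun f => Polynomial.coeff f 0) h4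
    simp only [Polynomial.coeff_C_mul, h5, h0, mul_one] at this
    exact this.symm
  rw [h6, Polynomial.C_1, one_mul] at h4
  exact h4

theorem exists_power_sums (A S : ℕ → ℂ) (h0 : A 0 = 1)
    (hA : ∀ n : ℕ, n * A n = ∑ j ∈ Finset.Icc 1 n, S j * A (n - j)) (p : Polynomial ℂ)
    (hp : (p : PowerSeries ℂ) = (1 - PowerSeries.X) * (1 - PowerSeries.C 2 * PowerSeries.X) *
      PowerSeries.mk A) :
    ∃ s : Multiset ℂ, p = (s.map fun c => 1 - Polynomial.C c * Polynomial.X).prod ∧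
      ∀ n, n ≠ 0 → S n = 1 + 2 ^ n - (s.map fun c => c ^ n).sum := by
  have hp0 : p.coeff 0 = 1 := by
    have := congrArg (PowerSeries.coeff 0) hp
    simpa [h0] using this
  obtain ⟨s, hs⟩ := exists_prod_one_sub p hp0
  refine ⟨s, hs, fun n hn => ?_⟩
  set T : PowerSeries ℂ := PowerSeries.mk fun n => if n = 0 then 0 else S n
  have h1 : eulerOp (PowerSeries.mk A) = PowerSeries.mk A * T := by
    ext n
    rw [coeff_eulerOp, PowerSeries.coeff_mk, hA, mul_comm, PowerSeries.coeff_mul,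
      Finset.Nat.sum_antidiagonal_eq_sum_range_succ
        (fun i j => PowerSeries.coeff i T * PowerSeries.coeff j (PowerSeries.mk A)),
      Finset.sum_range_succ']
    have h2 : Finset.Icc 1 n = (Finset.range n).image Nat.succ := by
      ext i
      simp only [Finset.mem_Icc, Finset.mem_image, Finset.mem_range]
      constructor
      · rintro ⟨h1, h2⟩; exact ⟨i - 1, by omega, by simp; omega⟩
      · rintro ⟨j, h, rfl⟩; simp; omega
    rw [h2, Finset.sum_image (fun a _ b _ h => Nat.succ_injective h)]
    simp [T]
  have h2 : ∀ c : ℂ, (1 - PowerSeries.C c * PowerSeries.X : PowerSeries ℂ) ≠ 0 := by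
    intro c h
    have := congrArg (PowerSeries.coeff 0) h
    simp at this
  have hX : (1 - PowerSeries.X : PowerSeries ℂ) = 1 - PowerSeries.C 1 * PowerSeries.X := by simp
  have h3 : eulerOp (p : PowerSeries ℂ) = p * (T - geomTail 1 - geomTail 2) := by
    rw [hp, hX, eulerOp_mul, eulerOp_mul, h1, eulerOp_linear, eulerOp_linear]
    ring
  have h4 : (p : PowerSeries ℂ) = (s.map fun c => 1 - PowerSeries.C c * PowerSeries.X).prod := by
    have h5 : (p : PowerSeries ℂ) = Polynomial.coeToPowerSeries.ringHom p := rfl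
    rw [h5, hs, map_multiset_prod, Multiset.map_map]
    congr 1
    refine Multiset.map_congr rfl fun c _ => ?_
    simp
  have h5 : (p : PowerSeries ℂ) ≠ 0 := by
    intro h
    have := congrArg (PowerSeries.coeff 0) h
    rw [Polynomial.coeff_coe, hp0] at this
    simp at this
  have h6 := eulerOp_prod s
  rw [← h4, h3, ← mul_neg] at h6
  have h7 := congrArg (PowerSeries.coeff n) (mul_left_cancel₀ h5 h6)
  have h8 : PowerSeries.coeff n (s.map geomTail).sum = (s.map fun c => c ^ n).sum := by
    rw [map_multiset_sum, Multiset.map_map]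
    congr 1
    refine Multiset.map_congr rfl fun c _ => ?_
    simp [geomTail, hn]
  rw [map_neg, h8] at h7
  simp only [map_sub, T, geomTail, PowerSeries.coeff_mk, hn, if_false, one_pow] at h7
  linear_combination h7

theorem exists_pow_re_ge (s : Multiset ℂ) (M : ℕ) :
    ∃ n, M ≤ n ∧ ∀ c ∈ s, ‖c‖ ^ n / 2 ≤ (c ^ n).re := by
  let g : {c // c ∈ s.toFinset} → Circle := fun c =>
    if h : c.1 = 0 then 1 else ⟨c.1 / ‖c.1‖, by
      rw [Submonoid.unitSphere, ← SetLike.mem_coe]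
      simp [h]⟩
  have h1 := mapClusterPt_one_atTop_pow g
  have h2 : {z : {c // c ∈ s.toFinset} → Circle | ∀ c, 1 / 2 < ((z c : Circle) : ℂ).re} ∈
      nhds (1 : {c // c ∈ s.toFinset} → Circle) := by
    refine IsOpen.mem_nhds ?_ ?_
    · have : {z : {c // c ∈ s.toFinset} → Circle | ∀ c, 1 / 2 < ((z c : Circle) : ℂ).re} =
          ⋂ c, {z | 1 / 2 < ((z c : Circle) : ℂ).re} := by ext; simp
      rw [this]
      exact isOpen_iInter_of_finite fun c => isOpen_lt continuous_const
        (Complex.continuous_re.comp (continuous_subtype_val.comp (continuous_apply c)))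
    · intro c; norm_num
  have h3 := (mapClusterPt_iff_frequently.1 h1) _ h2
  obtain ⟨n, hn, h4⟩ := (Filter.frequently_atTop.1 h3) (M + 1)
  refine ⟨n, by omega, fun c hc => ?_⟩
  have h5 := h4 ⟨c, Multiset.mem_toFinset.2 hc⟩
  by_cases h0 : c = 0
  · subst h0; simp [show n ≠ 0 by omega]
  · have h6 : (((g ^ n) ⟨c, Multiset.mem_toFinset.2 hc⟩ : Circle) : ℂ) = c ^ n / ‖c‖ ^ n := by
      rw [Pi.pow_apply, Circle.coe_pow]
      have h8 : ((g ⟨c, Multiset.mem_toFinset.2 hc⟩ : Circle) : ℂ) = c / ‖c‖ := by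
        have : g ⟨c, Multiset.mem_toFinset.2 hc⟩ = ⟨c / ‖c‖, _⟩ := dif_neg h0
        rw [this]
      rw [h8, div_pow]
    rw [h6, ← Complex.ofReal_pow, Complex.div_ofReal_re] at h5
    have h7 : 0 < ‖c‖ ^ n := by positivity
    rw [lt_div_iff₀ h7] at h5
    linarith

theorem no_small_real_root (A S : ℕ → ℂ) (h0 : A 0 = 1)
    (hA : ∀ n : ℕ, n * A n = ∑ j ∈ Finset.Icc 1 n, S j * A (n - j)) (p : Polynomial ℂ)
    (hp : (p : PowerSeries ℂ) = (1 - PowerSeries.X) * (1 - PowerSeries.C 2 * PowerSeries.X) *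
      PowerSeries.mk A) (N : ℕ) (hN : 0 < N) (C : ℝ)
    (hS : ∀ n : ℕ, 0 < n → 2 ^ (N * n) - C * √2 ^ (N * n) ≤ (S (N * n)).re)
    (t : ℝ) (ht : 0 < t) (ht2 : t * √2 < 1) : p.eval (t : ℂ) ≠ 0 := by
  intro hroot
  obtain ⟨s, hs, hSn⟩ := exists_power_sums A S h0 hA p hp
  have h1 : ((t : ℂ)⁻¹) ∈ s := by
    rw [hs, Polynomial.eval_multiset_prod, Multiset.map_map, Multiset.prod_eq_zero_iff] at hroot
    obtain ⟨c, hc, h⟩ := Multiset.mem_map.1 hroot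
    simp only [Function.comp_apply, Polynomial.eval_sub, Polynomial.eval_one, Polynomial.eval_mul,
      Polynomial.eval_C, Polynomial.eval_X] at h
    have : c = (t : ℂ)⁻¹ := eq_inv_of_mul_eq_one_left (by linear_combination -h)
    rwa [← this]
  set β := t⁻¹ / √2 with hβ
  have h2 : 0 < √2 := by positivity
  have hβ1 : 1 < β := by
    rw [hβ, lt_div_iff₀ h2, one_mul, lt_inv_comm₀ h2 ht, ← one_div, lt_div_iff₀ h2]
    exact ht2
  obtain ⟨M, hM⟩ := pow_unbounded_of_one_lt (2 * (|C| + 1)) hβ1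
  obtain ⟨n, hn, hre⟩ := exists_pow_re_ge (s.map fun c => c ^ N) (M + 1)
  have h3 : (t⁻¹) ^ (N * n) / 2 ≤ ((s.map fun c => c ^ (N * n)).sum).re := by
    have h4 : ∀ c ∈ s, ‖c‖ ^ (N * n) / 2 ≤ (c ^ (N * n)).re := by
      intro c hc
      have := hre (c ^ N) (Multiset.mem_map_of_mem _ hc)
      rwa [norm_pow, ← pow_mul, ← pow_mul] at this
    have h5 : ((s.map fun c => c ^ (N * n)).sum).re = (s.map fun c => (c ^ (N * n)).re).sum := by
      have := map_multiset_sum Complex.reAddGroupHom (s.map fun c => c ^ (N * n))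
      rw [Multiset.map_map] at this
      exact this
    rw [h5]
    have h6 := Multiset.single_le_sum (s := s.map fun c => (c ^ (N * n)).re) (fun x hx => by
      obtain ⟨c, hc, rfl⟩ := Multiset.mem_map.1 hx
      exact le_trans (by positivity) (h4 c hc)) _ (Multiset.mem_map_of_mem _ h1)
    refine le_trans ?_ h6
    have := h4 _ h1
    rwa [norm_inv, Complex.norm_real, Real.norm_eq_abs, abs_of_pos ht] at this
  have h4 := hSn (N * n) (Nat.mul_ne_zero hN.ne' (by omega))
  have h5 : (S (N * n)).re = 1 + 2 ^ (N * n) - ((s.map fun c => c ^ (N * n)).sum).re := by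
    rw [h4, Complex.sub_re, Complex.add_re, Complex.one_re]
    congr 2
    have : (2 : ℂ) ^ (N * n) = (((2 : ℝ) ^ (N * n) : ℝ) : ℂ) := by push_cast; rfl
    rw [this, Complex.ofReal_re]
  have h6 := hS n (by omega)
  have h7 : t⁻¹ ^ (N * n) = β ^ (N * n) * √2 ^ (N * n) := by
    rw [← mul_pow, hβ, div_mul_cancel₀ _ h2.ne']
  have h8 : 1 ≤ √2 ^ (N * n) := one_le_pow₀ (by
    rw [Real.one_le_sqrt]; norm_num)
  have h9 : 2 * (|C| + 1) < β ^ (N * n) := lt_of_lt_of_le hM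
    (pow_le_pow_right₀ hβ1.le (by nlinarith))
  have h10 : β ^ (N * n) * √2 ^ (N * n) / 2 ≤ 1 + C * √2 ^ (N * n) := by
    rw [← h7]; linarith
  have h11 : C * √2 ^ (N * n) ≤ |C| * √2 ^ (N * n) :=
    mul_le_mul_of_nonneg_right (le_abs_self C) (by positivity)
  have h12 := mul_lt_mul_of_pos_right h9 (lt_of_lt_of_le one_pos h8)
  linarith

end PowerSums

end CFF

namespace CFF

section Counts

variable {K : Type} [Field K] [Algebra (ZMod 2) K] [FnField (ZMod 2) K] [Curve K]

theorem el_of_large {n : ℤ} (hn : 7 ≤ n) : (el K n : ℤ) = n - 3 := by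
  have := el_riemann_roch (K := K) n
  rw [el_of_neg (n := 6 - n) (by omega)] at this
  simpa using this

theorem el_four : el K 4 = 1 + el K 2 := by
  have := el_riemann_roch (K := K) 4
  norm_num at this; omega

theorem el_five : el K 5 = 2 + el K 1 := by
  have := el_riemann_roch (K := K) 5
  norm_num at this; omega

theorem el_six : el K 6 = 4 := by
  have := el_riemann_roch (K := K) 6
  norm_num [el_zero] at this; omega

theorem An_cast (n : ℤ) : (An K n : ℤ) = 2 ^ el K n - 1 := by
  rw [An_eq, Nat.cast_sub Nat.one_le_two_pow]; simp

theorem An_zero : An K 0 = 1 := by rw [An_eq, el_zero]; norm_num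

theorem An_four : An K 4 = 2 * An K 2 + 1 := by
  have h1 := An_cast (K := K) 4
  have h2 := An_cast (K := K) 2
  rw [el_four, pow_add] at h1
  omega

theorem An_five : An K 5 = 4 * An K 1 + 3 := by
  have h1 := An_cast (K := K) 5
  have h2 := An_cast (K := K) 1
  rw [el_five, pow_add] at h1
  omega

theorem An_six : An K 6 = 15 := by rw [An_eq, el_six]; norm_num

theorem An_of_large {n : ℕ} (hn : 7 ≤ n) : (An K n : ℤ) = 2 ^ (n - 3) - 1 := by
  have h1 := el_of_large (K := K) (n := n) (by omega)
  have h2 : el K n = n - 3 := by omega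
  rw [An_cast, h2]

/-- The polynomial `1 + c₁X + ⋯ + c₈X⁸`. -/
def octic (c : Fin 8 → ℂ) : Polynomial ℂ :=
  1 + Polynomial.C (c 0) * Polynomial.X +
    Polynomial.C (c 1) * Polynomial.X ^ 2 +
    Polynomial.C (c 2) * Polynomial.X ^ 3 +
    Polynomial.C (c 3) * Polynomial.X ^ 4 +
    Polynomial.C (c 4) * Polynomial.X ^ 5 +
    Polynomial.C (c 5) * Polynomial.X ^ 6 +
    Polynomial.C (c 6) * Polynomial.X ^ 7 +
    Polynomial.C (c 7) * Polynomial.X ^ 8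

theorem coeff_octic_zero (c : Fin 8 → ℂ) : (octic c).coeff 0 = 1 := by
  simp [octic]

theorem coeff_octic (c : Fin 8 → ℂ) (i : Fin 8) : (octic c).coeff (i + 1) = c i := by
  fin_cases i <;> simp [octic, Polynomial.coeff_one, Polynomial.coeff_X, Polynomial.coeff_X_pow]

theorem coeff_octic_of_lt (c : Fin 8 → ℂ) {n : ℕ} (hn : 8 < n) : (octic c).coeff n = 0 := by
  have h : ∀ k : ℕ, k ≤ 8 → n ≠ k := fun k hk => by omega
  simp [octic, Polynomial.coeff_one, Polynomial.coeff_X, Polynomial.coeff_X_pow,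
    h 0 (by norm_num), (h 1 (by norm_num)).symm, h 2 (by norm_num), h 3 (by norm_num),
    h 4 (by norm_num), h 5 (by norm_num), h 6 (by norm_num), h 7 (by norm_num), h 8 (by norm_num)]

variable (K) in
/-- The numerator of the zeta function. -/
def zetaNum : Polynomial ℂ :=
  octic ![(An K 1 : ℂ) - 3, (An K 2 : ℂ) - 3 * An K 1 + 2,
    (An K 3 : ℂ) - 3 * An K 2 + 2 * An K 1, 4 * (An K 2 : ℂ) - 3 * An K 3 + 1,
    4 * (An K 1 : ℂ) - 6 * An K 2 + 2 * An K 3, 8 - 12 * (An K 1 : ℂ) + 4 * An K 2,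
    8 * (An K 1 : ℂ) - 24, 16]

theorem zetaNum_eq : (zetaNum K : PowerSeries ℂ) =
    (1 - PowerSeries.X) * (1 - PowerSeries.C 2 * PowerSeries.X) *
      PowerSeries.mk fun n => (An K n : ℂ) := by
  have h4 : (An K 4 : ℂ) = 2 * An K 2 + 1 := by rw [An_four]; push_cast; rfl
  have h5 : (An K 5 : ℂ) = 4 * An K 1 + 3 := by rw [An_five]; push_cast; rfl
  have h6 : (An K 6 : ℂ) = 15 := by rw [An_six]; norm_num
  have hl : ∀ n : ℕ, 7 ≤ n → (An K n : ℂ) = 2 ^ (n - 3) - 1 := fun n hn => by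
    have := congrArg (Int.cast : ℤ → ℂ) (An_of_large (K := K) hn)
    push_cast at this; exact this
  have h0 : (An K 0 : ℂ) = 1 := by rw [An_zero]; norm_num
  have h7 : (An K 7 : ℂ) = 15 := by have := hl 7 le_rfl; norm_num at this; exact this
  have h8 : (An K 8 : ℂ) = 31 := by have := hl 8 (by norm_num); norm_num at this; exact this
  have hmul : (1 - PowerSeries.X) * (1 - PowerSeries.C 2 * PowerSeries.X) *
      (PowerSeries.mk fun n => (An K n : ℂ)) = (PowerSeries.mk fun n => (An K n : ℂ)) -
      PowerSeries.X * (PowerSeries.C 3 * (PowerSeries.mk fun n => (An K n : ℂ)) -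
      PowerSeries.X * (PowerSeries.C 2 * (PowerSeries.mk fun n => (An K n : ℂ)))) := by
    have h23 : (PowerSeries.C 3 : PowerSeries ℂ) = PowerSeries.C 2 + 1 := by
      rw [← map_one (PowerSeries.C (R := ℂ)), ← map_add]; norm_num
    rw [h23]; ring
  rw [hmul]
  ext n
  rw [Polynomial.coeff_coe, zetaNum]
  rcases n with _ | _ | n
  · rw [coeff_octic_zero]; simp [h0]
  · rw [show (0 + 1 : ℕ) = ((0 : Fin 8) : ℕ) + 1 from rfl, coeff_octic]
    simp [PowerSeries.coeff_succ_X_mul, h0]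
  · simp only [PowerSeries.coeff_succ_X_mul, map_sub, PowerSeries.coeff_C_mul,
      PowerSeries.coeff_mk]
    by_cases hn : 7 ≤ n
    · rw [coeff_octic_of_lt _ (by omega), hl (n + 1 + 1) (by omega), hl (n + 1) (by omega),
        hl n hn]
      have e1 : n + 1 + 1 - 3 = (n - 3) + 2 := by omega
      have e2 : n + 1 - 3 = (n - 3) + 1 := by omega
      rw [e1, e2, pow_succ, pow_succ]
      ring
    · push Not at hn
      rw [show n + 1 + 1 = ((⟨n + 1, by omega⟩ : Fin 8) : ℕ) + 1 from rfl, coeff_octic]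
      interval_cases n <;> simp [h0, h4, h5, h6, h7, h8] <;> ring

theorem An_eq_zero_of_bound (N : ℕ) (hN : 0 < N) (C : ℝ)
    (hS : ∀ n : ℕ, 0 < n → 2 ^ (N * n) - C * √2 ^ (N * n) ≤ (Sn K (N * n) : ℝ)) :
    An K 1 = 0 ∧ An K 2 = 0 ∧ An K 3 = 0 := by
  have key := no_small_real_root (fun n => (An K n : ℂ)) (fun n => (Sn K n : ℂ))
    (by simp [An_zero]) (fun n => by
      have := congrArg (Int.cast : ℤ → ℂ) (mul_An_eq (K := K) n)
      push_cast at this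
      rw [this]
      refine Finset.sum_congr rfl fun j hj => ?_
      rw [Finset.mem_Icc] at hj
      rw [Nat.cast_sub hj.2]) (zetaNum K) zetaNum_eq N hN C (fun n hn => by
      have := hS n hn
      rwa [Complex.natCast_re])
  by_contra hcon
  set a : ℝ := ((An K 1 : ℕ) : ℝ)
  set b : ℝ := ((An K 2 : ℕ) : ℝ)
  set c : ℝ := ((An K 3 : ℕ) : ℝ)
  let f : ℝ → ℝ := fun t => 1 + (a - 3) * t + (b - 3 * a + 2) * t ^ 2 +
    (c - 3 * b + 2 * a) * t ^ 3 + (4 * b - 3 * c + 1) * t ^ 4 + (4 * a - 6 * b + 2 * c) * t ^ 5 +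
    (8 - 12 * a + 4 * b) * t ^ 6 + (8 * a - 24) * t ^ 7 + 16 * t ^ 8
  have hf : ∀ t : ℝ, (zetaNum K).eval (t : ℂ) = (f t : ℂ) := fun t => by
    simp [zetaNum, octic, f, a, b, c]
  have h2 : √2 * √2 = 2 := Real.mul_self_sqrt (by norm_num)
  have hs0 : 0 < √2 := by positivity
  have hslo : 1.4142 < √2 := Real.lt_sqrt_of_sq_lt (by norm_num)
  have hshi : √2 < 1.41422 := by
    rw [Real.sqrt_lt' (by norm_num)]; norm_num
  set r := √2 / 2
  have hr2 : r ^ 2 = 1 / 2 := by simp only [r]; nlinarith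
  have hfr : f r < 0 := by
    have e : f r = 17 / 4 + 2 * b - 3 * a - 3 / 4 * c + r * (4 * a - 6 - 3 * b + c) := by
      have e3 : r ^ 3 = r / 2 := by rw [pow_succ, hr2]; ring
      have e4 : r ^ 4 = 1 / 4 := by rw [show r ^ 4 = (r ^ 2) ^ 2 by ring, hr2]; norm_num
      have e5 : r ^ 5 = r / 4 := by rw [pow_succ, e4]; ring
      have e6 : r ^ 6 = 1 / 8 := by rw [show r ^ 6 = (r ^ 2) ^ 3 by ring, hr2]; norm_num
      have e7 : r ^ 7 = r / 8 := by rw [pow_succ, e6]; ring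
      have e8 : r ^ 8 = 1 / 16 := by rw [show r ^ 8 = (r ^ 2) ^ 4 by ring, hr2]; norm_num
      simp only [f]
      rw [hr2, e3, e4, e5, e6, e7, e8]; ring
    rw [e]
    have hr_lo : 0.7071 < r := by simp only [r]; linarith
    have hr_hi : r < 0.70711 := by simp only [r]; linarith
    have ha : 0 ≤ a := Nat.cast_nonneg _
    have hb : 0 ≤ b := Nat.cast_nonneg _
    have hc : 0 ≤ c := Nat.cast_nonneg _
    have habc : 1 ≤ a + b + c := by
      have : 1 ≤ An K 1 + An K 2 + An K 3 := by omega
      simp only [a, b, c]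
      exact_mod_cast this
    have h3 : r * a ≤ 0.70711 * a := mul_le_mul_of_nonneg_right hr_hi.le ha
    have h4 : 0.7071 * b ≤ r * b := mul_le_mul_of_nonneg_right hr_lo.le hb
    have h5 : r * c ≤ 0.70711 * c := mul_le_mul_of_nonneg_right hr_hi.le hc
    nlinarith
  have hcont : ContinuousOn f (Set.Icc 0 r) := by
    apply Continuous.continuousOn; fun_prop
  have hr0 : 0 ≤ r := by positivity
  have hf0 : f 0 = 1 := by simp [f]
  obtain ⟨t, ht, hft⟩ := intermediate_value_Icc' hr0 hcont ⟨hfr.le, by rw [hf0]; norm_num⟩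
  have ht0 : t ≠ 0 := by rintro rfl; rw [hf0] at hft; norm_num at hft
  have htr : t ≠ r := by rintro rfl; exact hfr.ne hft
  refine key t (lt_of_le_of_ne ht.1 (Ne.symm ht0)) ?_ (by rw [hf, hft]; simp)
  have : t < r := lt_of_le_of_ne ht.2 htr
  have : t * √2 < r * √2 := mul_lt_mul_of_pos_right this hs0
  have h3 : r * √2 = 1 := by simp only [r]; linarith
  linarith

end Counts

end CFF

namespace CFF

section Elimination

open Polynomial

theorem natDegree_det_le {R : Type*} [CommRing R] {n : ℕ} (A : Matrix (Fin n) (Fin n) R[X])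
    {M : ℕ} (h : ∀ i j, (A i j).natDegree ≤ M) : A.det.natDegree ≤ n * M := by
  rw [Matrix.det_apply]
  refine natDegree_sum_le_of_forall_le _ _ fun σ _ => ?_
  refine (natDegree_smul_le _ _).trans ((natDegree_prod_le _ _).trans ?_)
  refine (Finset.sum_le_sum fun i _ => h (σ i) i).trans (by simp)

theorem natDegree_resultant_le {R : Type*} [CommRing R] (f g : R[X][X]) (m n : ℕ) {M : ℕ}
    (hf : ∀ i, (f.coeff i).natDegree ≤ M) (hg : ∀ i, (g.coeff i).natDegree ≤ M) :
    (resultant f g m n).natDegree ≤ (m + n) * M := by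
  refine natDegree_det_le _ fun i j => ?_
  rw [sylvester, Matrix.of_apply]
  refine j.addCases (fun j₁ => ?_) (fun j₁ => ?_)
  · rw [Fin.addCases_left]; split_ifs
    · exact hg _
    · simp
  · rw [Fin.addCases_right]; split_ifs
    · exact hf _
    · simp

variable {F K : Type} [Field F] [Field K] [Algebra F K]

/-- The extension of scalars of a bivariate polynomial. -/
abbrev scal (K : Type) [Field K] [Algebra F K] (f : F[X][X]) : K[X][X] :=
  f.map (mapRingHom (algebraMap F K))

theorem scal_irreducible [FnField F K] {f : F[X][X]} (hf : f.Monic) (hirr : Irreducible f) :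
    Irreducible (scal K f) := by
  have hinj : Function.Injective (mapRingHom (algebraMap F K)) :=
    map_injective _ (algebraMap F K).injective
  rw [(hf.map _).irreducible_iff_natDegree']
  have hlift : ∀ q : K[X][X], q.Monic → q ∣ scal K f →
      ∃ q' : F[X][X], q'.Monic ∧ scal K q' = q := by
    intro q hq hd
    have h1 : ∀ i, ∃ c : F[X], mapRingHom (algebraMap F K) c = q.coeff i := by
      intro i
      letI := Polynomial.algebra F K
      have h2 : IsIntegral F[X] (q.coeff i) := isIntegral_coeff_of_dvd f q hf hq hd i
      rw [Polynomial.isIntegral_iff_isIntegral_coeff] at h2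
      have h3 : ∀ n, ∃ a, algebraMap F K a = (q.coeff i).coeff n := fun n => by
        by_contra hcon
        exact FnField.transcendental (F := F) _ hcon (h2 n).isAlgebraic
      have h4 : q.coeff i ∈ lifts (algebraMap F K) := (lifts_iff_coeff_lifts _).2 h3
      exact h4
    have h5 : q ∈ lifts (mapRingHom (algebraMap F K)) := (lifts_iff_coeff_lifts _).2 h1
    obtain ⟨q', h6, -, h7⟩ := lifts_and_degree_eq_and_monic h5 hq
    exact ⟨q', h7, h6⟩
  refine ⟨fun h => ?_, fun g h hg hh hgh => ?_⟩
  · refine hirr.not_isUnit ?_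
    have : f = 1 := map_injective _ hinj (by rw [h, Polynomial.map_one])
    rw [this]; exact isUnit_one
  · obtain ⟨g', hg', rfl⟩ := hlift g hg ⟨h, hgh.symm⟩
    obtain ⟨h', hh', rfl⟩ := hlift h hh ⟨_, by rw [mul_comm]; exact hgh.symm⟩
    have e : g' * h' = f := map_injective _ hinj (by rw [Polynomial.map_mul]; exact hgh)
    have := ((hf.irreducible_iff_natDegree').1 hirr).2 g' h' hg' hh' e
    rwa [natDegree_map_eq_of_injective hinj, natDegree_map_eq_of_injective hinj]

theorem exists_eliminant [FnField F K] {f : F[X][X]} (hf : f.Monic) (hirr : Irreducible f)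
    (G : K[X][X]) (hG : G ≠ 0) (hdeg : G.natDegree < f.natDegree) {M : ℕ}
    (hfM : ∀ i, (f.coeff i).natDegree ≤ M) (hGM : ∀ i, (G.coeff i).natDegree ≤ M) :
    ∃ p q : K[X][X], ∃ N : K[X], N ≠ 0 ∧ scal K f * p + G * q = C N ∧
      N.natDegree ≤ 2 * f.natDegree * M := by
  have hinj : Function.Injective (mapRingHom (algebraMap F K)) :=
    map_injective _ (algebraMap F K).injective
  have hfd : (scal K f).natDegree = f.natDegree := natDegree_map_eq_of_injective hinj f
  obtain ⟨p, q, -, -, h⟩ := exists_mul_add_mul_eq_C_resultant (scal K f) G le_rfl le_rfl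
    (Or.inl (by rw [hfd]; omega))
  refine ⟨p, q, _, ?_, h, ?_⟩
  · intro h0
    have hri := (hf.map (mapRingHom (algebraMap F K))).irreducible_iff_irreducible_map_fraction_map
      (K := RatFunc K) |>.1 (scal_irreducible hf hirr)
    have hj : Function.Injective (algebraMap K[X] (RatFunc K)) := RatFunc.algebraMap_injective K
    have h1 := congrArg (algebraMap K[X] (RatFunc K)) h0
    rw [← resultant_map_map, map_zero, ← natDegree_map_eq_of_injective hj (scal K f),
      ← natDegree_map_eq_of_injective hj G, resultant_eq_zero_iff] at h1
    refine h1.2 ((hri.coprime_iff_not_dvd).2 fun hd => ?_)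
    have hG0 : G.map (algebraMap K[X] (RatFunc K)) ≠ 0 := by
      rwa [Ne, Polynomial.map_eq_zero_iff hj]
    have := natDegree_le_of_dvd hd hG0
    rw [natDegree_map_eq_of_injective hj, natDegree_map_eq_of_injective hj, hfd] at this
    omega
  · refine (natDegree_resultant_le _ _ _ _ (M := M) (fun i => ?_) hGM).trans ?_
    · rw [coeff_map, coe_mapRingHom]; exact natDegree_map_le.trans (hfM i)
    · rw [hfd]; gcongr; omega

end Elimination

end CFF

namespace CFF

section PlaneModel

open Polynomial

/-- A plane model of degree five over the polynomials in `x`: a generator `θ` integral over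
`𝔽₂[x]` with its equation `f`. -/
structure PlaneModel (K : Type) [Field K] [Algebra (ZMod 2) K] where
  x : K
  θ : K
  f : (ZMod 2)[X][X]
  notMem : x ∉ (algebraMap (ZMod 2) K).range
  finrank_eq : Module.finrank (IntermediateField.adjoin (ZMod 2) {x}) K = 5
  monic : f.Monic
  irreducible : Irreducible f
  natDegree_eq : f.natDegree = 5
  root : eval₂ (aeval x : (ZMod 2)[X] →ₐ[ZMod 2] K).toRingHom θ f = 0

variable {K : Type} [Field K] [Algebra (ZMod 2) K] [FnField (ZMod 2) K]

theorem sum_range_two_mul {M : Type*} [AddCommMonoid M] (f : ℕ → M) (n : ℕ) :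
    ∑ i ∈ Finset.range (2 * n), f i = ∑ i ∈ Finset.range n, (f (2 * i) + f (2 * i + 1)) := by
  induction n with
  | zero => simp
  | succ n ih =>
    rw [Finset.sum_range_succ, ← ih, show 2 * (n + 1) = 2 * n + 1 + 1 by ring,
      Finset.sum_range_succ, Finset.sum_range_succ, add_assoc]

instance charP_two : CharP K 2 := charP_of_injective_algebraMap (algebraMap (ZMod 2) K).injective 2

theorem indep_of_not_square {x : K} (hx : ∀ y, x ≠ y ^ 2) (m : ℕ) (ν : ℕ → K)
    (h : ∑ i ∈ Finset.range (2 ^ m), ν i ^ 2 ^ m * x ^ i = 0) : ∀ i < 2 ^ m, ν i = 0 := by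
  induction m generalizing ν with
  | zero => intro i hi; simp at h hi; subst hi; exact h
  | succ m ih =>
    rw [pow_succ', sum_range_two_mul, Finset.sum_add_distrib] at h
    set A := ∑ i ∈ Finset.range (2 ^ m), ν (2 * i) ^ 2 ^ m * x ^ i with hA
    set B := ∑ i ∈ Finset.range (2 ^ m), ν (2 * i + 1) ^ 2 ^ m * x ^ i with hB
    have h1 : A ^ 2 + x * B ^ 2 = 0 := by
      rw [hA, hB, sum_pow_char, sum_pow_char, Finset.mul_sum, ← h]
      congr 1 <;> refine Finset.sum_congr rfl fun i _ => ?_ <;> ring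
    have hB0 : B = 0 := by
      by_contra hB0
      refine hx (A / B) ?_
      rw [div_pow, eq_div_iff (pow_ne_zero _ hB0)]
      have h2 := CharTwo.add_self_eq_zero (x * B ^ 2)
      linear_combination h2 - h1
    have hA0 : A = 0 := by
      rw [hB0] at h1
      simpa using h1
    intro i hi
    rw [pow_succ'] at hi
    rcases Nat.even_or_odd' i with ⟨j, rfl | rfl⟩
    · exact ih (fun i => ν (2 * i)) hA0 j (by omega)
    · exact ih (fun i => ν (2 * i + 1)) hB0 j (by omega)

namespace PlaneModel

variable (Γ : PlaneModel K)

theorem x_ne_sq (y : K) : Γ.x ≠ y ^ 2 := by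
  intro h
  have h1 := deg_zdiv Γ.notMem
  rw [Γ.finrank_eq] at h1
  have h2 : zdiv Γ.x = zdiv y + zdiv y := by
    ext P
    rw [Finsupp.add_apply, zdiv_apply, zdiv_apply, h, ord_pow]
    omega
  rw [h2, deg_add] at h1
  push_cast at h1
  omega

/-- The degree in `x` of the equation. -/
def height : ℕ := Finset.sup (Finset.range 6) fun i => (Γ.f.coeff i).natDegree

theorem natDegree_coeff_le (i : ℕ) : (Γ.f.coeff i).natDegree ≤ Γ.height := by
  by_cases hi : i < 6
  · exact Finset.le_sup (f := fun i => (Γ.f.coeff i).natDegree) (Finset.mem_range.2 hi)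
  · rw [coeff_eq_zero_of_natDegree_lt (by rw [Γ.natDegree_eq]; omega)]; simp

/-- Evaluation at the point, with the `2 ^ m`-th power map on the coefficients. -/
def twist (m : ℕ) : K[X][X] →+* K :=
  eval₂RingHom (eval₂RingHom (iterateFrobenius K 2 m) Γ.x) Γ.θ

theorem twist_scal (m : ℕ) : Γ.twist m (scal K Γ.f) = 0 := by
  rw [twist, coe_eval₂RingHom, scal, eval₂_map, ← Γ.root]
  congr 1
  refine Polynomial.ringHom_ext (fun a => ?_) ?_
  · simp only [RingHom.comp_apply, coe_mapRingHom, map_C, coe_eval₂RingHom, eval₂_C,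
      iterateFrobenius_def, AlgHom.toRingHom_eq_coe, RingHom.coe_coe, aeval_C]
    rcases zmod_two_cases a with rfl | rfl <;> simp
  · simp

theorem twist_ne_zero (m : ℕ) {G : K[X][X]} (hG : G ≠ 0) (hd : G.natDegree < 5) {M : ℕ}
    (hGM : ∀ i, (G.coeff i).natDegree ≤ M) (hM : Γ.height ≤ M) (hm : 10 * M < 2 ^ m) :
    Γ.twist m G ≠ 0 := by
  intro h0
  obtain ⟨p, q, N, hN, h, hNd⟩ := exists_eliminant Γ.monic Γ.irreducible G hG
    (by rw [Γ.natDegree_eq]; exact hd) (fun i => (Γ.natDegree_coeff_le i).trans hM) hGM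
  have h1 := congrArg (Γ.twist m) h
  rw [map_add, map_mul, map_mul, h0, twist_scal, zero_mul, zero_mul, add_zero] at h1
  rw [Γ.natDegree_eq] at hNd
  have h2 : Γ.twist m (C N) = ∑ i ∈ Finset.range (2 ^ m), N.coeff i ^ 2 ^ m * Γ.x ^ i := by
    rw [twist, coe_eval₂RingHom, eval₂_C, coe_eval₂RingHom,
      eval₂_eq_sum_range' _ (show N.natDegree < 2 ^ m by omega)]
    rfl
  rw [h2] at h1
  have h3 := indep_of_not_square Γ.x_ne_sq m _ h1.symm
  apply hN
  ext i
  by_cases hi : i < 2 ^ m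
  · rw [h3 i hi, coeff_zero]
  · rw [coeff_eq_zero_of_natDegree_lt (by omega), coeff_zero]

theorem twist_array_ne_zero (m a : ℕ) {t : Fin (a + 1) → Fin 5 → K} (ht : t ≠ 0)
    (hm : 10 * max a Γ.height < 2 ^ m) :
    ∑ i, ∑ j, t i j ^ 2 ^ m * (Γ.x ^ (i : ℕ) * Γ.θ ^ (j : ℕ)) ≠ 0 := by
  set G : K[X][X] := ∑ j : Fin 5, monomial (j : ℕ) (∑ i : Fin (a + 1), monomial (i : ℕ) (t i j)) with hG
  have hc : ∀ i j, (G.coeff (j : Fin 5)).coeff (i : Fin (a + 1)) = t i j := by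
    intro i j
    simp [hG, finset_sum_coeff, coeff_monomial, Fin.val_inj]
  have hG0 : G ≠ 0 := by
    intro h
    apply ht
    ext i j
    rw [← hc, h]; simp
  have hd : G.natDegree ≤ 4 := by
    rw [hG]
    refine natDegree_sum_le_of_forall_le _ _ fun j _ => (natDegree_monomial_le _).trans ?_
    omega
  have hM : ∀ n, (G.coeff n).natDegree ≤ max a Γ.height := by
    intro n
    refine le_trans ?_ (le_max_left _ _)
    rw [hG, finset_sum_coeff]
    refine natDegree_sum_le_of_forall_le _ _ fun j _ => ?_
    rw [coeff_monomial]
    split_ifs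
    · refine natDegree_sum_le_of_forall_le _ _ fun i _ => (natDegree_monomial_le _).trans ?_
      omega
    · simp
  have := Γ.twist_ne_zero m hG0 (by omega) hM (le_max_right _ _) hm
  have e : Γ.twist m G = ∑ i, ∑ j, t i j ^ 2 ^ m * (Γ.x ^ (i : ℕ) * Γ.θ ^ (j : ℕ)) := by
    rw [hG, map_sum, Finset.sum_comm]
    refine Finset.sum_congr rfl fun j _ => ?_
    rw [twist, coe_eval₂RingHom, eval₂_monomial, coe_eval₂RingHom, eval₂_finsetSum,
      Finset.sum_mul]
    refine Finset.sum_congr rfl fun i _ => ?_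
    rw [eval₂_monomial, iterateFrobenius_def]; ring
  rwa [e] at this

theorem array_ne_zero (a : ℕ) {t : Fin (a + 1) → Fin 5 → ZMod 2} (ht : t ≠ 0) :
    ∑ i, ∑ j, algebraMap (ZMod 2) K (t i j) * (Γ.x ^ (i : ℕ) * Γ.θ ^ (j : ℕ)) ≠ 0 := by
  obtain ⟨m, hm⟩ : ∃ m : ℕ, 10 * max a Γ.height < 2 ^ m := ⟨_, Nat.lt_two_pow_self⟩
  have h1 : (fun i j => algebraMap (ZMod 2) K (t i j)) ≠ 0 := by
    intro h
    apply ht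
    ext i j
    have := congrFun (congrFun h i) j
    simpa using this
  have := Γ.twist_array_ne_zero m a h1 hm
  convert this using 5 with i _ j
  rcases zmod_two_cases (t i j) with h | h <;> simp [h]

theorem exists_cofactor : ∃ e : Fin 4 → K, ∀ y,
    eval₂ (aeval Γ.x : (ZMod 2)[X] →ₐ[ZMod 2] K).toRingHom y Γ.f =
      (y - Γ.θ) * (∑ m, e m * y ^ (m : ℕ) + y ^ 4) := by
  set φ := Γ.f.map (aeval Γ.x : (ZMod 2)[X] →ₐ[ZMod 2] K).toRingHom with hφ
  have hr : φ.IsRoot Γ.θ := by rw [IsRoot, hφ, eval_map]; exact Γ.root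
  have hmul := mul_divByMonic_eq_iff_isRoot.2 hr
  have hmon : (φ /ₘ (X - C Γ.θ)).Monic := by
    refine Monic.of_mul_monic_left (monic_X_sub_C Γ.θ) ?_
    rw [hmul]; exact Γ.monic.map _
  have hdeg : (φ /ₘ (X - C Γ.θ)).natDegree = 4 := by
    rw [natDegree_divByMonic _ (monic_X_sub_C _), natDegree_X_sub_C, hφ, Γ.monic.natDegree_map,
      Γ.natDegree_eq]
  refine ⟨fun m => (φ /ₘ (X - C Γ.θ)).coeff m, fun y => ?_⟩
  rw [← eval_map, ← hφ]
  nth_rewrite 1 [← hmul]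
  rw [eval_mul, eval_sub, eval_X, eval_C]
  congr 1
  have h4 := hmon.coeff_natDegree
  rw [hdeg] at h4
  rw [eval_eq_sum_range, hdeg, Finset.sum_range_succ, h4, one_mul,
    Finset.sum_range (fun i => (φ /ₘ (X - C Γ.θ)).coeff i * y ^ i)]

end PlaneModel

end PlaneModel

end CFF

namespace CFF

section Congruences

open Polynomial

variable {K : Type} [Field K] [Algebra (ZMod 2) K] [FnField (ZMod 2) K]

/-- Evaluation of bivariate polynomials. -/
def ev (x y : K) (g : (ZMod 2)[X][X]) : K :=
  eval₂ (aeval x : (ZMod 2)[X] →ₐ[ZMod 2] K).toRingHom y g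

theorem ev_add (x y : K) (g h : (ZMod 2)[X][X]) : ev x y (g + h) = ev x y g + ev x y h :=
  eval₂_add _ _

theorem ev_monomial (x y : K) (n : ℕ) (p : (ZMod 2)[X]) :
    ev x y (monomial n p) = aeval x p * y ^ n := eval₂_monomial _ _

theorem pow_mem_fil_zero {P : Pl K} {x : K} (hx : x ∈ fil P 0) (n : ℕ) : x ^ n ∈ fil P 0 :=
  mem_fil_zero.2 (pow_mem (mem_fil_zero.1 hx) n)

theorem mul_mem_fil' {P : Pl K} {x y : K} {n : ℤ} (hx : x ∈ fil P 0) (hy : y ∈ fil P n) :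
    x * y ∈ fil P n := by
  have := mul_mem_fil hx hy
  rwa [zero_add] at this

theorem pow_sub_pow_mem {P : Pl K} {x x' : K} {n : ℤ} (hx : x ∈ fil P 0) (hx' : x' ∈ fil P 0)
    (h : x' - x ∈ fil P n) (k : ℕ) : x' ^ k - x ^ k ∈ fil P n := by
  induction k with
  | zero => simp
  | succ k ih =>
    have e : x' ^ (k + 1) - x ^ (k + 1) = x' * (x' ^ k - x ^ k) + x ^ k * (x' - x) := by ring
    rw [e]
    exact add_mem (mul_mem_fil' hx' ih) (mul_mem_fil' (pow_mem_fil_zero hx k) h)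

theorem aeval_mem {P : Pl K} {x : K} (hx : x ∈ fil P 0) (p : (ZMod 2)[X]) :
    aeval x p ∈ fil P 0 := by
  induction p using Polynomial.induction_on' with
  | add p q hp hq => rw [map_add]; exact add_mem hp hq
  | monomial n a =>
    rw [aeval_monomial]; exact mul_mem_fil' (algebraMap_mem_fil P a) (pow_mem_fil_zero hx n)

theorem aeval_sub_mem {P : Pl K} {x x' : K} {n : ℤ} (hx : x ∈ fil P 0) (hx' : x' ∈ fil P 0)
    (h : x' - x ∈ fil P n) (p : (ZMod 2)[X]) : aeval x' p - aeval x p ∈ fil P n := by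
  induction p using Polynomial.induction_on' with
  | add p q hp hq => rw [map_add, map_add, add_sub_add_comm]; exact add_mem hp hq
  | monomial m a =>
    rw [aeval_monomial, aeval_monomial, ← mul_sub]
    exact mul_mem_fil' (algebraMap_mem_fil P a) (pow_sub_pow_mem hx hx' h m)

theorem ev_mem {P : Pl K} {x y : K} (hx : x ∈ fil P 0) (hy : y ∈ fil P 0) (g : (ZMod 2)[X][X]) :
    ev x y g ∈ fil P 0 := by
  induction g using Polynomial.induction_on' with
  | add p q hp hq => rw [ev_add]; exact add_mem hp hq
  | monomial m a =>
    rw [ev_monomial]; exact mul_mem_fil' (aeval_mem hx a) (pow_mem_fil_zero hy m)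

theorem ev_sub_mem {P : Pl K} {x x' y y' : K} {n : ℤ} (hx : x ∈ fil P 0) (hx' : x' ∈ fil P 0)
    (hy : y ∈ fil P 0) (hy' : y' ∈ fil P 0)
    (h : x' - x ∈ fil P n) (h' : y' - y ∈ fil P n) (g : (ZMod 2)[X][X]) :
    ev x' y' g - ev x y g ∈ fil P n := by
  induction g using Polynomial.induction_on' with
  | add p q hp hq => rw [ev_add, ev_add, add_sub_add_comm]; exact add_mem hp hq
  | monomial m a =>
    rw [ev_monomial, ev_monomial]
    have e : aeval x' a * y' ^ m - aeval x a * y ^ m =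
      aeval x' a * (y' ^ m - y ^ m) + y ^ m * (aeval x' a - aeval x a) := by ring
    rw [e]
    exact add_mem (mul_mem_fil' (aeval_mem hx' a) (pow_sub_pow_mem hy hy' h' m))
      (mul_mem_fil' (pow_mem_fil_zero hy m) (aeval_sub_mem hx hx' h a))

theorem aeval_pow (x : K) (n : ℕ) (p : (ZMod 2)[X]) :
    aeval x p ^ 2 ^ n = aeval (x ^ 2 ^ n) p := by
  induction p using Polynomial.induction_on' with
  | add p q hp hq => rw [map_add, map_add, add_pow_char_pow, hp, hq]
  | monomial m a =>
    rw [aeval_monomial, aeval_monomial, mul_pow, pow_right_comm]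
    congr 1
    rcases zmod_two_cases a with rfl | rfl <;> simp

theorem ev_pow (x y : K) (n : ℕ) (g : (ZMod 2)[X][X]) :
    ev x y g ^ 2 ^ n = ev (x ^ 2 ^ n) (y ^ 2 ^ n) g := by
  induction g using Polynomial.induction_on' with
  | add p q hp hq => rw [ev_add, ev_add, add_pow_char_pow, hp, hq]
  | monomial m a => rw [ev_monomial, ev_monomial, mul_pow, aeval_pow, pow_right_comm]

theorem ord_eq_zero_of {P : Pl K} {u : K} (h0 : u ∈ fil P 0) (h1 : u ∉ fil P 1) : ord P u = 0 := by
  rw [mem_fil] at h0 h1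
  push Not at h1
  rcases h0 with h0 | h0
  · exact absurd h0 h1.1
  · omega

theorem ne_zero_of_notMem_fil {P : Pl K} {u : K} {n : ℤ} (h1 : u ∉ fil P n) : u ≠ 0 := fun h =>
  h1 (h ▸ zero_mem _)

namespace PlaneModel

variable (Γ : PlaneModel K)

theorem ev_root : ev Γ.x Γ.θ Γ.f = 0 := Γ.root

theorem θ_mem {P : Pl K} (hx : Γ.x ∈ fil P 0) : Γ.θ ∈ fil P 0 := by
  have hx' := mem_fil_zero.1 hx
  let φ : (ZMod 2)[X] →+* P.1 :=
    (aeval Γ.x : (ZMod 2)[X] →ₐ[ZMod 2] K).toRingHom.codRestrict P.1.toSubring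
      fun p => mem_fil_zero.1 (aeval_mem hx p)
  have h_int : IsIntegral P.1 Γ.θ := by
    refine ⟨Γ.f.map φ, Γ.monic.map _, ?_⟩
    rw [eval₂_map, ← Γ.root]
    rfl
  obtain ⟨y, hy⟩ := IsIntegrallyClosed.isIntegral_iff.1 h_int
  rw [mem_fil_zero, ← hy]
  exact y.2

/-- The array of coefficients of tensors used in the counting argument. -/
abbrev Arr (a b : ℕ) := Fin (a + 1) → Fin 5 → Fin (b + 1) → Fin 5 → ZMod 2

/-- The second factor of a tensor. -/
def tau {a b : ℕ} (c : Arr a b) (i : Fin (a + 1)) (j : Fin 5) (x y : K) : K :=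
  ∑ k, ∑ l, algebraMap (ZMod 2) K (c i j k l) * (x ^ (k : ℕ) * y ^ (l : ℕ))

/-- The coefficients in the second variable of a twisted tensor. -/
def hh {a b : ℕ} (m : ℕ) (c : Arr a b) (l : Fin 5) : K :=
  ∑ i, ∑ j, ∑ k, algebraMap (ZMod 2) K (c i j k l) *
    ((Γ.x ^ (i : ℕ) * Γ.θ ^ (j : ℕ)) ^ 2 ^ m * Γ.x ^ (k : ℕ))

theorem hh_sub {a b : ℕ} (m : ℕ) (c c' : Arr a b) (l : Fin 5) :
    Γ.hh m (c - c') l = Γ.hh m c l - Γ.hh m c' l := by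
  simp only [hh, Pi.sub_apply, map_sub, sub_mul, Finset.sum_sub_distrib]

theorem sum_hh {a b : ℕ} (m : ℕ) (c : Arr a b) (y : K) :
    ∑ l : Fin 5, Γ.hh m c l * y ^ (l : ℕ) =
      ∑ i : Fin (a + 1), ∑ j : Fin 5,
        (Γ.x ^ (i : ℕ) * Γ.θ ^ (j : ℕ)) ^ 2 ^ m * tau c i j Γ.x y := by
  simp only [hh, tau, Finset.sum_mul, Finset.mul_sum]
  rw [Finset.sum_comm]
  refine Finset.sum_congr rfl fun i _ => ?_
  rw [Finset.sum_comm]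
  refine Finset.sum_congr rfl fun j _ => ?_
  rw [Finset.sum_comm]
  refine Finset.sum_congr rfl fun k _ => Finset.sum_congr rfl fun l _ => ?_
  ring

/-- The auxiliary function. -/
def gg {a b : ℕ} (m : ℕ) (c : Arr a b) : K :=
  ∑ i, ∑ j, tau c i j Γ.x Γ.θ ^ 2 ^ m * (Γ.x ^ (i : ℕ) * Γ.θ ^ (j : ℕ))

theorem gg_ne_zero {a b : ℕ} (m : ℕ) {c : Arr a b} (hc : c ≠ 0)
    (hm : 10 * max a Γ.height < 2 ^ m) : Γ.gg m c ≠ 0 := by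
  refine Γ.twist_array_ne_zero m a (t := fun i j => tau c i j Γ.x Γ.θ) (fun h => hc ?_) hm
  ext i j : 2
  by_contra hij
  exact Γ.array_ne_zero b hij (congrFun (congrFun h i) j)

theorem tau_pow {a b : ℕ} (c : Arr a b) (i : Fin (a + 1)) (j : Fin 5) (x y : K) (n : ℕ) :
    tau c i j x y ^ 2 ^ n = tau c i j (x ^ 2 ^ n) (y ^ 2 ^ n) := by
  simp only [tau, sum_pow_char_pow]
  refine Finset.sum_congr rfl fun k _ => Finset.sum_congr rfl fun l _ => ?_
  rw [mul_pow, mul_pow, pow_right_comm, pow_right_comm (n := (l : ℕ))]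
  congr 1
  rcases zmod_two_cases (c i j k l) with h | h <;> simp [h]

theorem tau_sub_mem {a b : ℕ} (c : Arr a b) (i : Fin (a + 1)) (j : Fin 5) {P : Pl K}
    {x x' y : K} {n : ℤ} (hx : x ∈ fil P 0) (hx' : x' ∈ fil P 0) (hy : y ∈ fil P 0)
    (h : x' - x ∈ fil P n) : tau c i j x' y - tau c i j x y ∈ fil P n := by
  rw [tau, tau, ← Finset.sum_sub_distrib]
  refine sum_mem fun k _ => ?_
  rw [← Finset.sum_sub_distrib]
  refine sum_mem fun l _ => ?_
  rw [← mul_sub, ← sub_mul, mul_comm _ (y ^ _)]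
  exact mul_mem_fil' (algebraMap_mem_fil P _) (mul_mem_fil' (pow_mem_fil_zero hy _)
    (pow_sub_pow_mem hx hx' h _))

theorem gg_mem {a b : ℕ} (m : ℕ) {c : Arr a b} {e : Fin 4 → K}
    (he : ∀ y, ev Γ.x y Γ.f = (y - Γ.θ) * (∑ m, e m * y ^ (m : ℕ) + y ^ 4))
    (hc : ∀ l : Fin 4, Γ.hh m c l.castSucc = Γ.hh m c (Fin.last 4) * e l)
    {P : Pl K} (hx : Γ.x ∈ fil P 0) (h1 : Γ.x ^ 2 ^ (2 * m) - Γ.x ∈ fil P 1)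
    (h2 : Γ.θ ^ 2 ^ (2 * m) - Γ.θ ∉ fil P 1) : Γ.gg m c ∈ fil P 1 := by
  have hθ := Γ.θ_mem hx
  set x' := Γ.x ^ 2 ^ (2 * m) with hx'
  set φ := Γ.θ ^ 2 ^ (2 * m) with hφ
  have hx'm : x' ∈ fil P 0 := pow_mem_fil_zero hx _
  have hφm : φ ∈ fil P 0 := pow_mem_fil_zero hθ _
  have h3 : ev x' φ Γ.f = 0 := by
    rw [hx', hφ, ← ev_pow, Γ.ev_root, zero_pow (by positivity)]
  have h4 : ev Γ.x φ Γ.f ∈ fil P 1 := by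
    have := ev_sub_mem hx hx'm hφm hφm h1 (by rw [sub_self]; exact zero_mem _) Γ.f
    rw [h3, zero_sub, neg_mem_iff] at this
    exact this
  have h5 : ∑ m, e m * φ ^ (m : ℕ) + φ ^ 4 ∈ fil P 1 := by
    rw [he, mul_mem_fil_iff (ne_zero_of_notMem_fil h2),
      ord_eq_zero_of (sub_mem hφm hθ) h2, sub_zero] at h4
    exact h4
  have h6 : ∑ l : Fin 5, Γ.hh m c l * φ ^ (l : ℕ) ∈ fil P 1 := by
    rw [Fin.sum_univ_castSucc]
    have : ∑ l : Fin 4, Γ.hh m c l.castSucc * φ ^ ((l.castSucc : Fin 5) : ℕ) +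
        Γ.hh m c (Fin.last 4) * φ ^ ((Fin.last 4 : Fin 5) : ℕ) =
        Γ.hh m c (Fin.last 4) * (∑ m, e m * φ ^ (m : ℕ) + φ ^ 4) := by
      rw [mul_add, Finset.mul_sum]
      congr 1
      refine Finset.sum_congr rfl fun l _ => ?_
      rw [hc l, mul_assoc]; rfl
    rw [this]
    refine mul_mem_fil' ?_ h5
    refine sum_mem fun i _ => sum_mem fun j _ => sum_mem fun k _ => ?_
    exact mul_mem_fil' (algebraMap_mem_fil P _) (mul_mem_fil' (pow_mem_fil_zero (mul_mem_fil'
      (pow_mem_fil_zero hx _) (pow_mem_fil_zero hθ _)) _) (pow_mem_fil_zero hx _))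
  have h7 : Γ.gg m c ^ 2 ^ m ∈ fil P 1 := by
    have e1 : Γ.gg m c ^ 2 ^ m =
        ∑ i : Fin (a + 1), ∑ j : Fin 5,
          (Γ.x ^ (i : ℕ) * Γ.θ ^ (j : ℕ)) ^ 2 ^ m * (tau c i j x' φ - tau c i j Γ.x φ) +
        ∑ l : Fin 5, Γ.hh m c l * φ ^ (l : ℕ) := by
      rw [sum_hh, ← Finset.sum_add_distrib, gg]
      simp only [sum_pow_char_pow]
      refine Finset.sum_congr rfl fun i _ => ?_
      rw [← Finset.sum_add_distrib]
      refine Finset.sum_congr rfl fun j _ => ?_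
      rw [← mul_add, sub_add_cancel, mul_pow, ← pow_mul, ← pow_add, ← two_mul, tau_pow]
      ring
    rw [e1]
    refine add_mem (sum_mem fun i _ => sum_mem fun j _ => ?_) h6
    exact mul_mem_fil' (pow_mem_fil_zero (mul_mem_fil'
      (pow_mem_fil_zero hx _) (pow_mem_fil_zero hθ _)) _) (tau_sub_mem c i j hx hx'm hφm h1)
  rw [mem_fil, ord_pow] at h7
  rw [mem_fil]
  rcases h7 with h7 | h7
  · exact Or.inl (pow_eq_zero_iff (by positivity) |>.1 h7)
  · right
    by_contra hcon
    have : ord P (Γ.gg m c) ≤ 0 := by omega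
    have := mul_nonpos_of_nonneg_of_nonpos (show (0:ℤ) ≤ ((2 ^ m : ℕ) : ℤ) by positivity) this
    omega

end PlaneModel

end Congruences

end CFF

namespace CFF

section BadPlaces

variable {K : Type} [Field K] [Algebra (ZMod 2) K] [FnField (ZMod 2) K]

theorem deg_mul_le_of_pos_on {D : Divisor (ZMod 2) K} {g : K} (hg : g ≠ 0) (hD : g ∈ L D)
    (hD0 : 0 ≤ D) (S : Finset (Pl K)) (hS : ∀ P ∈ S, g ∈ fil P 1) :
    (∑ P ∈ S, (pdeg P : ℤ)) ≤ deg D := by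
  rw [mem_L_of_ne hg] at hD
  have h1 : deg (pdiv g + D) = deg D := by rw [deg_add, deg_pdiv, zero_add]
  rw [← h1, deg_eq_sum_of_subset (pdiv g + D) (S := S ∪ (pdiv g + D).support)
    Finset.subset_union_right]
  refine le_trans (Finset.sum_le_sum fun P hP => ?_) (Finset.sum_le_sum_of_subset_of_nonneg
    Finset.subset_union_left fun P _ _ => mul_nonneg (hD P) (by positivity))
  have h2 : 1 ≤ ord P g := (mem_fil_of_ne hg).1 (hS P hP)
  have h3 : 0 ≤ D P := hD0 P
  have h4 : (pdiv g + D) P = ord P g + D P := rfl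
  rw [h4]
  nlinarith [show (0:ℤ) ≤ pdeg P by positivity]

namespace PlaneModel

variable (Γ : PlaneModel K)

/-- The pole divisor of `x`. -/
def polx : Divisor (ZMod 2) K := zdiv Γ.x⁻¹

/-- The pole divisor of `θ`. -/
def polθ : Divisor (ZMod 2) K := zdiv Γ.θ⁻¹

theorem polx_nonneg : 0 ≤ Γ.polx := zdiv_nonneg _

theorem polθ_nonneg : 0 ≤ Γ.polθ := zdiv_nonneg _

theorem deg_polx : deg Γ.polx = 5 := by
  rw [polx, deg_zdiv (inv_notMem_range Γ.notMem), finrank_adjoin_inv, Γ.finrank_eq]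
  rfl

theorem pow_x_mem {i a : ℕ} (h : i ≤ a) : Γ.x ^ i ∈ L (a • Γ.polx) :=
  L_mono (nsmul_le_nsmul_left Γ.polx_nonneg h) (pow_mem_L (mem_L_zdiv_inv _) _)

theorem pow_θ_mem {i a : ℕ} (h : i ≤ a) : Γ.θ ^ i ∈ L (a • Γ.polθ) :=
  L_mono (nsmul_le_nsmul_left Γ.polθ_nonneg h) (pow_mem_L (mem_L_zdiv_inv _) _)

theorem algebraMap_mul_mem_L {D : Divisor (ZMod 2) K} {f : K} (c : ZMod 2) (hf : f ∈ L D) :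
    algebraMap (ZMod 2) K c * f ∈ L D := by
  rw [← Algebra.smul_def]; exact smul_mem_L c hf

theorem hh_mem {a b : ℕ} (m : ℕ) (c : Arr a b) (l : Fin 5) :
    Γ.hh m c l ∈ L (2 ^ m • (a • Γ.polx + 4 • Γ.polθ) + b • Γ.polx) :=
  sum_mem fun i _ => sum_mem fun j _ => sum_mem fun k _ => algebraMap_mul_mem_L _
    (mul_mem_L (pow_mem_L (mul_mem_L (Γ.pow_x_mem (by omega)) (Γ.pow_θ_mem (by omega))) _)
      (Γ.pow_x_mem (by omega)))

theorem gg_mem_L {a b : ℕ} (m : ℕ) (c : Arr a b) :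
    Γ.gg m c ∈ L (2 ^ m • (b • Γ.polx + 4 • Γ.polθ) + (a • Γ.polx + 4 • Γ.polθ)) :=
  sum_mem fun i _ => sum_mem fun j _ => mul_mem_L (pow_mem_L
    (sum_mem fun k _ => sum_mem fun l _ => algebraMap_mul_mem_L _ (mul_mem_L
      (Γ.pow_x_mem (by omega)) (Γ.pow_θ_mem (by omega)))) _)
    (mul_mem_L (Γ.pow_x_mem (by omega)) (Γ.pow_θ_mem (by omega)))

theorem exists_array {e : Fin 4 → K} {E : Divisor (ZMod 2) K} (hE : 0 ≤ E)
    (heE : ∀ i, e i ∈ L E) {a b m : ℕ}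
    (h : 4 * (2 ^ m * (5 * a + 4 * deg Γ.polθ) + 5 * b + deg E + 1) <
      25 * (a + 1) * (b + 1)) :
    ∃ c : Arr a b, c ≠ 0 ∧
      ∀ l : Fin 4, Γ.hh m c l.castSucc = Γ.hh m c (Fin.last 4) * e l := by
  set D : Divisor (ZMod 2) K := 2 ^ m • (a • Γ.polx + 4 • Γ.polθ) + b • Γ.polx + E with hD
  have hx := Γ.polx_nonneg
  have hθ := Γ.polθ_nonneg
  have hD0 : 0 ≤ D := by positivity
  have hmem : ∀ (c : Arr a b) (l : Fin 4),
      Γ.hh m c l.castSucc - Γ.hh m c (Fin.last 4) * e l ∈ L D := fun c l =>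
    sub_mem (L_mono (le_add_of_nonneg_right hE) (Γ.hh_mem m c _))
      (mul_mem_L (Γ.hh_mem m c _) (heE l))
  have hr := rr_le_deg hD0
  have hdeg : deg D = 2 ^ m * (5 * a + 4 * deg Γ.polθ) + 5 * b + deg E := by
    rw [hD, deg_add, deg_add, deg_nsmul, deg_add, deg_nsmul, deg_nsmul, deg_nsmul, deg_polx]
    push_cast
    ring
  haveI : Fintype (L D) := Fintype.ofFinite _
  have hcard : Fintype.card (Fin 4 → L D) < Fintype.card (Arr a b) := by
    rw [Fintype.card_fun, Fintype.card_fin, ← Nat.card_eq_fintype_card, card_L_eq]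
    simp only [Arr, Fintype.card_fun, Fintype.card_fin, ZMod.card, ← pow_mul]
    refine Nat.pow_lt_pow_right one_lt_two ?_
    have : (rr D : ℤ) * 4 < 5 * (b + 1) * 5 * (a + 1) := by linarith
    exact_mod_cast this
  obtain ⟨c, c', hne, hcc⟩ := Fintype.exists_ne_map_eq_of_card_lt
    (fun (c : Arr a b) (l : Fin 4) => (⟨_, hmem c l⟩ : L D)) hcard
  refine ⟨c - c', sub_ne_zero.2 hne, fun l => ?_⟩
  have := congrArg Subtype.val (congrFun hcc l)
  simp only at this
  rw [hh_sub, hh_sub]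
  linear_combination this

theorem exists_bad_bound : ∃ C m₀ : ℕ, ∀ m, m₀ ≤ m → ∀ S : Finset (Pl K),
    (∀ P ∈ S, Γ.x ∈ fil P 0 ∧ Γ.x ^ 2 ^ (2 * m) - Γ.x ∈ fil P 1 ∧
      Γ.θ ^ 2 ^ (2 * m) - Γ.θ ∉ fil P 1) →
    ∑ P ∈ S, pdeg P ≤ 4 * 4 ^ m + C * 2 ^ m := by
  obtain ⟨e, he⟩ := Γ.exists_cofactor
  obtain ⟨E, hE, heE⟩ := exists_mem_L_finset (Finset.univ.image e)
  obtain ⟨c, hc⟩ := Int.eq_ofNat_of_zero_le (deg_nonneg Γ.polθ_nonneg)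
  obtain ⟨e₀, he₀⟩ := Int.eq_ofNat_of_zero_le (deg_nonneg hE)
  set δ := 16 * c + e₀ + 1 with hδ
  refine ⟨5 * δ + 8 * c + 1, 80 + 20 * Γ.height, fun m hm S hS => ?_⟩
  set q := 2 ^ m with hq
  have hqm : 80 + 20 * Γ.height < q := lt_of_le_of_lt hm Nat.lt_two_pow_self
  set a := q / 20 with ha
  set b := 4 * q / 5 + δ with hb
  have ha1 : 20 * a ≤ q := by omega
  have ha2 : q + 1 ≤ 20 * (a + 1) := by omega
  have hb1 : 5 * b ≤ 4 * q + 5 * δ := by omega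
  have hb2 : 4 * q + 5 * δ + 1 ≤ 5 * (b + 1) := by omega
  have hineq : 4 * (q * (5 * a + 4 * c) + 5 * b + e₀ + 1) < 25 * (a + 1) * (b + 1) := by
    have h1 : 5 * (a + 1) * (4 * q + 5 * δ + 1) ≤ 5 * (a + 1) * (5 * (b + 1)) :=
      Nat.mul_le_mul_left _ hb2
    have h2 : (q + 1) * (5 * δ + 1) ≤ 20 * (a + 1) * (5 * δ + 1) := Nat.mul_le_mul_right _ ha2
    have h3 : 80 * δ ≤ q * δ := Nat.mul_le_mul_right _ (by omega)
    have h4 : q * δ = 16 * (q * c) + q * e₀ + q := by rw [hδ]; ring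
    have h5 : 80 * e₀ ≤ q * e₀ := Nat.mul_le_mul_right _ (by omega)
    nlinarith
  obtain ⟨t, ht, htl⟩ := Γ.exists_array (e := e) (a := a) (b := b) (m := m) hE
    (fun i => heE _ (Finset.mem_image_of_mem _ (Finset.mem_univ _))) (by
      rw [hc, he₀]; exact_mod_cast hineq)
  have hg := Γ.gg_ne_zero m ht (by rw [← hq]; rcases max_cases a Γ.height with h | h <;> omega)
  have hx := Γ.polx_nonneg
  have hθ := Γ.polθ_nonneg
  have h1 := deg_mul_le_of_pos_on hg (Γ.gg_mem_L m t) (by positivity) S fun P hP =>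
    Γ.gg_mem m he htl (hS P hP).1 (hS P hP).2.1 (hS P hP).2.2
  rw [deg_add, deg_nsmul, deg_add, deg_add, deg_nsmul, deg_nsmul, deg_nsmul, deg_polx, hc] at h1
  have h2 : ∑ P ∈ S, pdeg P ≤ q * (b * 5 + 4 * c) + (a * 5 + 4 * c) := by
    rw [hq]; exact_mod_cast h1
  have h3 : (4:ℕ) ^ m = q * q := by rw [hq, ← mul_pow]; norm_num
  rw [h3]
  have h4 : q * (5 * b) ≤ q * (4 * q + 5 * δ) := Nat.mul_le_mul_left _ hb1
  have h5 : c ≤ q * c := Nat.le_mul_of_pos_left _ (by omega)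
  nlinarith

end PlaneModel

end BadPlaces

end CFF

namespace CFF

section Counting

open Polynomial

variable {K : Type} [Field K] [Algebra (ZMod 2) K] [FnField (ZMod 2) K]

theorem pdeg_dvd_of {P : Pl K} {n : ℕ} (h : ∀ u ∈ fil P 0, u ^ 2 ^ n - u ∈ fil P 1) :
    pdeg P ∣ n := by
  letI := (residueHom (ZMod 2) P).toAlgebra
  haveI : Finite (IsLocalRing.ResidueField P.1) := by
    apply Nat.finite_of_card_ne_zero
    rw [card_residueField P, ZMod.card]; positivity
  have h1 : orderOf (FiniteField.frobeniusAlgHom (ZMod 2) (IsLocalRing.ResidueField P.1)) =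
    pdeg P := FiniteField.orderOf_frobeniusAlgHom _ _
  rw [← h1]
  apply orderOf_dvd_of_pow_eq_one
  ext u
  obtain ⟨u, rfl⟩ := IsLocalRing.residue_surjective u
  have h2 : ∀ k : ℕ, (FiniteField.frobeniusAlgHom (ZMod 2) (IsLocalRing.ResidueField P.1) ^ k)
      (IsLocalRing.residue P.1 u) = IsLocalRing.residue P.1 u ^ 2 ^ k := by
    intro k
    induction k with
    | zero => simp
    | succ k ih =>
      rw [pow_succ', AlgHom.mul_apply, ih, FiniteField.coe_frobeniusAlgHom, ZMod.card, pow_succ 2 k,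
        pow_mul]
  rw [h2, AlgHom.one_apply, ← sub_eq_zero, ← map_pow, ← map_sub, IsLocalRing.residue_eq_zero_iff,
    ValuationSubring.valuation_lt_one_iff]
  have h3 := h u (mem_fil_zero.2 u.2)
  by_cases h0 : (u : K) ^ 2 ^ n - u = 0
  · have : ((u ^ 2 ^ n - u : P.1) : K) = 0 := h0
    rw [this, map_zero]; exact zero_lt_one
  · rw [mem_fil_of_ne h0] at h3
    exact (ord_pos_iff P h0).1 h3

theorem pow_mem_fil {P : Pl K} {k : ℤ} (hk : 0 ≤ k) {u : K} (hu : u ∈ fil P k) {n : ℕ}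
    (hn : n ≠ 0) : u ^ n ∈ fil P k := by
  obtain ⟨m, rfl⟩ := Nat.exists_eq_succ_of_ne_zero hn
  rw [pow_succ]
  exact mul_mem_fil' (pow_mem_fil_zero (fil_anti P hk hu) _) hu

theorem pow_iter_sub_mem {P : Pl K} {k : ℤ} (hk : 0 ≤ k) {u : K} {n : ℕ}
    (hu : u ^ 2 ^ n - u ∈ fil P k) (d : ℕ) : u ^ 2 ^ (n * d) - u ∈ fil P k := by
  induction d with
  | zero => simp
  | succ d ih =>
    have e : u ^ 2 ^ (n * (d + 1)) - u = (u ^ 2 ^ (n * d) - u) ^ 2 ^ n + (u ^ 2 ^ n - u) := by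
      rw [sub_pow_char_pow, ← pow_mul, ← pow_add, mul_add_one]; ring
    rw [e]
    exact add_mem (pow_mem_fil hk ih (by positivity)) hu

theorem ord_pow_sub_of_neg {P : Pl K} {u : K} (hu : ord P u < 0) {n : ℕ} (hn : n ≠ 0) :
    u ^ 2 ^ n - u ≠ 0 ∧ ord P (u ^ 2 ^ n - u) = 2 ^ n * ord P u := by
  have hu0 : u ≠ 0 := by rintro rfl; simp [ord_zero] at hu
  have h1 : (2:ℤ) ≤ 2 ^ n := by
    obtain ⟨m, rfl⟩ := Nat.exists_eq_succ_of_ne_zero hn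
    rw [pow_succ]
    have : (1:ℤ) ≤ 2 ^ m := one_le_pow₀ (by norm_num)
    linarith
  have h2 : ord P (u ^ 2 ^ n) = 2 ^ n * ord P u := by rw [ord_pow]; push_cast; ring
  have := ord_add_eq_of_lt (P := P) (pow_ne_zero (2 ^ n) hu0) (g := -u) (by
    rw [neg_mem_iff, mem_fil_of_ne hu0, h2]
    nlinarith)
  rwa [h2, ← sub_eq_add_neg] at this

theorem ord_pow_iter_sub {P : Pl K} {u : K} {n : ℕ} (hn : n ≠ 0) (h0 : u ^ 2 ^ n - u ≠ 0)
    (h1 : u ^ 2 ^ n - u ∈ fil P 1) {d : ℕ} (hd : d ≠ 0) :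
    ord P (u ^ 2 ^ (n * d) - u) = ord P (u ^ 2 ^ n - u) := by
  obtain ⟨d, rfl⟩ := Nat.exists_eq_succ_of_ne_zero hd
  clear hd
  have h1' := (mem_fil_of_ne h0).1 h1
  induction d with
  | zero => simp
  | succ d ih =>
    have e : u ^ 2 ^ (n * (d + 1 + 1)) - u =
        (u ^ 2 ^ n - u) + (u ^ 2 ^ (n * (d + 1)) - u) ^ 2 ^ n := by
      rw [sub_pow_char_pow, ← pow_mul, ← pow_add, mul_add_one n (d + 1)]; ring
    have h2 : (2:ℤ) ≤ 2 ^ n := by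
      obtain ⟨m, rfl⟩ := Nat.exists_eq_succ_of_ne_zero hn
      rw [pow_succ]
      have : (1:ℤ) ≤ 2 ^ m := one_le_pow₀ (by norm_num)
      linarith
    rw [Nat.succ_eq_add_one] at ih ⊢
    rw [e]
    refine (ord_add_eq_of_lt h0 ?_).2
    rw [mem_fil, ord_pow, ih]
    right
    push_cast
    nlinarith

theorem exists_expansion {P : Pl K} {x y t : K} (hx : x ∈ fil P 0) (hy : y ∈ fil P 0)
    (ht : t ∈ fil P 0) (g : (ZMod 2)[X][X]) :
    ∃ k ∈ fil P 0, ev x (y + t) g = ev x y g + ev x y (derivative g) * t + k * t ^ 2 := by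
  have hx' := mem_fil_zero.1 hx
  let φ : (ZMod 2)[X] →+* P.1 :=
    (aeval x : (ZMod 2)[X] →ₐ[ZMod 2] K).toRingHom.codRestrict P.1.toSubring
      fun p => mem_fil_zero.1 (aeval_mem hx p)
  have hev : ∀ (z : P.1) (q : (ZMod 2)[X][X]), ev x (z : K) q = ((q.map φ).eval z : P.1) := by
    intro z q
    have : ((q.map φ).eval z : P.1) = q.eval₂ φ z := eval_map _ _
    rw [this]
    have h2 := hom_eval₂ q φ P.1.subtype z
    exact h2.symm
  obtain ⟨k, hk⟩ := binomExpansion (g.map φ) ⟨y, mem_fil_zero.1 hy⟩ ⟨t, mem_fil_zero.1 ht⟩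
  refine ⟨k, mem_fil_zero.2 k.2, ?_⟩
  have h1 := congrArg (Subtype.val) hk
  rw [derivative_map] at h1
  have e1 := hev (⟨y, mem_fil_zero.1 hy⟩ + ⟨t, mem_fil_zero.1 ht⟩) g
  have e2 := hev ⟨y, mem_fil_zero.1 hy⟩ g
  have e3 := hev ⟨y, mem_fil_zero.1 hy⟩ (derivative g)
  change ev x (y + t) g = _ at e1
  rw [e1, e2, e3, h1]
  rfl

theorem exists_ev_eq {x y : K} {a b : ℕ} (t : Fin (a + 1) → Fin b → ZMod 2) :
    ∃ g : (ZMod 2)[X][X], ev x y g =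
      ∑ i, ∑ j, algebraMap (ZMod 2) K (t i j) * (x ^ (i : ℕ) * y ^ (j : ℕ)) := by
  refine ⟨∑ i : Fin (a + 1), ∑ j : Fin b, monomial (j : ℕ) (monomial (i : ℕ) (t i j)), ?_⟩
  rw [ev, eval₂_finsetSum]
  refine Finset.sum_congr rfl fun i _ => ?_
  rw [eval₂_finset_sum]
  refine Finset.sum_congr rfl fun j _ => ?_
  have := ev_monomial x y (j : ℕ) (monomial (i : ℕ) (t i j))
  rw [ev] at this
  rw [this, aeval_monomial, mul_assoc]

namespace PlaneModel

variable (Γ : PlaneModel K)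

theorem polx_apply {P : Pl K} (hx : Γ.x ∈ fil P 0) : Γ.polx P = 0 := by
  have h0 := (mem_fil_of_ne (ne_zero_of_notMem_range Γ.notMem)).1 hx
  rw [polx, zdiv_apply, ord_inv]; omega

theorem sub_single_mem [Curve K] {P : Pl K} (hx : Γ.x ∈ fil P 0) (n : ℕ) (k : ℤ) (hk : 0 ≤ k)
    {f : K} : f ∈ L (n • Γ.polx - Finsupp.single P k) ↔ f ∈ L (n • Γ.polx) ∧ f ∈ fil P k := by
  have e : ∀ Q, (n • Γ.polx - Finsupp.single P k) Q = n • Γ.polx Q - Finsupp.single P k Q :=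
    fun Q => rfl
  have e' : ∀ Q, (n • Γ.polx) Q = n • Γ.polx Q := fun Q => rfl
  rw [mem_L, mem_L]
  constructor
  · intro h
    refine ⟨fun Q => fil_anti Q ?_ (h Q), ?_⟩
    · rw [e, e']
      have : 0 ≤ Finsupp.single P k Q := by
        rw [Finsupp.single_apply]; split_ifs <;> omega
      linarith
    · have := h P
      rw [e, polx_apply Γ hx, Finsupp.single_eq_same] at this
      simpa using this
  · rintro ⟨h, h'⟩ Q
    rw [e]
    by_cases hQ : Q = P
    · subst hQ
      rw [polx_apply Γ hx, Finsupp.single_eq_same]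
      simpa using h'
    · rw [Finsupp.single_eq_of_ne hQ]
      have := h Q
      rw [e'] at this
      simpa using this

theorem rr_sub_single [Curve K] (P : Pl K) {n : ℕ} {k : ℕ} (hn : 7 + k * pdeg P ≤ 5 * n) :
    (rr (n • Γ.polx - Finsupp.single P (k : ℤ)) : ℤ) = 5 * n - k * pdeg P - 3 := by
  have hd : deg (n • Γ.polx - Finsupp.single P (k : ℤ)) = 5 * n - k * pdeg P := by
    rw [deg_sub, deg_nsmul, deg_polx, deg_single]; ring
  rw [rr_eq_el, hd, el_of_large]
  have : ((7 + k * pdeg P : ℕ) : ℤ) ≤ (5 * n : ℕ) := by exact_mod_cast hn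
  push_cast at this
  linarith

theorem exists_approx [Curve K] {P : Pl K} (hx : Γ.x ∈ fil P 0) {u : K} (hu : u ∈ fil P 0) :
    ∃ n : ℕ, ∃ v ∈ L (n • Γ.polx), u - v ∈ fil P 1 := by
  set n := 7 + 2 * pdeg P with hn
  refine ⟨n, ?_⟩
  have h0 := Γ.rr_sub_single P (n := n) (k := 0) (by rw [hn]; change _ + 0 * pdeg P ≤ _; omega)
  have h1 := Γ.rr_sub_single P (n := n) (k := 1) (by omega)
  have hle : n • Γ.polx - Finsupp.single P ((1 : ℕ) : ℤ) ≤ n • Γ.polx := by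
    rw [sub_le_self_iff, Finsupp.single_nonneg]; norm_num
  have hrel := relIndex_L_eq hle
  have hL : L (n • Γ.polx - Finsupp.single P ((1 : ℕ) : ℤ)) = fil P 1 ⊓ L (n • Γ.polx) := by
    ext f
    rw [Γ.sub_single_mem hx _ _ (by norm_num), AddSubgroup.mem_inf, and_comm]; rfl
  rw [hL, AddSubgroup.inf_relIndex_right] at hrel
  have h2 : rr (n • Γ.polx) - rr (n • Γ.polx - Finsupp.single P ((1 : ℕ) : ℤ)) = pdeg P := by
    rw [Nat.cast_zero, Finsupp.single_zero, sub_zero] at h0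
    push_cast at h0 h1 ⊢
    change ℕ at *
    have : (rr (n • Γ.polx) : ℤ) = rr (n • Γ.polx - Finsupp.single P 1) + pdeg P := by
      rw [h0, h1]; ring
    have : rr (n • Γ.polx) = rr (n • Γ.polx - Finsupp.single P 1) + pdeg P := by
      exact_mod_cast this
    omega
  rw [h2] at hrel
  have h3 := relIndex_fil_add P 0 1
  rw [one_mul, ← hrel] at h3
  have hL0 : L (n • Γ.polx) ≤ fil P 0 := fun f hf => by
    have := mem_L.1 hf P
    have e' : (n • Γ.polx) P = n • Γ.polx P := rfl
    rw [e', polx_apply Γ hx] at this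
    simpa using this
  have h4 : fil P (0 + ((1 : ℕ) : ℤ)) = fil P 1 := by norm_num
  rw [h4] at h3
  have h5 := AddSubgroup.relIndex_mul_relIndex (fil P 1) (L (n • Γ.polx) ⊔ fil P 1) (fil P 0)
    le_sup_right (sup_le hL0 (fil_anti P (by norm_num)))
  rw [AddSubgroup.relIndex_sup_right, h3] at h5
  have h6 : (L (n • Γ.polx) ⊔ fil P 1).relIndex (fil P 0) = 1 := by
    have hpos : 0 < (fil P 1).relIndex (L (n • Γ.polx)) := by rw [hrel]; positivity
    exact Nat.eq_of_mul_eq_mul_left hpos (by rw [h5, mul_one])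
  rw [AddSubgroup.relIndex_eq_one] at h6
  obtain ⟨v, hv, w, hw, hvw⟩ := AddSubgroup.mem_sup.1 (h6 hu)
  exact ⟨v, hv, by rw [← hvw, add_sub_cancel_left]; exact hw⟩

theorem exists_local_parameter [Curve K] {P : Pl K} (hx : Γ.x ∈ fil P 0) :
    ∃ n : ℕ, ∃ v ∈ L (n • Γ.polx), v ∈ fil P 1 ∧ v ∉ fil P 2 := by
  set n := 7 + 2 * pdeg P with hn
  refine ⟨n, ?_⟩
  have h1 := Γ.rr_sub_single P (n := n) (k := 1) (by omega)
  have h2 := Γ.rr_sub_single P (n := n) (k := 2) (by omega)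
  by_contra! hcon
  have hle : L (n • Γ.polx - Finsupp.single P ((1 : ℕ) : ℤ)) ≤
      L (n • Γ.polx - Finsupp.single P ((2 : ℕ) : ℤ)) := by
    intro f hf
    rw [Γ.sub_single_mem hx _ _ (by norm_num)] at hf ⊢
    exact ⟨hf.1, hcon f hf.1 hf.2⟩
  have h3 := Nat.card_le_card_of_injective _ (AddSubgroup.inclusion_injective hle)
  rw [card_L_eq, card_L_eq] at h3
  have h4 := (Nat.pow_le_pow_iff_right one_lt_two).1 h3
  have h5 : (rr (n • Γ.polx - Finsupp.single P ((1 : ℕ) : ℤ)) : ℤ) ≤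
    rr (n • Γ.polx - Finsupp.single P ((2 : ℕ) : ℤ)) := by exact_mod_cast h4
  rw [h1, h2] at h5
  have := placeDegree_pos P
  have h6 : (1:ℤ) ≤ pdeg P := by exact_mod_cast this
  push_cast at h5
  linarith

theorem exists_denominator : ∃ M : ℕ, ∀ (n : ℕ) (u : K), u ∈ L (n • Γ.polx) →
    ∃ p : (ZMod 2)[X], p ≠ 0 ∧ p.natDegree ≤ M ∧ ∃ g, aeval Γ.x p * u = ev Γ.x Γ.θ g := by
  obtain ⟨c, hc⟩ := Int.eq_ofNat_of_zero_le (deg_nonneg Γ.polθ_nonneg)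
  refine ⟨4 * c, fun n u hu => ?_⟩
  set b := n + 4 * c with hb
  set D := b • Γ.polx + 4 • Γ.polθ with hD
  have hx := Γ.polx_nonneg
  have hθ := Γ.polθ_nonneg
  have hD0 : 0 ≤ D := by positivity
  have hdeg : deg D = 5 * b + 4 * c := by
    rw [hD, deg_add, deg_nsmul, deg_nsmul, deg_polx, hc]; push_cast; ring
  let A := Fin (4 * c + 1) → ZMod 2
  let B := Fin (b + 1) → Fin 5 → ZMod 2
  let ψ : A × B → K := fun st =>
    (∑ i, algebraMap (ZMod 2) K (st.1 i) * (Γ.x ^ (i : ℕ) * u)) +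
      ∑ i, ∑ j, algebraMap (ZMod 2) K (st.2 i j) * (Γ.x ^ (i : ℕ) * Γ.θ ^ (j : ℕ))
  have hψ : ∀ st, ψ st ∈ L D := by
    intro st
    refine add_mem (sum_mem fun i _ => algebraMap_mul_mem_L _ ?_) (sum_mem fun i _ =>
      sum_mem fun j _ => algebraMap_mul_mem_L _ (mul_mem_L (Γ.pow_x_mem (by omega))
        (Γ.pow_θ_mem (by omega))))
    refine L_mono ?_ (mul_mem_L (Γ.pow_x_mem (a := 4 * c) (by omega)) hu)
    rw [← add_nsmul, add_comm, ← hb]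
    exact le_add_of_nonneg_right (by positivity)
  have hr := rr_le_deg hD0
  rw [hdeg] at hr
  haveI : Fintype (L D) := Fintype.ofFinite _
  have hcard : Fintype.card (L D) < Fintype.card (A × B) := by
    rw [← Nat.card_eq_fintype_card, card_L_eq]
    simp only [A, B, Fintype.card_prod, Fintype.card_fun, Fintype.card_fin, ZMod.card, ← pow_mul,
      ← pow_add]
    refine Nat.pow_lt_pow_right one_lt_two ?_
    omega
  obtain ⟨⟨s, t⟩, ⟨s', t'⟩, hne, heq⟩ := Fintype.exists_ne_map_eq_of_card_lt
    (fun st => (⟨ψ st, hψ st⟩ : L D)) hcard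
  have heq := congrArg Subtype.val heq
  simp only [ψ] at heq
  have hsum : (∑ i, algebraMap (ZMod 2) K ((s - s') i) * (Γ.x ^ (i : ℕ) * u)) =
      ∑ i, ∑ j, algebraMap (ZMod 2) K ((t' - t) i j) * (Γ.x ^ (i : ℕ) * Γ.θ ^ (j : ℕ)) := by
    have e1 : ∀ i, (s - s') i = s i - s' i := fun _ => rfl
    have e2 : ∀ i j, (t' - t) i j = t' i j - t i j := fun _ _ => rfl
    simp only [e1, e2, map_sub, sub_mul, Finset.sum_sub_distrib]
    linear_combination heq
  obtain ⟨g, hg⟩ := exists_ev_eq (x := Γ.x) (y := Γ.θ) (t' - t)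
  set p : (ZMod 2)[X] := ∑ i : Fin (4 * c + 1), monomial (i : ℕ) ((s - s') i) with hp
  have hpc : ∀ i : Fin (4 * c + 1), p.coeff i = (s - s') i := by
    intro i
    simp [hp, finset_sum_coeff, coeff_monomial, Fin.val_inj]
  refine ⟨p, fun h0 => ?_, ?_, g, ?_⟩
  · have hs : s - s' = 0 := by
      ext i
      rw [← hpc, h0]; rfl
    have e0 : ∀ i, (0 : A) i = 0 := fun _ => rfl
    rw [hs] at hsum
    simp only [e0, map_zero, zero_mul, Finset.sum_const_zero] at hsum
    by_cases ht : t' - t = 0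
    · exact hne (by rw [sub_eq_zero.1 hs, sub_eq_zero.1 ht])
    · exact Γ.array_ne_zero b ht hsum.symm
  · exact natDegree_sum_le_of_forall_le _ _ fun i _ =>
      (natDegree_monomial_le _).trans (by omega)
  · rw [hg, ← hsum, hp, map_sum, Finset.sum_mul]
    refine Finset.sum_congr rfl fun i _ => ?_
    rw [aeval_monomial, mul_assoc]

theorem ev_derivative_ne_zero : ev Γ.x Γ.θ (derivative Γ.f) ≠ 0 := by
  intro h
  have hd : (derivative Γ.f).natDegree < 5 := by
    have := natDegree_derivative_lt (p := Γ.f) (by rw [Γ.natDegree_eq]; norm_num)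
    rwa [Γ.natDegree_eq] at this
  obtain ⟨N, hN⟩ : ∃ N, ∀ i, ((derivative Γ.f).coeff i).natDegree ≤ N := by
    refine ⟨Finset.sup (Finset.range 5) fun i => ((derivative Γ.f).coeff i).natDegree, fun i => ?_⟩
    by_cases hi : i < 5
    · exact Finset.le_sup (f := fun i => ((derivative Γ.f).coeff i).natDegree) (Finset.mem_range.2 hi)
    · rw [coeff_eq_zero_of_natDegree_lt (by omega)]; simp
  have h4 : (derivative Γ.f).coeff 4 = 1 := by
    rw [coeff_derivative, show 4 + 1 = Γ.f.natDegree from Γ.natDegree_eq.symm, Γ.monic.coeff_natDegree]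
    have h2 : (2 : (ZMod 2)[X]) = 0 := CharTwo.two_eq_zero
    push_cast
    linear_combination 2 * h2
  refine Γ.array_ne_zero N (t := fun i j => ((derivative Γ.f).coeff j).coeff i) ?_ ?_
  · intro h0
    have := congrFun (congrFun h0 0) 4
    simp only [Pi.zero_apply] at this
    rw [show (((4 : Fin 5) : ℕ)) = 4 from rfl, h4] at this
    simp at this
  · rw [Finset.sum_comm, ← h, ev, eval₂_eq_sum_range' _ hd, Finset.sum_range]
    refine Finset.sum_congr rfl fun j _ => ?_
    change _ = aeval Γ.x _ * _
    rw [aeval_eq_sum_range' (Nat.lt_succ_of_le (hN j)), Finset.sum_range, Finset.sum_mul]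
    refine Finset.sum_congr rfl fun i _ => ?_
    rw [Algebra.smul_def, mul_assoc]

end PlaneModel

end Counting

end CFF

namespace CFF

section Counting

open Polynomial

variable {K : Type} [Field K] [Algebra (ZMod 2) K] [FnField (ZMod 2) K]

namespace PlaneModel

variable (Γ : PlaneModel K)

theorem mem_fil_zero_of_mem_L {P : Pl K} (hx : Γ.x ∈ fil P 0) {n : ℕ} {u : K}
    (hu : u ∈ L (n • Γ.polx)) : u ∈ fil P 0 := by
  have := mem_L.1 hu P
  have e' : (n • Γ.polx) P = n • Γ.polx P := rfl
  rw [e', polx_apply Γ hx] at this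
  simpa using this

theorem pow_sub_mem_of_regular {M : ℕ}
    (hM : ∀ (n : ℕ) (u : K), u ∈ L (n • Γ.polx) →
      ∃ p : (ZMod 2)[X], p ≠ 0 ∧ p.natDegree ≤ M ∧ ∃ g, aeval Γ.x p * u = ev Γ.x Γ.θ g)
    {P : Pl K} (hx : Γ.x ∈ fil P 0)
    (hP : ∀ p : (ZMod 2)[X], p ≠ 0 → p.natDegree ≤ M → aeval Γ.x p ∉ fil P 1)
    {n : ℕ} {k : ℤ} (h1 : Γ.x ^ 2 ^ n - Γ.x ∈ fil P k) (h2 : Γ.θ ^ 2 ^ n - Γ.θ ∈ fil P k)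
    {j : ℕ} {u : K} (hu : u ∈ L (j • Γ.polx)) : u ^ 2 ^ n - u ∈ fil P k := by
  obtain ⟨p, hp0, hpM, g, hg⟩ := hM j u hu
  have hθ := Γ.θ_mem hx
  have hu0 := Γ.mem_fil_zero_of_mem_L hx hu
  have h3 := ev_sub_mem hx (pow_mem_fil_zero hx _) hθ (pow_mem_fil_zero hθ _) h1 h2 g
  have h4 := aeval_sub_mem hx (pow_mem_fil_zero hx _) h1 p
  rw [← ev_pow, ← hg] at h3
  rw [← aeval_pow] at h4
  have hpP := hP p hp0 hpM
  have e : aeval Γ.x p * (u ^ 2 ^ n - u) = ((aeval Γ.x p * u) ^ 2 ^ n - aeval Γ.x p * u) -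
      u ^ 2 ^ n * (aeval Γ.x p ^ 2 ^ n - aeval Γ.x p) := by ring
  have h5 : aeval Γ.x p * (u ^ 2 ^ n - u) ∈ fil P k := by
    rw [e]
    exact sub_mem h3 (mul_mem_fil' (pow_mem_fil_zero hu0 _) h4)
  rwa [mul_mem_fil_iff (ne_zero_of_notMem_fil hpP), ord_eq_zero_of (aeval_mem hx p) hpP,
    sub_zero] at h5

theorem pdeg_dvd_of_regular [Curve K] {M : ℕ}
    (hM : ∀ (n : ℕ) (u : K), u ∈ L (n • Γ.polx) →
      ∃ p : (ZMod 2)[X], p ≠ 0 ∧ p.natDegree ≤ M ∧ ∃ g, aeval Γ.x p * u = ev Γ.x Γ.θ g)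
    {P : Pl K} (hx : Γ.x ∈ fil P 0)
    (hP : ∀ p : (ZMod 2)[X], p ≠ 0 → p.natDegree ≤ M → aeval Γ.x p ∉ fil P 1)
    {n : ℕ} (h1 : Γ.x ^ 2 ^ n - Γ.x ∈ fil P 1) (h2 : Γ.θ ^ 2 ^ n - Γ.θ ∈ fil P 1) :
    pdeg P ∣ n := by
  refine pdeg_dvd_of fun u hu => ?_
  obtain ⟨j, v, hv, huv⟩ := Γ.exists_approx hx hu
  have h3 := Γ.pow_sub_mem_of_regular hM hx hP h1 h2 hv
  have e : u ^ 2 ^ n - u = (u - v) ^ 2 ^ n + (v ^ 2 ^ n - v) - (u - v) := by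
    rw [sub_pow_char_pow]; ring
  rw [e]
  exact sub_mem (add_mem (pow_mem_fil zero_le_one huv (by positivity)) h3) huv

theorem pow_sub_notMem_fil_two [Curve K] {M : ℕ}
    (hM : ∀ (n : ℕ) (u : K), u ∈ L (n • Γ.polx) →
      ∃ p : (ZMod 2)[X], p ≠ 0 ∧ p.natDegree ≤ M ∧ ∃ g, aeval Γ.x p * u = ev Γ.x Γ.θ g)
    {P : Pl K} (hx : Γ.x ∈ fil P 0)
    (hP : ∀ p : (ZMod 2)[X], p ≠ 0 → p.natDegree ≤ M → aeval Γ.x p ∉ fil P 1)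
    (hf : ev Γ.x Γ.θ (derivative Γ.f) ∉ fil P 1) {n : ℕ} (hn : n ≠ 0) :
    Γ.x ^ 2 ^ n - Γ.x ∉ fil P 2 := by
  intro h
  have hθ := Γ.θ_mem hx
  set N := n * pdeg P with hN
  have hN0 : N ≠ 0 := mul_ne_zero hn (placeDegree_pos P).ne'
  have h1 : Γ.x ^ 2 ^ N - Γ.x ∈ fil P 2 := pow_iter_sub_mem (by norm_num) h _
  have h2 : Γ.θ ^ 2 ^ N - Γ.θ ∈ fil P 1 := by
    rw [hN, mul_comm]
    exact pow_iter_sub_mem zero_le_one (pow_card_residue_sub_mem P (mem_fil_zero.1 hθ)) _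
  set t := Γ.θ ^ 2 ^ N - Γ.θ with ht
  have h3 : ev Γ.x (Γ.θ + t) Γ.f ∈ fil P 2 := by
    have := ev_sub_mem hx (pow_mem_fil_zero hx (2 ^ N)) (pow_mem_fil_zero hθ (2 ^ N))
      (pow_mem_fil_zero hθ (2 ^ N)) h1 (by rw [sub_self]; exact zero_mem _) Γ.f
    rw [← ev_pow, Γ.ev_root, zero_pow (by positivity), zero_sub, neg_mem_iff] at this
    rwa [ht, add_sub_cancel]
  obtain ⟨k, hk, he⟩ := exists_expansion hx hθ (fil_anti P zero_le_one h2) Γ.f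
  rw [he, Γ.ev_root, zero_add] at h3
  have h4 : k * t ^ 2 ∈ fil P 2 := by
    refine mul_mem_fil' hk ?_
    rw [pow_two]
    exact mul_mem_fil h2 h2
  have h5 := sub_mem h3 h4
  rw [add_sub_cancel_right, mul_mem_fil_iff (ne_zero_of_notMem_fil hf),
    ord_eq_zero_of (ev_mem hx hθ _) hf, sub_zero] at h5
  obtain ⟨j, v, hv, hv1, hv2⟩ := Γ.exists_local_parameter hx
  have h6 := Γ.pow_sub_mem_of_regular hM hx hP h1 h5 hv
  apply hv2
  have h7 : v ^ 2 ^ N ∈ fil P 2 := by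
    obtain ⟨N', hN'⟩ := Nat.exists_eq_succ_of_ne_zero hN0
    rw [hN', pow_succ, pow_mul, pow_two]
    have := pow_mem_fil zero_le_one hv1 (n := 2 ^ N') (by positivity)
    exact mul_mem_fil this this
  have := sub_mem h7 h6
  rwa [sub_sub_cancel] at this

theorem pow_sub_ne_zero {n : ℕ} (hn : n ≠ 0) : Γ.x ^ 2 ^ n - Γ.x ≠ 0 := by
  obtain ⟨P, hP⟩ := exists_pole Γ.notMem
  exact (ord_pow_sub_of_neg hP hn).1

theorem deg_zdiv_pow_sub {n : ℕ} (hn : n ≠ 0) :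
    deg (zdiv (Γ.x ^ 2 ^ n - Γ.x)) = 5 * 2 ^ n := by
  have h1 := zdiv_sub (Γ.x ^ 2 ^ n - Γ.x)
  have h2 := deg_pdiv (Γ.x ^ 2 ^ n - Γ.x)
  have h3 : zdiv (Γ.x ^ 2 ^ n - Γ.x)⁻¹ = 2 ^ n • Γ.polx := by
    ext P
    have e' : (2 ^ n • Γ.polx) P = 2 ^ n • Γ.polx P := rfl
    rw [e', polx, zdiv_apply, zdiv_apply, ord_inv, ord_inv]
    by_cases hx : Γ.x ∈ fil P 0
    · have h4 := (mem_fil_of_ne (ne_zero_of_notMem_range Γ.notMem)).1 hx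
      have h5 : Γ.x ^ 2 ^ n - Γ.x ∈ fil P 0 := sub_mem (pow_mem_fil_zero hx _) hx
      rw [mem_fil_of_ne (Γ.pow_sub_ne_zero hn)] at h5
      rw [max_eq_right (by omega), max_eq_right (by omega), smul_zero]
    · rw [mem_fil_of_ne (ne_zero_of_notMem_range Γ.notMem)] at hx
      push Not at hx
      have h6 := (ord_pow_sub_of_neg hx hn).2
      rw [h6, max_eq_left, max_eq_left (by omega)]
      · simp
      · nlinarith [show (0:ℤ) < 2 ^ n by positivity]
  rw [← h1, deg_sub, h3, deg_nsmul, deg_polx] at h2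
  push_cast at h2
  linarith

theorem finite_exceptional (M : ℕ) : {P : Pl K | ev Γ.x Γ.θ (derivative Γ.f) ∈ fil P 1 ∨
    ∃ p : (ZMod 2)[X], p ≠ 0 ∧ p.natDegree ≤ M ∧ aeval Γ.x p ∈ fil P 1}.Finite := by
  have key : ∀ {y : K}, y ≠ 0 → {P : Pl K | y ∈ fil P 1}.Finite := fun {y} hy =>
    (finite_zeros hy).subset fun P hP => (mem_fil_of_ne hy).1 hP
  have hp : {p : (ZMod 2)[X] | p.natDegree ≤ M}.Finite := by
    have := (Polynomial.degreeLT (ZMod 2) (M + 1))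
    haveI : Finite (Polynomial.degreeLT (ZMod 2) (M + 1)) :=
      Finite.of_equiv _ (degreeLTEquiv (ZMod 2) (M + 1)).toEquiv.symm
    refine (Set.toFinite (Polynomial.degreeLT (ZMod 2) (M + 1) : Set (ZMod 2)[X])).subset ?_
    intro p hp
    have hp : p.natDegree ≤ M := hp
    rw [SetLike.mem_coe, mem_degreeLT]
    exact lt_of_le_of_lt degree_le_natDegree (by exact_mod_cast Nat.lt_succ_of_le hp)
  refine ((key Γ.ev_derivative_ne_zero).union ((hp.subset (fun p (hp' : p ≠ 0 ∧ p.natDegree ≤ M) => hp'.2)).biUnion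
    fun p hp' => key (y := aeval Γ.x p) ?_)).subset fun P hP => ?_
  · have hp' : p ≠ 0 ∧ p.natDegree ≤ M := hp'
    exact transcendental_iff_injective.1 (FnField.transcendental Γ.x Γ.notMem) |>.ne hp'.1 |>.trans_eq
      (map_zero _)
  · rcases hP with hP | ⟨p, h1, h2, h3⟩
    · exact Or.inl hP
    · exact Or.inr (Set.mem_biUnion (show p ∈ {p | p ≠ 0 ∧ p.natDegree ≤ M} from ⟨h1, h2⟩) h3)

theorem exists_lower_bound [Curve K] (Γ : PlaneModel K) : ∃ N C₁ C₂ : ℕ, 0 < N ∧ ∀ i, 0 < i →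
    2 ^ (2 * (N * i)) ≤ Sn K (2 * (N * i)) + C₁ * 2 ^ (N * i) + C₂ := by
  obtain ⟨M, hM⟩ := Γ.exists_denominator
  obtain ⟨C, m₀, hC⟩ := Γ.exists_bad_bound
  set X := (Γ.finite_exceptional M).toFinset with hX
  set N₀ := ∏ P ∈ X, pdeg P with hN₀
  have hN₀pos : 0 < N₀ := Finset.prod_pos fun P _ => placeDegree_pos P
  set w : Pl K → ℕ := fun P => (zdiv (Γ.x ^ 2 ^ (2 * N₀) - Γ.x) P).toNat * pdeg P with hw
  refine ⟨N₀ * (m₀ + 1), C, ∑ P ∈ X, w P, by positivity, fun i hi => ?_⟩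
  set m := N₀ * (m₀ + 1) * i with hm
  have hmm : m₀ ≤ m := by
    calc m₀ ≤ 1 * (m₀ + 1) * 1 := by omega
      _ ≤ m := by rw [hm]; gcongr <;> omega
  have hm0 : m ≠ 0 := by positivity
  set n := 2 * m with hn
  have hn0 : n ≠ 0 := by positivity
  set D := zdiv (Γ.x ^ 2 ^ n - Γ.x) with hD
  have hne := Γ.pow_sub_ne_zero hn0
  have hsupp : ∀ P ∈ D.support, Γ.x ∈ fil P 0 ∧ Γ.x ^ 2 ^ n - Γ.x ∈ fil P 1 := by
    intro P hP
    rw [Finsupp.mem_support_iff, hD, zdiv_apply] at hP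
    have h1 : 0 < ord P (Γ.x ^ 2 ^ n - Γ.x) := by
      by_contra hcon
      exact hP (max_eq_right (by omega))
    refine ⟨?_, (mem_fil_of_ne hne).2 h1⟩
    rw [mem_fil_of_ne (ne_zero_of_notMem_range Γ.notMem)]
    by_contra hcon
    push Not at hcon
    rw [(ord_pow_sub_of_neg hcon hn0).2] at h1
    nlinarith [show (0:ℤ) < 2 ^ n by positivity]
  have hnX : ∀ P ∉ X, ev Γ.x Γ.θ (derivative Γ.f) ∉ fil P 1 ∧
      ∀ p : (ZMod 2)[X], p ≠ 0 → p.natDegree ≤ M → aeval Γ.x p ∉ fil P 1 := by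
    intro P hP
    rw [hX, Set.Finite.mem_toFinset, Set.mem_ofPred_eq] at hP
    push Not at hP
    exact hP
  set S₁ := D.support.filter (fun P => P ∉ X ∧ Γ.θ ^ 2 ^ n - Γ.θ ∈ fil P 1) with hS₁
  set S₂ := D.support.filter (fun P => P ∉ X ∧ Γ.θ ^ 2 ^ n - Γ.θ ∉ fil P 1) with hS₂
  have hone : ∀ P ∈ D.support, P ∉ X → D P = 1 := by
    intro P hP hPX
    obtain ⟨h1, h2⟩ := hsupp P hP
    have h3 := Γ.pow_sub_notMem_fil_two hM h1 (hnX P hPX).2 (hnX P hPX).1 hn0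
    rw [mem_fil_of_ne hne] at h2 h3
    rw [hD, zdiv_apply, max_eq_left (by omega)]
    omega
  have hXw : ∀ P ∈ D.support, P ∈ X → D P * (pdeg P : ℤ) ≤ w P := by
    intro P hP hPX
    obtain ⟨h1, h2⟩ := hsupp P hP
    obtain ⟨e, he⟩ : pdeg P ∣ N₀ := Finset.dvd_prod_of_mem _ hPX
    have h3 : Γ.x ^ 2 ^ (2 * N₀) - Γ.x ∈ fil P 1 := by
      rw [he, mul_left_comm]
      exact pow_iter_sub_mem zero_le_one (pow_card_residue_sub_mem P (mem_fil_zero.1 h1)) _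
    have h4 := ord_pow_iter_sub (n := 2 * N₀) (by positivity) (Γ.pow_sub_ne_zero (by positivity)) h3
      (d := (m₀ + 1) * i) (by positivity)
    have h5 : 2 * N₀ * ((m₀ + 1) * i) = n := by rw [hn, hm]; ring
    rw [h5] at h4
    rw [hw]
    push_cast
    rw [hD, zdiv_apply, h4, zdiv_apply]
    refine mul_le_mul_of_nonneg_right ?_ (by positivity)
    exact Int.self_le_toNat _
  have h1 := hC m hmm S₂ fun P hP => by
    rw [hS₂, Finset.mem_filter] at hP
    exact ⟨(hsupp P hP.1).1, (hsupp P hP.1).2, hP.2.2⟩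
  have h2 : ∑ P ∈ S₁, pdeg P ≤ Sn K n := by
    rw [Sn]
    refine Finset.sum_le_sum_of_subset fun P hP => ?_
    rw [hS₁, Finset.mem_filter] at hP
    have h3 := hsupp P hP.1
    have h4 := Γ.pdeg_dvd_of_regular hM h3.1 (hnX P hP.2.1).2 h3.2 hP.2.2
    rw [Finset.mem_filter, mem_plc]
    exact ⟨Nat.le_of_dvd (Nat.pos_of_ne_zero hn0) h4, h4⟩
  have h3 := Γ.deg_zdiv_pow_sub hn0
  rw [deg_eq_sum_of_subset _ subset_rfl] at h3
  have h4 : (∑ P ∈ D.support, D P * (pdeg P : ℤ)) ≤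
      ∑ P ∈ D.support, ((if P ∈ X then (w P : ℤ) else 0) +
        (if P ∉ X ∧ Γ.θ ^ 2 ^ n - Γ.θ ∈ fil P 1 then (pdeg P : ℤ) else 0) +
        (if P ∉ X ∧ Γ.θ ^ 2 ^ n - Γ.θ ∉ fil P 1 then (pdeg P : ℤ) else 0)) := by
    refine Finset.sum_le_sum fun P hP => ?_
    by_cases hPX : P ∈ X
    · simp only [hPX, if_true, not_true, false_and, if_false, add_zero]
      exact hXw P hP hPX
    · rw [hone P hP hPX]
      by_cases ht : Γ.θ ^ 2 ^ n - Γ.θ ∈ fil P 1 <;> simp [hPX, ht]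
  rw [h3, Finset.sum_add_distrib, Finset.sum_add_distrib, ← Finset.sum_filter,
    ← Finset.sum_filter, ← Finset.sum_filter, ← hS₁, ← hS₂] at h4
  have h5 : (∑ P ∈ D.support with P ∈ X, (w P : ℤ)) ≤ ∑ P ∈ X, (w P : ℤ) :=
    Finset.sum_le_sum_of_subset_of_nonneg (fun P hP => (Finset.mem_filter.1 hP).2)
      fun P _ _ => by positivity
  have h6 : (4:ℤ) ^ m = 2 ^ n := by rw [hn, pow_mul (2:ℤ) 2 m]; norm_num
  zify at h1 h2 ⊢
  rw [h6] at h1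
  linarith

theorem An_eq_zero [Curve K] (Γ : PlaneModel K) : An K 1 = 0 ∧ An K 2 = 0 ∧ An K 3 = 0 := by
  obtain ⟨N, C₁, C₂, hN, h⟩ := Γ.exists_lower_bound
  refine An_eq_zero_of_bound (2 * N) (by positivity) (C₁ + C₂) fun i hi => ?_
  have h1 := h i hi
  rw [mul_assoc]
  have h2 : √2 ^ (2 * (N * i)) = (2:ℝ) ^ (N * i) := by
    rw [pow_mul, Real.sq_sqrt (by norm_num)]
  rw [h2]
  have h3 : (1:ℝ) ≤ 2 ^ (N * i) := one_le_pow₀ (by norm_num)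
  have h4 : (2:ℝ) ^ (2 * (N * i)) ≤ Sn K (2 * (N * i)) + C₁ * 2 ^ (N * i) + C₂ := by
    exact_mod_cast h1
  have h5 : (C₂ : ℝ) * 1 ≤ C₂ * 2 ^ (N * i) := mul_le_mul_of_nonneg_left h3 (by positivity)
  linarith

end PlaneModel

end Counting

end CFF

namespace CFF

section RationalSubfield

open Polynomial

variable {K : Type} [Field K] [Algebra (ZMod 2) K] [Algebra (RatFunc (ZMod 2)) K]
  [IsScalarTower (ZMod 2) (RatFunc (ZMod 2)) K]

theorem algebraMap_X_notMem_range :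
    algebraMap (RatFunc (ZMod 2)) K RatFunc.X ∉ (algebraMap (ZMod 2) K).range := by
  rintro ⟨c, hc⟩
  rw [IsScalarTower.algebraMap_apply (ZMod 2) (RatFunc (ZMod 2)) K] at hc
  have h := (algebraMap (RatFunc (ZMod 2)) K).injective hc
  have ht := RatFunc.transcendental_X (K := ZMod 2)
  rw [← h] at ht
  exact ht (isAlgebraic_algebraMap c)

theorem mem_adjoin_algebraMap_X (g : RatFunc (ZMod 2)) : algebraMap (RatFunc (ZMod 2)) K g ∈
    IntermediateField.adjoin (ZMod 2) {algebraMap (RatFunc (ZMod 2)) K RatFunc.X} := by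
  have h : IntermediateField.adjoin (ZMod 2) {algebraMap (RatFunc (ZMod 2)) K RatFunc.X} =
      (IntermediateField.adjoin (ZMod 2) {(RatFunc.X : RatFunc (ZMod 2))}).map
        (IsScalarTower.toAlgHom (ZMod 2) (RatFunc (ZMod 2)) K) := by
    rw [IntermediateField.adjoin_map]; simp
  rw [h, RatFunc.adjoin_X]
  exact ⟨g, trivial, rfl⟩

theorem mem_adjoin_algebraMap_X_iff (y : K) : y ∈
    IntermediateField.adjoin (ZMod 2) {algebraMap (RatFunc (ZMod 2)) K RatFunc.X} ↔
    ∃ g, algebraMap (RatFunc (ZMod 2)) K g = y := by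
  constructor
  · have h : IntermediateField.adjoin (ZMod 2) {algebraMap (RatFunc (ZMod 2)) K RatFunc.X} ≤
      (IsScalarTower.toAlgHom (ZMod 2) (RatFunc (ZMod 2)) K).fieldRange := by
      rw [IntermediateField.adjoin_simple_le_iff]
      exact ⟨_, rfl⟩
    intro hy
    obtain ⟨g, hg⟩ := h hy
    exact ⟨g, hg⟩
  · rintro ⟨g, rfl⟩
    exact mem_adjoin_algebraMap_X g

theorem finrank_adjoin_algebraMap_X : Module.finrank
    (IntermediateField.adjoin (ZMod 2) {algebraMap (RatFunc (ZMod 2)) K RatFunc.X}) K =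
    Module.finrank (RatFunc (ZMod 2)) K := by
  let φ : RatFunc (ZMod 2) →+*
      IntermediateField.adjoin (ZMod 2) {algebraMap (RatFunc (ZMod 2)) K RatFunc.X} :=
    (algebraMap (RatFunc (ZMod 2)) K).codRestrict _ mem_adjoin_algebraMap_X
  have hφ : Function.Bijective φ := by
    refine ⟨φ.injective, fun y => ?_⟩
    obtain ⟨g, hg⟩ := (mem_adjoin_algebraMap_X_iff y.1).1 y.2
    exact ⟨g, Subtype.ext hg⟩
  refine (Algebra.finrank_eq_of_equiv_equiv (RingEquiv.ofBijective φ hφ) (RingEquiv.refl K) ?_).symm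
  ext g
  rfl

theorem exists_planeModel (h : Module.finrank (RatFunc (ZMod 2)) K = 5) :
    ∃ Γ : PlaneModel K, Γ.x = algebraMap (RatFunc (ZMod 2)) K RatFunc.X := by
  letI : Algebra (ZMod 2)[X] K :=
    ((algebraMap (RatFunc (ZMod 2)) K).comp (algebraMap (ZMod 2)[X] (RatFunc (ZMod 2)))).toAlgebra
  haveI : IsScalarTower (ZMod 2)[X] (RatFunc (ZMod 2)) K := IsScalarTower.of_algebraMap_eq' rfl
  haveI : Module.Finite (RatFunc (ZMod 2)) K := Module.finite_of_finrank_pos (by omega)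
  obtain ⟨θ₀, hθ₀⟩ : ∃ θ₀ : K, θ₀ ∉ (⊥ : IntermediateField (RatFunc (ZMod 2)) K) := by
    by_contra! hc
    have : (⊥ : IntermediateField (RatFunc (ZMod 2)) K) = ⊤ := by
      ext z; simp [hc z]
    have h1 := IntermediateField.finrank_top' (F := RatFunc (ZMod 2)) (E := K)
    rw [← this, IntermediateField.finrank_bot] at h1
    omega
  have hinj : Function.Injective (algebraMap (ZMod 2)[X] K) :=
    (algebraMap (RatFunc (ZMod 2)) K).injective.comp (RatFunc.algebraMap_injective _)
  obtain ⟨d, hd, h_int⟩ : ∃ d : (ZMod 2)[X], d ≠ 0 ∧ IsIntegral (ZMod 2)[X] (d • θ₀) := by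
    have h1 : IsAlgebraic (ZMod 2)[X] θ₀ :=
      (IsFractionRing.isAlgebraic_iff (ZMod 2)[X] (RatFunc (ZMod 2)) K).2
        (Algebra.IsAlgebraic.isAlgebraic θ₀)
    exact h1.exists_integral_multiple
  set θ := d • θ₀ with hθ
  have hθ' : θ ∉ (⊥ : IntermediateField (RatFunc (ZMod 2)) K) := by
    intro hc
    rw [hθ, Algebra.smul_def, IsScalarTower.algebraMap_apply (ZMod 2)[X] (RatFunc (ZMod 2)) K] at hc
    have hd' : algebraMap (RatFunc (ZMod 2)) K (algebraMap (ZMod 2)[X] (RatFunc (ZMod 2)) d) ≠ 0 := by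
      rw [_root_.map_ne_zero]
      exact RatFunc.algebraMap_ne_zero hd
    have := mul_mem (inv_mem (IntermediateField.algebraMap_mem ⊥
      (algebraMap (ZMod 2)[X] (RatFunc (ZMod 2)) d))) hc
    rw [inv_mul_cancel_left₀ hd'] at this
    exact hθ₀ this
  have hmin := minpoly.isIntegrallyClosed_eq_field_fractions' (RatFunc (ZMod 2)) h_int
  have hdegθ : (minpoly (RatFunc (ZMod 2)) θ).natDegree = 5 := by
    have h1 : (minpoly (RatFunc (ZMod 2)) θ).natDegree ∣ 5 := by
      rw [← h]; exact minpoly.degree_dvd (Algebra.IsIntegral.isIntegral θ)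
    rcases (Nat.dvd_prime (by norm_num)).1 h1 with h2 | h2
    · obtain ⟨g, hg⟩ := minpoly.mem_range_of_degree_eq_one (RatFunc (ZMod 2)) θ (by
        rw [degree_eq_natDegree (minpoly.ne_zero (Algebra.IsIntegral.isIntegral θ)), h2]; rfl)
      rw [← hg] at hθ'
      exact absurd (IntermediateField.algebraMap_mem ⊥ g) hθ'
    · exact h2
  have hmonic : (minpoly (ZMod 2)[X] θ).Monic := minpoly.monic h_int
  refine ⟨⟨algebraMap (RatFunc (ZMod 2)) K RatFunc.X, θ, minpoly (ZMod 2)[X] θ,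
    algebraMap_X_notMem_range, finrank_adjoin_algebraMap_X.trans h, hmonic, ?_, ?_, ?_⟩, rfl⟩
  · exact minpoly.irreducible h_int
  · rw [← hdegθ, hmin, hmonic.natDegree_map]
  · have h1 : (aeval (algebraMap (RatFunc (ZMod 2)) K RatFunc.X) :
        (ZMod 2)[X] →ₐ[ZMod 2] K).toRingHom = algebraMap (ZMod 2)[X] K := by
      refine Polynomial.ringHom_ext (fun c => ?_) ?_
      · change aeval _ (Polynomial.C c) = algebraMap (RatFunc (ZMod 2)) K
          (algebraMap (ZMod 2)[X] (RatFunc (ZMod 2)) (Polynomial.C c))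
        rw [aeval_C, RatFunc.algebraMap_C, IsScalarTower.algebraMap_apply (ZMod 2) (RatFunc (ZMod 2)) K]
        rfl
      · change aeval _ (Polynomial.X) = algebraMap (RatFunc (ZMod 2)) K
          (algebraMap (ZMod 2)[X] (RatFunc (ZMod 2)) Polynomial.X)
        rw [aeval_X, RatFunc.algebraMap_X]
    rw [h1]
    exact minpoly.aeval (ZMod 2)[X] θ

theorem Curve.of_invariants [FnField (ZMod 2) K]
    (hg : genus (ZMod 2) K = 4) (hh : classNumber (ZMod 2) K = 1)
    (h : Module.finrank (RatFunc (ZMod 2)) K = 5) : Curve K :=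
  { GenusFour.of_invariants hg hh with
    five := ⟨zdiv (algebraMap (RatFunc (ZMod 2)) K RatFunc.X), by
      rw [deg_zdiv algebraMap_X_notMem_range, finrank_adjoin_algebraMap_X, h]; rfl⟩ }

end RationalSubfield

end CFF

namespace CFF

/-- A `Curve` without effective divisors of degrees one, two and three. -/
class SpecialCurve (K : Type) [Field K] [Algebra (ZMod 2) K] [FnField (ZMod 2) K] : Prop
    extends Curve K where
  An_small : An K 1 = 0 ∧ An K 2 = 0 ∧ An K 3 = 0

section SpecialCurve

variable {K : Type} [Field K] [Algebra (ZMod 2) K] [FnField (ZMod 2) K]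

theorem single_nonneg (P : Pl K) : (0 : Divisor (ZMod 2) K) ≤ Finsupp.single P 1 :=
  Finsupp.single_nonneg.2 zero_le_one

theorem single_one_injective : Function.Injective
    fun P : Pl K => (Finsupp.single P 1 : Divisor (ZMod 2) K) :=
  Finsupp.single_left_injective one_ne_zero

theorem deg_single_one (P : Pl K) : deg (Finsupp.single P 1) = pdeg P := by
  rw [deg_single, one_mul]

theorem single_mem_Eff (P : Pl K) : Finsupp.single P 1 ∈ Eff K (pdeg P) :=
  ⟨single_nonneg P, deg_single_one P⟩

theorem four_le_pdeg [SpecialCurve K] (P : Pl K) : 4 ≤ pdeg P := by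
  by_contra! h
  have h0 : 0 < pdeg P := placeDegree_pos P
  have h1 : An K (pdeg P) ≠ 0 := by
    haveI : Nonempty (Eff K (pdeg P)) := ⟨⟨_, single_mem_Eff P⟩⟩
    exact Nat.card_pos.ne'
  obtain ⟨h2, h3, h4⟩ := SpecialCurve.An_small (K := K)
  have : pdeg P = 1 ∨ pdeg P = 2 ∨ pdeg P = 3 := by omega
  rcases this with h | h | h <;> rw [h] at h1 <;> contradiction

theorem eq_single_of_nonneg [SpecialCurve K] {D : Divisor (ZMod 2) K} (hD : 0 ≤ D)
    (h0 : 0 < deg D) (h8 : deg D < 8) : ∃ P, D = Finsupp.single P 1 := by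
  have hne : ∀ E : Divisor (ZMod 2) K, 0 ≤ E → E ≠ 0 → ∃ P, Finsupp.single P 1 ≤ E := by
    intro E hE hE0
    obtain ⟨P, hP⟩ := Finsupp.ne_iff.1 hE0
    have h1 : 0 ≤ E P := hE P
    have h2 : E P ≠ 0 := hP
    refine ⟨P, fun Q => ?_⟩
    by_cases hQ : Q = P
    · subst hQ
      rw [Finsupp.single_eq_same]
      omega
    · rw [Finsupp.single_eq_of_ne hQ]
      exact hE Q
  obtain ⟨P, hP⟩ := hne D hD (by rintro rfl; rw [deg_zero] at h0; omega)
  refine ⟨P, ?_⟩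
  by_contra hc
  obtain ⟨Q, hQ⟩ := hne (D - Finsupp.single P 1) (sub_nonneg.2 hP) (sub_ne_zero.2 hc)
  have h1 := deg_mono hQ
  rw [deg_sub, deg_single_one, deg_single_one] at h1
  have := four_le_pdeg P
  have := four_le_pdeg Q
  omega

theorem card_places_eq_An [SpecialCurve K] {n : ℕ} (h0 : 0 < n) (h8 : n < 8) :
    Nat.card {P : Pl K // pdeg P = n} = An K n := by
  refine Nat.card_congr (Equiv.ofBijective
    (fun P => ⟨Finsupp.single P.1 1, by have := single_mem_Eff P.1; rwa [P.2] at this⟩) ⟨?_, ?_⟩)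
  · intro P Q h
    exact Subtype.ext (single_one_injective (congrArg Subtype.val h))
  · rintro ⟨D, hD, hn⟩
    obtain ⟨P, rfl⟩ := eq_single_of_nonneg hD (by omega) (by omega)
    rw [deg_single_one] at hn
    exact ⟨⟨P, by exact_mod_cast hn⟩, rfl⟩

theorem el_one_two [SpecialCurve K] : el K 1 = 0 ∧ el K 2 = 0 := by
  obtain ⟨h1, h2, -⟩ := SpecialCurve.An_small (K := K)
  rw [An_eq] at h1 h2
  constructor
  · by_contra h
    have := Nat.one_lt_two_pow h
    omega
  · by_contra h
    have := Nat.one_lt_two_pow h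
    omega

theorem card_places_four [SpecialCurve K] : Nat.card {P : Pl K // pdeg P = 4} = 1 := by
  rw [card_places_eq_An (by norm_num) (by norm_num), Nat.cast_ofNat, An_eq, el_four, el_one_two.2]
  norm_num

theorem card_places_five [SpecialCurve K] : Nat.card {P : Pl K // pdeg P = 5} = 3 := by
  rw [card_places_eq_An (by norm_num) (by norm_num), Nat.cast_ofNat, An_eq, el_five, el_one_two.1]
  norm_num

variable (K) in
/-- A canonical divisor. -/
def canon [Curve K] : Divisor (ZMod 2) K := (6 : ℤ) • dd K

theorem deg_canon [Curve K] : deg (canon K) = 6 := deg_zsmul_dd 6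

theorem rr_canon [Curve K] : rr (canon K) = 4 := by rw [rr_eq_el, deg_canon, el_six]

theorem rr_nsmul_canon [Curve K] {n : ℕ} (hn : 2 ≤ n) : rr (n • canon K) = 6 * n - 3 := by
  rw [rr_eq_el, deg_nsmul, deg_canon]
  have h := el_of_large (K := K) (n := 6 * n) (by omega)
  rw [show (n : ℤ) * 6 = ((6 * n : ℕ) : ℤ) by push_cast; ring]
  push_cast at h ⊢
  omega

/-- The differentials of the first kind, up to a choice of a generator. -/
abbrev Ω (K : Type) [Field K] [Algebra (ZMod 2) K] [FnField (ZMod 2) K] [Curve K] :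
    AddSubgroup K := L (canon K)

theorem exists_single_of_mem_Ω [SpecialCurve K] {x : K} (hx : x ∈ Ω K) (hx0 : x ≠ 0) :
    ∃ P, pdeg P = 6 ∧ pdiv x + canon K = Finsupp.single P 1 := by
  have h1 := (mem_L_of_ne hx0).1 hx
  have h2 : deg (pdiv x + canon K) = 6 := by rw [deg_add, deg_pdiv, deg_canon, zero_add]
  obtain ⟨P, hP⟩ := eq_single_of_nonneg h1 (by omega) (by omega)
  refine ⟨P, ?_, hP⟩
  rw [hP, deg_single_one] at h2
  exact_mod_cast h2

theorem mul_ne_mul_of_mem_Ω [SpecialCurve K] {x y z w : K} (hx : x ∈ Ω K) (hy : y ∈ Ω K)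
    (hz : z ∈ Ω K) (hw : w ∈ Ω K) (hx0 : x ≠ 0) (hy0 : y ≠ 0) (hxz : x ≠ z) (hxw : x ≠ w) :
    x * y ≠ z * w := by
  intro h
  have hzw : z * w ≠ 0 := h ▸ mul_ne_zero hx0 hy0
  have hz0 := left_ne_zero_of_mul hzw
  have hw0 := right_ne_zero_of_mul hzw
  obtain ⟨P, -, hP⟩ := exists_single_of_mem_Ω hx hx0
  obtain ⟨Q, -, hQ⟩ := exists_single_of_mem_Ω hy hy0
  obtain ⟨R, -, hR⟩ := exists_single_of_mem_Ω hz hz0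
  obtain ⟨S, -, hS⟩ := exists_single_of_mem_Ω hw hw0
  have h1 : Finsupp.single P (1 : ℤ) + Finsupp.single Q 1 =
      Finsupp.single R 1 + Finsupp.single S 1 := by
    rw [← hP, ← hQ, ← hR, ← hS]
    have h2 := congrArg pdiv h
    rw [pdiv_mul hx0 hy0, pdiv_mul hz0 hw0] at h2
    rw [add_add_add_comm, h2, add_add_add_comm]
  have h3 := DFunLike.congr_fun h1 P
  rw [Finsupp.add_apply, Finsupp.add_apply, Finsupp.single_eq_same] at h3
  have hRP : R ≠ P := by
    rintro rfl
    exact hxz (eq_of_pdiv_eq hx0 hz0 (add_right_cancel (hP.trans hR.symm)))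
  have hSP : S ≠ P := by
    rintro rfl
    exact hxw (eq_of_pdiv_eq hx0 hw0 (add_right_cancel (hP.trans hS.symm)))
  rw [Finsupp.single_eq_of_ne hRP.symm, Finsupp.single_eq_of_ne hSP.symm] at h3
  have h4 := (Finsupp.single_nonneg.2 (zero_le_one (α := ℤ)) :
    (0 : Divisor (ZMod 2) K) ≤ Finsupp.single Q 1) P
  rw [Finsupp.zero_apply] at h4
  omega

end SpecialCurve

end CFF

namespace CFF

section Frame

variable {K : Type} [Field K] [Algebra (ZMod 2) K] [FnField (ZMod 2) K]

/-- A linear combination of four elements with coefficients in `𝔽₂`. -/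
def lin (x y s t : K) (p : Fin 4 → ZMod 2) : K := p 0 • x + p 1 • y + p 2 • s + p 3 • t

theorem lin_sub (x y s t : K) (p q : Fin 4 → ZMod 2) :
    lin x y s t (p - q) = lin x y s t p - lin x y s t q := by
  have e : ∀ i : Fin 4, (p - q) i = p i - q i := fun _ => rfl
  simp only [lin, e, sub_smul]
  ring

/-- Four differentials of the first kind which are independent over `𝔽₂`. -/
structure IsFrame [Curve K] (x y s t : K) : Prop where
  mem₁ : x ∈ Ω K
  mem₂ : y ∈ Ω K
  mem₃ : s ∈ Ω K
  mem₄ : t ∈ Ω K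
  ind : ∀ p : Fin 4 → ZMod 2, lin x y s t p = 0 → p = 0

theorem lin_mem [Curve K] {x y s t : K} (h : IsFrame x y s t) (p : Fin 4 → ZMod 2) :
    lin x y s t p ∈ Ω K :=
  add_mem (add_mem (add_mem (smul_mem_L _ h.mem₁) (smul_mem_L _ h.mem₂))
    (smul_mem_L _ h.mem₃)) (smul_mem_L _ h.mem₄)

theorem IsFrame.ne_zero [Curve K] {x y s t : K} (h : IsFrame x y s t) {p : Fin 4 → ZMod 2}
    (hp : p ≠ 0) : lin x y s t p ≠ 0 := fun h0 => hp (h.ind p h0)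

theorem IsFrame.injective [Curve K] {x y s t : K} (h : IsFrame x y s t) :
    Function.Injective (lin x y s t) := fun p q hpq =>
  sub_eq_zero.1 (h.ind _ (by rw [lin_sub, hpq, sub_self]))

theorem IsFrame.mul_ne_mul [SpecialCurve K] {x y s t : K} (h : IsFrame x y s t)
    (p q r w : Fin 4 → ZMod 2) (hp : p ≠ 0) (hq : q ≠ 0) (hpr : p ≠ r) (hpw : p ≠ w) :
    lin x y s t p * lin x y s t q ≠ lin x y s t r * lin x y s t w :=
  mul_ne_mul_of_mem_Ω (lin_mem h p) (lin_mem h q) (lin_mem h r) (lin_mem h w)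
    (h.ne_zero hp) (h.ne_zero hq) (h.injective.ne hpr) (h.injective.ne hpw)

theorem IsFrame.change [Curve K] {x y s t x' y' s' t' : K} (h : IsFrame x y s t)
    (p q r w : Fin 4 → ZMod 2) (hx : x' = lin x y s t p) (hy : y' = lin x y s t q)
    (hs : s' = lin x y s t r) (ht : t' = lin x y s t w)
    (hi : ∀ c : Fin 4 → ZMod 2, c 0 • p + c 1 • q + c 2 • r + c 3 • w = 0 → c = 0) :
    IsFrame x' y' s' t' := by
  refine ⟨hx ▸ lin_mem h p, hy ▸ lin_mem h q, hs ▸ lin_mem h r, ht ▸ lin_mem h w,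
    fun c hc => hi c (h.ind _ ?_)⟩
  rw [← hc, hx, hy, hs, ht]
  have e : ∀ i, (c 0 • p + c 1 • q + c 2 • r + c 3 • w) i =
    c 0 * p i + c 1 * q i + c 2 * r i + c 3 * w i := fun _ => rfl
  simp only [lin, e]
  simp only [Algebra.smul_def, map_add, map_mul]
  ring

/-- A frame satisfying the quadratic relation in normal form. -/
structure NormalFrame [Curve K] (X Z a b : K) : Prop extends IsFrame X Z a b where
  rel : X * Z = a ^ 2 + a * b + b ^ 2

theorem IsFrame.exists_normal_of_mul_eq [SpecialCurve K] {u v s t : K} (h : IsFrame u v s t)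
    (γ δ ε : ZMod 2) (hr : u * v = γ • s ^ 2 + δ • t ^ 2 + ε • (s * t)) :
    ∃ X Z a b : K, NormalFrame X Z a b := by
  rcases zmod_two_cases ε with rfl | rfl
  · exfalso
    refine h.mul_ne_mul ![1, 0, 0, 0] ![0, 1, 0, 0] ![0, 0, γ, δ] ![0, 0, γ, δ]
      (by clear hr; revert γ δ; decide) (by decide) (by clear hr; revert γ δ; decide) (by clear hr; revert γ δ; decide) ?_
    rcases zmod_two_cases γ with rfl | rfl <;> rcases zmod_two_cases δ with rfl | rfl <;>
      simp only [lin, Matrix.cons_val, zero_smul, one_smul] at hr ⊢ <;> grind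
  rcases zmod_two_cases γ with rfl | rfl
  · exfalso
    refine h.mul_ne_mul ![1, 0, 0, 0] ![0, 1, 0, 0] ![0, 0, 0, 1] ![0, 0, 1, δ]
      (by decide) (by decide) (by decide) (by clear hr; revert δ; decide) ?_
    rcases zmod_two_cases δ with rfl | rfl <;>
      simp only [lin, Matrix.cons_val, zero_smul, one_smul] at hr ⊢ <;> grind
  rcases zmod_two_cases δ with rfl | rfl
  · exfalso
    refine h.mul_ne_mul ![1, 0, 0, 0] ![0, 1, 0, 0] ![0, 0, 1, 0] ![0, 0, 1, 1]
      (by decide) (by decide) (by decide) (by decide) ?_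
    simp only [lin, Matrix.cons_val, zero_smul, one_smul] at hr ⊢
    grind
  · refine ⟨u, v, s, t, h, ?_⟩
    simp only [one_smul] at hr
    grind

theorem IsFrame.exists_normal_of_norm_eq [SpecialCurve K] {u v s t : K} (h : IsFrame u v s t)
    (γ δ ε : ZMod 2) (hr : u ^ 2 + u * v + v ^ 2 = γ • s ^ 2 + δ • t ^ 2 + ε • (s * t)) :
    ∃ X Z a b : K, NormalFrame X Z a b := by
  rcases zmod_two_cases ε with rfl | rfl
  · exfalso
    refine h.mul_ne_mul ![1, 0, 0, 0] ![0, 1, 0, 0] ![1, 1, γ, δ] ![1, 1, γ, δ]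
      (by decide) (by decide) (by clear hr; revert γ δ; decide) (by clear hr; revert γ δ; decide) ?_
    rcases zmod_two_cases γ with rfl | rfl <;> rcases zmod_two_cases δ with rfl | rfl <;>
      simp only [lin, Matrix.cons_val, zero_smul, one_smul] at hr ⊢ <;> grind
  rcases zmod_two_cases γ with rfl | rfl
  · refine ⟨t, s + δ • t, u, v, h.change ![0, 0, 0, 1] ![0, 0, 1, δ] ![1, 0, 0, 0] ![0, 1, 0, 0]
      ?_ ?_ ?_ ?_ (by clear hr; revert δ; decide), ?_⟩
    all_goals
      rcases zmod_two_cases δ with rfl | rfl <;>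
        simp only [lin, Matrix.cons_val, zero_smul, one_smul] at hr ⊢ <;> grind
  rcases zmod_two_cases δ with rfl | rfl
  · refine ⟨s, s + t, u, v, h.change ![0, 0, 1, 0] ![0, 0, 1, 1] ![1, 0, 0, 0] ![0, 1, 0, 0]
      ?_ ?_ ?_ ?_ (by decide), ?_⟩
    all_goals
      simp only [lin, Matrix.cons_val, zero_smul, one_smul] at hr ⊢ <;> grind
  · exfalso
    refine h.mul_ne_mul ![1, 0, 1, 0] ![1, 1, 1, 0] ![0, 1, 0, 1] ![0, 1, 1, 1]
      (by decide) (by decide) (by decide) (by decide) ?_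
    simp only [lin, Matrix.cons_val, zero_smul, one_smul] at hr ⊢
    grind

theorem IsFrame.exists_normal_of_mul_add_eq [SpecialCurve K] {u v s t : K} (h : IsFrame u v s t)
    (α β γ δ ε : ZMod 2)
    (hr : u * v + α • u ^ 2 + β • v ^ 2 = γ • s ^ 2 + δ • t ^ 2 + ε • (s * t)) :
    ∃ X Z a b : K, NormalFrame X Z a b := by
  rcases zmod_two_cases α with rfl | rfl <;> rcases zmod_two_cases β with rfl | rfl <;>
    simp only [zero_smul, one_smul, add_zero] at hr
  · exact h.exists_normal_of_mul_eq γ δ ε hr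
  · refine IsFrame.exists_normal_of_mul_eq (u := v) (v := u + v) (s := s) (t := t)
      (h.change ![0, 1, 0, 0] ![1, 1, 0, 0] ![0, 0, 1, 0] ![0, 0, 0, 1] ?_ ?_ ?_ ?_ (by decide))
      γ δ ε (by rw [← hr]; ring)
    all_goals simp [lin]
  · refine IsFrame.exists_normal_of_mul_eq (u := u) (v := u + v) (s := s) (t := t)
      (h.change ![1, 0, 0, 0] ![1, 1, 0, 0] ![0, 0, 1, 0] ![0, 0, 0, 1] ?_ ?_ ?_ ?_ (by decide))
      γ δ ε (by rw [← hr]; ring)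
    all_goals simp [lin]
  · exact h.exists_normal_of_norm_eq γ δ ε (by rw [← hr]; ring)

theorem IsFrame.exists_normal_of_coeff_eq_one [SpecialCurve K] {x y s t : K}
    (h : IsFrame x y s t) (c₁₁ c₂₂ c₃₃ c₄₄ c₁₃ c₁₄ c₂₃ c₂₄ c₃₄ : ZMod 2)
    (hr : c₁₁ • x ^ 2 + c₂₂ • y ^ 2 + c₃₃ • s ^ 2 + c₄₄ • t ^ 2 + x * y + c₁₃ • (x * s) +
      c₁₄ • (x * t) + c₂₃ • (y * s) + c₂₄ • (y * t) + c₃₄ • (s * t) = 0) :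
    ∃ X Z a b : K, NormalFrame X Z a b := by
  refine IsFrame.exists_normal_of_mul_add_eq (u := x + c₂₃ • s + c₂₄ • t)
    (v := y + c₁₃ • s + c₁₄ • t) (s := s) (t := t)
    (h.change ![1, 0, c₂₃, c₂₄] ![0, 1, c₁₃, c₁₄] ![0, 0, 1, 0] ![0, 0, 0, 1] ?_ ?_ ?_ ?_ ?_)
    c₁₁ c₂₂ (c₃₃ + c₁₃ * c₂₃ + c₁₁ * c₂₃ + c₂₂ * c₁₃) (c₄₄ + c₁₄ * c₂₄ + c₁₁ * c₂₄ + c₂₂ * c₁₄)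
    (c₃₄ + c₁₃ * c₂₄ + c₁₄ * c₂₃) ?_
  · simp [lin]
  · simp [lin]
  · simp [lin]
  · simp [lin]
  · clear hr
    revert c₁₃ c₁₄ c₂₃ c₂₄
    decide
  · have hsq : ∀ c : ZMod 2, (algebraMap (ZMod 2) K c) ^ 2 = algebraMap (ZMod 2) K c := by
      intro c
      rw [← map_pow]
      congr 1
      revert c
      decide
    have h2 : (2 : K) = 0 := CharTwo.two_eq_zero
    have i1 := hsq c₁₃
    have i2 := hsq c₁₄
    have i3 := hsq c₂₃
    have i4 := hsq c₂₄
    simp only [Algebra.smul_def, map_add, map_mul] at hr ⊢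
    generalize algebraMap (ZMod 2) K c₁₁ = A at *
    generalize algebraMap (ZMod 2) K c₂₂ = B at *
    generalize algebraMap (ZMod 2) K c₃₃ = C at *
    generalize algebraMap (ZMod 2) K c₄₄ = D at *
    generalize algebraMap (ZMod 2) K c₁₃ = a at *
    generalize algebraMap (ZMod 2) K c₁₄ = b at *
    generalize algebraMap (ZMod 2) K c₂₃ = c at *
    generalize algebraMap (ZMod 2) K c₂₄ = d at *
    generalize algebraMap (ZMod 2) K c₃₄ = e at *
    clear hsq h
    grind

theorem exists_relation (D : Divisor (ZMod 2) K) {n : ℕ} (f : Fin n → K) (hf : ∀ i, f i ∈ L D)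
    (hn : rr D < n) : ∃ c : Fin n → ZMod 2, c ≠ 0 ∧ ∑ i, c i • f i = 0 := by
  haveI := Fintype.ofFinite (L D)
  obtain ⟨c, c', hne, heq⟩ := Fintype.exists_ne_map_eq_of_card_lt
    (fun c : Fin n → ZMod 2 => (⟨∑ i, c i • f i, sum_mem fun i _ => smul_mem_L _ (hf i)⟩ : L D))
    (by rw [Fintype.card_eq_nat_card, card_L_eq]; simpa using Nat.pow_lt_pow_right one_lt_two hn)
  refine ⟨c - c', sub_ne_zero.2 hne, ?_⟩
  have e : ∀ i, (c - c') i = c i - c' i := fun _ => rfl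
  simp only [e, sub_smul, Finset.sum_sub_distrib]
  exact sub_eq_zero.2 (congrArg Subtype.val heq)

theorem exists_frame [SpecialCurve K] : ∃ x y s t : K, IsFrame x y s t := by
  have h4 : Module.finrank (ZMod 2) (RRspace (ZMod 2) (canon K)) = 4 := rr_canon
  haveI : Module.Finite (ZMod 2) (RRspace (ZMod 2) (canon K)) :=
    Module.finite_of_finrank_pos (by omega)
  let B := Module.finBasisOfFinrankEq _ _ h4
  have hmem : ∀ i, (B i : K) ∈ Ω K := by
    intro i
    have := (B i).2
    exact (RRspace_eq (canon K)).le this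
  refine ⟨B 0, B 1, B 2, B 3, hmem _, hmem _, hmem _, hmem _, fun p hp => ?_⟩
  have h1 : ∑ i, p i • B i = 0 := by
    apply Subtype.ext
    rw [Fin.sum_univ_four]
    exact hp
  exact funext fun i => Fintype.linearIndependent_iff.1 B.linearIndependent p h1 i

theorem mul_mem_two_canon [Curve K] {x y : K} (hx : x ∈ Ω K) (hy : y ∈ Ω K) :
    x * y ∈ L (2 • canon K) := by
  rw [two_nsmul]
  exact mul_mem_L hx hy

theorem exists_normalFrame [SpecialCurve K] : ∃ X Z a b : K, NormalFrame X Z a b := by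
  obtain ⟨x, y, s, t, h⟩ := exists_frame (K := K)
  obtain ⟨c, hc0, hc⟩ := exists_relation (2 • canon K)
    ![x ^ 2, y ^ 2, s ^ 2, t ^ 2, x * y, x * s, x * t, y * s, y * t, s * t]
    (by
      obtain ⟨h1, h2, h3, h4, -⟩ := h
      intro i
      fin_cases i <;> simp only [Fin.zero_eta, Fin.mk_one, Fin.reduceFinMk, Matrix.cons_val, sq] <;>
        apply mul_mem_two_canon <;> assumption)
    (by rw [rr_nsmul_canon le_rfl]; norm_num)
  have hc' : c 0 • x ^ 2 + c 1 • y ^ 2 + c 2 • s ^ 2 + c 3 • t ^ 2 + c 4 • (x * y) +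
      c 5 • (x * s) + c 6 • (x * t) + c 7 • (y * s) + c 8 • (y * t) + c 9 • (s * t) = 0 := by
    rw [← hc, Fin.sum_univ_succ, Fin.sum_univ_succ, Fin.sum_univ_eight]
    simp only [Fin.succ_zero_eq_one, Fin.reduceSucc, Matrix.cons_val]
    ring
  clear hc
  rcases zmod_two_cases (c 4) with h4 | h4
  swap
  · refine h.exists_normal_of_coeff_eq_one (c 0) (c 1) (c 2) (c 3) (c 5) (c 6) (c 7) (c 8) (c 9) ?_
    rw [← hc', h4, one_smul]
  rcases zmod_two_cases (c 5) with h5 | h5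
  swap
  · refine IsFrame.exists_normal_of_coeff_eq_one (x := x) (y := s) (s := y) (t := t)
      (h.change ![1, 0, 0, 0] ![0, 0, 1, 0] ![0, 1, 0, 0] ![0, 0, 0, 1] ?_ ?_ ?_ ?_ (by decide))
      (c 0) (c 2) (c 1) (c 3) (c 4) (c 6) (c 7) (c 9) (c 8) ?_
    · simp [lin]
    · simp [lin]
    · simp [lin]
    · simp [lin]
    · rw [← hc', h5, one_smul, mul_comm y s]
      ring
  rcases zmod_two_cases (c 6) with h6 | h6
  swap
  · refine IsFrame.exists_normal_of_coeff_eq_one (x := x) (y := t) (s := y) (t := s)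
      (h.change ![1, 0, 0, 0] ![0, 0, 0, 1] ![0, 1, 0, 0] ![0, 0, 1, 0] ?_ ?_ ?_ ?_ (by decide))
      (c 0) (c 3) (c 1) (c 2) (c 4) (c 5) (c 8) (c 9) (c 7) ?_
    · simp [lin]
    · simp [lin]
    · simp [lin]
    · simp [lin]
    · rw [← hc', h6, one_smul, mul_comm y t, mul_comm s t]
      ring
  rcases zmod_two_cases (c 7) with h7 | h7
  swap
  · refine IsFrame.exists_normal_of_coeff_eq_one (x := y) (y := s) (s := x) (t := t)
      (h.change ![0, 1, 0, 0] ![0, 0, 1, 0] ![1, 0, 0, 0] ![0, 0, 0, 1] ?_ ?_ ?_ ?_ (by decide))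
      (c 1) (c 2) (c 0) (c 3) (c 4) (c 8) (c 5) (c 9) (c 6) ?_
    · simp [lin]
    · simp [lin]
    · simp [lin]
    · simp [lin]
    · rw [← hc', h7, one_smul, mul_comm x y, mul_comm x s]
      ring
  rcases zmod_two_cases (c 8) with h8 | h8
  swap
  · refine IsFrame.exists_normal_of_coeff_eq_one (x := y) (y := t) (s := x) (t := s)
      (h.change ![0, 1, 0, 0] ![0, 0, 0, 1] ![1, 0, 0, 0] ![0, 0, 1, 0] ?_ ?_ ?_ ?_ (by decide))
      (c 1) (c 3) (c 0) (c 2) (c 4) (c 7) (c 6) (c 9) (c 5) ?_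
    · simp [lin]
    · simp [lin]
    · simp [lin]
    · simp [lin]
    · rw [← hc', h8, one_smul, mul_comm x y, mul_comm x t, mul_comm s t]
      ring
  rcases zmod_two_cases (c 9) with h9 | h9
  swap
  · refine IsFrame.exists_normal_of_coeff_eq_one (x := s) (y := t) (s := x) (t := y)
      (h.change ![0, 0, 1, 0] ![0, 0, 0, 1] ![1, 0, 0, 0] ![0, 1, 0, 0] ?_ ?_ ?_ ?_ (by decide))
      (c 2) (c 3) (c 0) (c 1) (c 5) (c 7) (c 6) (c 8) (c 4) ?_
    · simp [lin]
    · simp [lin]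
    · simp [lin]
    · simp [lin]
    · rw [← hc', h9, one_smul, mul_comm x s, mul_comm x t, mul_comm y s, mul_comm y t]
      ring
  exfalso
  rw [h4, h5, h6, h7, h8, h9] at hc'
  simp only [zero_smul, add_zero] at hc'
  have hsq : lin x y s t ![c 0, c 1, c 2, c 3] ^ 2 = 0 := by
    rw [← hc']
    simp only [lin, Matrix.cons_val]
    rcases zmod_two_cases (c 0) with h0 | h0 <;> rcases zmod_two_cases (c 1) with h1 | h1 <;>
      rcases zmod_two_cases (c 2) with h2 | h2 <;> rcases zmod_two_cases (c 3) with h3 | h3 <;>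
      rw [h0, h1, h2, h3] <;> simp only [zero_smul, one_smul] <;> grind
  have hz := h.ind _ (pow_eq_zero_iff two_ne_zero |>.1 hsq)
  have h0 : c 0 = 0 := congrFun hz 0
  have h1 : c 1 = 0 := congrFun hz 1
  have h2 : c 2 = 0 := congrFun hz 2
  have h3 : c 3 = 0 := congrFun hz 3
  refine hc0 (funext fun i => ?_)
  fin_cases i <;> assumption

end Frame

end CFF

namespace CFF

section Mask

/-- The element with coordinates the binary digits of `E` in a list `ms` of generators. -/
def bsum {K : Type} [CommRing K] : List K → ℕ → K
  | [], _ => 0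
  | m :: ms, E => (E : K) * m + bsum ms (E / 2)

/-- The linear map on binary vectors whose matrix has the given columns. -/
def act : List ℕ → ℕ → ℕ
  | [], _ => 0
  | c :: cs, E => ((E % 2) * c) ^^^ act cs (E / 2)

section CharTwo

variable {K : Type} [CommRing K] [CharP K 2]

theorem cast_eq_cast_mod_two (E : ℕ) : (E : K) = ((E % 2 : ℕ) : K) := by
  conv_lhs => rw [← Nat.mod_add_div E 2]
  rw [Nat.cast_add, Nat.cast_mul, Nat.cast_ofNat, CharTwo.two_eq_zero (R := K), zero_mul, add_zero]

theorem cast_xor (E F : ℕ) : ((E ^^^ F : ℕ) : K) = E + F := by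
  rw [← Nat.cast_add, cast_eq_cast_mod_two (E ^^^ F), Nat.xor_mod_two_eq, ← cast_eq_cast_mod_two]

theorem bsum_xor (ms : List K) (E F : ℕ) : bsum ms (E ^^^ F) = bsum ms E + bsum ms F := by
  induction ms generalizing E F with
  | nil => simp [bsum]
  | cons m ms ih =>
    simp only [bsum, cast_xor]
    rw [Nat.xor_div_two, ih]
    ring

theorem bsum_zero (ms : List K) : bsum ms 0 = 0 := by
  induction ms with
  | nil => rfl
  | cons m ms ih => simp [bsum, ih]

theorem bsum_act {ms ms' : List K} {cs : List ℕ} (h : List.Forall₂ (fun c m => bsum ms' c = m) cs ms)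
    (E : ℕ) : bsum ms' (act cs E) = bsum ms E := by
  induction h generalizing E with
  | nil => simp [bsum, act, bsum_zero]
  | @cons c m cs ms h _ ih =>
    simp only [bsum, act, bsum_xor, ih]
    rw [cast_eq_cast_mod_two E]
    rcases Nat.mod_two_eq_zero_or_one E with h0 | h0 <;> rw [h0] <;> simp [bsum_zero, h]

theorem map_bsum {R S : Type} [CommRing R] [CommRing S] (φ : R →+* S) (ms : List R) (E : ℕ) :
    φ (bsum ms E) = bsum (ms.map φ) E := by
  induction ms generalizing E with
  | nil => simp [bsum]
  | cons m ms ih => simp [bsum, ih]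

theorem bsum_map_mul {R : Type} [CommRing R] (c : R) (ms : List R) (E : ℕ) :
    bsum (ms.map (c * ·)) E = c * bsum ms E := by
  induction ms generalizing E with
  | nil => simp [bsum]
  | cons m ms ih => simp only [List.map_cons, bsum, ih]; ring

end CharTwo

variable {K : Type} [Field K] [Algebra (ZMod 2) K] [FnField (ZMod 2) K]

theorem bsum_mem {D : Divisor (ZMod 2) K} {ms : List K} (h : ∀ m ∈ ms, m ∈ L D) (E : ℕ) :
    bsum ms E ∈ L D := by
  induction ms generalizing E with
  | nil => exact zero_mem _
  | cons m ms ih =>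
    refine add_mem ?_ (ih (fun m hm => h m (List.mem_cons_of_mem _ hm)) _)
    rw [← nsmul_eq_mul]
    exact nsmul_mem (h m List.mem_cons_self) E

theorem exists_bsum_eq_zero {D : Divisor (ZMod 2) K} {ms : List K} (h : ∀ m ∈ ms, m ∈ L D)
    (hlt : rr D < ms.length) : ∃ E < 2 ^ ms.length, E ≠ 0 ∧ bsum ms E = 0 := by
  haveI := Fintype.ofFinite (L D)
  obtain ⟨E, F, hne, heq⟩ := Fintype.exists_ne_map_eq_of_card_lt
    (fun E : Fin (2 ^ ms.length) => (⟨bsum ms E, bsum_mem h E⟩ : L D))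
    (by
      rw [Fintype.card_eq_nat_card, card_L_eq, Fintype.card_fin]
      exact Nat.pow_lt_pow_right one_lt_two hlt)
  refine ⟨E ^^^ F, Nat.xor_lt_two_pow E.2 F.2, ?_, ?_⟩
  · rwa [Ne, Nat.xor_eq_zero_iff, ← Fin.ext_iff]
  · rw [bsum_xor]
    have h1 : bsum ms E = bsum ms F := congrArg Subtype.val heq
    rw [h1]
    exact CharTwo.add_self_eq_zero _

/-- The cubic monomials in `X, Z, a, b` which are not divisible by `XZ`. -/
def cubics {K : Type} [CommRing K] (X Z a b : K) : List K :=
  [X ^ 3, X ^ 2 * a, X * a ^ 2, a ^ 3, Z * a ^ 2, Z ^ 2 * a, Z ^ 3,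
    X ^ 2 * b, X * b ^ 2, b ^ 3, Z * b ^ 2, Z ^ 2 * b,
    a * b ^ 2, a ^ 2 * b, Z * a * b, X * a * b]

/-- Four involutions in the orthogonal group of the form `XZ + a² + ab + b²`. -/
def isom : Fin 4 → K × K × K × K → K × K × K × K
  | 0, (X, Z, a, b) => (X, Z, b, a)
  | 1, (X, Z, a, b) => (X, Z, a + b, b)
  | 2, (X, Z, a, b) => (Z, X, a, b)
  | 3, (X, Z, a, b) => (X, Z + X + b, a + X, b)

/-- The action of the four involutions on cubic forms modulo the quadratic form. -/
def isomMatrix : Fin 4 → List ℕ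
  | 0 => [1, 128, 256, 512, 1024, 2048, 64, 2, 4, 8, 16, 32, 8192, 4096, 16384, 32768]
  | 1 => [1, 130, 260, 12808, 1040, 2080, 64, 128, 256, 512, 1024, 2048, 4608, 8704, 17408, 33024]
  | 2 => [64, 32, 16, 8, 4, 2, 1, 2048, 1024, 512, 256, 128, 4096, 8192, 32768, 16384]
  | 3 => [1, 3, 5, 15, 41361, 21811, 51925, 128, 256, 512, 1792, 2688, 4352, 8320, 58240, 32896]

/-- The frame `y` is normal. -/
def IsNormal [Curve K] (y : K × K × K × K) : Prop := NormalFrame y.1 y.2.1 y.2.2.1 y.2.2.2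

/-- The value of the cubic form `E` at `y`. -/
def evc (E : ℕ) (y : K × K × K × K) : K := bsum (cubics y.1 y.2.1 y.2.2.1 y.2.2.2) E

theorem IsNormal.isom [Curve K] {y : K × K × K × K} (h : IsNormal y) (k : Fin 4) :
    IsNormal (isom k y) := by
  obtain ⟨X, Z, a, b⟩ := y
  obtain ⟨h, hr⟩ := h
  have h2 : (2 : K) = 0 := CharTwo.two_eq_zero
  simp only at h hr
  fin_cases k
  · refine ⟨h.change ![1, 0, 0, 0] ![0, 1, 0, 0] ![0, 0, 0, 1] ![0, 0, 1, 0] ?_ ?_ ?_ ?_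
      (by decide), ?_⟩ <;> simp [lin, CFF.isom]
    linear_combination hr
  · refine ⟨h.change ![1, 0, 0, 0] ![0, 1, 0, 0] ![0, 0, 1, 1] ![0, 0, 0, 1] ?_ ?_ ?_ ?_
      (by decide), ?_⟩ <;> simp [lin, CFF.isom]
    linear_combination hr - (b ^ 2 + a * b) * h2
  · refine ⟨h.change ![0, 1, 0, 0] ![1, 0, 0, 0] ![0, 0, 1, 0] ![0, 0, 0, 1] ?_ ?_ ?_ ?_
      (by decide), ?_⟩ <;> simp [lin, CFF.isom]
    linear_combination hr
  · refine ⟨h.change ![1, 0, 0, 0] ![1, 1, 0, 1] ![1, 0, 1, 0] ![0, 0, 0, 1] ?_ ?_ ?_ ?_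
      (by decide), ?_⟩ <;> simp [lin, CFF.isom]
    · ring
    · ring
    · linear_combination hr - a * X * h2

theorem IsNormal.evc_isom [Curve K] {y : K × K × K × K} (h : IsNormal y) (k : Fin 4) (E : ℕ) :
    evc (act (isomMatrix k) E) (CFF.isom k y) = evc E y := by
  obtain ⟨X, Z, a, b⟩ := y
  obtain ⟨-, hr⟩ := h
  simp only at hr
  refine bsum_act ?_ E
  fin_cases k <;>
    simp only [CFF.isom, isomMatrix, cubics, Fin.zero_eta, Fin.mk_one, Fin.reduceFinMk,
      List.forall₂_cons, List.Forall₂.nil, and_true] <;>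
    refine ⟨?_, ?_, ?_, ?_, ?_, ?_, ?_, ?_, ?_, ?_, ?_, ?_, ?_, ?_, ?_, ?_⟩ <;>
    simp only [bsum, Nat.reduceDiv, Nat.cast_ofNat, Nat.cast_zero, Nat.cast_one] <;> clear * - hr <;>
    grind

end Mask

end CFF

namespace CFF

section Sextic

/-- The irreducible polynomials of degree six over `𝔽₂`, and zero, encoded in binary. -/
def sextics : List ℕ := [0, 67, 73, 87, 91, 97, 103, 109, 115, 117]

variable {κ : Type} [Field κ] [Algebra (ZMod 2) κ] [CharP κ 2]

/-- The first seven powers of an element. -/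
def powers {R : Type} [CommRing R] (z : R) : List R := [1, z, z ^ 2, z ^ 3, z ^ 4, z ^ 5, z ^ 6]

theorem natDegree_minpoly_eq_six (h6 : Module.finrank (ZMod 2) κ = 6) {z : κ} (h2 : z ≠ 0)
    (h3 : z + 1 ≠ 0) (h7 : z ^ 2 + z + 1 ≠ 0) (h11 : z ^ 3 + z + 1 ≠ 0)
    (h13 : z ^ 3 + z ^ 2 + 1 ≠ 0) : (minpoly (ZMod 2) z).natDegree = 6 := by
  haveI : Module.Finite (ZMod 2) κ := Module.finite_of_finrank_pos (by omega)
  have h_int : IsIntegral (ZMod 2) z := IsIntegral.of_finite _ _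
  have hdvd : (minpoly (ZMod 2) z).natDegree ∣ 6 := by
    rw [← h6]
    exact (minpoly.degree_dvd h_int)
  have hpos := minpoly.natDegree_pos h_int
  have hle : (minpoly (ZMod 2) z).natDegree ≤ 6 := Nat.le_of_dvd (by norm_num) hdvd
  have haev := minpoly.aeval (ZMod 2) z
  rw [Polynomial.aeval_eq_sum_range] at haev
  have hlead : (minpoly (ZMod 2) z).coeff (minpoly (ZMod 2) z).natDegree = 1 :=
    minpoly.monic h_int
  by_contra hne
  generalize minpoly (ZMod 2) z = p at *
  generalize p.natDegree = d at *
  have hd : d = 1 ∨ d = 2 ∨ d = 3 := by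
    interval_cases d <;> first | omega | (exfalso; revert hdvd; decide)
  rcases hd with rfl | rfl | rfl <;> simp only [Finset.sum_range_succ, Finset.sum_range_zero,
    hlead, one_smul, pow_zero, pow_one, zero_add] at haev
  · rcases zmod_two_cases (p.coeff 0) with h | h <;> rw [h] at haev <;>
      simp only [zero_smul, one_smul, zero_add] at haev <;> grind
  · rcases zmod_two_cases (p.coeff 0) with h | h <;> rcases zmod_two_cases (p.coeff 1) with h' | h' <;>
      rw [h, h'] at haev <;>
      simp only [zero_smul, one_smul, zero_add] at haev <;> grind
  · rcases zmod_two_cases (p.coeff 0) with h | h <;> rcases zmod_two_cases (p.coeff 1) with h' | h' <;>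
      rcases zmod_two_cases (p.coeff 2) with h'' | h'' <;>
      rw [h, h', h''] at haev <;>
      simp only [zero_smul, one_smul, zero_add] at haev <;> grind

theorem bsum_powers_ne_zero {z : κ} (h : (minpoly (ZMod 2) z).natDegree = 6) {s : ℕ}
    (hs0 : s ≠ 0) (hs : s < 64) : bsum (powers z) s ≠ 0 := by
  intro h0
  set q : Polynomial (ZMod 2) := bsum (powers Polynomial.X) s with hq
  have h1 : Polynomial.aeval z q = 0 := by
    rw [hq]
    have := map_bsum (Polynomial.aeval (R := ZMod 2) z).toRingHom (powers Polynomial.X) s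
    refine this.trans ?_
    rw [← h0]
    simp [powers]
  have hco : ∀ i < 6, q.coeff i = ((s / 2 ^ i : ℕ) : ZMod 2) := by
    intro i hi
    have e : q = bsum (powers Polynomial.X) s := rfl
    rw [e]
    simp only [powers, bsum, ← Polynomial.C_eq_natCast, Polynomial.coeff_add,
      Polynomial.coeff_C_mul, Polynomial.coeff_X_pow, Polynomial.coeff_one, Polynomial.coeff_X,
      Polynomial.coeff_zero, Nat.div_div_eq_div_mul]
    interval_cases i <;> norm_num
  have hq0 : q ≠ 0 := by
    intro hq0
    rw [hq0] at hco
    simp only [Polynomial.coeff_zero, eq_comm, ZMod.natCast_eq_zero_iff] at hco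
    have a0 := hco 0 (by norm_num)
    have a1 := hco 1 (by norm_num)
    have a2 := hco 2 (by norm_num)
    have a3 := hco 3 (by norm_num)
    have a4 := hco 4 (by norm_num)
    have a5 := hco 5 (by norm_num)
    norm_num at a0 a1 a2 a3 a4 a5
    omega
  have h2 := Polynomial.natDegree_le_natDegree (minpoly.degree_le_of_ne_zero (ZMod 2) z hq0 h1)
  have h3 : q.natDegree ≤ 5 := by
    have hs6 : s / 2 / 2 / 2 / 2 / 2 / 2 = 0 := by omega
    rw [hq]
    simp only [powers, bsum, hs6, ← Polynomial.C_eq_natCast, Nat.cast_zero, map_zero, zero_mul,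
      add_zero]
    compute_degree
  omega

theorem bsum_powers_two_mul {R : Type} [CommRing R] [CharP R 2] (z : R) {r : ℕ} (hr : r < 64) :
    bsum (powers z) (2 * r) = z * bsum (powers z) r := by
  have h6 : r / 2 / 2 / 2 / 2 / 2 / 2 = 0 := by omega
  have h0 : 2 * r / 2 = r := by omega
  simp only [powers, bsum, h6, h0, Nat.cast_mul, Nat.cast_ofNat, CharTwo.two_eq_zero (R := R),
    Nat.cast_zero]
  ring

theorem mem_sextics (h6 : Module.finrank (ZMod 2) κ = 6) {z : κ} (h2 : z ≠ 0)
    (h3 : z + 1 ≠ 0) (h7 : z ^ 2 + z + 1 ≠ 0) (h11 : z ^ 3 + z + 1 ≠ 0)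
    (h13 : z ^ 3 + z ^ 2 + 1 ≠ 0) {s : ℕ} (hs : s < 128) (h : bsum (powers z) s = 0) :
    s ∈ sextics := by
  have hdeg := natDegree_minpoly_eq_six h6 h2 h3 h7 h11 h13
  by_contra hns
  have hs64 : 64 ≤ s := by
    by_contra hlt
    refine bsum_powers_ne_zero hdeg ?_ (by omega) h
    rintro rfl
    exact hns (by decide)
  have key : ((List.range 128).all fun s => decide (s < 64) || sextics.contains s ||
      (List.range 64).any fun r => r != 0 && (s == 2 * r || s == r ^^^ 2 * r ||
        r < 32 && s == r ^^^ 2 * r ^^^ 2 * (2 * r) ||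
        r < 16 && (s == r ^^^ 2 * r ^^^ 2 * (2 * (2 * r)) ||
          s == r ^^^ 2 * (2 * r) ^^^ 2 * (2 * (2 * r))))) = true := by
    decide +kernel
  rw [List.all_eq_true] at key
  have key := key s (List.mem_range.2 hs)
  rw [Bool.or_eq_true, Bool.or_eq_true, decide_eq_true_iff, List.contains_iff_mem,
    List.any_eq_true] at key
  rcases key with (key | key) | ⟨r, hr, key⟩
  · omega
  · exact hns key
  rw [List.mem_range] at hr
  simp only [Bool.and_eq_true, Bool.or_eq_true, bne_iff_ne, beq_iff_eq, decide_eq_true_iff] at key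
  obtain ⟨hr0, ((rfl | rfl) | ⟨hr', rfl⟩) | ⟨hr', rfl | rfl⟩⟩ := key
  all_goals
    have hne := bsum_powers_ne_zero hdeg hr0 (by omega)
    try simp only [bsum_xor] at h
    repeat rw [bsum_powers_two_mul z (by omega)] at h
  · exact mul_ne_zero h2 hne h
  · exact mul_ne_zero h3 hne (by linear_combination h)
  · exact mul_ne_zero h7 hne (by linear_combination h)
  · exact mul_ne_zero h11 hne (by linear_combination h)
  · exact mul_ne_zero h13 hne (by linear_combination h)

end Sextic

end CFF

namespace CFF

section Plane

variable {K : Type} [Field K] [Algebra (ZMod 2) K] [FnField (ZMod 2) K]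

theorem IsFrame.exists_eq_lin [SpecialCurve K] {x y s t : K} (h : IsFrame x y s t) {w : K}
    (hw : w ∈ Ω K) : ∃ p, w = lin x y s t p := by
  haveI := Fintype.ofFinite (Ω K)
  have hinj : Function.Injective fun p => (⟨lin x y s t p, lin_mem h p⟩ : Ω K) :=
    fun p q hpq => h.injective (congrArg Subtype.val hpq)
  have hcard : Fintype.card (Fin 4 → ZMod 2) = Fintype.card (Ω K) := by
    rw [Fintype.card_eq_nat_card (α := Ω K), card_L_eq, rr_canon]
    simp
  obtain ⟨p, hp⟩ := ((Fintype.bijective_iff_injective_and_card _).2 ⟨hinj, hcard⟩).2 ⟨w, hw⟩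
  exact ⟨p, (congrArg Subtype.val hp).symm⟩

theorem NormalFrame.quadric_ne_mul [SpecialCurve K] {X Z a b w : K} (h : NormalFrame X Z a b)
    (hw : w ∈ Ω K) : a * Z + a * X + X ^ 2 ≠ b * w := by
  intro he
  obtain ⟨p, rfl⟩ := h.exists_eq_lin hw
  have hr := h.rel
  have hn := h.mul_ne_mul
  simp only [lin] at he
  rcases zmod_two_cases (p 0) with h0 | h0 <;> rcases zmod_two_cases (p 1) with h1 | h1 <;>
    rcases zmod_two_cases (p 2) with h2 | h2 <;> rcases zmod_two_cases (p 3) with h3 | h3 <;>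
    rw [h0, h1, h2, h3] at he <;> simp only [zero_smul, one_smul] at he
  · refine hn ![0, 0, 1, 0] ![1, 1, 0, 0] ![1, 0, 0, 0] ![1, 0, 0, 0] (by decide) (by decide) (by decide) (by decide) ?_
    simp only [lin, Matrix.cons_val, zero_smul, one_smul]
    grind
  · refine hn ![0, 0, 1, 0] ![1, 1, 0, 0] ![1, 0, 0, 1] ![1, 0, 0, 1] (by decide) (by decide) (by decide) (by decide) ?_
    simp only [lin, Matrix.cons_val, zero_smul, one_smul]
    grind
  · refine hn ![0, 0, 1, 0] ![1, 1, 0, 1] ![1, 0, 0, 0] ![1, 0, 0, 0] (by decide) (by decide) (by decide) (by decide) ?_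
    simp only [lin, Matrix.cons_val, zero_smul, one_smul]
    grind
  · refine hn ![0, 0, 1, 0] ![1, 1, 0, 1] ![1, 0, 0, 1] ![1, 0, 0, 1] (by decide) (by decide) (by decide) (by decide) ?_
    simp only [lin, Matrix.cons_val, zero_smul, one_smul]
    grind
  · refine hn ![0, 0, 1, 1] ![1, 1, 0, 0] ![1, 0, 0, 0] ![1, 0, 0, 1] (by decide) (by decide) (by decide) (by decide) ?_
    simp only [lin, Matrix.cons_val, zero_smul, one_smul]
    grind
  · refine hn ![0, 0, 1, 1] ![1, 0, 0, 0] ![1, 0, 1, 1] ![1, 1, 1, 0] (by decide) (by decide) (by decide) (by decide) ?_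
    simp only [lin, Matrix.cons_val, zero_smul, one_smul]
    grind
  · refine hn ![1, 0, 1, 1] ![1, 1, 1, 1] ![1, 0, 0, 0] ![0, 0, 1, 0] (by decide) (by decide) (by decide) (by decide) ?_
    simp only [lin, Matrix.cons_val, zero_smul, one_smul]
    grind
  · refine hn ![0, 0, 1, 1] ![1, 1, 0, 1] ![1, 0, 0, 0] ![1, 0, 0, 1] (by decide) (by decide) (by decide) (by decide) ?_
    simp only [lin, Matrix.cons_val, zero_smul, one_smul]
    grind
  · refine hn ![0, 0, 1, 0] ![1, 1, 0, 0] ![1, 0, 0, 0] ![1, 0, 0, 1] (by decide) (by decide) (by decide) (by decide) ?_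
    simp only [lin, Matrix.cons_val, zero_smul, one_smul]
    grind
  · refine hn ![0, 0, 1, 0] ![1, 0, 0, 0] ![1, 0, 1, 0] ![1, 1, 1, 1] (by decide) (by decide) (by decide) (by decide) ?_
    simp only [lin, Matrix.cons_val, zero_smul, one_smul]
    grind
  · refine hn ![0, 0, 1, 0] ![1, 1, 0, 1] ![1, 0, 0, 0] ![1, 0, 0, 1] (by decide) (by decide) (by decide) (by decide) ?_
    simp only [lin, Matrix.cons_val, zero_smul, one_smul]
    grind
  · refine hn ![1, 0, 1, 0] ![1, 1, 1, 0] ![1, 0, 0, 0] ![0, 0, 1, 1] (by decide) (by decide) (by decide) (by decide) ?_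
    simp only [lin, Matrix.cons_val, zero_smul, one_smul]
    grind
  · refine hn ![0, 0, 1, 1] ![1, 1, 0, 0] ![1, 0, 0, 0] ![1, 0, 0, 0] (by decide) (by decide) (by decide) (by decide) ?_
    simp only [lin, Matrix.cons_val, zero_smul, one_smul]
    grind
  · refine hn ![0, 0, 1, 1] ![1, 1, 0, 0] ![1, 0, 0, 1] ![1, 0, 0, 1] (by decide) (by decide) (by decide) (by decide) ?_
    simp only [lin, Matrix.cons_val, zero_smul, one_smul]
    grind
  · refine hn ![0, 0, 1, 1] ![1, 1, 0, 1] ![1, 0, 0, 1] ![1, 0, 0, 1] (by decide) (by decide) (by decide) (by decide) ?_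
    simp only [lin, Matrix.cons_val, zero_smul, one_smul]
    grind
  · refine hn ![0, 0, 1, 1] ![1, 1, 0, 1] ![1, 0, 0, 0] ![1, 0, 0, 0] (by decide) (by decide) (by decide) (by decide) ?_
    simp only [lin, Matrix.cons_val, zero_smul, one_smul]
    grind

end Plane

end CFF

namespace CFF

theorem bsum_mod {R : Type} [CommRing R] [CharP R 2] (ms : List R) (E : ℕ) :
    bsum ms (E % 2 ^ ms.length) = bsum ms E := by
  induction ms generalizing E with
  | nil => rfl
  | cons m ms ih =>
    simp only [bsum, List.length_cons]
    rw [pow_succ', Nat.mod_mul_right_div_self, ih, cast_eq_cast_mod_two (E % _),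
      Nat.mod_mul_right_mod, ← cast_eq_cast_mod_two]

theorem bsum_append_zeros {R : Type} [CommRing R] (ms ms' : List R) (h : ∀ m ∈ ms', m = 0) (E : ℕ) :
    bsum (ms ++ ms') E = bsum ms E := by
  induction ms generalizing E with
  | nil =>
    simp only [List.nil_append, bsum]
    induction ms' generalizing E with
    | nil => rfl
    | cons m ms' ih =>
      rw [bsum, ih (fun x hx => h x (List.mem_cons_of_mem _ hx)), h m List.mem_cons_self]
      simp
  | cons m ms ih => simp only [List.cons_append, bsum, ih]

section Residue

variable {K : Type} [Field K] [Algebra (ZMod 2) K] [FnField (ZMod 2) K]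

theorem residue_eq_zero_iff_mem_fil (P : Pl K) (x : P.1) :
    IsLocalRing.residue P.1 x = 0 ↔ (x : K) ∈ fil P 1 := by
  rw [IsLocalRing.residue_eq_zero_iff, ValuationSubring.valuation_lt_one_iff]
  by_cases hx : (x : K) = 0
  · rw [hx]; simp [AddSubgroup.zero_mem]
  · rw [mem_fil_of_ne hx]
    exact (ord_pos_iff P hx).symm

theorem div_mem_L [Curve K] {b q : K} {P : Pl K} (hb0 : b ≠ 0)
    (hP : pdiv b + canon K = Finsupp.single P 1) {D : Divisor (ZMod 2) K}
    (hq : q ∈ L (D + canon K)) (hqP : q ∈ fil P (1 - (D + canon K) P)) : q / b ∈ L D := by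
  rw [mem_L] at hq ⊢
  intro R
  rw [div_eq_inv_mul, mul_mem_fil_iff (inv_ne_zero hb0), ord_inv]
  have h1 := DFunLike.congr_fun hP R
  have e : (pdiv b + canon K) R = ord R b + canon K R := rfl
  have e' : ∀ R, (D + canon K) R = D R + canon K R := fun _ => rfl
  rw [e] at h1
  by_cases hR : R = P
  · subst hR
    rw [Finsupp.single_eq_same] at h1
    rw [e'] at hqP
    convert hqP using 2
    omega
  · rw [Finsupp.single_eq_of_ne hR] at h1
    have := hq R
    rw [e'] at this
    convert this using 2
    omega

/-- A normal frame seen at the place where its last element vanishes. -/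
theorem NormalFrame.exists_place [SpecialCurve K] {X Z a b : K} (h : NormalFrame X Z a b) :
    ∃ P : Pl K, pdeg P = 6 ∧ (∀ u ∈ Ω K, u / X ∈ fil P 0) ∧
      (∀ u ∈ Ω K, u / X ∈ fil P 1 → u = 0 ∨ u = b) ∧ b / X ∈ fil P 1 ∧
      ∀ q ∈ L (canon K + canon K), q / X ^ 2 ∈ fil P 1 → ∃ w ∈ Ω K, q = b * w := by
  have hb0 : b ≠ 0 := by simpa [lin] using h.ne_zero (p := ![0, 0, 0, 1]) (by decide)
  have hX0 : X ≠ 0 := by simpa [lin] using h.ne_zero (p := ![1, 0, 0, 0]) (by decide)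
  have hXb : X ≠ b := by
    simpa [lin] using h.injective.ne (a₁ := ![1, 0, 0, 0]) (a₂ := ![0, 0, 0, 1]) (by decide)
  obtain ⟨P, hP6, hP⟩ := exists_single_of_mem_Ω h.mem₄ hb0
  have key : ∀ u ∈ Ω K, u ∈ fil P (1 - canon K P) → u = 0 ∨ u = b := by
    intro u hu huP
    have h1 : u / b ∈ L (0 : Divisor (ZMod 2) K) :=
      div_mem_L hb0 hP (by rwa [zero_add]) (by rwa [zero_add])
    rcases mem_L_zero.1 h1 with h1 | h1
    · left
      simpa [hb0] using h1
    · right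
      exact (div_eq_one_iff_eq hb0).1 h1
  have hmem : ∀ u ∈ Ω K, u ∈ fil P (- canon K P) := fun u hu => mem_L.1 hu P
  have hord : ord P X = - canon K P := by
    have h1 := (mem_fil_of_ne hX0).1 (hmem X h.mem₁)
    by_contra hne
    rcases key X h.mem₁ ((mem_fil_of_ne hX0).2 (by omega)) with h2 | h2
    · exact hX0 h2
    · exact hXb h2
  have hordb : ord P b = 1 - canon K P := by
    have h1 := DFunLike.congr_fun hP P
    rw [Finsupp.single_eq_same] at h1
    have e : (pdiv b + canon K) P = ord P b + canon K P := rfl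
    omega
  have hdiv : ∀ (u : K) (n : ℤ), u / X ∈ fil P n ↔ u ∈ fil P (n - canon K P) := by
    intro u n
    rw [div_eq_inv_mul, mul_mem_fil_iff (inv_ne_zero hX0), ord_inv, hord, neg_neg]
  refine ⟨P, hP6, fun u hu => ?_, fun u hu hu1 => ?_, ?_, fun q hq hq1 => ?_⟩
  · rw [hdiv, zero_sub]
    exact hmem u hu
  · exact key u hu ((hdiv u 1).1 hu1)
  · rw [hdiv, mem_fil_of_ne hb0]
    omega
  · refine ⟨q / b, div_mem_L hb0 hP hq ?_, by field_simp⟩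
    rw [div_eq_inv_mul, mul_mem_fil_iff (inv_ne_zero (pow_ne_zero 2 hX0)), ord_inv, ord_pow,
      hord] at hq1
    convert hq1 using 2
    have e : (canon K + canon K) P = canon K P + canon K P := rfl
    rw [e]
    push_cast
    ring

theorem map_cubics {R : Type} [CommRing R] {S : Type} [CommRing S] (φ : R →+* S) (X Z a b : R) :
    (cubics X Z a b).map φ = cubics (φ X) (φ Z) (φ a) (φ b) := by
  simp [cubics]

theorem cubics_eq_map {X : K} (hX : X ≠ 0) (Z a b : K) :
    cubics X Z a b = (cubics 1 (Z / X) (a / X) (b / X)).map (X ^ 3 * ·) := by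
  simp only [cubics, List.map_cons, List.map_nil, List.cons.injEq, and_true]
  refine ⟨?_, ?_, ?_, ?_, ?_, ?_, ?_, ?_, ?_, ?_, ?_, ?_, ?_, ?_, ?_, ?_⟩ <;> field_simp

theorem bsum_cubics_div {X : K} (hX : X ≠ 0) (Z a b : K) (E : ℕ) :
    bsum (cubics X Z a b) E = X ^ 3 * bsum (cubics 1 (Z / X) (a / X) (b / X)) E := by
  rw [cubics_eq_map hX, bsum_map_mul]

theorem IsNormal.mod_mem [SpecialCurve K] {y : K × K × K × K} (h : IsNormal y) {E : ℕ}
    (hE : evc E y = 0) : E % 128 ∈ sextics := by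
  have hswap := h.isom 2
  obtain ⟨X, Z, a, b⟩ := y
  change NormalFrame X Z a b at h
  change NormalFrame Z X a b at hswap
  change bsum (cubics X Z a b) E = 0 at hE
  have hX0 : X ≠ 0 := by simpa [lin] using h.ne_zero (p := ![1, 0, 0, 0]) (by decide)
  obtain ⟨P, hP6, h0, h1, hb, h2⟩ := h.exists_place
  letI := (residueHom (ZMod 2) P).toAlgebra
  haveI : CharP (IsLocalRing.ResidueField P.1) 2 :=
    charP_of_injective_algebraMap (algebraMap (ZMod 2) _).injective 2
  have hfin : Module.finrank (ZMod 2) (IsLocalRing.ResidueField P.1) = 6 := hP6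
  set A : P.1 := ⟨a / X, mem_fil_zero.1 (h0 a h.mem₃)⟩ with hA
  set B : P.1 := ⟨b / X, mem_fil_zero.1 (h0 b h.mem₄)⟩ with hB
  set C : P.1 := ⟨Z / X, mem_fil_zero.1 (h0 Z h.mem₂)⟩ with hC
  have hCrel : C = A ^ 2 + A * B + B ^ 2 := by
    apply Subtype.ext
    change Z / X = (a / X) ^ 2 + (a / X) * (b / X) + (b / X) ^ 2
    field_simp
    linear_combination h.rel
  have hρB : IsLocalRing.residue P.1 B = 0 := (residue_eq_zero_iff_mem_fil P B).2 hb
  set z := IsLocalRing.residue P.1 A with hz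
  have hρC : IsLocalRing.residue P.1 C = z ^ 2 := by
    rw [hCrel]
    simp [hρB, hz]
  have hlin : ∀ p : Fin 4 → ZMod 2, p ≠ 0 → p ≠ ![0, 0, 0, 1] →
      ¬ lin X Z a b p / X ∈ fil P 1 := by
    intro p hp hpb hmem
    rcases h1 _ (lin_mem h.toIsFrame p) hmem with h3 | h3
    · exact h.ne_zero hp h3
    · refine hpb (h.injective ?_)
      simpa [lin] using h3
  have h2mul : ∀ {u v : K}, u ∈ Ω K → v ∈ Ω K → u * v ∈ L (canon K + canon K) := mul_mem_L
  refine mem_sextics (z := z) hfin ?_ ?_ ?_ ?_ ?_ (Nat.mod_lt _ (by norm_num)) ?_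
  · intro h3
    refine hlin ![0, 0, 1, 0] (by decide) (by decide) ?_
    simpa [lin] using (residue_eq_zero_iff_mem_fil P A).1 h3
  · intro h3
    refine hlin ![1, 0, 1, 0] (by decide) (by decide) ?_
    have h4 := (residue_eq_zero_iff_mem_fil P (A + 1)).1 (by rw [map_add, map_one]; exact h3)
    convert h4 using 1
    change _ = a / X + 1
    simp only [lin, Matrix.cons_val, zero_smul, one_smul]
    field_simp
    ring
  · intro h3
    refine hlin ![1, 1, 1, 0] (by decide) (by decide) ?_
    have h4 := (residue_eq_zero_iff_mem_fil P (C + A + 1)).1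
      (by rw [map_add, map_add, map_one, hρC]; exact h3)
    convert h4 using 1
    change _ = Z / X + a / X + 1
    simp only [lin, Matrix.cons_val, zero_smul, one_smul]
    field_simp
    ring
  · intro h3
    have h4 := (residue_eq_zero_iff_mem_fil P (A * C + A + 1)).1
      (by rw [map_add, map_add, map_mul, map_one, hρC]; linear_combination h3)
    obtain ⟨w, hw, he⟩ := h2 (a * Z + a * X + X ^ 2)
      (add_mem (add_mem (h2mul h.mem₃ h.mem₂) (h2mul h.mem₃ h.mem₁))
        (by rw [sq]; exact h2mul h.mem₁ h.mem₁))
      (by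
        convert h4 using 1
        change _ = a / X * (Z / X) + a / X + 1
        field_simp)
    exact h.quadric_ne_mul hw he
  · intro h3
    have h4 := (residue_eq_zero_iff_mem_fil P (A * C + A + C ^ 2)).1
      (by rw [map_add, map_add, map_mul, map_pow, hρC]; linear_combination z * h3)
    obtain ⟨w, hw, he⟩ := h2 (a * X + a * Z + Z ^ 2)
      (add_mem (add_mem (h2mul h.mem₃ h.mem₁) (h2mul h.mem₃ h.mem₂))
        (by rw [sq]; exact h2mul h.mem₂ h.mem₂))
      (by
        convert h4 using 1
        change _ = a / X * (Z / X) + a / X + (Z / X) ^ 2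
        field_simp
        ring)
    exact hswap.quadric_ne_mul hw he
  · rw [bsum_cubics_div hX0] at hE
    have h3 := (mul_eq_zero.1 hE).resolve_left (pow_ne_zero 3 hX0)
    have h4 : bsum (cubics 1 C A B) E = 0 := by
      apply Subtype.ext
      have := map_bsum P.1.subtype (cubics 1 C A B) E
      rw [map_cubics, map_one] at this
      exact this.trans h3
    have h5 := map_bsum (IsLocalRing.residue P.1) (cubics 1 C A B) E
    rw [h4, map_zero, map_cubics, map_one, hρC, hρB] at h5
    have h6 := bsum_mod (powers z) E
    refine h6.trans (Eq.trans ?_ h5.symm)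
    rw [← bsum_append_zeros (powers z) [0, 0, 0, 0, 0, 0, 0, 0, 0] (by simp)]
    congr 1
    simp only [powers, cubics, List.cons_append, List.nil_append, List.cons.injEq, and_true]
    refine ⟨?_, ?_, ?_, ?_, ?_, ?_, ?_, ?_, ?_, ?_, ?_, ?_, ?_, ?_, ?_, ?_⟩ <;> ring

end Residue

end CFF

namespace CFF

section Orbit

variable {K : Type} [Field K] [Algebra (ZMod 2) K] [FnField (ZMod 2) K]

/-- The action of a word in the four involutions on normal frames. -/
def isoms (w : List (Fin 4)) (y : K × K × K × K) : K × K × K × K :=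
  w.foldl (fun y k => isom k y) y

/-- The action of a word in the four involutions on cubic forms. -/
def acts (w : List (Fin 4)) (E : ℕ) : ℕ := w.foldl (fun E k => act (isomMatrix k) E) E

theorem IsNormal.isoms [Curve K] {y : K × K × K × K} (h : IsNormal y) (w : List (Fin 4)) :
    IsNormal (isoms w y) := by
  induction w generalizing y with
  | nil => exact h
  | cons k w ih => exact ih (h.isom k)

theorem IsNormal.evc_isoms [Curve K] {y : K × K × K × K} (h : IsNormal y) (w : List (Fin 4))
    (E : ℕ) : evc (acts w E) (CFF.isoms w y) = evc E y := by
  induction w generalizing y E with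
  | nil => rfl
  | cons k w ih => exact (ih (h.isom k) _).trans (h.evc_isom k E)

/-- Words whose images of a cubic form of a curve with class number one are tested for places of
degree six. -/
def testWords : List (List (Fin 4)) :=
  [[0], [1, 0], [3, 0], [0, 3, 0], [1, 3, 0], [2, 3, 0], [0, 2, 3, 0], [1, 2, 3, 0], [3, 0, 2, 3, 0]]

/-- Words carrying the admissible cubic forms to one of them. -/
def orbitWords : List (List (Fin 4)) :=
  [[], [0], [1], [2], [3], [1, 0], [3, 0], [0, 1], [2, 1], [3, 1], [3, 2], [0, 1, 0], [3, 1, 0],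
    [0, 3, 0], [2, 3, 0], [2, 0, 1], [3, 0, 1], [0, 3, 1], [0, 3, 2], [3, 0, 1, 0], [0, 3, 1, 0],
    [1, 0, 3, 0], [0, 3, 0, 1], [3, 0, 3, 1]]

theorem exists_orbitWord {E : ℕ} (hE : E < 65536) (h0 : E ≠ 0) (hs : E % 128 ∈ sextics)
    (hw : ∀ w ∈ testWords, acts w E % 128 ∈ sextics) : ∃ w ∈ orbitWords, acts w E = 47945 := by
  have key : (sextics.all fun s => (List.range 512).all fun m =>
      !(testWords.all fun w => sextics.contains (acts w (s + 128 * m) % 128)) ||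
        (s + 128 * m == 0 || orbitWords.any fun w => acts w (s + 128 * m) == 47945)) = true := by
    decide +kernel
  rw [List.all_eq_true] at key
  have key := List.all_eq_true.1 (key _ hs) (E / 128) (List.mem_range.2 (by omega))
  rw [Nat.mod_add_div, Bool.or_eq_true, Bool.or_eq_true, List.any_eq_true] at key
  simp only [Bool.not_eq_true', beq_iff_eq] at key
  rcases key with key | key | key
  · exfalso
    rw [List.all_eq_false] at key
    obtain ⟨w, hwt, hn⟩ := key
    exact hn (List.contains_iff_mem.2 (hw w hwt))
  · exact absurd key h0
  · exact key

theorem exists_normal_evc_eq_zero [SpecialCurve K] :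
    ∃ y : K × K × K × K, IsNormal y ∧ evc 47945 y = 0 := by
  obtain ⟨X, Z, a, b, h⟩ := exists_normalFrame (K := K)
  have hX := h.mem₁
  have hZ := h.mem₂
  have ha := h.mem₃
  have hb := h.mem₄
  have hmem : ∀ {u v w : K}, u ∈ Ω K → v ∈ Ω K → w ∈ Ω K → u * v * w ∈ L (3 • canon K) := by
    intro u v w hu hv hw
    rw [show 3 • canon K = canon K + canon K + canon K by abel]
    exact mul_mem_L (mul_mem_L hu hv) hw
  obtain ⟨E, hlt, hE0, hE⟩ := exists_bsum_eq_zero (D := 3 • canon K) (ms := cubics X Z a b) (by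
    intro m hm
    simp only [cubics, List.mem_cons, List.not_mem_nil, or_false] at hm
    rcases hm with rfl | rfl | rfl | rfl | rfl | rfl | rfl | rfl | rfl | rfl | rfl | rfl | rfl |
      rfl | rfl | rfl <;> try simp only [pow_succ, pow_zero, one_mul, ← mul_assoc]
    all_goals apply hmem <;> assumption) (by rw [rr_nsmul_canon (by norm_num)]; simp [cubics])
  have hy : IsNormal (X, Z, a, b) := h
  have hE : evc E (X, Z, a, b) = 0 := hE
  obtain ⟨w, -, hw⟩ := exists_orbitWord (by simpa [cubics] using hlt) hE0 (hy.mod_mem hE)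
    (fun w _ => (hy.isoms w).mod_mem (by rw [hy.evc_isoms, hE]))
  exact ⟨CFF.isoms w (X, Z, a, b), hy.isoms w, by rw [← hw, hy.evc_isoms, hE]⟩

end Orbit

end CFF

namespace CFF

section Form

open Polynomial

/-- The dehomogenised cubic form of the curve, in which the quadratic relation has been used to
eliminate one coordinate. -/
def sexticForm {R : Type} [CommRing R] (t Y : R) : R :=
  (Y ^ 2 + Y * t + t ^ 2) ^ 3 + (Y ^ 2 + Y * t + t ^ 2) ^ 2 * t + Y ^ 3 + t ^ 3 + Y * t ^ 2 +
    Y ^ 2 * t + t ^ 2 + Y * t + 1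

theorem map_sexticForm {R S : Type} [CommRing R] [CommRing S] (φ : R →+* S) (t Y : R) :
    φ (sexticForm t Y) = sexticForm (φ t) (φ Y) := by
  simp [sexticForm]

theorem sexticForm_zero {R : Type} [CommRing R] (Y : R) : sexticForm 0 Y = Y ^ 6 + Y ^ 3 + 1 := by
  simp only [sexticForm]
  ring

theorem irreducible_X_pow_six_add : Irreducible (X ^ 6 + X ^ 3 + 1 : (ZMod 2)[X]) := by
  have hd : (X ^ 6 + X ^ 3 + 1 : (ZMod 2)[X]).natDegree = 6 := by compute_degree!
  have hm : (X ^ 6 + X ^ 3 + 1 : (ZMod 2)[X]).Monic := by monicity!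
  have h1 : (X ^ 6 + X ^ 3 + 1 : (ZMod 2)[X]) ≠ 1 := by
    intro h
    rw [h, natDegree_one] at hd
    norm_num at hd
  rw [hm.irreducible_iff_lt_natDegree_lt h1, hd]
  intro q hq hqd hdvd
  rw [Finset.mem_Ioc] at hqd
  obtain ⟨hq0, hq3⟩ := hqd
  have hdeg : q.degree ≠ 0 := (natDegree_pos_iff_degree_pos.1 hq0).ne'
  obtain ⟨z, hz⟩ := IsAlgClosed.exists_aeval_eq_zero (AlgebraicClosure (ZMod 2)) q hdeg
  have hz6 : z ^ 6 + z ^ 3 + 1 = 0 := by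
    have h := aeval_eq_zero_of_dvd_aeval_eq_zero hdvd hz
    simpa using h
  haveI : CharP (AlgebraicClosure (ZMod 2)) 2 :=
    charP_of_injective_algebraMap (algebraMap (ZMod 2) _).injective 2
  rw [aeval_eq_sum_range] at hz
  have hlead : q.coeff q.natDegree = 1 := hq
  clear hdvd hdeg hq hd hm h1
  generalize q.natDegree = d at *
  have hd : d = 1 ∨ d = 2 ∨ d = 3 := by omega
  rcases hd with rfl | rfl | rfl <;> simp only [Finset.sum_range_succ, Finset.sum_range_zero,
    hlead, one_smul, pow_zero, pow_one, zero_add] at hz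
  · rcases zmod_two_cases (q.coeff 0) with h | h <;> rw [h] at hz <;>
      simp only [zero_smul, one_smul, zero_add] at hz <;> grind
  · rcases zmod_two_cases (q.coeff 0) with h | h <;> rcases zmod_two_cases (q.coeff 1) with h' | h' <;>
      rw [h, h'] at hz <;>
      simp only [zero_smul, one_smul, zero_add] at hz <;> grind
  · rcases zmod_two_cases (q.coeff 0) with h | h <;> rcases zmod_two_cases (q.coeff 1) with h' | h' <;>
      rcases zmod_two_cases (q.coeff 2) with h'' | h'' <;>
      rw [h, h', h''] at hz <;>
      simp only [zero_smul, one_smul, zero_add] at hz <;> grind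

theorem monic_sexticForm {R : Type} [CommRing R] [Nontrivial R] (t : R) :
    (sexticForm (C t) X).Monic ∧ (sexticForm (C t) X).natDegree = 6 := by
  have hd : (sexticForm (C t) X).natDegree = 6 := by
    rw [sexticForm]
    compute_degree!
  refine ⟨?_, hd⟩
  rw [sexticForm]
  monicity!

/-- The equation of the curve over the rational function field. -/
def curvePoly : (RatFunc (ZMod 2))[X] := sexticForm (C RatFunc.X) X

theorem natDegree_curvePoly : curvePoly.natDegree = 6 := (monic_sexticForm _).2

theorem irreducible_curvePoly : Irreducible curvePoly := by
  have h1 : Irreducible (sexticForm (C (X : (ZMod 2)[X])) X) := by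
    refine (monic_sexticForm _).1.irreducible_of_irreducible_map (evalRingHom (0 : ZMod 2)) _ ?_
    rw [← coe_mapRingHom, map_sexticForm]
    simp only [coe_mapRingHom, map_C, map_X, coe_evalRingHom, eval_X, map_zero, sexticForm_zero]
    exact irreducible_X_pow_six_add
  rw [(monic_sexticForm _).1.irreducible_iff_irreducible_map_fraction_map
    (K := RatFunc (ZMod 2)), ← coe_mapRingHom, map_sexticForm] at h1
  simp only [coe_mapRingHom, map_C, map_X, RatFunc.algebraMap_X] at h1
  exact h1

theorem adjoinRoot_hom_ext {S : Type} [Field S] {p : (RatFunc (ZMod 2))[X]}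
    {f g : AdjoinRoot p →+* S} (h₁ : f (AdjoinRoot.root p) = g (AdjoinRoot.root p))
    (h₂ : f (AdjoinRoot.of p RatFunc.X) = g (AdjoinRoot.of p RatFunc.X)) : f = g := by
  have h3 : f.comp (AdjoinRoot.of p) = g.comp (AdjoinRoot.of p) := by
    refine IsLocalization.ringHom_ext (nonZeroDivisors (ZMod 2)[X]) ?_
    refine Polynomial.ringHom_ext' (Subsingleton.elim _ _) ?_
    simpa using h₂
  have h4 : f.comp (AdjoinRoot.mk p) = g.comp (AdjoinRoot.mk p) := by
    refine Polynomial.ringHom_ext' ?_ ?_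
    · exact h3
    · exact h₁
  refine RingHom.ext fun x => ?_
  induction x using AdjoinRoot.induction_on with
  | ih q => exact RingHom.congr_fun h4 q

end Form

section Model

variable {K : Type} [Field K] [Algebra (ZMod 2) K] [FnField (ZMod 2) K]

theorem exists_bijective_adjoinRoot {t y : K} (ht : t ∉ (algebraMap (ZMod 2) K).range)
    (hd : deg (zdiv t) = 6) (hy : sexticForm t y = 0) :
    ∃ φ : AdjoinRoot curvePoly →+* K, Function.Bijective φ ∧
      φ (AdjoinRoot.root curvePoly) = y ∧ φ (AdjoinRoot.of curvePoly RatFunc.X) = t := by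
  have hinj : Function.Injective (Polynomial.aeval (R := ZMod 2) t) :=
    transcendental_iff_injective.1 (FnField.transcendental t ht)
  let ι : RatFunc (ZMod 2) →ₐ[ZMod 2] K := IsFractionRing.liftAlgHom hinj
  have hι : ι RatFunc.X = t := by
    rw [← RatFunc.algebraMap_X]
    have := IsFractionRing.lift_algebraMap (K := RatFunc (ZMod 2)) hinj Polynomial.X
    refine Eq.trans this ?_
    simp
  letI := ι.toRingHom.toAlgebra
  haveI : IsScalarTower (ZMod 2) (RatFunc (ZMod 2)) K :=
    IsScalarTower.of_algebraMap_eq fun c => (ι.commutes c).symm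
  have hfin : Module.finrank (RatFunc (ZMod 2)) K = 6 := by
    rw [← finrank_adjoin_algebraMap_X]
    have h1 : algebraMap (RatFunc (ZMod 2)) K RatFunc.X = t := hι
    rw [h1]
    rw [deg_zdiv ht] at hd
    exact_mod_cast hd
  haveI : Fact (Irreducible curvePoly) := ⟨irreducible_curvePoly⟩
  have hev : curvePoly.eval₂ (algebraMap (RatFunc (ZMod 2)) K) y = 0 := by
    have := map_sexticForm (Polynomial.eval₂RingHom (algebraMap (RatFunc (ZMod 2)) K) y)
      (Polynomial.C RatFunc.X) Polynomial.X
    simp only [Polynomial.coe_eval₂RingHom, Polynomial.eval₂_C, Polynomial.eval₂_X] at this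
    refine this.trans ?_
    rw [show algebraMap (RatFunc (ZMod 2)) K RatFunc.X = t from hι, hy]
  let φ : AdjoinRoot curvePoly →ₐ[RatFunc (ZMod 2)] K :=
    AdjoinRoot.liftAlgHom curvePoly (Algebra.ofId _ _) y hev
  have hφi : Function.Injective φ := φ.toRingHom.injective
  have hfin' : Module.finrank (RatFunc (ZMod 2)) (AdjoinRoot curvePoly) = 6 := by
    rw [(AdjoinRoot.powerBasis irreducible_curvePoly.ne_zero).finrank, AdjoinRoot.powerBasis_dim,
      natDegree_curvePoly]
  haveI : Module.Finite (RatFunc (ZMod 2)) K := Module.finite_of_finrank_pos (by omega)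
  haveI : Module.Finite (RatFunc (ZMod 2)) (AdjoinRoot curvePoly) :=
    Module.finite_of_finrank_pos (by omega)
  have hφs : Function.Surjective φ :=
    (LinearMap.injective_iff_surjective_of_finrank_eq_finrank (f := φ.toLinearMap)
      (hfin'.trans hfin.symm)).1 hφi
  refine ⟨φ.toRingHom, ⟨hφi, hφs⟩, ?_, ?_⟩
  · exact AdjoinRoot.lift_root (f := curvePoly) (i := algebraMap (RatFunc (ZMod 2)) K) hev
  · exact (AdjoinRoot.lift_of (f := curvePoly) (i := algebraMap (RatFunc (ZMod 2)) K) hev).trans hι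

end Model

end CFF

namespace CFF

section Automorphism

variable {K : Type} [Field K] [Algebra (ZMod 2) K] [FnField (ZMod 2) K]

theorem deg_zdiv_div [SpecialCurve K] {x y : K} (hx : x ∈ Ω K) (hy : y ∈ Ω K) (hx0 : x ≠ 0)
    (hy0 : y ≠ 0) (hne : x ≠ y) : deg (zdiv (x / y)) = 6 := by
  obtain ⟨P, hP6, hP⟩ := exists_single_of_mem_Ω hx hx0
  obtain ⟨Q, -, hQ⟩ := exists_single_of_mem_Ω hy hy0
  have hPQ : P ≠ Q := by
    rintro rfl
    exact hne (eq_of_pdiv_eq hx0 hy0 (add_right_cancel (hP.trans hQ.symm)))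
  have h : zdiv (x / y) = Finsupp.single P 1 := by
    ext R
    rw [zdiv_apply, ord_div _ hx0 hy0]
    have h1 : ord R x + canon K R = Finsupp.single P (1 : ℤ) R := DFunLike.congr_fun hP R
    have h2 : ord R y + canon K R = Finsupp.single Q (1 : ℤ) R := DFunLike.congr_fun hQ R
    by_cases h3 : R = P
    · subst h3
      rw [Finsupp.single_eq_same] at h1 ⊢
      rw [Finsupp.single_eq_of_ne hPQ] at h2
      omega
    · rw [Finsupp.single_eq_of_ne h3] at h1 ⊢
      by_cases h4 : R = Q
      · subst h4
        rw [Finsupp.single_eq_same] at h2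
        omega
      · rw [Finsupp.single_eq_of_ne h4] at h2
        omega
  rw [h, deg_single_one, hP6]
  rfl

theorem div_notMem_range {x y : K} (hx0 : x ≠ 0) (hy0 : y ≠ 0) (hne : x ≠ y) :
    x / y ∉ (algebraMap (ZMod 2) K).range := by
  rintro ⟨c, hc⟩
  rcases zmod_two_cases c with rfl | rfl
  · rw [map_zero] at hc
    exact div_ne_zero hx0 hy0 hc.symm
  · rw [map_one] at hc
    exact hne ((div_eq_one_iff_eq hy0).1 hc.symm)

theorem NormalFrame.exists_bijective_adjoinRoot [SpecialCurve K] {X Z a b : K}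
    (h : NormalFrame X Z a b) (hE : evc 47945 (X, Z, a, b) = 0) :
    ∃ φ : AdjoinRoot curvePoly →+* K, Function.Bijective φ ∧
      φ (AdjoinRoot.root curvePoly) = a / X ∧ φ (AdjoinRoot.of curvePoly RatFunc.X) = b / X := by
  have hb0 : b ≠ 0 := by simpa [lin] using h.ne_zero (p := ![0, 0, 0, 1]) (by decide)
  have hX0 : X ≠ 0 := by simpa [lin] using h.ne_zero (p := ![1, 0, 0, 0]) (by decide)
  have hbX : b ≠ X := by
    simpa [lin] using h.injective.ne (a₁ := ![0, 0, 0, 1]) (a₂ := ![1, 0, 0, 0]) (by decide)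
  refine CFF.exists_bijective_adjoinRoot (div_notMem_range hb0 hX0 hbX)
    (deg_zdiv_div h.mem₄ h.mem₁ hb0 hX0 hbX) ?_
  change bsum (cubics X Z a b) 47945 = 0 at hE
  rw [bsum_cubics_div hX0] at hE
  have h1 := (mul_eq_zero.1 hE).resolve_left (pow_ne_zero 3 hX0)
  have h2 : Z / X = (a / X) ^ 2 + (a / X) * (b / X) + (b / X) ^ 2 := by
    field_simp
    linear_combination h.rel
  rw [h2] at h1
  generalize a / X = y at *
  generalize b / X = t at *
  simp only [cubics, bsum, Nat.reduceDiv, Nat.cast_ofNat, Nat.cast_zero, Nat.cast_one] at h1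
  clear hE h2 h
  simp only [sexticForm]
  grind

theorem NormalFrame.exists_automorphism [SpecialCurve K] {X Z a b : K}
    (h : NormalFrame X Z a b) (hE : evc 47945 (X, Z, a, b) = 0) :
    ∃ τ : K ≃+* K, τ (a / X) = (Z + b) / Z ∧ τ (b / X) = a / Z ∧
      ∀ f : K →+* K, f (a / X) = a / X → f (b / X) = b / X → f = RingHom.id K := by
  have hy : IsNormal (X, Z, a, b) := h
  have h' := hy.isoms [0, 2, 3]
  have hE' := hy.evc_isoms [0, 2, 3] 47945
  rw [hE, show acts [0, 2, 3] 47945 = 47945 by decide +kernel] at hE'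
  change NormalFrame Z (X + Z + a) (b + Z) a at h'
  change evc 47945 (Z, X + Z + a, b + Z, a) = 0 at hE'
  obtain ⟨φ, hφ, h1, h2⟩ := h.exists_bijective_adjoinRoot hE
  obtain ⟨φ', hφ', h1', h2'⟩ := h'.exists_bijective_adjoinRoot hE'
  refine ⟨(RingEquiv.ofBijective φ hφ).symm.trans (RingEquiv.ofBijective φ' hφ'), ?_, ?_, ?_⟩
  · rw [← h1, add_comm Z, ← h1']
    exact congrArg φ' ((RingEquiv.ofBijective φ hφ).symm_apply_apply _)
  · rw [← h2, ← h2']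
    exact congrArg φ' ((RingEquiv.ofBijective φ hφ).symm_apply_apply _)
  · intro f hf1 hf2
    have h3 : f.comp φ = φ := adjoinRoot_hom_ext (by simp [h1, hf1]) (by simp [h2, hf2])
    ext x
    obtain ⟨u, rfl⟩ := hφ.2 x
    exact RingHom.congr_fun h3 u

theorem exists_automorphism [SpecialCurve K] : ∃ τ : K ≃+* K, (∀ x, τ (τ (τ (τ (τ x)))) = x) ∧
    ∃ x, τ x ≠ x := by
  obtain ⟨⟨X, Z, a, b⟩, h, hE⟩ := exists_normal_evc_eq_zero (K := K)
  change NormalFrame X Z a b at h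
  obtain ⟨τ, h1, h2, h3⟩ := h.exists_automorphism hE
  have hX0 : X ≠ 0 := by simpa [lin] using h.ne_zero (p := ![1, 0, 0, 0]) (by decide)
  have hZ0 : Z ≠ 0 := by simpa [lin] using h.ne_zero (p := ![0, 1, 0, 0]) (by decide)
  have n1 : X + Z + a ≠ 0 := by simpa [lin] using h.ne_zero (p := ![1, 1, 1, 0]) (by decide)
  have n2 : X + Z + a + b ≠ 0 := by simpa [lin] using h.ne_zero (p := ![1, 1, 1, 1]) (by decide)
  have n3 : X + Z + b ≠ 0 := by simpa [lin] using h.ne_zero (p := ![1, 1, 0, 1]) (by decide)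
  have c2 : (2 : K) = 0 := CharTwo.two_eq_zero
  have hζ : Z / X = (a / X) ^ 2 + (a / X) * (b / X) + (b / X) ^ 2 := by
    field_simp
    linear_combination h.rel
  have hτζ : τ (Z / X) = (X + Z + a) / Z := by
    rw [hζ]
    simp only [map_add, map_mul, map_pow, h1, h2]
    field_simp
    linear_combination -h.rel + (Z * b) * c2
  have hl : ∀ p, τ (lin X Z a b p / X) = lin Z (X + Z + a) (Z + b) a p / Z := by
    intro p
    have e : lin X Z a b p / X = lin 1 (Z / X) (a / X) (b / X) p := by
      simp only [lin, Algebra.smul_def]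
      field_simp
    rw [e]
    simp only [lin]
    rcases zmod_two_cases (p 0) with e0 | e0 <;> rcases zmod_two_cases (p 1) with e1 | e1 <;>
      rcases zmod_two_cases (p 2) with e2 | e2 <;> rcases zmod_two_cases (p 3) with e3 | e3 <;>
      simp only [e0, e1, e2, e3, zero_smul, one_smul, map_add, map_zero, map_one, h1, h2, hτζ] <;>
      field_simp <;> ring
  have hq : ∀ {u v u' v' : K} (p q : Fin 4 → ZMod 2), lin X Z a b p = u → lin X Z a b q = v →
      lin Z (X + Z + a) (Z + b) a p = u' → lin Z (X + Z + a) (Z + b) a q = v' →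
      τ (u / v) = u' / v' := by
    rintro _ _ _ _ p q rfl rfl rfl rfl
    rw [← div_div_div_cancel_right₀ hX0, map_div₀, hl, hl, div_div_div_cancel_right₀ hZ0]
  have s0 : τ (a / X) = (Z + b) / Z := by
    refine hq ![0, 0, 1, 0] ![1, 0, 0, 0] ?_ ?_ ?_ ?_ <;>
      simp only [lin, Matrix.cons_val, zero_smul, one_smul] <;> grind
  have s1 : τ ((Z + b) / Z) = (X + Z) / (X + Z + a) := by
    refine hq ![0, 1, 0, 1] ![0, 1, 0, 0] ?_ ?_ ?_ ?_ <;>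
      simp only [lin, Matrix.cons_val, zero_smul, one_smul] <;> grind
  have s2 : τ ((X + Z) / (X + Z + a)) = (X + a) / (X + Z + a + b) := by
    refine hq ![1, 1, 0, 0] ![1, 1, 1, 0] ?_ ?_ ?_ ?_ <;>
      simp only [lin, Matrix.cons_val, zero_smul, one_smul] <;> grind
  have s3 : τ ((X + a) / (X + Z + a + b)) = b / (X + Z + b) := by
    refine hq ![1, 0, 1, 0] ![1, 1, 1, 1] ?_ ?_ ?_ ?_ <;>
      simp only [lin, Matrix.cons_val, zero_smul, one_smul] <;> grind
  have s4 : τ (b / (X + Z + b)) = a / X := by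
    refine hq ![0, 0, 0, 1] ![1, 1, 0, 1] ?_ ?_ ?_ ?_ <;>
      simp only [lin, Matrix.cons_val, zero_smul, one_smul] <;> grind
  have s5 : τ (b / X) = a / Z := by
    refine hq ![0, 0, 0, 1] ![1, 0, 0, 0] ?_ ?_ ?_ ?_ <;>
      simp only [lin, Matrix.cons_val, zero_smul, one_smul] <;> grind
  have s6 : τ (a / Z) = (Z + b) / (X + Z + a) := by
    refine hq ![0, 0, 1, 0] ![0, 1, 0, 0] ?_ ?_ ?_ ?_ <;>
      simp only [lin, Matrix.cons_val, zero_smul, one_smul] <;> grind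
  have s7 : τ ((Z + b) / (X + Z + a)) = (X + Z) / (X + Z + a + b) := by
    refine hq ![0, 1, 0, 1] ![1, 1, 1, 0] ?_ ?_ ?_ ?_ <;>
      simp only [lin, Matrix.cons_val, zero_smul, one_smul] <;> grind
  have s8 : τ ((X + Z) / (X + Z + a + b)) = (X + a) / (X + Z + b) := by
    refine hq ![1, 1, 0, 0] ![1, 1, 1, 1] ?_ ?_ ?_ ?_ <;>
      simp only [lin, Matrix.cons_val, zero_smul, one_smul] <;> grind
  have s9 : τ ((X + a) / (X + Z + b)) = b / X := by
    refine hq ![1, 0, 1, 0] ![1, 1, 0, 1] ?_ ?_ ?_ ?_ <;>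
      simp only [lin, Matrix.cons_val, zero_smul, one_smul] <;> grind
  refine ⟨τ, fun x => ?_, b / X, ?_⟩
  · let f : K →+* K := ((((τ : K →+* K).comp (τ : K →+* K)).comp (τ : K →+* K)).comp
      (τ : K →+* K)).comp (τ : K →+* K)
    refine RingHom.congr_fun (h3 f ?_ ?_) x
    · change τ (τ (τ (τ (τ (a / X))))) = a / X
      rw [s0, s1, s2, s3, s4]
    · change τ (τ (τ (τ (τ (b / X))))) = b / X
      rw [s5, s6, s7, s8, s9]
  · rw [h2]
    intro h4
    refine h.mul_ne_mul ![1, 0, 0, 0] ![0, 0, 1, 0] ![0, 1, 0, 0] ![0, 0, 0, 1] (by decide)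
      (by decide) (by decide) (by decide) ?_
    simp only [lin, Matrix.cons_val, zero_smul, one_smul]
    field_simp at h4
    linear_combination h4

end Automorphism

end CFF

namespace CFF

section Comap

variable {k L : Type} [Field k] [Algebra (ZMod 2) k] [FnField (ZMod 2) k]
  [Field L] [Algebra (ZMod 2) L] [FnField (ZMod 2) L]

/-- The restriction of a place along a homomorphism of fields. -/
def Place.comap (φ : k →+* L) (P : Pl L) (h : P.1.comap φ ≠ ⊤) : Pl k :=
  ⟨P.1.comap φ, h, fun c => by
    have h1 : φ.comp (algebraMap (ZMod 2) k) = algebraMap (ZMod 2) L := Subsingleton.elim _ _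
    change φ.comp (algebraMap (ZMod 2) k) c ∈ P.1
    rw [h1]
    exact P.2.2 c⟩

theorem exists_ord_comap {φ : k →+* L} {P : Pl L} {p : Pl k} (h : P.1.comap φ = p.1) :
    ∃ e : ℕ, 0 < e ∧ ∀ x, ord P (φ x) = e * ord p x := by
  have hmem : ∀ x, φ x ∈ P.1 ↔ x ∈ p.1 := fun x => by rw [← h]; rfl
  have h0 : ∀ x : k, x ≠ 0 → (0 ≤ ord P (φ x) ↔ 0 ≤ ord p x) := fun x hx => by
    rw [← mem_iff_ord P ((_root_.map_ne_zero φ).2 hx), ← mem_iff_ord p hx, hmem]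
  obtain ⟨t, ht0, ht⟩ := exists_ord_eq p 1
  have hunit : ∀ x : k, x ≠ 0 → ord p x = 0 → ord P (φ x) = 0 := fun x hx h1 => by
    have h2 := (h0 x hx).2 (by omega)
    have h3 := (h0 x⁻¹ (inv_ne_zero hx)).2 (by rw [ord_inv]; omega)
    rw [map_inv₀, ord_inv] at h3
    omega
  have ht0' : φ t ≠ 0 := (_root_.map_ne_zero φ).2 ht0
  have key : ∀ x : k, x ≠ 0 → ord P (φ x) = ord p x * ord P (φ t) := fun x hx => by
    have hx' : φ x ≠ 0 := (_root_.map_ne_zero φ).2 hx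
    obtain ⟨n, hn | hn⟩ := Int.eq_nat_or_neg (ord p x)
    · have h1 := hunit (x * (t ^ n)⁻¹) (by simp [*]) (by
        rw [ord_mul p hx (by simp [*]), ord_inv, ord_pow, ht, hn]
        ring)
      rw [map_mul, map_inv₀, map_pow, ord_mul P hx' (by simp [*]), ord_inv, ord_pow] at h1
      rw [hn]
      linarith
    · have h1 := hunit (x * t ^ n) (by simp [*]) (by
        rw [ord_mul p hx (by simp [*]), ord_pow, ht, hn]
        ring)
      rw [map_mul, map_pow, ord_mul P hx' (by simp [*]), ord_pow] at h1
      rw [hn]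
      linarith
  have hpos : 0 < ord P (φ t) := by
    have h1 := (h0 t ht0).2 (by omega)
    have h2 := (h0 t⁻¹ (inv_ne_zero ht0)).not.2 (by rw [ord_inv]; omega)
    rw [map_inv₀, ord_inv] at h2
    omega
  refine ⟨(ord P (φ t)).toNat, by omega, fun x => ?_⟩
  rw [Int.toNat_of_nonneg hpos.le]
  by_cases hx : x = 0
  · rw [hx, map_zero, ord_zero, ord_zero, mul_zero]
  · rw [key x hx, mul_comm]

theorem mem_fil_comap {φ : k →+* L} {P : Pl L} {p : Pl k} (h : P.1.comap φ = p.1) {x : k} :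
    φ x ∈ fil P 1 ↔ x ∈ fil p 1 := by
  obtain ⟨e, he, hord⟩ := exists_ord_comap h
  by_cases hx : x = 0
  · simp [hx, zero_mem]
  rw [mem_fil_of_ne hx, mem_fil_of_ne ((_root_.map_ne_zero φ).2 hx), hord]
  have h1 : (0 : ℤ) < e := by exact_mod_cast he
  constructor
  · intro h2
    have := (mul_pos_iff_of_pos_left h1).1 (show 0 < (e : ℤ) * ord p x by omega)
    omega
  · intro h2
    have := mul_pos h1 (show 0 < ord p x by omega)
    omega

theorem pdeg_dvd_pdeg {φ : k →+* L} {P : Pl L} {p : Pl k} (h : P.1.comap φ = p.1) :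
    pdeg p ∣ pdeg P := by
  refine pdeg_dvd_of fun u hu => ?_
  rw [← mem_fil_comap h, map_sub, map_pow]
  refine pow_card_residue_sub_mem P ?_
  rw [mem_fil_zero, ← h] at hu
  exact hu

theorem comap_ne_top_of_isIntegral {φ : k →+* L} (hφ : φ.IsIntegral) (P : Pl L) :
    P.1.comap φ ≠ ⊤ := by
  intro h
  refine P.2.1 (eq_top_iff.2 fun y _ => ?_)
  obtain ⟨q, hq, hy⟩ := hφ y
  have hmem : ∀ x, φ x ∈ P.1 := fun x => by
    change x ∈ P.1.comap φ
    rw [h]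
    trivial
  let ψ : k →+* P.1 := φ.codRestrict P.1.toSubring hmem
  have h1 : IsIntegral P.1 y := ⟨q.map ψ, hq.map ψ, by
    rw [Polynomial.eval₂_map]
    exact hy⟩
  obtain ⟨z, rfl⟩ := IsIntegrallyClosed.isIntegral_iff.1 h1
  exact z.2

end Comap

section Automorphism

variable {K : Type} [Field K] [Algebra (ZMod 2) K] [FnField (ZMod 2) K]

/-- The action of an automorphism on places. -/
def plMap (τ : K ≃+* K) (P : Pl K) : Pl K :=
  Place.comap (τ : K →+* K) P
    (comap_ne_top_of_isIntegral ((τ : K →+* K).isIntegral_of_surjective τ.surjective) P)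

theorem mem_plMap {τ : K ≃+* K} {P : Pl K} {x : K} : x ∈ (plMap τ P).1 ↔ τ x ∈ P.1 := Iff.rfl

theorem plMap_iterate {τ : K ≃+* K} (h : ∀ x, τ (τ (τ (τ (τ x)))) = x) (P : Pl K) :
    plMap τ (plMap τ (plMap τ (plMap τ (plMap τ P)))) = P := by
  refine Subtype.ext (ValuationSubring.ext _ _ fun x => ?_)
  simp only [mem_plMap, h]

theorem pdeg_plMap {τ : K ≃+* K} (h : ∀ x, τ (τ (τ (τ (τ x)))) = x) (P : Pl K) :
    pdeg (plMap τ P) = pdeg P := by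
  have hd : ∀ Q : Pl K, pdeg (plMap τ Q) ∣ pdeg Q := fun Q =>
    pdeg_dvd_pdeg (φ := (τ : K →+* K)) rfl
  refine Nat.dvd_antisymm (hd P) ?_
  conv_lhs => rw [← plMap_iterate h P]
  exact (hd _).trans ((hd _).trans ((hd _).trans (hd _)))

theorem ord_plMap {τ : K ≃+* K} (h : ∀ x, τ (τ (τ (τ (τ x)))) = x) (P : Pl K) (x : K) :
    ord (plMap τ P) x = ord P (τ x) := by
  have he : ∀ Q : Pl K, ∃ e : ℕ, 0 < e ∧ ∀ x, ord Q (τ x) = e * ord (plMap τ Q) x := fun Q =>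
    exists_ord_comap (φ := (τ : K →+* K)) (p := plMap τ Q) rfl
  obtain ⟨e, he0, he⟩ := he P
  obtain ⟨y, -, hy⟩ := exists_ord_eq P 1
  have h1 := he (τ.symm y)
  rw [τ.apply_symm_apply, hy] at h1
  have h2 : (e : ℤ) = 1 := Int.eq_one_of_mul_eq_one_right (by simp [*]) h1.symm
  rw [he, h2, one_mul]

end Automorphism

end CFF

namespace CFF

section Aeval

variable {K : Type} [Field K] [Algebra (ZMod 2) K] [FnField (ZMod 2) K]

theorem ord_aeval_of_neg {P : Pl K} {x : K} (hx : ord P x < 0) (g : Polynomial (ZMod 2))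
    (hg : g ≠ 0) : ord P (Polynomial.aeval x g) = g.natDegree * ord P x := by
  have hx0 : x ≠ 0 := by
    rintro rfl
    rw [ord_zero] at hx
    omega
  have hlead : g.leadingCoeff = 1 := by
    rcases zmod_two_cases g.leadingCoeff with h | h
    · exact absurd (Polynomial.leadingCoeff_eq_zero.1 h) hg
    · exact h
  rw [Polynomial.aeval_eq_sum_range, Finset.sum_range_succ, add_comm,
    Polynomial.coeff_natDegree, hlead, one_smul, ← ord_pow]
  refine (ord_add_eq_of_lt (P := P) (pow_ne_zero _ hx0) (sum_mem fun i hi => ?_)).2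
  rw [Finset.mem_range] at hi
  rcases zmod_two_cases (g.coeff i) with h | h
  · rw [h, zero_smul]
    exact zero_mem _
  · rw [h, one_smul, mem_fil_of_ne (pow_ne_zero _ hx0), ord_pow, ord_pow]
    have : (i : ℤ) + 1 ≤ g.natDegree := by exact_mod_cast hi
    nlinarith

theorem deg_zdiv_inv (x : K) : deg (zdiv x⁻¹) = deg (zdiv x) := by
  have h := deg_pdiv x
  rw [← zdiv_sub, deg_sub] at h
  omega

theorem deg_zdiv_aeval (x : K) (g : Polynomial (ZMod 2)) (hg : g ≠ 0) :
    deg (zdiv (Polynomial.aeval x g)) = g.natDegree * deg (zdiv x) := by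
  have h : zdiv (Polynomial.aeval x g)⁻¹ = g.natDegree • zdiv x⁻¹ := by
    ext P
    have e : (g.natDegree • zdiv x⁻¹) P = g.natDegree * zdiv x⁻¹ P := by
      rw [Finsupp.smul_apply, nsmul_eq_mul]
    rw [e, zdiv_apply, zdiv_apply, ord_inv, ord_inv]
    rcases lt_or_ge (ord P x) 0 with h1 | h1
    · rw [ord_aeval_of_neg h1 g hg, max_eq_left (by nlinarith), max_eq_left (by linarith)]
      ring
    · rw [max_eq_right (show -ord P x ≤ 0 by linarith), mul_zero, max_eq_right]
      by_cases h2 : Polynomial.aeval x g = 0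
      · rw [h2, ord_zero, neg_zero]
      · have h3 : x ∈ P.1 := by
          by_cases h4 : x = 0
          · rw [h4]
            exact zero_mem _
          · exact (mem_iff_ord P h4).2 h1
        have := (mem_iff_ord P h2).1 (mem_fil_zero.1 (aeval_mem (mem_fil_zero.2 h3) g))
        linarith
  rw [← deg_zdiv_inv, h, deg_nsmul, deg_zdiv_inv]

end Aeval

section Rational

theorem finrank_adjoin_X_self :
    Module.finrank (IntermediateField.adjoin (ZMod 2) {(RatFunc.X : RatFunc (ZMod 2))})
      (RatFunc (ZMod 2)) = 1 := by
  rw [RatFunc.adjoin_X]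
  exact IntermediateField.finrank_top

theorem algebraMap_X_ne_zero : (RatFunc.X : RatFunc (ZMod 2)) ∉
    Set.range (algebraMap (ZMod 2) (RatFunc (ZMod 2))) := by
  intro h
  obtain ⟨c, hc⟩ := h
  exact RatFunc.transcendental_X (K := ZMod 2) (hc ▸ isAlgebraic_algebraMap c)

theorem deg_zdiv_X : deg (zdiv (RatFunc.X : RatFunc (ZMod 2))) = 1 := by
  rw [deg_zdiv algebraMap_X_ne_zero, finrank_adjoin_X_self]
  rfl

variable {K : Type} [Field K] [Algebra (ZMod 2) K] [FnField (ZMod 2) K]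
  [Algebra (RatFunc (ZMod 2)) K] [IsScalarTower (ZMod 2) (RatFunc (ZMod 2)) K]

theorem deg_zdiv_algebraMap_X (hdeg : Module.finrank (RatFunc (ZMod 2)) K = 5) :
    deg (zdiv (algebraMap (RatFunc (ZMod 2)) K RatFunc.X)) = 5 := by
  rw [deg_zdiv algebraMap_X_notMem_range, finrank_adjoin_algebraMap_X, hdeg]
  rfl

theorem exists_aeval_mem_fil {K : Type} [Field K] [Algebra (ZMod 2) K] [FnField (ZMod 2) K]
    (P : Pl K) {x : K} (hx : x ∈ P.1) : ∃ g : Polynomial (ZMod 2), 0 < g.natDegree ∧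
      g.natDegree ≤ pdeg P ∧ Polynomial.aeval x g ∈ fil P 1 := by
  let _ := (residueHom (ZMod 2) P).toAlgebra
  have := residueField_finite P
  have h_int := Algebra.IsIntegral.isIntegral (R := ZMod 2) (IsLocalRing.residue P.1 ⟨x, hx⟩)
  refine ⟨_, minpoly.natDegree_pos h_int, minpoly.natDegree_le _, ?_⟩
  set g := minpoly (ZMod 2) (IsLocalRing.residue P.1 ⟨x, hx⟩)
  have h1 : Polynomial.eval₂ (residueHom (ZMod 2) P) (IsLocalRing.residue P.1 ⟨x, hx⟩) g = 0 :=
    minpoly.aeval _ _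
  rw [residueHom, ← Polynomial.hom_eval₂, IsLocalRing.residue_eq_zero_iff,
    ValuationSubring.valuation_lt_one_iff] at h1
  have h2 : ((Polynomial.eval₂ (constHom (ZMod 2) P) ⟨x, hx⟩ g : P.1) : K) =
      Polynomial.aeval x g := by
    change P.1.subtype _ = _
    rw [Polynomial.hom_eval₂]
    rfl
  rw [h2] at h1
  by_cases h0 : Polynomial.aeval x g = 0
  · rw [h0]
    exact zero_mem _
  · rw [mem_fil_of_ne h0]
    exact (ord_pos_iff P h0).2 h1

theorem exists_zdiv_eq_single (hdeg : Module.finrank (RatFunc (ZMod 2)) K = 5)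
    (p : Pl (RatFunc (ZMod 2))) : ∃ f : RatFunc (ZMod 2), f ≠ 0 ∧ zdiv f = Finsupp.single p 1 ∧
      deg (zdiv (algebraMap (RatFunc (ZMod 2)) K f)) = 5 * pdeg p := by
  obtain ⟨x, hxp, hx1, hx5⟩ : ∃ x ∈ p.1, deg (zdiv x) = 1 ∧
      deg (zdiv (algebraMap (RatFunc (ZMod 2)) K x)) = 5 := by
    rcases p.1.mem_or_inv_mem RatFunc.X with h | h
    · exact ⟨_, h, deg_zdiv_X, deg_zdiv_algebraMap_X hdeg⟩
    · refine ⟨_, h, ?_, ?_⟩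
      · rw [deg_zdiv_inv, deg_zdiv_X]
      · rw [map_inv₀, deg_zdiv_inv, deg_zdiv_algebraMap_X hdeg]
  obtain ⟨g, hg, hgp, hgm⟩ := exists_aeval_mem_fil p hxp
  have hg0 : g ≠ 0 := by
    rintro rfl
    simp at hg
  have hd := deg_zdiv_aeval x g hg0
  rw [hx1, mul_one] at hd
  have hf : Polynomial.aeval x g ≠ 0 := by
    intro h
    have h1 : zdiv (0 : RatFunc (ZMod 2)) = 0 := by
      ext P
      rw [zdiv_apply, ord_zero]
      rfl
    have h2 : deg (0 : Divisor (ZMod 2) (RatFunc (ZMod 2))) = 0 := map_zero _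
    rw [h, h1, h2] at hd
    omega
  have hle : Finsupp.single p 1 ≤ zdiv (Polynomial.aeval x g) := by
    intro Q
    by_cases h : Q = p
    · subst h
      rw [Finsupp.single_eq_same, zdiv_apply]
      rw [mem_fil_of_ne hf] at hgm
      exact le_max_of_le_left hgm
    · rw [Finsupp.single_eq_of_ne h]
      exact zdiv_nonneg _ Q
  have heq := eq_of_le_of_deg_le hle (by
    rw [hd, deg_single, one_mul]
    exact_mod_cast hgp)
  refine ⟨_, hf, heq.symm, ?_⟩
  rw [← heq, deg_single, one_mul] at hd
  rw [← Polynomial.aeval_algebraMap_apply, deg_zdiv_aeval _ g hg0, hx5, ← hd, mul_comm]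

end Rational

end CFF

namespace CFF

theorem injective_iterate_fin_five {α : Type*} {σ : α → α} {a : α} (h5 : σ^[5] a = a)
    (h1 : σ a ≠ a) : Function.Injective fun i : Fin 5 => σ^[(i : ℕ)] a := by
  have hd : Function.minimalPeriod σ a ∣ 5 := Function.IsPeriodicPt.minimalPeriod_dvd h5
  have hm : Function.minimalPeriod σ a = 5 := by
    rcases (Nat.dvd_prime Nat.prime_five).1 hd with h | h
    · exact absurd (Function.minimalPeriod_eq_one_iff_isFixedPt.1 h) h1
    · exact h
  intro i j hij
  have := Function.iterate_injOn_Iio_minimalPeriod (f := σ) (x := a)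
    (by rw [hm]; exact i.2) (by rw [hm]; exact j.2) hij
  exact Fin.ext this

section Automorphism

variable {K : Type} [Field K] [Algebra (ZMod 2) K]

theorem plMap_injective [FnField (ZMod 2) K] {τ : K ≃+* K}
    (h : ∀ x, τ (τ (τ (τ (τ x)))) = x) : Function.Injective (plMap τ) := by
  intro P Q hPQ
  rw [← plMap_iterate h P, ← plMap_iterate h Q, hPQ]

theorem pdeg_plMap_iterate [FnField (ZMod 2) K] {τ : K ≃+* K}
    (h : ∀ x, τ (τ (τ (τ (τ x)))) = x) (P : Pl K) (n : ℕ) : pdeg ((plMap τ)^[n] P) = pdeg P := by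
  induction n with
  | zero => rfl
  | succ n ih => rw [Function.iterate_succ_apply', pdeg_plMap h, ih]

theorem plMap_eq_of_pdeg_eq_five [FnField (ZMod 2) K] [SpecialCurve K] {τ : K ≃+* K}
    (h : ∀ x, τ (τ (τ (τ (τ x)))) = x) {P : Pl K} (hP : pdeg P = 5) : plMap τ P = P := by
  by_contra hne
  have hi := injective_iterate_fin_five (σ := plMap τ) (plMap_iterate h P) hne
  have h3 := card_places_five (K := K)
  have : Finite {P : Pl K // pdeg P = 5} := Nat.finite_of_card_ne_zero (by omega)
  have := Nat.card_le_card_of_injective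
    (fun i : Fin 5 => (⟨(plMap τ)^[(i : ℕ)] P, by rw [pdeg_plMap_iterate h, hP]⟩ :
      {P : Pl K // pdeg P = 5})) fun i j hij => hi (congrArg Subtype.val hij)
  rw [h3, Nat.card_fin] at this
  omega

theorem map_eq_self_of_deg_zdiv_eq_five [FnField (ZMod 2) K] [SpecialCurve K] {τ : K ≃+* K}
    (h : ∀ x, τ (τ (τ (τ (τ x)))) = x) {x : K} (hx : deg (zdiv x) = 5) : τ x = x := by
  have hx0 : x ≠ 0 := by
    rintro rfl
    have h1 : zdiv (0 : K) = 0 := by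
      ext P
      rw [zdiv_apply, ord_zero]
      rfl
    have h2 : deg (0 : Divisor (ZMod 2) K) = 0 := map_zero _
    rw [h1, h2] at hx
    omega
  have hs : ∀ y : K, deg (zdiv y) = 5 → ∃ P : Pl K, pdeg P = 5 ∧ zdiv y = Finsupp.single P 1 := by
    intro y hy
    obtain ⟨P, hP⟩ := eq_single_of_nonneg (zdiv_nonneg y) (by omega) (by omega)
    refine ⟨P, ?_, hP⟩
    rw [hP, deg_single_one] at hy
    exact_mod_cast hy
  obtain ⟨P, hP5, hP⟩ := hs x hx
  obtain ⟨Q, hQ5, hQ⟩ := hs x⁻¹ (by rw [deg_zdiv_inv, hx])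
  have hord : ∀ R : Pl K, ord R x = Finsupp.single P (1 : ℤ) R - Finsupp.single Q (1 : ℤ) R := by
    intro R
    have := zdiv_sub x
    rw [hP, hQ] at this
    exact (DFunLike.congr_fun this R).symm
  have hinv : ∀ R S : Pl K, pdeg S = 5 →
      Finsupp.single S (1 : ℤ) (plMap τ R) = Finsupp.single S (1 : ℤ) R := by
    intro R S hS
    have hiff : S = plMap τ R ↔ S = R := by
      conv_lhs => rw [← plMap_eq_of_pdeg_eq_five h hS]
      exact (plMap_injective h).eq_iff
    simp only [Finsupp.single_apply, hiff]
  refine eq_of_pdiv_eq ((_root_.map_ne_zero τ).2 hx0) hx0 (Finsupp.ext fun R => ?_)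
  rw [pdiv_apply, pdiv_apply, ← ord_plMap h, hord, hord, hinv R P hP5, hinv R Q hQ5]

variable [Algebra (RatFunc (ZMod 2)) K]

theorem map_algebraMap_eq [FnField (ZMod 2) K] [SpecialCurve K] [IsScalarTower (ZMod 2) (RatFunc (ZMod 2)) K]
    (hdeg : Module.finrank (RatFunc (ZMod 2)) K = 5) {τ : K ≃+* K}
    (h : ∀ x, τ (τ (τ (τ (τ x)))) = x) (f : RatFunc (ZMod 2)) :
    τ (algebraMap (RatFunc (ZMod 2)) K f) = algebraMap (RatFunc (ZMod 2)) K f := by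
  have hX := map_eq_self_of_deg_zdiv_eq_five h (deg_zdiv_algebraMap_X (K := K) hdeg)
  have : (τ : K →+* K).comp (algebraMap (RatFunc (ZMod 2)) K) = algebraMap _ _ := by
    refine IsLocalization.ringHom_ext (nonZeroDivisors (Polynomial (ZMod 2))) ?_
    refine Polynomial.ringHom_ext' (Subsingleton.elim _ _) ?_
    simpa using hX
  exact DFunLike.congr_fun this f

theorem mem_range_of_map_eq_self (hdeg : Module.finrank (RatFunc (ZMod 2)) K = 5) {τ : K ≃+* K}
    (hτ : ∀ f : RatFunc (ZMod 2), τ (algebraMap _ K f) = algebraMap _ K f)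
    (hne : ∃ x, τ x ≠ x) {y : K} (hy : τ y = y) :
    ∃ f : RatFunc (ZMod 2), algebraMap _ K f = y := by
  let E : IntermediateField (RatFunc (ZMod 2)) K :=
    { (τ : K →+* K).eqLocusField (RingHom.id K) with algebraMap_mem' := hτ }
  have := IntermediateField.isSimpleOrder_of_finrank_prime (RatFunc (ZMod 2)) K
    (hdeg ▸ Nat.prime_five)
  rcases eq_bot_or_eq_top E with h | h
  · have hyE : y ∈ E := hy
    rw [h] at hyE
    exact hyE
  · obtain ⟨x, hx⟩ := hne
    have hxE : x ∈ E := by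
      rw [h]
      trivial
    exact absurd hxE hx

end Automorphism

end CFF

namespace CFF

section PlacesAbove

variable {K : Type} [Field K] [Algebra (ZMod 2) K] [FnField (ZMod 2) K]
  [Algebra (RatFunc (ZMod 2)) K]

theorem algebraMap_isIntegral_of_finrank_eq_five
    (hdeg : Module.finrank (RatFunc (ZMod 2)) K = 5) :
    (algebraMap (RatFunc (ZMod 2)) K).IsIntegral := by
  have : Module.Finite (RatFunc (ZMod 2)) K := Module.finite_of_finrank_pos (by omega)
  exact algebraMap_isIntegral_iff.2 inferInstance

theorem liesOver_of_ord_pos (hdeg : Module.finrank (RatFunc (ZMod 2)) K = 5)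
    {p : Pl (RatFunc (ZMod 2))} {f : RatFunc (ZMod 2)} (hf : zdiv f = Finsupp.single p 1)
    {P : Pl K} (hP : 0 < ord P (algebraMap _ K f)) : LiesOver (ZMod 2) P p := by
  have h_int := algebraMap_isIntegral_of_finrank_eq_five hdeg
  set q := Place.comap _ P (comap_ne_top_of_isIntegral h_int P) with hq
  obtain ⟨e, he, hord⟩ := exists_ord_comap (P := P) (p := q) (φ := algebraMap _ K) rfl
  rw [hord] at hP
  have h1 : 0 < ord q f := by
    refine (mul_pos_iff_of_pos_left ?_).1 hP
    exact_mod_cast he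
  have h2 : zdiv f q ≠ 0 := by
    rw [zdiv_apply]
    exact (lt_max_of_lt_left h1).ne'
  rw [hf] at h2
  have h3 : q = p := by
    by_contra h
    exact h2 (Finsupp.single_eq_of_ne h)
  rw [← h3]
  rfl

theorem ord_pos_of_liesOver {p : Pl (RatFunc (ZMod 2))} {f : RatFunc (ZMod 2)}
    (hf : zdiv f = Finsupp.single p 1) {P : Pl K} (hP : LiesOver (ZMod 2) P p) :
    0 < ord P (algebraMap _ K f) := by
  obtain ⟨e, he, hord⟩ := exists_ord_comap (P := P) (p := p) (φ := algebraMap _ K) hP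
  have h1 := DFunLike.congr_fun hf p
  rw [zdiv_apply, Finsupp.single_eq_same] at h1
  have h2 : 0 < ord p f := by
    by_contra h
    rw [max_eq_right (by linarith)] at h1
    omega
  rw [hord]
  exact mul_pos (by exact_mod_cast he) h2

variable [IsScalarTower (ZMod 2) (RatFunc (ZMod 2)) K]

theorem exists_liesOver (hdeg : Module.finrank (RatFunc (ZMod 2)) K = 5)
    (p : Pl (RatFunc (ZMod 2))) : ∃ P : Pl K, LiesOver (ZMod 2) P p := by
  obtain ⟨f, -, hf, hfK⟩ := exists_zdiv_eq_single (K := K) hdeg p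
  by_contra! hcon
  have h0 : zdiv (algebraMap _ K f) = 0 := by
    ext P
    rw [zdiv_apply]
    refine max_eq_right ?_
    by_contra h
    exact hcon P (liesOver_of_ord_pos hdeg hf (by omega))
  have h1 : deg (0 : Divisor (ZMod 2) K) = 0 := map_zero _
  have h2 := placeDegree_pos p
  rw [h0, h1] at hfK
  change 0 < pdeg p at h2
  omega

theorem sum_pdeg_le (hdeg : Module.finrank (RatFunc (ZMod 2)) K = 5)
    {p : Pl (RatFunc (ZMod 2))} {ι : Type} [Fintype ι] {P : ι → Pl K} (hinj : P.Injective)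
    (hP : ∀ i, LiesOver (ZMod 2) (P i) p) : ∑ i, pdeg (P i) ≤ 5 * pdeg p := by
  obtain ⟨f, -, hf, hfK⟩ := exists_zdiv_eq_single (K := K) hdeg p
  have hle : ∑ i, Finsupp.single (P i) 1 ≤ zdiv (algebraMap _ K f) := by
    intro Q
    rw [Finsupp.finset_sum_apply]
    by_cases hQ : ∃ i, P i = Q
    · obtain ⟨i, rfl⟩ := hQ
      rw [Finset.sum_eq_single i (fun j _ hj => Finsupp.single_eq_of_ne fun h => hj (hinj h.symm))
        (by simp), Finsupp.single_eq_same, zdiv_apply]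
      exact le_max_of_le_left (ord_pos_of_liesOver hf (hP i))
    · push Not at hQ
      rw [Finset.sum_eq_zero fun i _ => Finsupp.single_eq_of_ne (hQ i).symm]
      exact zdiv_nonneg _ Q
  have h1 := deg_mono hle
  have h2 : deg (∑ i, Finsupp.single (P i) 1) = ∑ i, (pdeg (P i) : ℤ) :=
    (map_sum (degHom (ZMod 2) K) _ _).trans (Finset.sum_congr rfl fun i _ => deg_single_one _)
  rw [hfK, h2] at h1
  exact_mod_cast h1

theorem exists_mul_pdeg_eq (hdeg : Module.finrank (RatFunc (ZMod 2)) K = 5)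
    {p : Pl (RatFunc (ZMod 2))} {P : Pl K} (hP : LiesOver (ZMod 2) P p)
    (huniq : ∀ Q : Pl K, LiesOver (ZMod 2) Q p → Q = P) :
    pdeg P = 5 * pdeg p ∨ pdeg P = pdeg p := by
  obtain ⟨f, -, hf, hfK⟩ := exists_zdiv_eq_single (K := K) hdeg p
  have hz : zdiv (algebraMap _ K f) = Finsupp.single P (ord P (algebraMap _ K f)) := by
    ext Q
    rw [zdiv_apply]
    by_cases h : Q = P
    · subst h
      rw [Finsupp.single_eq_same, max_eq_left (ord_pos_of_liesOver hf hP).le]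
    · rw [Finsupp.single_eq_of_ne h]
      refine max_eq_right ?_
      by_contra h1
      exact h (huniq Q (liesOver_of_ord_pos hdeg hf (by omega)))
  obtain ⟨m, hm⟩ := pdeg_dvd_pdeg (P := P) (p := p) (φ := algebraMap _ K) hP
  have hp : 0 < pdeg p := placeDegree_pos p
  rw [hz, deg_single, hm] at hfK
  have h5 : (m : ℤ) ∣ 5 := by
    refine ⟨ord P (algebraMap _ K f), ?_⟩
    have : (pdeg p : ℤ) ≠ 0 := by exact_mod_cast hp.ne'
    refine mul_right_cancel₀ this ?_
    rw [← hfK]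
    push_cast
    ring
  rcases (Nat.dvd_prime Nat.prime_five).1 (by exact_mod_cast h5) with h | h
  · right
    rw [hm, h, mul_one]
  · left
    rw [hm, h, mul_comm]

end PlacesAbove

section Automorphism

variable {K : Type} [Field K] [Algebra (ZMod 2) K] [FnField (ZMod 2) K]
  [Algebra (RatFunc (ZMod 2)) K]

theorem liesOver_plMap {τ : K ≃+* K}
    (hτ : ∀ f : RatFunc (ZMod 2), τ (algebraMap _ K f) = algebraMap _ K f)
    {p : Pl (RatFunc (ZMod 2))} {P : Pl K} (hP : LiesOver (ZMod 2) P p) :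
    LiesOver (ZMod 2) (plMap τ P) p := by
  rw [LiesOver, ← hP]
  refine ValuationSubring.ext _ _ fun x => ?_
  rw [ValuationSubring.mem_comap, ValuationSubring.mem_comap, mem_plMap, hτ]

theorem eq_of_plMap_eq_self {τ : K ≃+* K} (h : ∀ x, τ (τ (τ (τ (τ x)))) = x)
    (hfix : ∀ y, τ y = y → ∃ f : RatFunc (ZMod 2), algebraMap _ K f = y)
    {p : Pl (RatFunc (ZMod 2))} {P Q : Pl K} (hP : LiesOver (ZMod 2) P p)
    (hQ : LiesOver (ZMod 2) Q p) (hPτ : plMap τ P = P) (hQτ : plMap τ Q = Q) : P = Q := by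
  by_contra hne
  obtain ⟨y, hy⟩ := weak_approx {P, Q} (fun R => if R = P then 0 else 1) (fun _ => 1)
  have hyP := hy P (by simp)
  have hyQ := hy Q (by simp)
  simp only [if_true, sub_zero] at hyP
  simp only [if_neg (Ne.symm hne)] at hyQ
  have hfil : ∀ R : Pl K, plMap τ R = R → ∀ x, x ∈ fil R 1 → τ x ∈ fil R 1 := by
    intro R hR x hx
    have : (plMap τ R).1 = R.1 := by rw [hR]
    exact (mem_fil_comap (φ := (τ : K →+* K)) (P := R) (p := plMap τ R) rfl).2 (by rwa [hR])
  have h_int : ∀ R : Pl K, plMap τ R = R → ∀ x, x ∈ R.1 → τ x ∈ R.1 := by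
    intro R hR x hx
    rw [← mem_plMap, hR]
    exact hx
  have hone : ∀ x, x - 1 ∈ fil Q 1 → τ x - 1 ∈ fil Q 1 := by
    intro x hx
    have := hfil Q hQτ _ hx
    rwa [map_sub, map_one] at this
  have hmul : ∀ a b : K, a - 1 ∈ fil Q 1 → b - 1 ∈ fil Q 1 → a * b - 1 ∈ fil Q 1 := by
    intro a b ha hb
    have h1 : a ∈ fil Q 0 := by
      have := add_mem (fil_anti Q (show (0 : ℤ) ≤ 1 by norm_num) ha) (one_mem_fil Q)
      rwa [sub_add_cancel] at this
    have h2 : a * b - 1 = a * (b - 1) + (a - 1) := by ring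
    rw [h2]
    refine add_mem ?_ ha
    have := mul_mem_fil h1 hb
    rwa [zero_add] at this
  obtain ⟨f, hf⟩ := hfix (y * τ y * τ (τ y) * τ (τ (τ y)) * τ (τ (τ (τ y)))) (by
    simp only [map_mul, h]
    ring)
  have hN : algebraMap _ K f - 1 ∈ fil Q 1 := by
    rw [hf]
    have h1 := hone _ hyQ
    have h2 := hone _ h1
    have h3 := hone _ h2
    have h4 := hone _ h3
    exact hmul _ _ (hmul _ _ (hmul _ _ (hmul _ _ hyQ h1) h2) h3) h4
  have hP0 : y ∈ P.1 := mem_fil_zero.1 (fil_anti P (by norm_num) hyP)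
  have hNP : algebraMap _ K f ∈ fil P 1 := by
    rw [hf]
    have h1 := h_int P hPτ _ hP0
    have h2 := h_int P hPτ _ h1
    have h3 := h_int P hPτ _ h2
    have h4 := h_int P hPτ _ h3
    have h5 := mul_mem_fil (mem_fil_zero.2 (mul_mem (mul_mem (mul_mem h1 h2) h3) h4)) hyP
    rw [zero_add] at h5
    convert h5 using 1
    ring
  rw [mem_fil_comap (p := p) hP, ← mem_fil_comap (P := Q) (φ := algebraMap _ K) hQ] at hNP
  have h1 := sub_mem hNP hN
  rw [sub_sub_cancel, mem_fil_of_ne one_ne_zero, ord_one] at h1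
  omega

variable [SpecialCurve K] [IsScalarTower (ZMod 2) (RatFunc (ZMod 2)) K]

theorem plMap_eq_self_of_liesOver (hdeg : Module.finrank (RatFunc (ZMod 2)) K = 5) {τ : K ≃+* K}
    (h : ∀ x, τ (τ (τ (τ (τ x)))) = x) {p : Pl (RatFunc (ZMod 2))} (hp : pdeg p ≤ 4) {P : Pl K}
    (hP : LiesOver (ZMod 2) P p) : plMap τ P = P := by
  by_contra hne
  have hlies : ∀ n : ℕ, LiesOver (ZMod 2) ((plMap τ)^[n] P) p := by
    intro n
    induction n with
    | zero => exact hP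
    | succ n ih =>
      rw [Function.iterate_succ_apply']
      exact liesOver_plMap (map_algebraMap_eq hdeg h) ih
  have hle := sum_pdeg_le hdeg (injective_iterate_fin_five (σ := plMap τ) (plMap_iterate h P) hne)
    fun i => hlies i
  simp only [pdeg_plMap_iterate h, Finset.sum_const, Finset.card_univ, Fintype.card_fin,
    smul_eq_mul] at hle
  have h4 := four_le_pdeg P
  have hP4 : pdeg P = 4 := by omega
  have h1 := (Nat.card_eq_one_iff_unique.1 (card_places_four (K := K))).1
  exact hne (congrArg Subtype.val (h1.elim ⟨plMap τ P, by rw [pdeg_plMap h, hP4]⟩ ⟨P, hP4⟩))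

/-- Over a place of `𝔽₂(T)` of degree at most four there is exactly one place. -/
theorem exists_unique_liesOver (hdeg : Module.finrank (RatFunc (ZMod 2)) K = 5)
    {p : Pl (RatFunc (ZMod 2))} (hp : pdeg p ≤ 4) : ∃ P : Pl K, LiesOver (ZMod 2) P p ∧
      (∀ Q : Pl K, LiesOver (ZMod 2) Q p → Q = P) ∧ (pdeg P = 5 * pdeg p ∨ pdeg P = pdeg p) := by
  obtain ⟨τ, h, hne⟩ := exists_automorphism (K := K)
  obtain ⟨P, hP⟩ := exists_liesOver (K := K) hdeg p
  have huniq : ∀ Q : Pl K, LiesOver (ZMod 2) Q p → Q = P := fun Q hQ =>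
    eq_of_plMap_eq_self h (fun y hy => mem_range_of_map_eq_self hdeg (map_algebraMap_eq hdeg h)
      hne hy) hQ hP (plMap_eq_self_of_liesOver hdeg h hp hQ) (plMap_eq_self_of_liesOver hdeg h hp hP)
  exact ⟨P, hP, huniq, exists_mul_pdeg_eq hdeg hP huniq⟩

end Automorphism

section Ramification

variable {K : Type} [Field K] [Algebra (ZMod 2) K] [FnField (ZMod 2) K] [SpecialCurve K]
  [Algebra (RatFunc (ZMod 2)) K] [IsScalarTower (ZMod 2) (RatFunc (ZMod 2)) K]

theorem isInert_of_pdeg_le_three (hdeg : Module.finrank (RatFunc (ZMod 2)) K = 5)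
    {p : Pl (RatFunc (ZMod 2))} (hp : pdeg p ≤ 3) : IsInert (ZMod 2) K p := by
  obtain ⟨P, hP, huniq, h⟩ := exists_unique_liesOver (K := K) hdeg (p := p) (by omega)
  have h4 := four_le_pdeg P
  refine ⟨P, hP, ?_, huniq⟩
  rw [hdeg]
  exact h.resolve_right (by omega)

theorem exists_isTotallyRamified (hdeg : Module.finrank (RatFunc (ZMod 2)) K = 5) :
    ∃ p : Pl (RatFunc (ZMod 2)), pdeg p = 4 ∧ IsTotallyRamified (ZMod 2) K p ∧
      ∀ q : Pl (RatFunc (ZMod 2)), pdeg q = 4 → q ≠ p → IsInert (ZMod 2) K q := by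
  obtain ⟨hsub, ⟨P, hP4⟩⟩ := Nat.card_eq_one_iff_unique.1 (card_places_four (K := K))
  set p := Place.comap _ P
    (comap_ne_top_of_isIntegral (algebraMap_isIntegral_of_finrank_eq_five hdeg) P) with hp
  have hPp : LiesOver (ZMod 2) P p := rfl
  have hdvd : pdeg p ∣ pdeg P := pdeg_dvd_pdeg (φ := algebraMap _ K) hPp
  have hle : pdeg p ≤ 4 := hP4 ▸ Nat.le_of_dvd (by omega) hdvd
  obtain ⟨P', hP', huniq, h⟩ := exists_unique_liesOver (K := K) hdeg hle
  obtain rfl := huniq P hPp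
  have hp4 : pdeg p = 4 := by omega
  refine ⟨p, hp4, ⟨P, hPp, hP4.trans hp4.symm, huniq⟩, fun q hq hne => ?_⟩
  obtain ⟨Q, hQ, huniqQ, hc⟩ := exists_unique_liesOver (K := K) hdeg hq.le
  refine ⟨Q, hQ, ?_, huniqQ⟩
  rw [hdeg]
  refine hc.resolve_right fun hQ4 => hne (Subtype.ext ?_)
  have hQP : Q = P := congrArg Subtype.val (hsub.elim ⟨Q, hQ4.trans hq⟩ ⟨P, hP4⟩)
  rw [← hQ, hQP, hPp]

end Ramification

end CFF

open CFF in
/-- For a congruence function field `K` over `𝔽₂` of genus `4` and class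
number `1`, with rational subfield `k = 𝔽₂(T)` of degree `5`: every place of
`k` of degree at most `3` is inert in `K/k`, and exactly one of the three
places of `k` of degree `4` is totally (and tamely, as `[K:k] = 5` is odd)
ramified in `K/k`, the other two places of degree `4` being inert. -/
theorem ramification_in_genus_four_field
    (K : Type) [Field K] [Algebra (ZMod 2) K]
    [Algebra (RatFunc (ZMod 2)) K] [IsScalarTower (ZMod 2) (RatFunc (ZMod 2)) K]
    (hFF : IsFunctionField (ZMod 2) K)
    (hconst : HasExactConstants (ZMod 2) K)
    (hg : genus (ZMod 2) K = 4)
    (hh : classNumber (ZMod 2) K = 1)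
    (hdeg : Module.finrank (RatFunc (ZMod 2)) K = 5) :
    (∀ p : Place (ZMod 2) (RatFunc (ZMod 2)),
      placeDegree (ZMod 2) p ≤ 3 → IsInert (ZMod 2) K p) ∧
    (∃ p : Place (ZMod 2) (RatFunc (ZMod 2)), placeDegree (ZMod 2) p = 4 ∧
      IsTotallyRamified (ZMod 2) K p ∧
      ¬ (2 ∣ Module.finrank (RatFunc (ZMod 2)) K) ∧
      (∀ p' : Place (ZMod 2) (RatFunc (ZMod 2)),
        placeDegree (ZMod 2) p' = 4 → p' ≠ p → IsInert (ZMod 2) K p')) := by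
  have := FnField.of_isFunctionField hFF hconst
  have := Curve.of_invariants hg hh hdeg
  obtain ⟨Γ, -⟩ := exists_planeModel hdeg
  have : SpecialCurve K := { An_small := Γ.An_eq_zero }
  refine ⟨fun p hp => isInert_of_pdeg_le_three hdeg hp, ?_⟩
  obtain ⟨p, hp, hram, hinert⟩ := exists_isTotallyRamified (K := K) hdeg
  exact ⟨p, hp, hram, by rw [hdeg]; decide, hinert⟩
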